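/- Let 𝓞 be the ring of Eisenstein integers, i.e. the ring of integers of the cyclotomic field ℚ(ζ₃). For every n ≥ 3, the rational group cohomology of SL_n(𝓞) vanishes in codimension one below its virtual cohomological dimension: H^{(n² − n) − 1}(SL_n(𝓞); ℚ) = 0. (Kupers–Miller–Patzt–Wilson) -/

import Mathlib

set_option linter.unusedSectionVars false

namespace Eis

open Finsupp

/-! ## Chains on lists -/

section Chains

variable {α : Type*}

/-- Rational chains on lists of vertices; lists of length `m` sit in degree `m`. -/
abbrev Ch (α : Type*) := List α →₀ ℚ

/-- Prepend a vertex. -/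
noncomputable def cone (a : α) : Ch α →ₗ[ℚ] Ch α := Finsupp.lmapDomain ℚ ℚ (List.cons a)

@[simp] lemma cone_single (a : α) (l : List α) (c : ℚ) :
    cone a (single l c) = single (a :: l) c := by
  simp [cone]

/-- Weighted alternating sum of the faces of a list. -/
noncomputable def ctL (χ : α → ℚ) : List α → Ch α
  | [] => 0
  | a :: l => χ a • single l 1 - cone a (ctL χ l)

/-- Contraction of chains by a weight `χ` on the vertices. -/
noncomputable def ct (χ : α → ℚ) : Ch α →ₗ[ℚ] Ch α := Finsupp.linearCombination ℚ (ctL χ)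

/-- The boundary operator. -/
noncomputable abbrev bd : Ch α →ₗ[ℚ] Ch α := ct (fun _ => (1 : ℚ))

lemma ct_single (χ : α → ℚ) (l : List α) : ct χ (single l 1) = ctL χ l := by
  simp [ct]

@[simp] lemma ct_single_nil (χ : α → ℚ) (c : ℚ) : ct χ (single [] c) = 0 := by
  simp [ct, ctL]

lemma single_eq_smul (l : List α) (c : ℚ) : (single l c : Ch α) = c • single l 1 := by simp

lemma ct_single_cons (χ : α → ℚ) (a : α) (l : List α) :
    ct χ (single (a :: l) 1) = χ a • single l 1 - cone a (ct χ (single l 1)) := by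
  simp only [ct_single, ctL]

lemma ct_cone (χ : α → ℚ) (a : α) (z : Ch α) :
    ct χ (cone a z) = χ a • z - cone a (ct χ z) := by
  induction z using Finsupp.induction_linear with
  | zero => simp
  | add f g hf hg => simp only [map_add, hf, hg, smul_add]; abel
  | single l c =>
    rw [single_eq_smul, map_smul, map_smul, cone_single, ct_single_cons, map_smul, map_smul,
      smul_sub, smul_comm]

lemma ch_ext {M : Type*} [AddCommGroup M] [Module ℚ M] {f g : Ch α →ₗ[ℚ] M}
    (h : ∀ l, f (single l 1) = g (single l 1)) : f = g := by
  ext l; exact h l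

lemma ct_ct (χ ψ : α → ℚ) (z : Ch α) : ct χ (ct ψ z) = - ct ψ (ct χ z) := by
  suffices h : (ct χ).comp (ct ψ) = - (ct ψ).comp (ct χ) from LinearMap.congr_fun h z
  refine ch_ext fun l => ?_
  induction l with
  | nil => simp
  | cons a l ih =>
    simp only [LinearMap.comp_apply, LinearMap.neg_apply] at ih ⊢
    rw [ct_single_cons, ct_single_cons, map_sub, map_sub, ct_cone, ct_cone, ih]
    simp only [map_smul, map_neg]
    abel

lemma ct_self (χ : α → ℚ) (z : Ch α) : ct χ (ct χ z) = 0 := by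
  have h := ct_ct χ χ z
  exact self_eq_neg.mp h

lemma ct_add (χ ψ : α → ℚ) (z : Ch α) : ct (χ + ψ) z = ct χ z + ct ψ z := by
  suffices h : ct (χ + ψ) = ct χ + ct ψ from LinearMap.congr_fun h z
  refine ch_ext fun l => ?_
  induction l with
  | nil => simp
  | cons a l ih =>
    simp only [LinearMap.add_apply] at ih ⊢
    rw [ct_single_cons, ct_single_cons, ct_single_cons, ih, map_add, Pi.add_apply, add_smul]
    abel

lemma bd_bd (z : Ch α) : bd (bd z) = 0 := ct_self _ z

lemma bd_cone (a : α) (z : Ch α) : bd (cone a z) = z - cone a (bd z) := by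
  rw [ct_cone, one_smul]

/-- Chains supported on a set of lists. -/
abbrev supp (K : Set (List α)) : Submodule ℚ (Ch α) := Finsupp.supported ℚ ℚ K

lemma single_mem_supp {K : Set (List α)} {l : List α} (h : l ∈ K) (c : ℚ) :
    single l c ∈ supp K := Finsupp.single_mem_supported ℚ c h

lemma supp_induction {K : Set (List α)} {p : Ch α → Prop} {z : Ch α} (hz : z ∈ supp K)
    (h0 : p 0) (hadd : ∀ x y, p x → p y → p (x + y)) (hs : ∀ (c : ℚ) x, p x → p (c • x))
    (h1 : ∀ l ∈ K, p (single l 1)) : p z := by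
  rw [supp, Finsupp.supported_eq_span_single] at hz
  induction hz using Submodule.span_induction with
  | mem x hx => obtain ⟨l, hl, rfl⟩ := hx; exact h1 l hl
  | zero => exact h0
  | add x y _ _ hx hy => exact hadd x y hx hy
  | smul c x _ hx => exact hs c x hx

/-- A linear map sending generators of `K` into `W` sends all chains on `K` into `W`. -/
lemma map_supp {M : Type*} [AddCommGroup M] [Module ℚ M] {K : Set (List α)} {W : Submodule ℚ M}
    (f : Ch α →ₗ[ℚ] M) (h : ∀ l ∈ K, f (single l 1) ∈ W) {z : Ch α} (hz : z ∈ supp K) :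
    f z ∈ W := by
  refine supp_induction hz (p := fun z => f z ∈ W) (by simp) (fun x y hx hy => ?_)
    (fun c x hx => ?_) h
  · rw [map_add]; exact W.add_mem hx hy
  · rw [map_smul]; exact W.smul_mem c hx

/-- Lists of length `k`. -/
def len (k : ℤ) : Set (List α) := {l | (l.length : ℤ) = k}

lemma cone_mem {K K' : Set (List α)} (a : α) (h : ∀ l ∈ K, a :: l ∈ K') {z : Ch α}
    (hz : z ∈ supp K) : cone a z ∈ supp K' :=
  map_supp _ (fun l hl => by rw [cone_single]; exact single_mem_supp (h l hl) 1) hz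

lemma ct_single_mem (χ : α → ℚ) (l : List α) :
    ct χ (single l 1) ∈ supp {l' | l'.Sublist l ∧ l'.length + 1 = l.length} := by
  induction l with
  | nil => simp
  | cons a l ih =>
    rw [ct_single_cons]
    refine Submodule.sub_mem _ (Submodule.smul_mem _ _ (single_mem_supp ?_ 1)) ?_
    · exact ⟨List.sublist_cons_self a l, by simp⟩
    · refine cone_mem a (fun l' hl' => ?_) ih
      exact ⟨hl'.1.cons_cons a, by simp [hl'.2]⟩

/-- A family of lists closed under passing to sublists. -/
def SubClosed (K : Set (List α)) : Prop := ∀ l ∈ K, ∀ l', l'.Sublist l → l' ∈ K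

lemma ct_mem {K : Set (List α)} (hK : SubClosed K) (χ : α → ℚ) {k : ℤ} {z : Ch α}
    (hz : z ∈ supp (K ∩ len k)) : ct χ z ∈ supp (K ∩ len (k - 1)) := by
  refine map_supp _ (fun l hl => ?_) hz
  refine Finsupp.supported_mono ?_ (ct_single_mem χ l)
  rintro l' ⟨h1, h2⟩
  refine ⟨hK l hl.1 l' h1, ?_⟩
  have := hl.2
  simp only [len, Set.mem_ofPred_eq] at this ⊢
  omega

/-- Among any `d + 1` cycles of length `k` on `K` some nontrivial combination bounds. -/
def RankLE (K : Set (List α)) (k : ℤ) (d : ℕ) : Prop :=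
  ∀ z : Fin (d + 1) → Ch α, (∀ i, z i ∈ supp (K ∩ len k)) → (∀ i, bd (z i) = 0) →
    ∃ c : Fin (d + 1) → ℚ, c ≠ 0 ∧ ∃ w ∈ supp (K ∩ len (k + 1)), bd w = ∑ i, c i • z i

/-- Every cycle of length `k` on `K` bounds. -/
def Acyc (K : Set (List α)) (k : ℤ) : Prop :=
  ∀ z ∈ supp (K ∩ len k), bd z = 0 → ∃ w ∈ supp (K ∩ len (k + 1)), bd w = z

lemma acyc_iff {K : Set (List α)} {k : ℤ} : RankLE K k 0 ↔ Acyc K k := by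
  constructor
  · intro h z hz hb
    obtain ⟨c, hc, w, hw, e⟩ := h (fun _ => z) (fun _ => hz) (fun _ => hb)
    have hc0 : c 0 ≠ 0 := fun h0 => hc (funext fun i => by fin_cases i; exact h0)
    refine ⟨(c 0)⁻¹ • w, Submodule.smul_mem _ _ hw, ?_⟩
    rw [Fin.sum_univ_one] at e
    rw [map_smul, e, smul_smul, inv_mul_cancel₀ hc0, one_smul]
  · intro h z hz hb
    obtain ⟨w, hw, e⟩ := h (z 0) (hz 0) (hb 0)
    exact ⟨fun _ => 1, fun h => one_ne_zero (congrFun h 0), w, hw, by simp [e]⟩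

lemma acyc_empty (k : ℤ) : Acyc (∅ : Set (List α)) k := by
  intro z hz _
  simp only [Set.empty_inter, supp, Finsupp.supported_empty, Submodule.mem_bot] at hz
  exact ⟨0, Submodule.zero_mem _, by simp [hz]⟩

lemma acyc_cone {K : Set (List α)} (a : α) (h : ∀ l ∈ K, a :: l ∈ K) (k : ℤ) : Acyc K k := by
  intro z hz hb
  refine ⟨cone a z, cone_mem a (fun l hl => ?_) hz, ?_⟩
  · have := hl.2
    refine ⟨h l hl.1, ?_⟩
    simp only [len, Set.mem_ofPred_eq, List.length_cons, Nat.cast_add, Nat.cast_one] at this ⊢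
    omega
  · rw [bd_cone, hb]; simp

lemma supp_union_split {K₁ K₂ : Set (List α)} {k : ℤ} {z : Ch α}
    (hz : z ∈ supp ((K₁ ∪ K₂) ∩ len k)) :
    ∃ z₁ ∈ supp (K₁ ∩ len k), ∃ z₂ ∈ supp (K₂ ∩ len k), z = z₁ + z₂ := by
  rw [Set.union_inter_distrib_right, supp, Finsupp.supported_union] at hz
  obtain ⟨z₁, h₁, z₂, h₂, e⟩ := Submodule.mem_sup.mp hz
  exact ⟨z₁, h₁, z₂, h₂, e.symm⟩

lemma supp_inter_of {K₁ K₂ : Set (List α)} {k : ℤ} {z : Ch α}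
    (h₁ : z ∈ supp (K₁ ∩ len k)) (h₂ : z ∈ supp (K₂ ∩ len k)) :
    z ∈ supp ((K₁ ∩ K₂) ∩ len k) := by
  intro l hl
  exact ⟨⟨(h₁ hl).1, (h₂ hl).1⟩, (h₁ hl).2⟩

lemma rankLE_union {K₁ K₂ : Set (List α)} (s₁ : SubClosed K₁) (s₂ : SubClosed K₂) {k : ℤ} {d : ℕ}
    (a₁ : Acyc K₁ k) (a₂ : Acyc K₂ k) (h : RankLE (K₁ ∩ K₂) (k - 1) d) :
    RankLE (K₁ ∪ K₂) k d := by
  intro z hz hb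
  choose z₁ h₁ z₂ h₂ e using fun i => supp_union_split (hz i)
  have hneg : ∀ i, bd (z₁ i) = - bd (z₂ i) := fun i => by
    have := hb i
    rw [e i, map_add] at this
    exact eq_neg_of_add_eq_zero_left this
  obtain ⟨c, hc, w, hw, ew⟩ := h (fun i => bd (z₁ i))
    (fun i => supp_inter_of (ct_mem s₁ _ (h₁ i))
      (by rw [hneg]; exact Submodule.neg_mem _ (ct_mem s₂ _ (h₂ i))))
    (fun i => bd_bd _)
  rw [sub_add_cancel] at hw
  have hw1 : w ∈ supp (K₁ ∩ len k) :=
    Finsupp.supported_mono (Set.inter_subset_inter_left _ Set.inter_subset_left) hw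
  have hw2 : w ∈ supp (K₂ ∩ len k) :=
    Finsupp.supported_mono (Set.inter_subset_inter_left _ Set.inter_subset_right) hw
  obtain ⟨w₁, hw₁, e₁⟩ := a₁ (∑ i, c i • z₁ i - w)
    (Submodule.sub_mem _ (Submodule.sum_mem _ fun i _ => Submodule.smul_mem _ _ (h₁ i)) hw1)
    (by rw [map_sub, ew, map_sum]; simp)
  obtain ⟨w₂, hw₂, e₂⟩ := a₂ (∑ i, c i • z₂ i + w)
    (Submodule.add_mem _ (Submodule.sum_mem _ fun i _ => Submodule.smul_mem _ _ (h₂ i)) hw2)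
    (by rw [map_add, ew, map_sum]; simp [hneg])
  refine ⟨c, hc, w₁ + w₂, Submodule.add_mem _
    (Finsupp.supported_mono (Set.inter_subset_inter_left _ Set.subset_union_left) hw₁)
    (Finsupp.supported_mono (Set.inter_subset_inter_left _ Set.subset_union_right) hw₂), ?_⟩
  rw [map_add, e₁, e₂]
  simp only [e, smul_add, Finset.sum_add_distrib]
  abel

lemma rankLE_of_union {K₁ K₂ : Set (List α)} (s₁ : SubClosed K₁) (s₂ : SubClosed K₂) {k : ℤ}
    {d : ℕ} (a₀ : Acyc (K₁ ∩ K₂) k) (h : RankLE (K₁ ∪ K₂) k d) : RankLE K₁ k d := by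
  intro z hz hb
  obtain ⟨c, hc, w, hw, e⟩ := h z (fun i => Finsupp.supported_mono
    (Set.inter_subset_inter_left _ Set.subset_union_left) (hz i)) hb
  obtain ⟨w₁, h₁, w₂, h₂, rfl⟩ := supp_union_split hw
  have hw2 : bd w₂ = ∑ i, c i • z i - bd w₁ := by rw [← e, map_add]; abel
  have m₁ := ct_mem s₁ (fun _ => 1) h₁
  have m₂ := ct_mem s₂ (fun _ => 1) h₂
  rw [add_sub_cancel_right] at m₁ m₂
  obtain ⟨w₀, h₀, e₀⟩ := a₀ (bd w₂) (supp_inter_of (by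
    rw [hw2]
    exact Submodule.sub_mem _
      (Submodule.sum_mem _ fun i _ => Submodule.smul_mem _ _ (hz i)) m₁) m₂) (bd_bd _)
  refine ⟨c, hc, w₁ + w₀, Submodule.add_mem _ h₁ (Finsupp.supported_mono
    (Set.inter_subset_inter_left _ Set.inter_subset_left) h₀), ?_⟩
  rw [map_add, e₀, hw2]; abel

end Chains

end Eis

namespace Eis

open Finsupp Module

section Conical

variable {L V : Type*} [AddCommGroup V] [Module ℝ V] (ι : L → V)

/-- Functionals positive on `P` and zero on `Z`. -/
def UU (P Z : Set V) : Set (Dual ℝ V) := {u | (∀ a ∈ P, 0 < u a) ∧ ∀ b ∈ Z, u b = 0}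

/-- Lists on which some functional of `UU P Z` is positive. -/
def KK (P Z : Set V) : Set (List L) := {l | ∃ u ∈ UU P Z, ∀ a ∈ l, 0 < u (ι a)}

/-- A finite set of vertices detects all nonzero functionals nonnegative at `p`. -/
def Cov (p : V) : Prop :=
  ∃ S : Finset L, ∀ u : Dual ℝ V, u ≠ 0 → 0 ≤ u p → ∃ v ∈ S, 0 < u (ι v)

variable {ι}

lemma subClosed_KK (P Z : Set V) : SubClosed (KK ι P Z) := by
  rintro l ⟨u, hu, hl⟩ l' hs
  exact ⟨u, hu, fun a ha => hl a (hs.subset ha)⟩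

lemma exists_perturb {F : Set V} (hF : F.Finite) (u u₀ : Dual ℝ V) (h : ∀ a ∈ F, 0 < u a) :
    ∃ ε > 0, ∀ s : ℝ, |s| ≤ ε → ∀ a ∈ F, 0 < (u + s • u₀) a := by
  have h1 : ∀ᶠ s : ℝ in nhds 0, ∀ a ∈ F, 0 < u a + s * u₀ a := by
    refine (Filter.eventually_all_finite hF).2 fun a ha => ?_
    have hc : Continuous fun s : ℝ => u a + s * u₀ a := by fun_prop
    exact hc.continuousAt.eventually (lt_mem_nhds (by simpa using h a ha))
  obtain ⟨ε, hε, h2⟩ := Metric.eventually_nhds_iff.1 h1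
  refine ⟨ε / 2, by positivity, fun s hs a ha => ?_⟩
  have := h2 (y := s) (by rw [Real.dist_eq, sub_zero]; linarith) a ha
  simpa using this

lemma exists_dual_one {Z : Set V} {h : V} (hh : h ∉ Submodule.span ℝ Z) :
    ∃ u₀ : Dual ℝ V, u₀ h = 1 ∧ ∀ b ∈ Z, u₀ b = 0 := by
  obtain ⟨f, hf, hk⟩ := Submodule.exists_le_ker_of_notMem hh
  refine ⟨(f h)⁻¹ • f, by simp [hf], fun b hb => ?_⟩
  have : f b = 0 := hk (Submodule.subset_span hb)
  simp [this]

lemma exists_perturb_KK {P Z : Set V} (hP : P.Finite) {h : V} (hh : h ∉ Submodule.span ℝ Z)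
    {l : List L} {u : Dual ℝ V} (hu : u ∈ UU P Z) (hl : ∀ a ∈ l, 0 < u (ι a)) (hz : u h = 0) :
    l ∈ KK ι (insert h P) Z ∧ l ∈ KK ι (insert (-h) P) Z := by
  obtain ⟨u₀, h1, h0⟩ := exists_dual_one hh
  obtain ⟨ε, hε, hp⟩ := exists_perturb (hP.union ((List.finite_toSet l).image ι)) u u₀ (by
    rintro a (ha | ⟨b, hb, rfl⟩)
    · exact hu.1 a ha
    · exact hl b hb)
  have key : ∀ s : ℝ, |s| ≤ ε → ∀ b, 0 < (u + s • u₀) b → l ∈ KK ι (insert b P) Z := by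
    intro s hs b hb
    refine ⟨u + s • u₀, ⟨?_, fun b hb => by simp [hu.2 b hb, h0 b hb]⟩,
      fun a ha => hp s hs _ (Or.inr ⟨a, ha, rfl⟩)⟩
    rintro a (rfl | ha)
    · exact hb
    · exact hp s hs a (Or.inl ha)
  exact ⟨key ε (abs_of_pos hε).le h (by simp [hz, h1, hε]),
    key (-ε) (by rw [abs_neg, abs_of_pos hε]) (-h) (by simp [hz, h1, hε])⟩

lemma KK_union {P Z : Set V} (hP : P.Finite) {h : V} (hh : h ∉ Submodule.span ℝ Z) :
    KK ι (insert h P) Z ∪ KK ι (insert (-h) P) Z = KK ι P Z := by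
  ext l
  constructor
  · rintro (⟨u, hu, hl⟩ | ⟨u, hu, hl⟩) <;>
      exact ⟨u, ⟨fun a ha => hu.1 a (Or.inr ha), hu.2⟩, hl⟩
  · rintro ⟨u, hu, hl⟩
    rcases lt_trichotomy (u h) 0 with hn | hz | hp
    · refine Or.inr ⟨u, ⟨?_, hu.2⟩, hl⟩
      rintro a (rfl | ha)
      · simpa using hn
      · exact hu.1 a ha
    · exact Or.inl (exists_perturb_KK hP hh hu hl hz).1
    · refine Or.inl ⟨u, ⟨?_, hu.2⟩, hl⟩
      rintro a (rfl | ha)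
      · exact hp
      · exact hu.1 a ha

lemma KK_inter {P Z : Set V} (hP : P.Finite) {h : V} (hh : h ∉ Submodule.span ℝ Z) :
    KK ι (insert h P) Z ∩ KK ι (insert (-h) P) Z = KK ι P (insert h Z) := by
  ext l
  constructor
  · rintro ⟨⟨u, hu, hl⟩, ⟨w, hw, hl'⟩⟩
    have h1 : 0 < u h := hu.1 h (Or.inl rfl)
    have h2 : 0 < - w h := by simpa using hw.1 (-h) (Or.inl rfl)
    refine ⟨(- w h) • u + u h • w, ⟨fun a ha => ?_, ?_⟩, fun a ha => ?_⟩
    · have := mul_pos h2 (hu.1 a (Or.inr ha))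
      have := mul_pos h1 (hw.1 a (Or.inr ha))
      simp only [LinearMap.add_apply, LinearMap.smul_apply, smul_eq_mul]
      linarith
    · rintro b (rfl | hb)
      · simp only [LinearMap.add_apply, LinearMap.smul_apply, smul_eq_mul]; ring
      · simp [hu.2 b hb, hw.2 b hb]
    · have := mul_pos h2 (hl a ha)
      have := mul_pos h1 (hl' a ha)
      simp only [LinearMap.add_apply, LinearMap.smul_apply, smul_eq_mul]
      linarith
  · rintro ⟨u, hu, hl⟩
    exact exists_perturb_KK hP hh ⟨hu.1, fun b hb => hu.2 b (Or.inr hb)⟩ hl (hu.2 h (Or.inl rfl))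

lemma finrank_span_insert_of_notMem [FiniteDimensional ℝ V] {Z : Set V} {h : V}
    (hh : h ∉ Submodule.span ℝ Z) :
    finrank ℝ (Submodule.span ℝ (insert h Z)) = finrank ℝ (Submodule.span ℝ Z) + 1 := by
  rw [Submodule.span_insert, sup_comm, Submodule.finrank_sup_span_singleton hh]

lemma acyc_of_cover [FiniteDimensional ℝ V] (d : ℕ) : ∀ (S : Finset L) (P Z : Set V), P.Finite →
    finrank ℝ V ≤ finrank ℝ (Submodule.span ℝ Z) + d →
    (∀ u ∈ UU P Z, ∃ v ∈ S, 0 < u (ι v)) → ∀ k, Acyc (KK ι P Z) k := by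
  classical
  induction d with
  | zero =>
    intro S P Z hP hd hS k
    have htop : Submodule.span ℝ Z = ⊤ :=
      Submodule.eq_top_of_finrank_eq (le_antisymm (Submodule.finrank_le _) hd)
    have : KK ι P Z = ∅ := by
      refine Set.eq_empty_of_forall_notMem ?_
      rintro l ⟨u, hu, _⟩
      obtain ⟨v, _, hv⟩ := hS u hu
      have : Submodule.span ℝ Z ≤ LinearMap.ker u := Submodule.span_le.2 fun b hb => hu.2 b hb
      rw [htop] at this
      have h0 : u (ι v) = 0 := this (x := ι v) Submodule.mem_top
      exact hv.ne' h0
    rw [this]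
    exact acyc_empty k
  | succ d ihd =>
    intro S
    induction S using Finset.induction_on with
    | empty =>
      intro P Z _ _ hS k
      have : KK ι P Z = ∅ := by
        refine Set.eq_empty_of_forall_notMem ?_
        rintro l ⟨u, hu, _⟩
        obtain ⟨v, hv, _⟩ := hS u hu
        simp at hv
      rw [this]
      exact acyc_empty k
    | insert v S _ ihS =>
      intro P Z hP hd hS k
      by_cases hv : ι v ∈ Submodule.span ℝ Z
      · refine ihS P Z hP hd (fun u hu => ?_) k
        obtain ⟨w, hw, hpos⟩ := hS u hu
        rcases Finset.mem_insert.1 hw with rfl | hw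
        · have : Submodule.span ℝ Z ≤ LinearMap.ker u :=
            Submodule.span_le.2 fun b hb => hu.2 b hb
          exact absurd (this hv) hpos.ne'
        · exact ⟨w, hw, hpos⟩
      · rw [← KK_union hP hv, ← acyc_iff]
        refine rankLE_union (subClosed_KK _ _) (subClosed_KK _ _) ?_ ?_ ?_
        · refine acyc_cone v ?_ k
          rintro l ⟨u, hu, hl⟩
          refine ⟨u, hu, ?_⟩
          intro a ha
          rcases List.mem_cons.1 ha with rfl | ha
          · exact hu.1 _ (Or.inl rfl)
          · exact hl a ha
        · refine ihS _ Z (hP.insert _) hd (fun u hu => ?_) k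
          obtain ⟨w, hw, hpos⟩ := hS u ⟨fun a ha => hu.1 a (Or.inr ha), hu.2⟩
          rcases Finset.mem_insert.1 hw with rfl | hw
          · have := hu.1 _ (Or.inl rfl)
            rw [map_neg] at this
            linarith
          · exact ⟨w, hw, hpos⟩
        · rw [KK_inter hP hv, acyc_iff]
          refine ihd (insert v S) P (insert (ι v) Z) hP ?_ (fun u hu => hS u ⟨hu.1, fun b hb =>
            hu.2 b (Or.inr hb)⟩) _
          rw [finrank_span_insert_of_notMem hv]
          omega

lemma rankLE_linear [FiniteDimensional ℝ V] {p : V} (hp : Cov ι p) (k : ℕ) : ∀ (Z : Set V), p ∈ Z →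
    finrank ℝ V = finrank ℝ (Submodule.span ℝ Z) + k → ∀ j : ℤ,
    RankLE (KK ι ∅ Z) j (if j = k then 1 else 0) := by
  obtain ⟨S, hS⟩ := hp
  induction k with
  | zero =>
    intro Z _ hd j
    have htop : Submodule.span ℝ Z = ⊤ := Submodule.eq_top_of_finrank_eq hd.symm
    have hnil : ∀ l ∈ KK ι ∅ Z, l = [] := by
      rintro l ⟨u, hu, hl⟩
      have : Submodule.span ℝ Z ≤ LinearMap.ker u := Submodule.span_le.2 fun b hb => hu.2 b hb
      rw [htop] at this
      cases l with
      | nil => rfl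
      | cons a l => exact absurd (this (x := ι a) Submodule.mem_top) (hl a (by simp)).ne'
    have hval : ∀ {z : Ch L}, z ∈ supp (KK ι ∅ Z ∩ len j) → ∃ c : ℚ, z = single [] c := by
      intro z hz
      refine ⟨z [], ?_⟩
      ext l
      by_cases hl : l = []
      · subst hl; simp
      · rw [Finsupp.single_apply, if_neg (Ne.symm hl)]
        by_contra hne
        exact hl (hnil l (hz (Finsupp.mem_support_iff.2 hne)).1)
    by_cases hj : j = ((0 : ℕ) : ℤ)
    · rw [if_pos hj]
      intro z hz _
      choose c hc using fun i => hval (hz i)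
      by_cases h1 : c 1 = 0
      · refine ⟨![0, 1], fun h => by simpa using congrFun h 1, 0, Submodule.zero_mem _, ?_⟩
        rw [Fin.sum_univ_two, hc 1, h1]; simp
      · refine ⟨![c 1, - c 0], fun h => h1 (by simpa using congrFun h 0), 0,
          Submodule.zero_mem _, ?_⟩
        rw [Fin.sum_univ_two, hc 1, hc 0]
        simp [mul_comm]
    · rw [if_neg hj, acyc_iff]
      intro z hz _
      refine ⟨0, Submodule.zero_mem _, ?_⟩
      rw [map_zero]
      ext l
      by_contra hne
      have := hz (Finsupp.mem_support_iff.2 (Ne.symm hne))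
      apply hj
      have h2 := this.2
      rw [hnil l this.1] at h2
      simpa [len] using h2.symm
  | succ k ih =>
    intro Z hZ hd j
    obtain ⟨h, hh⟩ : ∃ h, h ∉ Submodule.span ℝ Z := by
      by_contra! hall
      have : Submodule.span ℝ Z = ⊤ := by rw [eq_top_iff]; exact fun x _ => hall x
      rw [this, finrank_top] at hd
      omega
    have hcov : ∀ (b : V), ∀ u ∈ UU (insert b ∅) Z, ∃ v ∈ S, 0 < u (ι v) := by
      intro b u hu
      refine hS u (fun h0 => ?_) (hu.2 p hZ).ge
      have := hu.1 b (Or.inl rfl)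
      simp [h0] at this
    rw [← KK_union Set.finite_empty hh]
    refine rankLE_union (subClosed_KK _ _) (subClosed_KK _ _)
      (acyc_of_cover _ S _ Z (Set.finite_empty.insert _) (le_of_eq hd) (hcov h) _)
      (acyc_of_cover _ S _ Z (Set.finite_empty.insert _) (le_of_eq hd) (hcov (-h)) _) ?_
    rw [KK_inter Set.finite_empty hh]
    have := ih (insert h Z) (Or.inr hZ)
      (by rw [finrank_span_insert_of_notMem hh]; omega) (j - 1)
    convert this using 2
    push_cast
    omega

/-- Lists on which some functional negative on `P` is positive. -/
def Av (ι : L → V) (P : Set V) : Set (List L) :=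
  {l | ∃ u : Dual ℝ V, (∀ p ∈ P, u p < 0) ∧ ∀ a ∈ l, 0 < u (ι a)}

lemma Av_eq (P : Set V) : Av ι P = KK ι (Neg.neg '' P) ∅ := by
  ext l
  constructor
  · rintro ⟨u, h1, h2⟩
    exact ⟨u, ⟨by rintro _ ⟨p, hp, rfl⟩; simpa using h1 p hp, by simp⟩, h2⟩
  · rintro ⟨u, ⟨h1, -⟩, h2⟩
    exact ⟨u, fun p hp => by simpa using h1 (-p) ⟨p, hp, rfl⟩, h2⟩

/-- The lists avoiding a finite nonempty set of points have the cohomology of a sphere. -/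
theorem rankLE_Av [FiniteDimensional ℝ V] (τ : Dual ℝ V) (hτ : ∀ v, 0 < τ (ι v)) {P : Set V}
    (hP : P.Finite) (hne : P.Nonempty) (hcov : ∀ p ∈ P, Cov ι p) (hpos : ∀ p ∈ P, 0 < τ p)
    (j : ℤ) : RankLE (Av ι P) j (if j + 1 = finrank ℝ V then 1 else 0) := by
  rw [Av_eq]
  have hne0 : ∀ p ∈ P, p ∉ Submodule.span ℝ (∅ : Set V) := by
    intro p hp h
    have := hpos p hp
    simp only [Submodule.span_empty, Submodule.mem_bot] at h
    simp [h] at this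
  obtain ⟨p₀, hp₀⟩ := hne
  suffices H : ∀ Q : Set V, Q.Finite → Q ⊆ P →
      RankLE (KK ι (insert (-p₀) (Neg.neg '' Q)) ∅) j (if j + 1 = finrank ℝ V then 1 else 0) by
    have := H P hP le_rfl
    rwa [Set.insert_eq_of_mem (Set.mem_image_of_mem Neg.neg hp₀)] at this
  intro Q hQ
  induction Q, hQ using Set.Finite.induction_on with
  | empty =>
    intro _
    have e : KK ι (insert (-p₀) (Neg.neg '' (∅ : Set V))) ∅ = KK ι ∅ {p₀} := by
      ext l
      constructor
      · rintro ⟨u, ⟨h1, -⟩, h2⟩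
        have hp : 0 < - u p₀ := by simpa using h1 _ (Or.inl rfl)
        refine ⟨τ p₀ • u + (- u p₀) • τ, ⟨by simp, ?_⟩, fun a ha => ?_⟩
        · rintro _ rfl
          simp only [LinearMap.add_apply, LinearMap.smul_apply, smul_eq_mul]; ring
        · have := mul_pos (hpos p₀ hp₀) (h2 a ha)
          have := mul_pos hp (hτ a)
          simp only [LinearMap.add_apply, LinearMap.smul_apply, smul_eq_mul]
          linarith
      · rintro ⟨u, ⟨-, h1⟩, h2⟩
        have h0 := h1 p₀ rfl
        have := (exists_perturb_KK (P := ∅) Set.finite_empty (hne0 p₀ hp₀)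
          ⟨by simp, by simp⟩ h2 h0).2
        simpa using this
    rw [e]
    have h1 : finrank ℝ (Submodule.span ℝ ({p₀} : Set V)) = 1 :=
      finrank_span_singleton fun h => by simpa [h] using hpos p₀ hp₀
    have hle := Submodule.finrank_le (Submodule.span ℝ ({p₀} : Set V))
    have := rankLE_linear (hcov p₀ hp₀) (finrank ℝ V - 1) {p₀} rfl (by omega) j
    convert this using 2
    omega
  | @insert p Q _ hQf ih =>
    intro hsub
    have hp : p ∈ P := hsub (Or.inl rfl)
    have hfin : (insert (-p₀) (Neg.neg '' Q)).Finite := (hQf.image _).insert _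
    have ih' := ih fun x hx => hsub (Or.inr hx)
    have hU := KK_union (ι := ι) hfin (hne0 p hp)
    have hI := KK_inter (ι := ι) hfin (hne0 p hp)
    obtain ⟨S, hS⟩ := hcov p hp
    rw [← hU, Set.union_comm] at ih'
    rw [Set.image_insert_eq, Set.insert_comm]
    refine rankLE_of_union (subClosed_KK _ _) (subClosed_KK _ _) ?_ ih'
    rw [Set.inter_comm, hI]
    refine acyc_of_cover (finrank ℝ V) S _ _ hfin (by omega) (fun u hu => ?_) _
    refine hS u (fun h0 => ?_) (hu.2 p (Or.inl rfl)).ge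
    have := hu.1 (-p₀) (Or.inl rfl)
    simp [h0] at this

end Conical

end Eis

namespace Eis

open Finsupp Module

section Cochains

variable {α : Type*}

/-- Evaluation of a cochain on chains. -/
noncomputable def ev (f : List α → ℚ) : Ch α →ₗ[ℚ] ℚ := Finsupp.linearCombination ℚ f

@[simp] lemma ev_single (f : List α → ℚ) (l : List α) (c : ℚ) : ev f (single l c) = c * f l := by
  simp [ev]

/-- The coboundary operator. -/
noncomputable def dl : (List α → ℚ) →ₗ[ℚ] (List α → ℚ) where
  toFun f l := ev f (bd (single l 1))
  map_add' f g := by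
    ext l
    have : ∀ z : Ch α, ev (f + g) z = ev f z + ev g z := fun z => by
      suffices h : ev (f + g) = ev f + ev g from LinearMap.congr_fun h z
      exact ch_ext fun l => by simp
    exact this _
  map_smul' c f := by
    ext l
    have : ∀ z : Ch α, ev (c • f) z = c * ev f z := fun z => by
      suffices h : ev (c • f) = c • ev f from LinearMap.congr_fun h z
      exact ch_ext fun l => by simp
    exact this _

lemma dl_apply (f : List α → ℚ) (l : List α) : dl f l = ev f (bd (single l 1)) := rfl

lemma ev_dl (f : List α → ℚ) (z : Ch α) : ev (dl f) z = ev f (bd z) := by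
  suffices h : ev (dl f) = (ev f).comp bd from LinearMap.congr_fun h z
  exact ch_ext fun l => by simp [dl_apply]

lemma ev_eq_zero {f : List α → ℚ} {K : Set (List α)} (h : ∀ l ∈ K, f l = 0) {z : Ch α}
    (hz : z ∈ supp K) : ev f z = 0 := by
  have := map_supp (W := ⊥) (ev f) (fun l hl => by simp [h l hl]) hz
  simpa using this

/-- Push a chain forward along a vertex map. -/
noncomputable def mp {β : Type*} (s : α → β) : Ch α →ₗ[ℚ] Ch β :=
  Finsupp.lmapDomain ℚ ℚ (List.map s)

@[simp] lemma mp_single {β : Type*} (s : α → β) (l : List α) (c : ℚ) :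
    mp s (single l c) = single (l.map s) c := by simp [mp]

lemma mp_cone {β : Type*} (s : α → β) (a : α) (z : Ch α) :
    mp s (cone a z) = cone (s a) (mp s z) := by
  suffices h : (mp s).comp (cone a) = (cone (s a)).comp (mp s) from LinearMap.congr_fun h z
  exact ch_ext fun l => by simp

lemma mp_ct {β : Type*} (s : α → β) (χ : β → ℚ) (z : Ch α) :
    mp s (ct (χ ∘ s) z) = ct χ (mp s z) := by
  suffices h : (mp s).comp (ct (χ ∘ s)) = (ct χ).comp (mp s) from LinearMap.congr_fun h z
  refine ch_ext fun l => ?_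
  induction l with
  | nil => simp
  | cons a l ih =>
    simp only [LinearMap.comp_apply, mp_single, List.map_cons] at ih ⊢
    rw [ct_single_cons, ct_single_cons, map_sub, mp_cone, ih]
    simp

lemma mp_bd {β : Type*} (s : α → β) (z : Ch α) : mp s (bd z) = bd (mp s z) :=
  mp_ct s (fun _ => 1) z

lemma ev_mp {β : Type*} (s : α → β) (f : List β → ℚ) (z : Ch α) :
    ev (fun l => f (l.map s)) z = ev f (mp s z) := by
  suffices h : ev (fun l => f (l.map s)) = (ev f).comp (mp s) from LinearMap.congr_fun h z
  exact ch_ext fun l => by simp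

lemma dl_map {β : Type*} (s : α → β) (f : List β → ℚ) :
    dl (fun l => f (l.map s)) = fun l => dl f (l.map s) := by
  ext l
  rw [dl_apply, ev_mp, mp_bd, mp_single, dl_apply]

/-! ### Alternating cochains -/

/-- A cochain is alternating. -/
def IsAlt (f : List α → ℚ) : Prop :=
  ∀ (m : ℕ) (x : Fin m → α) (π : Equiv.Perm (Fin m)),
    f (List.ofFn (x ∘ π)) = (Equiv.Perm.sign π : ℤ) * f (List.ofFn x)

lemma ct_ofFn (χ : α → ℚ) : ∀ (m : ℕ) (x : Fin (m + 1) → α),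
    ct χ (single (List.ofFn x) 1) =
      ∑ i : Fin (m + 1), ((-1) ^ (i : ℕ) * χ (x i)) • single (List.ofFn (x ∘ i.succAbove)) 1 := by
  intro m
  induction m with
  | zero =>
    intro x
    rw [List.ofFn_succ, ct_single_cons]
    simp
  | succ m ih =>
    intro x
    rw [List.ofFn_succ, ct_single_cons, ih, map_sum, sub_eq_add_neg, ← Finset.sum_neg_distrib,
      Fin.sum_univ_succ (n := m + 1)]
    congr 1
    · simp [Function.comp_def]
    · refine Finset.sum_congr rfl fun i _ => ?_
      have e : List.ofFn (x ∘ i.succ.succAbove) =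
          x 0 :: List.ofFn ((fun j : Fin (m + 1) => x j.succ) ∘ i.succAbove) := by
        rw [List.ofFn_succ]
        simp [Function.comp_def]
      rw [e, map_smul, cone_single, ← neg_smul, Fin.val_succ, pow_succ]
      congr 1
      ring

lemma dl_ofFn (f : List α → ℚ) (m : ℕ) (x : Fin (m + 1) → α) :
    dl f (List.ofFn x) =
      ∑ i : Fin (m + 1), (-1) ^ (i : ℕ) * f (List.ofFn (x ∘ i.succAbove)) := by
  rw [dl_apply, ct_ofFn, map_sum]
  simp

lemma sum_perm_succ (m : ℕ) (F : Equiv.Perm (Fin (m + 1)) → ℚ) :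
    ∑ π, F π = ∑ i : Fin (m + 1), ∑ π : Equiv.Perm (Fin m),
      F (i.cycleRange.symm * Equiv.Perm.decomposeFin.symm (0, π)) := by
  rw [← Finset.sum_product']
  symm
  refine Fintype.sum_bijective
    (fun p : Fin (m + 1) × Equiv.Perm (Fin m) =>
      p.1.cycleRange.symm * Equiv.Perm.decomposeFin.symm (0, p.2)) ?_ _ _ (fun _ => rfl)
  rw [Fintype.bijective_iff_injective_and_card]
  refine ⟨?_, by simp [Fintype.card_perm, Nat.factorial_succ]⟩
  rintro ⟨i, π⟩ ⟨j, ρ⟩ h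
  have h0 := congrArg (fun σ : Equiv.Perm (Fin (m + 1)) => σ 0) h
  simp only [Equiv.Perm.coe_mul, Function.comp_apply, Equiv.Perm.decomposeFin_symm_apply_zero,
    Fin.cycleRange_symm_zero] at h0
  subst h0
  have h1 := mul_left_cancel h
  have h2 := Equiv.Perm.decomposeFin.symm.injective h1
  simpa using h2

/-- The unnormalized alternating sum over permutations of the entries. -/
noncomputable def altSum (f : List α → ℚ) (l : List α) : ℚ :=
  ∑ π : Equiv.Perm (Fin l.length), ((Equiv.Perm.sign π : ℤ) : ℚ) * f (List.ofFn (l.get ∘ π))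

lemma altSum_ofFn (f : List α → ℚ) {m : ℕ} (x : Fin m → α) :
    altSum f (List.ofFn x) =
      ∑ π : Equiv.Perm (Fin m), ((Equiv.Perm.sign π : ℤ) : ℚ) * f (List.ofFn (x ∘ π)) := by
  have key : ∀ (l : List α) (k : ℕ) (h : k = l.length), altSum f l =
      ∑ π : Equiv.Perm (Fin k), ((Equiv.Perm.sign π : ℤ) : ℚ) *
        f (List.ofFn (fun i => l.get (Fin.cast h (π i)))) := by
    rintro l k rfl
    rfl
  rw [key _ m (by simp)]
  refine Finset.sum_congr rfl fun π _ => ?_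
  congr 2
  congr 1
  ext i
  simp

lemma exists_ofFn (l : List α) : ∃ x : Fin l.length → α, l = List.ofFn x :=
  ⟨l.get, (List.ofFn_get l).symm⟩

lemma altSum_dl (f : List α → ℚ) (l : List α) :
    altSum (dl f) l = l.length * dl (altSum f) l := by
  obtain ⟨x, hx⟩ := exists_ofFn l
  revert x
  generalize l.length = m
  rintro x rfl
  cases m with
  | zero =>
    rw [altSum_ofFn]
    simp [dl_apply]
  | succ m =>
    rw [altSum_ofFn, dl_ofFn]
    have h1 : ∀ i : Fin (m + 1), ∑ π : Equiv.Perm (Fin (m + 1)), ((Equiv.Perm.sign π : ℤ) : ℚ) *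
        ((-1) ^ (i : ℕ) * f (List.ofFn ((x ∘ π) ∘ i.succAbove))) =
        ∑ π : Equiv.Perm (Fin (m + 1)), ((Equiv.Perm.sign π : ℤ) : ℚ) *
          f (List.ofFn (x ∘ π ∘ Fin.succ)) := by
      intro i
      refine Fintype.sum_equiv (Equiv.mulRight i.cycleRange.symm) _ _ fun π => ?_
      rw [Equiv.coe_mulRight, Equiv.Perm.sign_mul, Equiv.Perm.sign_symm, Fin.sign_cycleRange]
      have : (x ∘ ⇑(π * i.cycleRange.symm) ∘ Fin.succ) = (x ∘ π) ∘ i.succAbove := by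
        ext j; simp
      rw [this]
      push_cast
      ring
    have h2 : ∑ π : Equiv.Perm (Fin (m + 1)), ((Equiv.Perm.sign π : ℤ) : ℚ) *
          f (List.ofFn (x ∘ π ∘ Fin.succ)) =
        ∑ i : Fin (m + 1), (-1) ^ (i : ℕ) * altSum f (List.ofFn (x ∘ i.succAbove)) := by
      rw [sum_perm_succ]
      refine Finset.sum_congr rfl fun i _ => ?_
      rw [altSum_ofFn, Finset.mul_sum]
      refine Finset.sum_congr rfl fun π _ => ?_
      have : (x ∘ ⇑(i.cycleRange.symm * Equiv.Perm.decomposeFin.symm (0, π)) ∘ Fin.succ) =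
          (x ∘ i.succAbove) ∘ π := by
        ext j
        simp [Equiv.Perm.decomposeFin_symm_apply_succ]
      rw [this, Equiv.Perm.sign_mul, Equiv.Perm.sign_symm, Fin.sign_cycleRange,
        Equiv.Perm.decomposeFin.symm_sign]
      push_cast
      simp [mul_assoc]
    simp only [dl_ofFn, Finset.mul_sum]
    rw [Finset.sum_comm, Finset.sum_congr rfl fun i _ => h1 i, Finset.sum_const, h2]
    simp [Finset.mul_sum]

lemma altSum_of_isAlt {f : List α → ℚ} (hf : IsAlt f) (l : List α) :
    altSum f l = l.length.factorial * f l := by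
  obtain ⟨x, hx⟩ := exists_ofFn l
  revert x
  generalize l.length = m
  rintro x rfl
  rw [altSum_ofFn]
  have : ∀ π : Equiv.Perm (Fin m), ((Equiv.Perm.sign π : ℤ) : ℚ) * f (List.ofFn (x ∘ π)) =
      f (List.ofFn x) := fun π => by
    rw [hf m x π, ← mul_assoc, ← Int.cast_mul, ← Units.val_mul, Int.units_mul_self]
    simp
  rw [Finset.sum_congr rfl fun π _ => this π]
  simp [Fintype.card_perm]

lemma isAlt_altSum (f : List α → ℚ) : IsAlt (altSum f) := by
  intro m x π
  rw [altSum_ofFn, altSum_ofFn, Finset.mul_sum]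
  refine Fintype.sum_equiv (Equiv.mulLeft π) _ _ fun ρ => ?_
  rw [Equiv.coe_mulLeft, Equiv.Perm.sign_mul, ← mul_assoc]
  congr 1
  rw [Units.val_mul, Int.cast_mul, ← mul_assoc, ← Int.cast_mul, ← Units.val_mul,
    Int.units_mul_self]
  simp

end Cochains

section Compact

variable {L V : Type*} [AddCommGroup V] [Module ℝ V] (ι : L → V) (X : Set V) (r : Setoid L)

/-- Alternating `r`-invariant cochains of degree `m` which vanish on all lists avoiding some
finite subset of `X`. -/
def EE (m : ℕ) : Submodule ℚ (List L → ℚ) where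
  carrier := {f | (∀ l, l.length ≠ m → f l = 0) ∧ IsAlt f ∧
    (∀ l l', List.Forall₂ r l l' → f l = f l') ∧
    ∃ P : Set V, P.Finite ∧ P ⊆ X ∧ ∀ l ∈ Av ι P, f l = 0}
  zero_mem' := ⟨by simp, fun m x π => by simp, by simp, ∅, by simp⟩
  add_mem' := by
    rintro f g ⟨h1, h2, h3, P, h4, h6, h7⟩ ⟨k1, k2, k3, Q, k4, k6, k7⟩
    refine ⟨fun l hl => by simp [h1 l hl, k1 l hl], fun m x π => ?_,
      fun l l' hl => by simp [h3 l l' hl, k3 l l' hl], P ∪ Q, h4.union k4,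
      Set.union_subset h6 k6, ?_⟩
    · simp only [Pi.add_apply, h2 m x π, k2 m x π]; ring
    · rintro l ⟨u, hu, hl⟩
      rw [Pi.add_apply, h7 l ⟨u, fun p hp => hu p (Or.inl hp), hl⟩,
        k7 l ⟨u, fun p hp => hu p (Or.inr hp), hl⟩, add_zero]
  smul_mem' := by
    rintro c f ⟨h1, h2, h3, P, h4, h6, h7⟩
    refine ⟨fun l hl => by simp [h1 l hl], fun m x π => ?_,
      fun l l' hl => by simp [h3 l l' hl], P, h4, h6, fun l hl => by simp [h7 l hl]⟩
    simp only [Pi.smul_apply, h2 m x π, smul_eq_mul]; ring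

variable {ι X r}

lemma exists_factor {M N : Type*} [AddCommGroup M] [Module ℚ M] [AddCommGroup N] [Module ℚ N]
    (φ : M →ₗ[ℚ] N) (ψ : M →ₗ[ℚ] ℚ) (h : LinearMap.ker φ ≤ LinearMap.ker ψ) :
    ∃ G : N →ₗ[ℚ] ℚ, G.comp φ = ψ := by
  obtain ⟨G, hG⟩ := LinearMap.exists_extend
    (((LinearMap.ker φ).liftQ ψ h).comp φ.quotKerEquivRange.symm.toLinearMap)
  refine ⟨G, LinearMap.ext fun x => ?_⟩
  have := LinearMap.congr_fun hG ⟨φ x, LinearMap.mem_range_self φ x⟩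
  simp only [LinearMap.comp_apply, Submodule.subtype_apply, LinearEquiv.coe_coe] at this ⊢
  rw [this]
  have e : φ.quotKerEquivRange.symm ⟨φ x, LinearMap.mem_range_self φ x⟩ =
      (LinearMap.ker φ).mkQ x := by
    rw [LinearEquiv.symm_apply_eq]; rfl
  rw [e]; simp

lemma Av_anti {P Q : Set V} (h : P ⊆ Q) : Av ι Q ⊆ Av ι P := by
  rintro l ⟨u, hu, hl⟩
  exact ⟨u, fun p hp => hu p (h hp), hl⟩

lemma supp_len_eq_zero {K : Set (List L)} {k k' : ℤ} (hk : k ≠ k') {f : List L → ℚ}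
    (hf : ∀ l, (l.length : ℤ) ≠ k → f l = 0) {z : Ch L} (hz : z ∈ supp (K ∩ len k')) :
    ev f z = 0 :=
  ev_eq_zero (fun l hl => hf l fun h => hk (h.symm.trans hl.2)) hz

/-- Solving `δg = f` relative to an avoiding family, given the vanishing of the obstruction. -/
lemma exists_dl_of_obstruction (hι : ∀ a b, r a b → ι a = ι b) {P : Set V} (hP : P.Finite)
    (hPX : P ⊆ X) {m : ℕ} {f : List L → ℚ} (hf : f ∈ EE ι X r (m + 1)) (hc : dl f = 0)
    (v : L)
    (hobs : ∀ a ∈ supp (Av ι P ∩ len m), bd a = 0 → ev f (cone v a) = 0) :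
    ∃ g ∈ EE ι X r m, dl g = f := by
  obtain ⟨hf1, hf2, hf3, -⟩ := hf
  have hcl : ∀ z : Ch L, ev f (bd z) = 0 := fun z => by rw [← ev_dl, hc]; simp [ev]
  obtain ⟨G, hG⟩ := exists_factor
    ((bd (α := L)).coprod (supp (Av ι P ∩ len m)).subtype)
    ((ev f).comp (LinearMap.fst ℚ (Ch L) _)) (by
      rintro ⟨z, a, ha⟩ h
      simp only [LinearMap.mem_ker, LinearMap.coprod_apply, Submodule.subtype_apply,
        LinearMap.comp_apply, LinearMap.fst_apply] at h ⊢
      have hb : bd a = 0 := by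
        have := congrArg bd h
        rwa [map_add, bd_bd, zero_add, map_zero] at this
      have h1 := hobs a ha hb
      have h2 : bd (z + cone v a) = 0 := by
        rw [map_add, bd_cone, hb, map_zero, sub_zero, h]
      have h3 : z + cone v a = bd (cone v (z + cone v a)) := by
        rw [bd_cone, h2, map_zero, sub_zero]
      have h4 := hcl (cone v (z + cone v a))
      rw [← h3, map_add, h1, add_zero] at h4
      exact h4)
  have hG1 : ∀ z, G (bd z) = ev f z := fun z => by
    have := LinearMap.congr_fun hG (z, 0)
    simpa using this
  have hG2 : ∀ l ∈ Av ι P ∩ len (m : ℤ), G (single l 1) = 0 := fun l hl => by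
    have := LinearMap.congr_fun hG (0, ⟨single l 1, single_mem_supp hl 1⟩)
    simpa using this
  classical
  set g₀ : List L → ℚ := fun l => if l.length = m then G (single l 1) else 0 with hg₀
  have hg₀' : ∀ l, l.length ≠ m → g₀ l = 0 := fun l hl => by simp [hg₀, hl]
  have e₀ : dl g₀ = f := by
    ext l
    have hb := ct_mem (K := Set.univ) (fun _ _ _ _ => trivial) (fun _ => 1)
      (single_mem_supp (K := Set.univ ∩ len (l.length : ℤ)) (l := l) ⟨trivial, rfl⟩ 1)
    by_cases hl : l.length = m + 1
    · have : ev g₀ (bd (single l 1)) = G (bd (single l 1)) := by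
        have := map_supp (W := ⊥) (ev g₀ - G) (fun l' hl' => ?_) hb
        · simpa [sub_eq_zero] using this
        · have h2 := hl'.2
          simp only [len, Set.mem_ofPred_eq, hl, Nat.cast_add, Nat.cast_one,
            add_sub_cancel_right, Nat.cast_inj] at h2
          simp [hg₀, h2]
      rw [dl_apply, this, hG1]; simp
    · rw [hf1 l hl, dl_apply]
      refine supp_len_eq_zero (k := m) (fun h => hl ?_) (fun l' h => hg₀' l' ?_) hb
      · omega
      · exact_mod_cast h
  set s : L → L := fun a => (Quotient.mk r a).out with hs
  have hsr : ∀ a, r (s a) a := fun a => Quotient.exact (Quotient.out_eq (Quotient.mk r a))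
  have hsι : ∀ a, ι (s a) = ι a := fun a => hι _ _ (hsr a)
  have hsf : ∀ l : List L, f (l.map s) = f l := fun l => hf3 _ _ (by
    induction l with
    | nil => simp
    | cons a l ih => exact List.Forall₂.cons (hsr a) ih)
  set g₁ : List L → ℚ := fun l => g₀ (l.map s) with hg₁
  have e₁ : dl g₁ = f := by
    rw [hg₁, dl_map, e₀]; ext l; exact hsf l
  set g₂ : List L → ℚ := fun l => ((m.factorial : ℚ))⁻¹ * altSum g₁ l with hg₂
  have halt : IsAlt g₂ := by
    intro k x π
    simp only [hg₂, isAlt_altSum g₁ k x π]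
    ring
  have hlen : ∀ l, l.length ≠ m → g₂ l = 0 := by
    intro l hl
    simp only [hg₂, altSum, hg₁]
    rw [Finset.sum_eq_zero, mul_zero]
    intro π _
    rw [hg₀' _ (by simpa using hl), mul_zero]
  refine ⟨g₂, ⟨hlen, halt, ?_, P, hP, hPX, ?_⟩, ?_⟩
  · have hmm : ∀ l l' : List L, List.Forall₂ r l l' → l.map s = l'.map s := by
      intro l l' h
      induction h with
      | nil => rfl
      | cons hab _ ih => rw [List.map_cons, List.map_cons, ih, hs]; simp only [
        Quotient.sound (s := r) hab]
    intro l l' h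
    have hl := h.length_eq
    obtain ⟨x, hx⟩ := exists_ofFn l
    obtain ⟨y, hy⟩ := exists_ofFn l'
    revert x y
    rw [← hl]
    generalize l.length = k
    intro x hx y hy
    simp only [hg₂]
    rw [hx, hy, altSum_ofFn, altSum_ofFn]
    congr 1
    refine Finset.sum_congr rfl fun π _ => ?_
    congr 1
    simp only [hg₁]
    congr 1
    have := hmm l l' h
    rw [hx, hy, List.map_ofFn, List.map_ofFn, List.ofFn_inj] at this
    rw [List.map_ofFn, List.map_ofFn, List.ofFn_inj, ← Function.comp_assoc, this,
      Function.comp_assoc]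
  · rintro l ⟨u, hu, hl⟩
    by_cases hm : l.length = m
    · simp only [hg₂, altSum]
      rw [Finset.sum_eq_zero, mul_zero]
      intro π _
      simp only [hg₁, hg₀]
      rw [if_pos (by simpa using hm), hG2, mul_zero]
      refine ⟨⟨u, hu, ?_⟩, by simpa [len] using hm⟩
      intro a ha
      simp only [List.map_ofFn, List.mem_ofFn, Function.comp_apply] at ha
      obtain ⟨i, rfl⟩ := ha
      rw [hsι]
      exact hl _ (List.get_mem _ _)
    · exact hlen l hm
  · ext l
    by_cases hl : l.length = m + 1
    · have h1 := altSum_dl g₁ l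
      rw [e₁, altSum_of_isAlt hf2, hl, Nat.factorial_succ] at h1
      have h2 : dl g₂ = ((m.factorial : ℚ))⁻¹ • dl (altSum g₁) := by
        rw [← map_smul]; rfl
      rw [h2, Pi.smul_apply, smul_eq_mul]
      have h3 : ((m + 1 : ℕ) : ℚ) ≠ 0 := by positivity
      have h4 : (m.factorial : ℚ) ≠ 0 := by positivity
      push_cast at h1 h3
      field_simp
      refine mul_left_cancel₀ h3 ?_
      rw [← h1]; ring
    · rw [hf1 l hl, dl_apply]
      have hb := ct_mem (K := Set.univ) (fun _ _ _ _ => trivial) (fun _ => 1)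
        (single_mem_supp (K := Set.univ ∩ len (l.length : ℤ)) (l := l) ⟨trivial, rfl⟩ 1)
      refine supp_len_eq_zero (k := m) (fun h => hl ?_) (fun l' h => hlen l' ?_) hb
      · omega
      · exact_mod_cast h

variable [FiniteDimensional ℝ V]

/-- Hypotheses making the cochain complex `EE` have the cohomology of a point in degree
`finrank V`. -/
structure Good (ι : L → V) (X : Set V) (r : Setoid L) : Prop where
  inv : ∀ a b, r a b → ι a = ι b
  ne : X.Nonempty
  cov : ∀ p ∈ X, Cov ι p
  tau : ∃ τ : Dual ℝ V, (∀ v, 0 < τ (ι v)) ∧ ∀ p ∈ X, 0 < τ p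
  vert : Nonempty L

theorem Good.exists_dl (h : Good ι X r) {m : ℕ} (hm : m + 1 ≠ finrank ℝ V) {f : List L → ℚ}
    (hf : f ∈ EE ι X r (m + 1)) (hc : dl f = 0) : ∃ g ∈ EE ι X r m, dl g = f := by
  obtain ⟨p, hp⟩ := h.ne
  obtain ⟨τ, t1, t2⟩ := h.tau
  obtain ⟨v⟩ := h.vert
  obtain ⟨h1, h2, h3, P, hP, hPX, hv⟩ := id hf
  have hQX : insert p P ⊆ X := Set.insert_subset hp hPX
  have hvQ : ∀ l ∈ Av ι (insert p P), f l = 0 :=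
    fun l hl => hv l (Av_anti (Set.subset_insert p P) hl)
  have hr := rankLE_Av τ t1 (hP.insert p) ⟨p, Or.inl rfl⟩ (fun q hq => h.cov q (hQX hq))
    (fun q hq => t2 q (hQX hq)) m
  rw [if_neg (by exact_mod_cast hm), acyc_iff] at hr
  refine exists_dl_of_obstruction h.inv (hP.insert p) hQX hf hc v fun a ha hb => ?_
  obtain ⟨w, hw, rfl⟩ := hr a ha hb
  have e := bd_cone v w
  have h0 : ev f (bd (cone v w)) = 0 := by rw [← ev_dl, hc]; simp [ev]
  rw [e, map_sub, ev_eq_zero (fun l hl => hvQ l hl.1) hw] at h0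
  linarith

theorem Good.exists_dl_top (h : Good ι X r) {m : ℕ} (hm : m + 1 = finrank ℝ V)
    {f₁ f₂ : List L → ℚ} (hf₁ : f₁ ∈ EE ι X r (m + 1)) (hc₁ : dl f₁ = 0)
    (hf₂ : f₂ ∈ EE ι X r (m + 1)) (hc₂ : dl f₂ = 0) :
    ∃ a b : ℚ, (a ≠ 0 ∨ b ≠ 0) ∧ ∃ g ∈ EE ι X r m, dl g = a • f₁ + b • f₂ := by
  obtain ⟨p, hp⟩ := h.ne
  obtain ⟨τ, t1, t2⟩ := h.tau
  obtain ⟨v⟩ := h.vert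
  obtain ⟨-, -, -, P₁, hP₁, hPX₁, hv₁⟩ := id hf₁
  obtain ⟨-, -, -, P₂, hP₂, hPX₂, hv₂⟩ := id hf₂
  set Q := insert p (P₁ ∪ P₂) with hQ
  have hQf : Q.Finite := (hP₁.union hP₂).insert p
  have hQX : Q ⊆ X := Set.insert_subset hp (Set.union_subset hPX₁ hPX₂)
  have hv₁ : ∀ l ∈ Av ι Q, f₁ l = 0 :=
    fun l hl => hv₁ l (Av_anti (Set.subset_union_left.trans (Set.subset_insert p _)) hl)
  have hv₂ : ∀ l ∈ Av ι Q, f₂ l = 0 :=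
    fun l hl => hv₂ l (Av_anti (Set.subset_union_right.trans (Set.subset_insert p _)) hl)
  have hr := rankLE_Av τ t1 hQf ⟨p, Or.inl rfl⟩ (fun q hq => h.cov q (hQX hq))
    (fun q hq => t2 q (hQX hq)) m
  rw [if_pos (by exact_mod_cast hm)] at hr
  have hbdy : ∀ f : List L → ℚ, dl f = 0 → (∀ l ∈ Av ι Q, f l = 0) →
      ∀ w ∈ supp (Av ι Q ∩ len ((m : ℤ) + 1)), ev f (cone v (bd w)) = 0 := by
    intro f hc hv w hw
    have e := bd_cone v w
    have h0 : ev f (bd (cone v w)) = 0 := by rw [← ev_dl, hc]; simp [ev]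
    rw [e, map_sub, ev_eq_zero (fun l hl => hv l hl.1) hw] at h0
    linarith
  by_cases hall : ∀ a ∈ supp (Av ι Q ∩ len m), bd a = 0 → ev f₁ (cone v a) = 0
  · obtain ⟨g, hg, e⟩ := exists_dl_of_obstruction h.inv hQf hQX hf₁ hc₁ v hall
    exact ⟨1, 0, Or.inl one_ne_zero, g, hg, by simp [e]⟩
  · push Not at hall
    obtain ⟨a₁, ha₁, hb₁, hne⟩ := hall
    set c := ev f₂ (cone v a₁)
    set d := - ev f₁ (cone v a₁) with hd
    have hdn : d ≠ 0 := neg_ne_zero.2 hne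
    set f := c • f₁ + d • f₂ with hf
    have evf : ∀ z, ev f z = c * ev f₁ z + d * ev f₂ z := fun z => by
      suffices H : ev f = c • ev f₁ + d • ev f₂ from LinearMap.congr_fun H z
      exact ch_ext fun l => by simp [hf]
    have hmem : f ∈ EE ι X r (m + 1) :=
      Submodule.add_mem _ (Submodule.smul_mem _ _ hf₁) (Submodule.smul_mem _ _ hf₂)
    have hcf : dl f = 0 := by rw [hf, map_add, map_smul, map_smul, hc₁, hc₂]; simp
    have hvf : ∀ l ∈ Av ι Q, f l = 0 := fun l hl => by simp [hf, hv₁ l hl, hv₂ l hl]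
    obtain ⟨g, hg, e⟩ := exists_dl_of_obstruction h.inv hQf hQX hmem hcf v (by
      intro a ha hb
      obtain ⟨q, hq, w, hw, ew⟩ := hr ![a₁, a] (by
        intro i; fin_cases i
        · exact ha₁
        · exact ha) (by
        intro i; fin_cases i
        · exact hb₁
        · exact hb)
      simp only [Nat.reduceAdd, Fin.sum_univ_two, Matrix.cons_val_zero, Matrix.cons_val_one] at ew
      have k1 := hbdy f₁ hc₁ hv₁ w hw
      have k2 := hbdy f hcf hvf w hw
      rw [ew, map_add, map_smul, map_smul, map_add, map_smul, map_smul, smul_eq_mul,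
        smul_eq_mul] at k1 k2
      have k3 : ev f (cone v a₁) = 0 := by rw [evf, hd]; ring
      rw [k3, mul_zero, zero_add] at k2
      rcases mul_eq_zero.1 k2 with h0 | h0
      · rw [h0, zero_mul, add_zero] at k1
        rcases mul_eq_zero.1 k1 with h1 | h1
        · exact absurd (funext fun i => by fin_cases i; exacts [h1, h0]) hq
        · exact absurd h1 hne
      · exact h0)
    exact ⟨c, d, Or.inr hdn, g, hg, e⟩

end Compact

end Eis

namespace Eis

open Finsupp groupCohomology

/-! ## Homogeneous cochains and group cohomology -/

section GroupCohomology

universe u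

variable {G : Type} [Group G]

lemma dl_partialProd {b : List G → ℚ} (hb : ∀ g l, b (l.map (g * ·)) = b l) (n : ℕ)
    (g : Fin (n + 1) → G) :
    (inhomogeneousCochains.d (Rep.trivial ℚ G ℚ) n
      (fun x : Fin n → G => b (List.ofFn (Fin.partialProd x))) g : ℚ) =
      dl b (List.ofFn (Fin.partialProd g)) := by
  rw [dl_ofFn, Fin.sum_univ_succ]
  rw [inhomogeneousCochains.d_hom_apply]
  have h0 : b (List.ofFn (Fin.partialProd g ∘ (0 : Fin (n + 2)).succAbove)) =
      b (List.ofFn (Fin.partialProd fun i => g i.succ)) := by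
    rw [← hb (g 0) (List.ofFn (Fin.partialProd fun i => g i.succ)), List.map_ofFn]
    congr 2
    funext j
    simp only [Function.comp_apply, Fin.zero_succAbove]
    exact Fin.partialProd_succ' g j
  rw [h0]
  simp only [Fin.val_zero, pow_zero, one_mul, Fin.val_succ]
  congr 1
  refine Finset.sum_congr rfl fun j _ => ?_
  rw [Fin.partialProd_contractNth]
  rfl

/-- The homogeneous cochain attached to an inhomogeneous one. -/
noncomputable def homCochain (n : ℕ) (f : (Fin n → G) → ℚ) (l : List G) : ℚ :=
  if l.length = n + 1 then f fun j => (l.getD j 1)⁻¹ * l.getD (j + 1) 1 else 0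

lemma homCochain_ofFn (n : ℕ) (f : (Fin n → G) → ℚ) (x : Fin (n + 1) → G) :
    homCochain n f (List.ofFn x) = f fun j => (x j.castSucc)⁻¹ * x j.succ := by
  rw [homCochain, if_pos (by simp)]
  congr 1
  funext j
  have h1 : (j : ℕ) < n + 1 := by omega
  have h2 : (j : ℕ) + 1 < n + 1 := by omega
  rw [List.getD_eq_getElem _ _ (by simp [h1]), List.getD_eq_getElem _ _ (by simp)]
  simp only [List.getElem_ofFn]
  rfl

lemma homCochain_map (n : ℕ) (f : (Fin n → G) → ℚ) (g : G) (l : List G) :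
    homCochain n f (l.map (g * ·)) = homCochain n f l := by
  by_cases h : l.length = n + 1
  · obtain ⟨x, hx⟩ := exists_ofFn l
    revert x
    rw [h]
    rintro x rfl
    rw [List.map_ofFn, homCochain_ofFn, homCochain_ofFn]
    congr 1
    funext j
    simp [mul_assoc]
  · rw [homCochain, homCochain, if_neg h, if_neg (by simpa using h)]

lemma homCochain_partialProd (n : ℕ) (f : (Fin n → G) → ℚ) (g : Fin n → G) :
    homCochain n f (List.ofFn (Fin.partialProd g)) = f g := by
  rw [homCochain_ofFn]
  congr 1
  funext j
  exact Fin.partialProd_right_inv g j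

/-- Group cohomology vanishes if every homogeneous cocycle bounds. -/
theorem subsingleton_groupCohomology (m : ℕ)
    (H : ∀ c : List G → ℚ, (∀ l, l.length ≠ m + 2 → c l = 0) →
      (∀ g l, c (l.map (g * ·)) = c l) → dl c = 0 →
      ∃ b : List G → ℚ, (∀ g l, b (l.map (g * ·)) = b l) ∧
        ∀ l, l.length = m + 2 → dl b l = c l) :
    Subsingleton (groupCohomology (Rep.trivial ℚ G ℚ) (m + 1)) := by
  refine subsingleton_of_forall_eq 0 fun x => ?_
  induction x using groupCohomology_induction_on with
  | h y =>
  set f : (Fin (m + 1) → G) → ℚ := groupCohomology.iCocycles (Rep.trivial ℚ G ℚ) (m + 1) y with hf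
  have hd : inhomogeneousCochains.d (Rep.trivial ℚ G ℚ) (m + 1) f = 0 := by
    have := (inhomogeneousCochains (Rep.trivial ℚ G ℚ)).iCycles_d (m + 1) (m + 2)
    have h2 := LinearMap.congr_fun (congrArg ModuleCat.Hom.hom this) y
    rw [inhomogeneousCochains.d_def] at h2
    exact h2
  have hc0 : ∀ l, l.length ≠ m + 2 → homCochain (m + 1) f l = 0 := fun l hl => if_neg hl
  have hfun : f = fun x => homCochain (m + 1) f (List.ofFn (Fin.partialProd x)) :=
    funext fun x => (homCochain_partialProd _ f x).symm
  obtain ⟨b, hb, hbc⟩ := H (homCochain (m + 1) f) hc0 (homCochain_map _ f) (by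
    funext l
    by_cases h : l.length = m + 3
    · obtain ⟨x, hx⟩ := exists_ofFn l
      revert x
      rw [h]
      rintro x rfl
      have h1 := dl_partialProd (homCochain_map _ f) (m + 1) fun i => (x i.castSucc)⁻¹ * x i.succ
      rw [← hfun, hd] at h1
      have h2 := Fin.partialProd_left_inv x
      have h3 : dl (homCochain (m + 1) f) (List.ofFn x) = dl (homCochain (m + 1) f)
          (List.ofFn (Fin.partialProd fun i => (x i.castSucc)⁻¹ * x i.succ)) := by
        conv_lhs => rw [← h2]
        have := congrFun (dl_map (x 0 * ·) (homCochain (m + 1) f))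
          (List.ofFn (Fin.partialProd fun i => (x i.castSucc)⁻¹ * x i.succ))
        simp only [homCochain_map] at this
        rw [this, List.map_ofFn]
        rfl
      rw [h3, ← h1]
      rfl
    · rw [dl_apply]
      refine ev_eq_zero (fun l' hl' => hc0 l' fun h' => h ?_) (ct_single_mem _ l)
      rw [← hl'.2, h'])
  set b' : (Fin m → G) → ℚ := fun x => b (List.ofFn (Fin.partialProd x))
  have hy : y = groupCohomology.toCocycles (Rep.trivial ℚ G ℚ) m (m + 1) b' := by
    apply (ModuleCat.mono_iff_injective (groupCohomology.iCocycles (Rep.trivial ℚ G ℚ) (m + 1))).1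
      inferInstance
    have h1 := LinearMap.congr_fun (congrArg ModuleCat.Hom.hom
      ((inhomogeneousCochains (Rep.trivial ℚ G ℚ)).toCycles_i m (m + 1))) b'
    have h2 : groupCohomology.iCocycles (Rep.trivial ℚ G ℚ) (m + 1)
        (groupCohomology.toCocycles (Rep.trivial ℚ G ℚ) m (m + 1) b') =
        inhomogeneousCochains.d (Rep.trivial ℚ G ℚ) m b' := by
      rw [inhomogeneousCochains.d_def] at h1
      exact h1
    rw [h2]
    change f = _
    funext g
    rw [dl_partialProd hb m g, hbc _ (by simp), homCochain_partialProd]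
  rw [hy]
  have := LinearMap.congr_fun (congrArg ModuleCat.Hom.hom
    ((inhomogeneousCochains (Rep.trivial ℚ G ℚ)).toCycles_comp_homologyπ m (m + 1))) b'
  exact this

end GroupCohomology

end Eis

namespace Eis

open Finsupp TensorProduct

/-! ## Equivariant chains and orbit sums -/

section Equivariant

variable {Γ L : Type*} [Group Γ] [MulAction Γ L]

/-- Translation of chains by a group element. -/
noncomputable abbrev tr {α : Type*} [MulAction Γ α] (γ : Γ) : Ch α →ₗ[ℚ] Ch α := mp (γ • ·)

/-- Translation of cochains. -/
def tc {α : Type*} [MulAction Γ α] (γ : Γ) : (List α → ℚ) →ₗ[ℚ] (List α → ℚ) where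
  toFun f l := f (l.map (γ⁻¹ • ·))
  map_add' _ _ := rfl
  map_smul' _ _ := rfl

lemma map_smul_map {α : Type*} [MulAction Γ α] (γ δ : Γ) (l : List α) :
    (l.map (δ • ·)).map (γ • ·) = l.map ((γ * δ) • ·) := by
  simp [List.map_map, Function.comp_def, mul_smul]

lemma map_one_smul {α : Type*} [MulAction Γ α] (l : List α) :
    l.map ((1 : Γ) • ·) = l := by
  simp

lemma tr_tr {α : Type*} [MulAction Γ α] (γ δ : Γ) (z : Ch α) : tr γ (tr δ z) = tr (γ * δ) z := by
  suffices h : (tr γ).comp (tr δ) = (tr (γ * δ) : Ch α →ₗ[ℚ] Ch α) from LinearMap.congr_fun h z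
  exact ch_ext fun l => by simp [mul_smul, Function.comp_def]

lemma dl_tc {α : Type*} [MulAction Γ α] (γ : Γ) (f : List α → ℚ) : dl (tc γ f) = tc γ (dl f) :=
  dl_map _ f

lemma tc_tc {α : Type*} [MulAction Γ α] (γ δ : Γ) (f : List α → ℚ) :
    tc γ (tc δ f) = tc (γ * δ) f := by
  ext l
  simp [tc, mul_smul, Function.comp_def]

variable (Γ L) in
/-- Cochains with finite support on every orbit. -/
def FO : Submodule ℚ (List L → ℚ) where
  carrier := {f | ∀ x : List L, {γ : Γ | f (x.map (γ • ·)) ≠ 0}.Finite}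
  zero_mem' := by intro x; simp
  add_mem' := by
    intro f g hf hg x
    refine ((hf x).union (hg x)).subset fun γ h => ?_
    by_contra h'
    simp only [Set.mem_union, Set.mem_ofPred_eq, not_or, not_not] at h h'
    exact h (by simp [h'.1, h'.2])
  smul_mem' := by
    intro c f hf x
    refine (hf x).subset fun γ h h' => h ?_
    simp [h']

lemma mem_FO {f : List L → ℚ} :
    f ∈ FO Γ L ↔ ∀ x : List L, {γ : Γ | f (x.map (γ • ·)) ≠ 0}.Finite := Iff.rfl

variable (Γ L) in
lemma exists_orb : ∃ o : (List L → ℚ) →ₗ[ℚ] (List L → Γ →₀ ℚ),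
    ∀ f ∈ FO Γ L, ∀ x γ, o f x γ = f (x.map (γ • ·)) := by
  let o₀ : FO Γ L →ₗ[ℚ] (List L → Γ →₀ ℚ) :=
    { toFun := fun f x => Finsupp.ofSupportFinite (fun γ => f.1 (x.map (γ • ·))) (mem_FO.1 f.2 x)
      map_add' := fun f g => by ext x γ; rfl
      map_smul' := fun c f => by ext x γ; rfl }
  obtain ⟨o, ho⟩ := LinearMap.exists_extend o₀
  refine ⟨o, fun f hf x γ => ?_⟩
  have := LinearMap.congr_fun ho ⟨f, hf⟩
  simp only [LinearMap.comp_apply, Submodule.subtype_apply] at this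
  rw [this]
  rfl

variable (Γ) in
/-- The values of a cochain along orbits; meaningful for cochains in `FO`. -/
noncomputable def orb : (List L → ℚ) →ₗ[ℚ] (List L → Γ →₀ ℚ) := (exists_orb Γ L).choose

lemma orb_apply {f : List L → ℚ} (hf : f ∈ FO Γ L) (x : List L) (γ : Γ) :
    orb Γ f x γ = f (x.map (γ • ·)) := (exists_orb Γ L).choose_spec f hf x γ

lemma ev_tr {α : Type*} [MulAction Γ α] (γ : Γ) (f : List α → ℚ) (z : Ch α) :
    ev f (tr γ z) = ev (fun l => f (l.map (γ • ·))) z := (ev_mp _ f z).symm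

lemma orb_lin {f : List L → ℚ} (hf : f ∈ FO Γ L) (γ : Γ) (z : Ch L) :
    (Finsupp.linearCombination ℚ (orb Γ f) z) γ = ev f (tr γ z) := by
  suffices h : (Finsupp.lapply γ).comp (Finsupp.linearCombination ℚ (orb Γ f)) =
      (ev f).comp (tr γ) from LinearMap.congr_fun h z
  exact ch_ext fun l => by simp [orb_apply hf]

lemma dl_mem_FO {f : List L → ℚ} (hf : f ∈ FO Γ L) : dl f ∈ FO Γ L := by
  refine mem_FO.2 fun x => ?_
  refine (Finsupp.hasFiniteSupport
    (Finsupp.linearCombination ℚ (orb Γ f) (bd (single x 1)))).subset fun γ h => ?_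
  simp only [Set.mem_ofPred_eq, Function.mem_support, ne_eq] at h ⊢
  rwa [orb_lin hf, mp_bd, mp_single, ← dl_apply]

lemma orb_dl {f : List L → ℚ} (hf : f ∈ FO Γ L) (x : List L) :
    orb Γ (dl f) x = Finsupp.linearCombination ℚ (orb Γ f) (bd (single x 1)) := by
  ext γ
  rw [orb_lin hf, mp_bd, mp_single, ← dl_apply, orb_apply (dl_mem_FO hf)]

lemma tc_mem_FO {f : List L → ℚ} (hf : f ∈ FO Γ L) (δ : Γ) : tc δ f ∈ FO Γ L := by
  refine mem_FO.2 fun x => ?_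
  refine ((mem_FO.1 hf x).image (δ * ·)).subset fun γ h => ?_
  refine ⟨δ⁻¹ * γ, ?_, by simp⟩
  simpa [tc, mul_smul, Function.comp_def] using h

/-- The sum of a finitely supported function. -/
noncomputable def tot : (Γ →₀ ℚ) →ₗ[ℚ] ℚ := Finsupp.linearCombination ℚ fun _ => (1 : ℚ)

variable (Γ) in
/-- Orbit sums of a cochain. -/
noncomputable def nm : (List L → ℚ) →ₗ[ℚ] (List L → ℚ) where
  toFun f x := tot (orb Γ f x)
  map_add' f g := by ext x; simp
  map_smul' c f := by ext x; simp

/-- The action of the group ring on chains. -/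
noncomputable def grp {α : Type*} [MulAction Γ α] : (Γ →₀ ℚ) →ₗ[ℚ] Ch α →ₗ[ℚ] Ch α :=
  Finsupp.linearCombination ℚ (fun γ => tr γ)

/-- If `a` and `b` agree after a translation then so do their actions. -/
lemma grp_shift {α : Type*} [MulAction Γ α] {a b : Γ →₀ ℚ} (δ : Γ) (h : ∀ γ, a γ = b (γ * δ))
    (z : Ch α) : grp a (tr δ z) = grp b z := by
  have hb : b = Finsupp.mapDomain (· * δ) a := by
    ext γ
    have := Finsupp.mapDomain_apply (f := (· * δ)) (mul_left_injective δ) a (γ * δ⁻¹)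
    simp only [inv_mul_cancel_right] at this
    rw [this, h, inv_mul_cancel_right]
  rw [hb, grp, Finsupp.linearCombination_mapDomain, Finsupp.linearCombination_apply,
    Finsupp.linearCombination_apply, Finsupp.sum, Finsupp.sum, LinearMap.sum_apply,
    LinearMap.sum_apply]
  refine Finset.sum_congr rfl fun γ _ => ?_
  simp [tr_tr]

lemma tot_shift {a b : Γ →₀ ℚ} (δ : Γ) (h : ∀ γ, a γ = b (γ * δ)) : tot a = tot b := by
  have hb : b = Finsupp.mapDomain (· * δ) a := by
    ext γ
    have := Finsupp.mapDomain_apply (f := (· * δ)) (mul_left_injective δ) a (γ * δ⁻¹)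
    simp only [inv_mul_cancel_right] at this
    rw [this, h, inv_mul_cancel_right]
  rw [hb, tot, Finsupp.linearCombination_mapDomain]
  rfl

lemma tot_shift_left {a b : Γ →₀ ℚ} (δ : Γ) (h : ∀ γ, a γ = b (δ * γ)) : tot a = tot b := by
  have hb : b = Finsupp.mapDomain (δ * ·) a := by
    ext γ
    have := Finsupp.mapDomain_apply (f := (δ * ·)) (mul_right_injective δ) a (δ⁻¹ * γ)
    simp only [mul_inv_cancel_left] at this
    rw [this, h, mul_inv_cancel_left]
  rw [hb, tot, Finsupp.linearCombination_mapDomain]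
  rfl

lemma grp_shift_left {α : Type*} [MulAction Γ α] {a b : Γ →₀ ℚ} (δ : Γ)
    (h : ∀ γ, a γ = b (δ * γ)) (z : Ch α) : tr δ (grp a z) = grp b z := by
  have hb : b = Finsupp.mapDomain (δ * ·) a := by
    ext γ
    have := Finsupp.mapDomain_apply (f := (δ * ·)) (mul_right_injective δ) a (δ⁻¹ * γ)
    simp only [mul_inv_cancel_left] at this
    rw [this, h, mul_inv_cancel_left]
  rw [hb, grp, Finsupp.linearCombination_mapDomain, Finsupp.linearCombination_apply,
    Finsupp.linearCombination_apply, Finsupp.sum, Finsupp.sum, LinearMap.sum_apply,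
    LinearMap.sum_apply, map_sum]
  refine Finset.sum_congr rfl fun γ _ => ?_
  simp [tr_tr]

lemma nm_smul {f : List L → ℚ} (hf : f ∈ FO Γ L) (δ : Γ) (x : List L) :
    nm Γ f (x.map (δ • ·)) = nm Γ f x :=
  tot_shift δ fun γ => by
    rw [orb_apply hf, orb_apply hf, map_smul_map]

lemma nm_tc {f : List L → ℚ} (hf : f ∈ FO Γ L) (δ : Γ) : nm Γ (tc δ f) = nm Γ f := by
  ext x
  refine tot_shift_left δ⁻¹ fun γ => ?_
  rw [orb_apply (tc_mem_FO hf δ), orb_apply hf, ← map_smul_map]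
  rfl

lemma ev_nm {f : List L → ℚ} (z : Ch L) :
    ev (nm Γ f) z = tot (Finsupp.linearCombination ℚ (orb Γ f) z) := by
  suffices h : ev (nm Γ f) = (tot (Γ := Γ)).comp (Finsupp.linearCombination ℚ (orb Γ f)) from
    LinearMap.congr_fun h z
  exact ch_ext fun l => by simp [nm]

lemma nm_dl {f : List L → ℚ} (hf : f ∈ FO Γ L) : nm Γ (dl f) = dl (nm Γ f) := by
  ext x
  rw [dl_apply, ev_nm, ← orb_dl hf]
  rfl

/-! ### Pairing cochains with mixed chains -/

variable (Γ L) in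
/-- Mixed chains. -/
abbrev TT := Ch L ⊗[ℚ] Ch Γ

lemma tt_ext {M : Type*} [AddCommGroup M] [Module ℚ M] {f g : TT Γ L →ₗ[ℚ] M}
    (h : ∀ x z, f (single x 1 ⊗ₜ z) = g (single x 1 ⊗ₜ z)) : f = g := by
  refine TensorProduct.ext (ch_ext fun x => LinearMap.ext fun z => ?_)
  exact h x z

/-- The pairing of a cochain with mixed chains by summing over orbits. -/
noncomputable def pair : (List L → ℚ) →ₗ[ℚ] TT Γ L →ₗ[ℚ] Ch Γ where
  toFun f := TensorProduct.lift (Finsupp.linearCombination ℚ fun x => grp (orb Γ f x))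
  map_add' f g := tt_ext fun x z => by simp
  map_smul' c f := tt_ext fun x z => by simp

lemma pair_apply (f : List L → ℚ) (x : List L) (z : Ch Γ) :
    pair f (single x 1 ⊗ₜ z) = grp (orb Γ f x) z := by simp [pair]

/-- The boundary on the first factor. -/
noncomputable def bL : TT Γ L →ₗ[ℚ] TT Γ L := LinearMap.rTensor _ bd

/-- The boundary on the second factor. -/
noncomputable def bG : TT Γ L →ₗ[ℚ] TT Γ L := LinearMap.lTensor _ bd

lemma bG_bL (t : TT Γ L) : bG (bL t) = bL (bG t) := by
  suffices h : (bG (Γ := Γ) (L := L)).comp bL = bL.comp bG from LinearMap.congr_fun h t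
  exact tt_ext fun x z => by simp [bG, bL]

lemma bL_bL (t : TT Γ L) : bL (bL t) = 0 := by
  suffices h : (bL (Γ := Γ) (L := L)).comp bL = 0 from LinearMap.congr_fun h t
  exact tt_ext fun x z => by simp [bL, bd_bd]

lemma grp_bd (a : Γ →₀ ℚ) (z : Ch Γ) : bd (grp a z) = grp a (bd z) := by
  rw [grp, Finsupp.linearCombination_apply, Finsupp.sum, LinearMap.sum_apply, LinearMap.sum_apply,
    map_sum]
  refine Finset.sum_congr rfl fun γ _ => ?_
  rw [LinearMap.smul_apply, LinearMap.smul_apply, map_smul, mp_bd]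

lemma bd_pair (f : List L → ℚ) (t : TT Γ L) : bd (pair f t) = pair f (bG t) := by
  suffices h : bd.comp (pair f) = (pair f).comp (bG (Γ := Γ) (L := L)) from LinearMap.congr_fun h t
  exact tt_ext fun x z => by simp [bG, pair_apply, grp_bd]

lemma pair_bL {f : List L → ℚ} (hf : f ∈ FO Γ L) (t : TT Γ L) :
    pair f (bL t) = pair (dl f) t := by
  suffices h : (pair f).comp bL = pair (Γ := Γ) (dl f) from LinearMap.congr_fun h t
  refine tt_ext fun x z => ?_
  rw [pair_apply, orb_dl hf, LinearMap.comp_apply, bL, LinearMap.rTensor_tmul]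
  generalize bd (single x 1) = y
  suffices h : (pair f).comp ((TensorProduct.mk ℚ (Ch L) (Ch Γ)).flip z) =
      (grp.flip z).comp (Finsupp.linearCombination ℚ (orb Γ f)) from LinearMap.congr_fun h y
  exact ch_ext fun l => by simp [pair_apply]

lemma pair_tc {f : List L → ℚ} (hf : f ∈ FO Γ L) (δ : Γ) (t : TT Γ L) :
    pair (tc δ f) t = tr δ (pair f t) := by
  suffices h : pair (tc δ f) = (tr δ).comp (pair (Γ := Γ) f) from LinearMap.congr_fun h t
  refine tt_ext fun x z => ?_
  rw [LinearMap.comp_apply, pair_apply, pair_apply]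
  symm
  refine grp_shift_left δ (fun γ => ?_) z
  rw [orb_apply (tc_mem_FO hf δ), orb_apply hf, ← map_smul_map]
  simp [tc, Function.comp_def]

end Equivariant

end Eis

namespace Eis

open Finsupp TensorProduct

section Homotopy

variable {Γ : Type*} [Group Γ]

lemma tr_cone (γ g : Γ) (z : Ch Γ) : tr γ (cone g z) = cone (γ * g) (tr γ z) := mp_cone _ g z

lemma bd_single_mem_len {α : Type*} {l : List α} {k : ℕ} (h : l.length = k + 1) :
    bd (single l 1) ∈ supp (len (k : ℤ)) := by
  refine Finsupp.supported_mono ?_ (ct_single_mem _ l)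
  rintro l' ⟨-, h'⟩
  change (l'.length : ℤ) = k
  omega

/-- The equivariant homotopy between a chain map and the identity. -/
noncomputable def htp (Ω : ℕ → Ch Γ →ₗ[ℚ] Ch Γ) : ℕ → Ch Γ →ₗ[ℚ] Ch Γ
  | 0 => 0
  | k + 1 => Finsupp.linearCombination ℚ fun l =>
    (l.head?.map fun g => cone g
      (Ω (k + 1) (single l 1) - single l 1 - htp Ω k (bd (single l 1)))).getD 0

lemma htp_single (Ω : ℕ → Ch Γ →ₗ[ℚ] Ch Γ) (k : ℕ) (g : Γ) (l : List Γ) :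
    htp Ω (k + 1) (single (g :: l) 1) = cone g
      (Ω (k + 1) (single (g :: l) 1) - single (g :: l) 1 - htp Ω k (bd (single (g :: l) 1))) := by
  simp [htp]

lemma eqOn_len {α M : Type*} [AddCommGroup M] [Module ℚ M] {k : ℕ} {f g : Ch α →ₗ[ℚ] M}
    (h : ∀ l : List α, l.length = k → f (single l 1) = g (single l 1)) {z : Ch α}
    (hz : z ∈ supp (len (k : ℤ))) : f z = g z := by
  have := map_supp (W := ⊥) (f - g) (fun l hl => by
    have hl' : l.length = k := Nat.cast_injective (R := ℤ) hl
    simp [h l hl']) hz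
  simpa [sub_eq_zero] using this

variable {Ω : ℕ → Ch Γ →ₗ[ℚ] Ch Γ} {K : ℕ}

lemma htp_tr (heq : ∀ k ≤ K, ∀ γ : Γ, ∀ l : List Γ, l.length = k →
      Ω k (tr γ (single l 1)) = tr γ (Ω k (single l 1))) (k : ℕ) (hk : k ≤ K) (γ : Γ) (l : List Γ)
    (hl : l.length = k) : htp Ω k (tr γ (single l 1)) = tr γ (htp Ω k (single l 1)) := by
  induction k generalizing l with
  | zero => simp [htp]
  | succ k ih =>
    cases l with
    | nil => simp at hl
    | cons g t =>
      have h1 := heq (k + 1) hk γ _ hl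
      have h2 : htp Ω k (tr γ (bd (single (g :: t) 1))) =
          tr γ (htp Ω k (bd (single (g :: t) 1))) :=
        eqOn_len (f := (htp Ω k).comp (tr γ)) (g := (tr γ).comp (htp Ω k))
          (fun l hl => ih (by omega) l hl) (bd_single_mem_len hl)
      rw [htp_single, tr_cone, map_sub (tr γ), map_sub (tr γ), ← h1, ← h2, mp_bd, mp_single,
        List.map_cons, htp_single]
      rfl

lemma bd_htp (h0 : Ω 0 (single [] 1) = single [] 1)
    (hch : ∀ k < K, ∀ l : List Γ, l.length = k + 1 →
      bd (Ω (k + 1) (single l 1)) = Ω k (bd (single l 1))) (k : ℕ) (hk : k < K) (l : List Γ)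
    (hl : l.length = k + 1) :
    bd (htp Ω (k + 1) (single l 1)) =
      Ω (k + 1) (single l 1) - single l 1 - htp Ω k (bd (single l 1)) := by
  induction k generalizing l with
  | zero =>
    obtain ⟨g, rfl⟩ := List.length_eq_one_iff.1 hl
    have h1 := hch 0 hk [g] rfl
    rw [htp_single, bd_cone, map_sub bd, map_sub bd, h1]
    have h2 : bd (single [g] (1 : ℚ)) = single [] 1 := by rw [ct_single_cons]; simp
    rw [h2, h0]
    simp [htp]
  | succ k ih =>
    cases l with
    | nil => simp at hl
    | cons g t =>
      have h1 := hch _ hk _ hl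
      have h2 : bd (htp Ω (k + 1) (bd (single (g :: t) 1))) =
          Ω (k + 1) (bd (single (g :: t) 1)) - bd (single (g :: t) 1) -
            htp Ω k (bd (bd (single (g :: t) 1))) :=
        eqOn_len (f := bd.comp (htp Ω (k + 1)))
          (g := Ω (k + 1) - LinearMap.id - (htp Ω k).comp bd)
          (fun l hl => by simpa using ih (by omega) l hl) (bd_single_mem_len hl)
      rw [htp_single, bd_cone, map_sub bd, map_sub bd, h1, h2, bd_bd, map_zero, sub_zero]
      simp

/-- An equivariant augmentation-preserving chain map does not change cohomology classes. -/
lemma exists_homotopy (h0 : Ω 0 (single [] 1) = single [] 1)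
    (heq : ∀ k ≤ K, ∀ γ : Γ, ∀ l : List Γ, l.length = k →
      Ω k (tr γ (single l 1)) = tr γ (Ω k (single l 1)))
    (hch : ∀ k < K, ∀ l : List Γ, l.length = k + 1 →
      bd (Ω (k + 1) (single l 1)) = Ω k (bd (single l 1)))
    {c : List Γ → ℚ} (hc : ∀ g l, c (l.map (g * ·)) = c l) (hd : dl c = 0) {k : ℕ} (hk : k < K) :
    ∃ e : List Γ → ℚ, (∀ g l, e (l.map (g * ·)) = e l) ∧
      ∀ l : List Γ, l.length = k + 1 → ev c (Ω (k + 1) (single l 1)) - c l = dl e l := by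
  classical
  refine ⟨fun l => if l.length = k then ev c (htp Ω k (single l 1)) else 0,
    fun g l => ?_, fun l hl => ?_⟩
  · by_cases h : l.length = k
    · have h1 := htp_tr heq k hk.le g l h
      have h2 := congrArg (ev c) h1
      rw [ev_tr] at h2
      simp only [smul_eq_mul, hc, mp_single] at h2
      simpa [h] using h2
    · simp [h]
  · have h1 := congrArg (ev c) (bd_htp h0 hch k hk l hl)
    rw [← ev_dl, hd] at h1
    simp only [map_sub, ev_single, one_mul] at h1
    have h3 : ev (0 : List Γ → ℚ) (htp Ω (k + 1) (single l 1)) = 0 := by simp [ev]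
    rw [h3] at h1
    have h2 : ev (fun l => if l.length = k then ev c (htp Ω k (single l 1)) else 0)
        (bd (single l 1)) = ev c (htp Ω k (bd (single l 1))) :=
      eqOn_len (g := (ev c).comp (htp Ω k)) (fun l hl => by simp [hl]) (bd_single_mem_len hl)
    rw [dl_apply, h2]
    linarith

end Homotopy

end Eis

namespace Eis

open Finsupp TensorProduct

section Pipeline

variable (Γ : Type*) {L : Type*} [Group Γ] [MulAction Γ L]

/-- The hypotheses of the comparison between a resolution by cochains and group cohomology. -/
structure Pipe (E : ℕ → Submodule ℚ (List L → ℚ)) (S : Set (List L)) (N : ℕ) : Prop where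
  fin : ∀ m, E m ≤ FO Γ L
  stab : ∀ m, ∀ f ∈ E m, ∀ γ : Γ, tc γ f ∈ E m
  van : ∀ m, ∀ f ∈ E m, ∀ x ∉ S, f x = 0
  sub : SubClosed Sᶜ
  inv : ∀ x ∈ S, ∀ γ : Γ, x.map (γ • ·) ∈ S
  free : ∀ x ∈ S, ∀ γ : Γ, x.map (γ • ·) = x → γ = 1
  ex : ∀ m, m + 1 ≠ N → ∀ f ∈ E (m + 1), dl f = 0 → ∃ g ∈ E m, dl g = f
  top : ∀ m, m + 1 = N → ∀ f₁ ∈ E (m + 1), dl f₁ = 0 → ∀ f₂ ∈ E (m + 1), dl f₂ = 0 →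
    ∃ a b : ℚ, (a ≠ 0 ∨ b ≠ 0) ∧ ∃ g ∈ E m, dl g = a • f₁ + b • f₂

/-- Chains whose coinvariants are supported off `S`. -/
noncomputable def JL (S : Set (List L)) : Submodule ℚ (Ch L) :=
  Submodule.span ℚ ({z | ∃ (γ : Γ) (x : List L), z = single (x.map (γ • ·)) 1 - single x 1} ∪
    {z | ∃ x ∉ S, z = single x 1})

/-- Mixed chains whose coinvariants are supported off `S`. -/
noncomputable def JT (S : Set (List L)) : Submodule ℚ (TT Γ L) :=
  Submodule.span ℚ ({t | ∃ (γ : Γ) (x : List L) (z : Ch Γ),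
      t = single (x.map (γ • ·)) 1 ⊗ₜ tr γ z - single x 1 ⊗ₜ z} ∪
    {t | ∃ x ∉ S, ∃ z : Ch Γ, t = single x 1 ⊗ₜ z})

variable {Γ} {S : Set (List L)}

lemma JT_map {M : Type*} [AddCommGroup M] [Module ℚ M] (φ : TT Γ L →ₗ[ℚ] M) (W : Submodule ℚ M)
    (h1 : ∀ (γ : Γ) (x : List L) (z : Ch Γ),
      φ (single (x.map (γ • ·)) 1 ⊗ₜ tr γ z) - φ (single x 1 ⊗ₜ z) ∈ W)
    (h2 : ∀ x ∉ S, ∀ z : Ch Γ, φ (single x 1 ⊗ₜ z) ∈ W) {t : TT Γ L} (ht : t ∈ JT Γ S) :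
    φ t ∈ W := by
  suffices h : JT Γ S ≤ W.comap φ from h ht
  refine Submodule.span_le.2 ?_
  rintro _ (⟨γ, x, z, rfl⟩ | ⟨x, hx, z, rfl⟩)
  · simpa using h1 γ x z
  · exact h2 x hx z

lemma JT_sub (γ : Γ) (x : List L) (z : Ch Γ) :
    single (x.map (γ • ·)) 1 ⊗ₜ tr γ z - single x 1 ⊗ₜ z ∈ JT Γ S :=
  Submodule.subset_span (Or.inl ⟨γ, x, z, rfl⟩)

lemma JT_off {x : List L} (hx : x ∉ S) (z : Ch Γ) : single x 1 ⊗ₜ z ∈ JT Γ S :=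
  Submodule.subset_span (Or.inr ⟨x, hx, z, rfl⟩)

lemma JT_sub_chain (γ : Γ) (y : Ch L) (z : Ch Γ) : tr γ y ⊗ₜ tr γ z - y ⊗ₜ z ∈ JT Γ S := by
  suffices h : ∀ y, ((TensorProduct.mk ℚ (Ch L) (Ch Γ)).flip (tr γ z)).comp (tr γ) y -
      (TensorProduct.mk ℚ (Ch L) (Ch Γ)).flip z y ∈ JT Γ S from h y
  intro y
  rw [← LinearMap.sub_apply]
  refine map_supp (K := Set.univ) _ (fun l _ => ?_) (by simp [supp])
  simpa using JT_sub γ l z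

lemma JT_off_chain {K : Set (List L)} (hK : ∀ x ∈ K, x ∉ S) {y : Ch L} (hy : y ∈ supp K)
    (z : Ch Γ) : y ⊗ₜ z ∈ JT Γ S :=
  map_supp ((TensorProduct.mk ℚ (Ch L) (Ch Γ)).flip z) (fun l hl => JT_off (hK l hl) z) hy

lemma ct_off (hS : SubClosed Sᶜ) {x : List L} (hx : x ∉ S) : bd (single x 1) ∈ supp Sᶜ :=
  Finsupp.supported_mono (fun _ h => hS x hx _ h.1) (ct_single_mem _ x)

lemma JT_bL (hS : SubClosed Sᶜ) {t : TT Γ L} (ht : t ∈ JT Γ S) : bL t ∈ JT Γ S := by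
  refine JT_map _ _ (fun γ x z => ?_) (fun x hx z => ?_) ht
  · simp only [bL, LinearMap.rTensor_tmul]
    rw [← mp_single, ← mp_bd]
    exact JT_sub_chain γ _ z
  · simp only [bL, LinearMap.rTensor_tmul]
    exact JT_off_chain (fun x hx => hx) (ct_off hS hx) z

/-- Cone construction in the second factor based at a section `σ`. -/
noncomputable def sg (σ : List L → Γ) : TT Γ L →ₗ[ℚ] TT Γ L :=
  TensorProduct.lift (Finsupp.linearCombination ℚ fun x =>
    (TensorProduct.mk ℚ (Ch L) (Ch Γ) (single x 1)).comp (cone (σ x)))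

lemma sg_apply (σ : List L → Γ) (x : List L) (z : Ch Γ) :
    sg σ (single x 1 ⊗ₜ z) = single x 1 ⊗ₜ cone (σ x) z := by simp [sg]

lemma bG_sg (σ : List L → Γ) (t : TT Γ L) : bG (sg σ t) = t - sg σ (bG t) := by
  suffices h : bG.comp (sg σ) = LinearMap.id - (sg σ).comp bG from LinearMap.congr_fun h t
  refine tt_ext fun x z => ?_
  simp only [LinearMap.comp_apply, LinearMap.sub_apply, LinearMap.id_apply, sg_apply, bG,
    LinearMap.lTensor_tmul, bd_cone, TensorProduct.tmul_sub]

lemma JT_sg {σ : List L → Γ} (hinv : ∀ x ∉ S, ∀ γ : Γ, x.map (γ • ·) ∉ S)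
    (hσ : ∀ x ∈ S, ∀ γ : Γ, σ (x.map (γ • ·)) = γ * σ x)
    {t : TT Γ L} (ht : t ∈ JT Γ S) : sg σ t ∈ JT Γ S := by
  refine JT_map _ _ (fun γ x z => ?_) (fun x hx z => ?_) ht
  · rw [sg_apply, sg_apply]
    by_cases hx : x ∈ S
    · rw [hσ x hx, ← tr_cone]
      exact JT_sub γ _ _
    · exact Submodule.sub_mem _ (JT_off (hinv x hx γ) _) (JT_off hx _)
  · rw [sg_apply]; exact JT_off hx _

lemma pair_JT {f : List L → ℚ} (hf : f ∈ FO Γ L) (hv : ∀ x ∉ S, f x = 0)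
    (hinv : ∀ x ∉ S, ∀ γ : Γ, x.map (γ • ·) ∉ S) {t : TT Γ L} (ht : t ∈ JT Γ S) :
    pair f t = 0 := by
  have := JT_map (pair f) ⊥ (fun γ x z => ?_) (fun x hx z => ?_) ht
  · simpa using this
  · rw [pair_apply, pair_apply, grp_shift γ (b := orb Γ f x), sub_self]
    · exact Submodule.zero_mem _
    · intro δ
      rw [orb_apply hf, orb_apply hf, map_smul_map]
  · have : orb Γ f x = 0 := by
      ext γ
      rw [orb_apply hf, hv _ (hinv x hx γ)]
      rfl
    rw [pair_apply, this, map_zero]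
    exact Submodule.zero_mem _

lemma nm_off {f : List L → ℚ} (hf : f ∈ FO Γ L) (hv : ∀ x ∉ S, f x = 0)
    (hinv : ∀ x ∉ S, ∀ γ : Γ, x.map (γ • ·) ∉ S) {x : List L} (hx : x ∉ S) : nm Γ f x = 0 := by
  have : orb Γ f x = 0 := by
    ext γ
    rw [orb_apply hf, hv _ (hinv x hx γ)]
    rfl
  change tot (orb Γ f x) = 0
  rw [this, map_zero]

/-- An invariant cochain vanishing off `S` kills `JL`. -/
lemma ev_JL {h : List L → ℚ} (h1 : ∀ (γ : Γ) x, h (x.map (γ • ·)) = h x) (h2 : ∀ x ∉ S, h x = 0)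
    {z : Ch L} (hz : z ∈ JL Γ S) : ev h z = 0 := by
  suffices h : JL Γ S ≤ LinearMap.ker (ev h) from h hz
  refine Submodule.span_le.2 ?_
  rintro _ (⟨γ, x, rfl⟩ | ⟨x, hx, rfl⟩)
  · simp [h1]
  · simp [h2 x hx]

lemma JL_nil {z : Ch L} (hz : z ∈ JL Γ S) : z ⊗ₜ single [] 1 ∈ JT Γ S := by
  suffices h : JL Γ S ≤ (JT Γ S).comap ((TensorProduct.mk ℚ (Ch L) (Ch Γ)).flip (single [] 1)) from
    h hz
  refine Submodule.span_le.2 ?_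
  rintro _ (⟨γ, x, rfl⟩ | ⟨x, hx, rfl⟩)
  · have := JT_sub (S := S) γ x (single [] 1)
    rw [mp_single] at this
    simpa using this
  · exact JT_off hx _

/-- Contract the second factor with a cochain. -/
noncomputable def con (c : List Γ → ℚ) : TT Γ L →ₗ[ℚ] Ch L :=
  TensorProduct.lift ((LinearMap.lsmul ℚ (Ch L)).flip.compr₂ LinearMap.id |>.compl₂ (ev c))

lemma con_apply (c : List Γ → ℚ) (y : Ch L) (z : Ch Γ) : con c (y ⊗ₜ z) = ev c z • y := by
  simp [con]

lemma con_bL (c : List Γ → ℚ) (t : TT Γ L) : con c (bL t) = bd (con c t) := by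
  suffices h : (con c).comp bL = bd.comp (con c) from LinearMap.congr_fun h t
  exact tt_ext fun x z => by
    simp only [LinearMap.comp_apply, bL, LinearMap.rTensor_tmul, con_apply, map_smul]

lemma con_bG {c : List Γ → ℚ} (hc : dl c = 0) (t : TT Γ L) : con c (bG t) = 0 := by
  suffices h : (con c).comp bG = 0 from LinearMap.congr_fun h t
  refine tt_ext fun x z => ?_
  simp only [LinearMap.comp_apply, bG, LinearMap.lTensor_tmul, con_apply]
  rw [← ev_dl, hc]
  simp [ev]

lemma con_JT {c : List Γ → ℚ} (hc : ∀ (g : Γ) l, c (l.map (g * ·)) = c l) {t : TT Γ L}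
    (ht : t ∈ JT Γ S) : con c t ∈ JL Γ S := by
  refine JT_map _ _ (fun γ x z => ?_) (fun x hx z => ?_) ht
  · rw [con_apply, con_apply, ev_tr]
    simp only [smul_eq_mul, hc]
    rw [← smul_sub]
    exact Submodule.smul_mem _ _ (Submodule.subset_span (Or.inl ⟨γ, x, rfl⟩))
  · rw [con_apply]
    exact Submodule.smul_mem _ _ (Submodule.subset_span (Or.inr ⟨x, hx, rfl⟩))

lemma ev_grp {c : List Γ → ℚ} (hc : ∀ (g : Γ) l, c (l.map (g * ·)) = c l) (a : Γ →₀ ℚ)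
    (z : Ch Γ) : ev c (grp a z) = tot a * ev c z := by
  rw [grp, tot, Finsupp.linearCombination_apply, Finsupp.linearCombination_apply, Finsupp.sum,
    Finsupp.sum, LinearMap.sum_apply, map_sum, Finset.sum_mul]
  refine Finset.sum_congr rfl fun γ _ => ?_
  rw [LinearMap.smul_apply, map_smul, ev_tr]
  simp [hc]

lemma ev_pair {c : List Γ → ℚ} (hc : ∀ (g : Γ) l, c (l.map (g * ·)) = c l) (f : List L → ℚ)
    (t : TT Γ L) : ev c (pair f t) = ev (nm Γ f) (con c t) := by
  suffices h : (ev c).comp (pair f) = (ev (nm Γ f)).comp (con c) from LinearMap.congr_fun h t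
  refine tt_ext fun x z => ?_
  rw [LinearMap.comp_apply, LinearMap.comp_apply, pair_apply, con_apply, map_smul, ev_single,
    ev_grp hc, one_mul, smul_eq_mul, mul_comm]
  rfl

/-- Mixed chains of given length in the first factor. -/
noncomputable def TL (m : ℤ) : Submodule ℚ (TT Γ L) :=
  Submodule.span ℚ {t | ∃ x : List L, (x.length : ℤ) = m ∧ ∃ z : Ch Γ, t = single x 1 ⊗ₜ z}

lemma TL_map {M : Type*} [AddCommGroup M] [Module ℚ M] (φ : TT Γ L →ₗ[ℚ] M) (W : Submodule ℚ M)
    {m : ℤ} (h : ∀ x : List L, (x.length : ℤ) = m → ∀ z : Ch Γ, φ (single x 1 ⊗ₜ z) ∈ W)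
    {t : TT Γ L} (ht : t ∈ TL m) : φ t ∈ W := by
  suffices h : TL m ≤ W.comap φ from h ht
  refine Submodule.span_le.2 ?_
  rintro _ ⟨x, hx, z, rfl⟩
  exact h x hx z

lemma TL_chain {m : ℤ} {y : Ch L} (hy : y ∈ supp (len m)) (z : Ch Γ) : y ⊗ₜ z ∈ TL (Γ := Γ) m :=
  map_supp ((TensorProduct.mk ℚ (Ch L) (Ch Γ)).flip z)
    (fun l hl => by exact Submodule.subset_span ⟨l, hl, z, rfl⟩) hy

lemma TL_bL {m : ℤ} {t : TT Γ L} (ht : t ∈ TL m) : bL t ∈ TL (Γ := Γ) (L := L) (m - 1) := by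
  refine TL_map _ _ (fun x hx z => ?_) ht
  rw [bL, LinearMap.rTensor_tmul]
  refine TL_chain (Finsupp.supported_mono ?_ (ct_single_mem _ x)) z
  rintro l ⟨-, h⟩
  change (l.length : ℤ) = m - 1
  omega

lemma TL_sg (σ : List L → Γ) {m : ℤ} {t : TT Γ L} (ht : t ∈ TL m) : sg σ t ∈ TL (Γ := Γ) m := by
  refine TL_map _ _ (fun x hx z => ?_) ht
  rw [sg_apply]
  exact Submodule.subset_span ⟨x, hx, _, rfl⟩

lemma con_TL (c : List Γ → ℚ) {m : ℤ} {t : TT Γ L} (ht : t ∈ TL m) : con c t ∈ supp (len m) := by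
  refine TL_map _ _ (fun x hx z => ?_) ht
  rw [con_apply]
  exact Submodule.smul_mem _ _ (single_mem_supp hx 1)

lemma exists_section (hfree : ∀ x ∈ S, ∀ γ : Γ, x.map (γ • ·) = x → γ = 1) :
    ∃ σ : List L → Γ, ∀ x ∈ S, ∀ γ : Γ, σ (x.map (γ • ·)) = γ * σ x := by
  classical
  let R : Setoid (List L) :=
    { r := fun x y => ∃ γ : Γ, y.map (γ • ·) = x
      iseqv := ⟨fun x => ⟨1, map_one_smul x⟩,
        fun {x y} ⟨γ, h⟩ => ⟨γ⁻¹, by rw [← h, map_smul_map, inv_mul_cancel, map_one_smul]⟩,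
        fun {x y z} ⟨γ, h⟩ ⟨δ, h'⟩ => ⟨γ * δ, by rw [← h, ← h', map_smul_map]⟩⟩ }
  have hrep : ∀ x : List L, ∃ γ : Γ, ((Quotient.mk R x).out).map (γ • ·) = x := fun x =>
    R.symm (Quotient.mk_out (s := R) x)
  choose σ hσ using hrep
  refine ⟨σ, fun x hx γ => ?_⟩
  have hq : Quotient.mk R (x.map (γ • ·)) = Quotient.mk R x := Quotient.sound (s := R) ⟨γ, rfl⟩
  have h1 := hσ (x.map (γ • ·))
  rw [hq] at h1
  have h2 := hσ x
  have h5 := congrArg (List.map ((σ x)⁻¹ • ·)) h2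
  rw [map_smul_map, inv_mul_cancel, map_one_smul] at h5
  have h3 : x.map ((γ⁻¹ * σ (x.map (γ • ·)) * (σ x)⁻¹) • ·) = x := by
    rw [← map_smul_map, ← h5, ← map_smul_map, h1, map_smul_map, inv_mul_cancel, map_one_smul]
  have h4 := hfree x hx _ h3
  rw [mul_inv_eq_one] at h4
  rw [← h4, mul_inv_cancel_left]

end Pipeline

end Eis

namespace Eis

open Finsupp TensorProduct

section Pipeline

variable {Γ L : Type*} [Group Γ] [MulAction Γ L]

open Classical in
/-- A chosen solution in `W` of `dl g = w`, if there is one. -/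
noncomputable def pick (W : Submodule ℚ (List L → ℚ)) (w : List L → ℚ) : List L → ℚ :=
  if h : ∃ g ∈ W, dl g = w then h.choose else 0

lemma pick_spec {W : Submodule ℚ (List L → ℚ)} {w : List L → ℚ} (h : ∃ g ∈ W, dl g = w) :
    pick W w ∈ W ∧ dl (pick W w) = w := by
  rw [pick, dif_pos h]
  exact h.choose_spec

/-- Linear extension of a family of cochains to chains. -/
noncomputable abbrev lin (φ : List Γ → List L → ℚ) : Ch Γ →ₗ[ℚ] (List L → ℚ) :=
  Finsupp.linearCombination ℚ φ

/-- An equivariant chain of solutions of `dl (Phi (k + 1) g) = Phi k (bd g)`. -/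
noncomputable def Phi (E : ℕ → Submodule ℚ (List L → ℚ)) (N : ℕ) (f₀ : List L → ℚ) :
    ℕ → List Γ → List L → ℚ
  | 0, l => tc (l.headD 1) f₀
  | k + 1, l => tc (l.headD 1) (pick (E (N - (k + 1)))
      (lin (Phi E N f₀ k) (bd (single (l.map ((l.headD 1)⁻¹ • ·)) 1))))

variable {E : ℕ → Submodule ℚ (List L → ℚ)} {S : Set (List L)} {N : ℕ}

lemma Pipe.inv' (P : Pipe Γ E S N) : ∀ x ∉ S, ∀ γ : Γ, x.map (γ • ·) ∉ S := by
  intro x hx γ h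
  have := P.inv _ h γ⁻¹
  rw [map_smul_map, inv_mul_cancel, map_one_smul] at this
  exact hx this

lemma Phi_map (f₀ : List L → ℚ) (k : ℕ) (γ : Γ) (l : List Γ) (hl : l ≠ []) :
    Phi E N f₀ k (l.map (γ • ·)) = tc γ (Phi E N f₀ k l) := by
  cases l with
  | nil => exact absurd rfl hl
  | cons g t =>
    have h : (List.map (γ • ·) (g :: t)).map ((γ * g)⁻¹ • ·) = (g :: t).map (g⁻¹ • ·) := by
      rw [map_smul_map]; simp
    cases k with
    | zero => simp [Phi, tc_tc]
    | succ k =>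
      have h2 : (List.map (γ • ·) (g :: t)).headD 1 = γ * g := rfl
      rw [Phi, Phi, h2, h, tc_tc]
      rfl

lemma lin_tr {φ : List Γ → List L → ℚ} {k : ℕ}
    (h : ∀ (γ : Γ) (l : List Γ), l.length = k → φ (l.map (γ • ·)) = tc γ (φ l)) (γ : Γ) {z : Ch Γ}
    (hz : z ∈ supp (len (k : ℤ))) : lin φ (tr γ z) = tc γ (lin φ z) :=
  eqOn_len (f := (lin φ).comp (tr γ)) (g := (tc γ).comp (lin φ))
    (fun l hl => by simpa using h γ l hl) hz

lemma lin_mem {φ : List Γ → List L → ℚ} {k : ℕ} {W : Submodule ℚ (List L → ℚ)}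
    (h : ∀ l : List Γ, l.length = k → φ l ∈ W) {z : Ch Γ} (hz : z ∈ supp (len (k : ℤ))) :
    lin φ z ∈ W :=
  map_supp (lin φ) (fun l hl => by simpa using h l (Nat.cast_injective (R := ℤ) hl)) hz

variable {f₀ : List L → ℚ} {a₀ : Ch L}

lemma nm_dl_eval (P : Pipe Γ E S N) (ha : bd a₀ ∈ JL Γ S) {m : ℕ} {g : List L → ℚ}
    (hg : g ∈ E m) : ev (nm Γ (dl g)) a₀ = 0 := by
  rw [nm_dl (P.fin m hg), ev_dl]
  exact ev_JL (fun γ x => nm_smul (P.fin m hg) γ x)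
    (fun x hx => nm_off (P.fin m hg) (P.van m g hg) P.inv' hx) ha

lemma Phi_spec (P : Pipe Γ E S N) (hf₀ : f₀ ∈ E N) (hd₀ : dl f₀ = 0) (ha : bd a₀ ∈ JL Γ S)
    (h1 : ev (nm Γ f₀) a₀ = 1) (k : ℕ) (hk : k ≤ N) :
    (∀ l : List Γ, l.length = k + 1 → Phi E N f₀ k l ∈ E (N - k)) ∧
    (k = 0 → ∀ l : List Γ, dl (Phi E N f₀ k l) = 0) ∧
    (∀ j, k = j + 1 → ∀ l : List Γ, l.length = k + 1 →
      dl (Phi E N f₀ k l) = lin (Phi E N f₀ j) (bd (single l 1))) := by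
  induction k with
  | zero =>
    refine ⟨fun l _ => P.stab _ _ hf₀ _, fun _ l => ?_, fun j hj => by omega⟩
    rw [Phi, dl_tc, hd₀, map_zero]
  | succ k ih =>
    obtain ⟨i1, i2, i3⟩ := ih (by omega)
    have key : ∀ l : List Γ, l.length = k + 2 →
        ∃ g ∈ E (N - (k + 1)), dl g = lin (Phi E N f₀ k) (bd (single l 1)) := by
      intro l hl
      have hw : lin (Phi E N f₀ k) (bd (single l 1)) ∈ E (N - (k + 1) + 1) := by
        rw [show N - (k + 1) + 1 = N - k by omega]
        exact lin_mem i1 (bd_single_mem_len hl)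
      rcases Nat.eq_zero_or_pos k with rfl | hk0
      · have hdw : dl (lin (Phi E N f₀ 0) (bd (single l 1))) = 0 :=
          lin_mem (W := LinearMap.ker dl) (fun l _ => i2 rfl l) (bd_single_mem_len hl)
        have hN : N - (0 + 1) + 1 = N := by omega
        obtain ⟨a, b, hab, g, hg, hgd⟩ := P.top _ hN _ hw hdw _ (by rw [hN]; exact hf₀) hd₀
        have hZ : ev (nm Γ (lin (Phi E N f₀ 0) (bd (single l 1)))) a₀ = 0 := by
          obtain ⟨g₁, g₂, rfl⟩ := List.length_eq_two.1 hl
          rw [ct_single_cons, ct_single_cons]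
          have e1 : ∀ g : Γ, ev (nm Γ (Phi E N f₀ 0 [g])) a₀ = 1 := fun g => by
            rw [Phi, nm_tc (P.fin _ hf₀), h1]
          have e2 : ∀ (f g : List L → ℚ), ev (f - g) a₀ = ev f a₀ - ev g a₀ := fun f g => by
            simp [ev, Finsupp.linearCombination_apply, Finsupp.sum, mul_sub,
              Finset.sum_sub_distrib]
          simp [e2, e1]
        have hZ2 := nm_dl_eval P ha hg
        have e3 : ∀ (f g : List L → ℚ) (a b : ℚ),
            ev (a • f + b • g) a₀ = a * ev f a₀ + b * ev g a₀ := fun f g a b => by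
          simp [ev, Finsupp.linearCombination_apply, Finsupp.sum, mul_add,
            Finset.sum_add_distrib, Finset.mul_sum, mul_left_comm]
        rw [hgd, map_add, map_smul, map_smul, e3, hZ, h1] at hZ2
        have hb : b = 0 := by linarith
        have ha' : a ≠ 0 := by rcases hab with h | h <;> simp_all
        refine ⟨a⁻¹ • g, Submodule.smul_mem _ _ hg, ?_⟩
        rw [map_smul, hgd, hb, zero_smul, add_zero, inv_smul_smul₀ ha']
      · obtain ⟨j, rfl⟩ : ∃ j, k = j + 1 := ⟨k - 1, by omega⟩
        refine P.ex _ (by omega) _ hw ?_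
        have := eqOn_len (f := dl.comp (lin (Phi E N f₀ (j + 1))))
          (g := (lin (Phi E N f₀ j)).comp bd) (fun l hl => by simpa using i3 j rfl l hl)
          (bd_single_mem_len hl)
        simpa [bd_bd] using this
    refine ⟨fun l hl => ?_, fun h => by omega, fun j hj l hl => ?_⟩
    · exact P.stab _ _ (pick_spec (key _ (by simpa using hl))).1 _
    · obtain rfl : k = j := by omega
      rw [Phi, dl_tc, (pick_spec (key _ (by simpa using hl))).2]
      rw [← lin_tr (k := k + 1) (fun γ l hl => Phi_map f₀ k γ l (by rintro rfl; simp at hl)) _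
        (bd_single_mem_len (by simpa using hl)), mp_bd, mp_single, map_smul_map, mul_inv_cancel,
        map_one_smul]

/-- Iterated cones on the fundamental chain. -/
noncomputable def itc (σ : List L → Γ) (a₀ : Ch L) : ℕ → TT Γ L
  | 0 => sg σ (a₀ ⊗ₜ single [] 1)
  | k + 1 => sg σ (bL (itc σ a₀ k))

lemma itc_TL (σ : List L → Γ) {m : ℤ} (ha : a₀ ∈ supp (len m)) (k : ℕ) :
    itc σ a₀ k ∈ TL (Γ := Γ) (m - k) := by
  induction k with
  | zero =>
    rw [Nat.cast_zero, sub_zero]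
    exact TL_sg σ (TL_chain ha _)
  | succ k ih =>
    rw [Nat.cast_succ, ← sub_sub]
    exact TL_sg σ (TL_bL ih)

lemma bG_itc (P : Pipe Γ E S N) {σ : List L → Γ}
    (hσ : ∀ x ∈ S, ∀ γ : Γ, σ (x.map (γ • ·)) = γ * σ x) (ha : bd a₀ ∈ JL Γ S) (k : ℕ) :
    bG (itc σ a₀ (k + 1)) - bL (itc σ a₀ k) ∈ JT Γ S := by
  have h0 : bG (itc σ a₀ 0) = a₀ ⊗ₜ single [] 1 := by
    rw [itc, bG_sg]
    simp [bG]
  rw [itc, bG_sg, sub_sub_cancel_left]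
  refine Submodule.neg_mem _ (JT_sg P.inv' hσ ?_)
  rw [bG_bL]
  induction k with
  | zero =>
    rw [h0, bL, LinearMap.rTensor_tmul]
    exact JL_nil ha
  | succ k ih =>
    rw [itc, bG_sg, map_sub, bL_bL, zero_sub]
    refine Submodule.neg_mem _ (JT_bL P.sub (JT_sg P.inv' hσ ?_))
    rw [bG_bL]
    exact ih

/-- The comparison chain map. -/
noncomputable def Om (E : ℕ → Submodule ℚ (List L → ℚ)) (N : ℕ) (f₀ : List L → ℚ)
    (b : ℕ → TT Γ L) : ℕ → Ch Γ →ₗ[ℚ] Ch Γ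
  | 0 => LinearMap.id
  | k + 1 => (pair.flip (b k)).comp (lin (Phi E N f₀ k))

lemma Om_single (b : ℕ → TT Γ L) (k : ℕ) (l : List Γ) :
    Om E N f₀ b (k + 1) (single l 1) = pair (Phi E N f₀ k l) (b k) := by
  simp [Om]

/-- Reduction of the vanishing of the cohomology of `Γ` to a statement about coinvariants. -/
theorem Pipe.exists_primitive (P : Pipe Γ E S N) (hf₀ : f₀ ∈ E N) (hd₀ : dl f₀ = 0)
    (ha₀ : a₀ ∈ supp (len (N : ℤ))) (ha : bd a₀ ∈ JL Γ S) (h1 : ev (nm Γ f₀) a₀ ≠ 0) {M i : ℕ}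
    (hN : N = M + (i + 1))
    (H : ∀ a ∈ supp (len (M : ℤ)), bd a ∈ JL Γ S →
      ∃ t : Ch L, ∀ f ∈ E M, ev (nm Γ f) a = ev (nm Γ f) (bd t))
    {c : List Γ → ℚ} (hc : ∀ g l, c (l.map (g * ·)) = c l) (hd : dl c = 0) :
    ∃ b : List Γ → ℚ, (∀ g l, b (l.map (g * ·)) = b l) ∧
      ∀ l : List Γ, l.length = i + 2 → dl b l = c l := by
  classical
  wlog h1' : ev (nm Γ f₀) a₀ = 1 generalizing f₀
  · refine this (f₀ := (ev (nm Γ f₀) a₀)⁻¹ • f₀) (Submodule.smul_mem _ _ hf₀)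
      (by rw [map_smul, hd₀, smul_zero]) ?_ ?_ <;>
    · rw [map_smul]
      have : ∀ (r : ℚ) (f : List L → ℚ), ev (r • f) a₀ = r * ev f a₀ := fun r f => by
        simp [ev, Finsupp.linearCombination_apply, Finsupp.sum, Finset.mul_sum, mul_left_comm]
      rw [this, inv_mul_cancel₀ h1]
      try exact one_ne_zero
  have hΦ := fun k hk => Phi_spec P hf₀ hd₀ ha h1' k hk
  obtain ⟨σ, hσ⟩ := exists_section P.free
  set b := itc σ a₀
  have heq : ∀ k ≤ i + 2, ∀ γ : Γ, ∀ l : List Γ, l.length = k →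
      Om E N f₀ b k (tr γ (single l 1)) = tr γ (Om E N f₀ b k (single l 1)) := by
    intro k hk γ l hl
    cases k with
    | zero => rfl
    | succ k =>
      have hne : l ≠ [] := by rintro rfl; simp at hl
      rw [mp_single, Om_single, Om_single, Phi_map f₀ k γ l hne,
        pair_tc (P.fin _ ((hΦ k (by omega)).1 l hl))]
  have hch : ∀ k < i + 2, ∀ l : List Γ, l.length = k + 1 →
      bd (Om E N f₀ b (k + 1) (single l 1)) = Om E N f₀ b k (bd (single l 1)) := by
    intro k hk l hl
    rw [Om_single, bd_pair]
    cases k with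
    | zero =>
      obtain ⟨g, rfl⟩ := List.length_eq_one_iff.1 hl
      have h0 : bG (b 0) = a₀ ⊗ₜ single [] 1 := by
        simp only [b]
        rw [itc, bG_sg]
        simp [bG]
      have h2 : bd (single [g] (1 : ℚ)) = single [] 1 := by rw [ct_single_cons]; simp
      have h3 : ∀ (f : List L → ℚ) (y : Ch L),
          pair f (y ⊗ₜ single ([] : List Γ) 1) = ev (nm Γ f) y • single [] 1 := by
        intro f y
        suffices h : (pair f).comp ((TensorProduct.mk ℚ (Ch L) (Ch Γ)).flip (single [] 1)) =
            (LinearMap.toSpanSingleton ℚ (Ch Γ) (single [] 1)).comp (ev (nm Γ f)) from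
          LinearMap.congr_fun h y
        refine ch_ext fun x => ?_
        simp only [LinearMap.comp_apply, LinearMap.flip_apply, TensorProduct.mk_apply, pair_apply,
          LinearMap.toSpanSingleton_apply, ev_single, one_mul]
        change grp (orb Γ f x) _ = tot (orb Γ f x) • _
        rw [grp, tot, Finsupp.linearCombination_apply, Finsupp.linearCombination_apply,
          Finsupp.sum, Finsupp.sum, LinearMap.sum_apply, Finset.sum_smul]
        simp
      rw [h0, h2, h3, Phi, nm_tc (P.fin _ hf₀), h1', one_smul]
      rfl
    | succ k =>
      have hm := (hΦ (k + 1) (by omega)).1 l hl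
      have h2 := pair_JT (P.fin _ hm) (P.van _ _ hm) P.inv' (bG_itc P hσ ha k)
      rw [map_sub, sub_eq_zero] at h2
      rw [h2, pair_bL (P.fin _ hm), (hΦ (k + 1) (by omega)).2.2 k rfl l hl]
      rfl
  obtain ⟨e, he, hde⟩ := exists_homotopy (K := i + 2) (Ω := Om E N f₀ b) rfl heq hch hc hd
    (k := i + 1) (by omega)
  have hM : (N : ℤ) - (i + 1 : ℕ) = M := by omega
  obtain ⟨t, ht⟩ := H (con c (b (i + 1))) (by rw [← hM]; exact con_TL c (itc_TL σ ha₀ _)) (by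
    rw [← con_bL]
    have h2 := con_JT hc (bG_itc P hσ ha (i + 1))
    rw [map_sub, con_bG hd, zero_sub] at h2
    simpa using Submodule.neg_mem _ h2)
  set b' : List Γ → ℚ := fun l => if l.length = i + 1 then ev (nm Γ (Phi E N f₀ i l)) t else 0
  have hb' : ∀ g l, b' (l.map (g * ·)) = b' l := by
    intro g l
    by_cases hl : l.length = i + 1
    · have hne : l ≠ [] := by rintro rfl; simp at hl
      have h3 := Phi_map (E := E) (N := N) f₀ i g l hne
      simp only [smul_eq_mul] at h3
      simp only [b', List.length_map, hl, if_true]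
      rw [h3, nm_tc (P.fin _ ((hΦ i (by omega)).1 l hl))]
    · simp [b', hl]
  refine ⟨b' - e, fun g l => by simp only [Pi.sub_apply, hb', he], fun l hl => ?_⟩
  rw [map_sub, Pi.sub_apply, ← hde l hl, Om_single, ev_pair hc]
  have hm := (hΦ (i + 1) (by omega)).1 l hl
  have h3 : N - (i + 1) = M := by omega
  rw [h3] at hm
  rw [ht _ hm, ← ev_dl, ← nm_dl (P.fin _ hm), (hΦ (i + 1) (by omega)).2.2 i rfl l hl]
  have h4 : dl b' l = ev (nm Γ (lin (Phi E N f₀ i) (bd (single l 1)))) t := by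
    rw [dl_apply]
    let evt : (List L → ℚ) →ₗ[ℚ] ℚ :=
      { toFun := fun f => ev f t
        map_add' := fun f g => by
          simp [ev, Finsupp.linearCombination_apply, Finsupp.sum, mul_add,
            Finset.sum_add_distrib]
        map_smul' := fun r f => by
          simp [ev, Finsupp.linearCombination_apply, Finsupp.sum, Finset.mul_sum,
            mul_left_comm] }
    exact eqOn_len (f := ev b') (g := (evt.comp (nm Γ)).comp (lin (Phi E N f₀ i)))
      (fun l hl => by simp [b', hl, evt]) (bd_single_mem_len hl)
  rw [h4]
  ring

end Pipeline

end Eis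

namespace Eis

open Finsupp

/-! ## Faces -/

section Faces

variable {α : Type*}

/-- Up to faces still containing `a`, the boundary of a list is the face deleting `a`. -/
lemma bd_single_append (a : α) : ∀ (l₁ l₂ : List α),
    bd (single (l₁ ++ a :: l₂) 1) - (-1 : ℚ) ^ l₁.length • single (l₁ ++ l₂) 1 ∈
      supp {l | a ∈ l ∧ l.Sublist (l₁ ++ a :: l₂) ∧ l.length = l₁.length + l₂.length}
  | [], l₂ => by
    rw [List.nil_append, List.nil_append, ct_single_cons, one_smul, List.length_nil, pow_zero,
      one_smul, sub_sub_cancel_left]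
    refine Submodule.neg_mem _ (cone_mem a (fun l hl => ?_) (ct_single_mem _ l₂))
    exact ⟨by simp, hl.1.cons_cons a, by simp [← hl.2]⟩
  | b :: l₁, l₂ => by
    have ih := bd_single_append a l₁ l₂
    rw [List.cons_append, List.cons_append, ct_single_cons, one_smul, List.length_cons, pow_succ]
    have e : single (l₁ ++ a :: l₂) (1 : ℚ) - cone b (bd (single (l₁ ++ a :: l₂) 1)) -
        ((-1 : ℚ) ^ l₁.length * -1) • single (b :: (l₁ ++ l₂)) 1 =
        single (l₁ ++ a :: l₂) (1 : ℚ) - cone b (bd (single (l₁ ++ a :: l₂) 1) -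
        (-1 : ℚ) ^ l₁.length • single (l₁ ++ l₂) 1) := by
      rw [map_sub, map_smul, cone_single, mul_neg_one, neg_smul]
      abel
    rw [e]
    refine Submodule.sub_mem _ (single_mem_supp (K := {l | a ∈ l ∧
      l.Sublist (b :: (l₁ ++ a :: l₂)) ∧
      l.length = l₁.length + 1 + l₂.length}) (by
        exact ⟨by simp, List.sublist_cons_self _ _, by simp; omega⟩) 1) (cone_mem b
          (fun l hl => ?_) ih)
    exact ⟨List.mem_cons_of_mem _ hl.1, hl.2.1.cons_cons b, by simp [hl.2.2]; omega⟩

end Faces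

/-! ## Modular symbols -/

section Symbols

variable {A : Type*} [CommRing A] {M : Type*} [AddCommGroup M] [Module A M]

/-- The span of the entries of a list. -/
abbrev sp (A : Type*) [CommRing A] {M : Type*} [AddCommGroup M] [Module A M] (l : List M) :
    Submodule A M := Submodule.span A {x | x ∈ l}

lemma mem_sp {l : List M} {x : M} (h : x ∈ l) : x ∈ sp A l := Submodule.subset_span h

/-- The spanning lists of length `n`. -/
def Sp (A : Type*) [CommRing A] (M : Type*) [AddCommGroup M] [Module A M] (n : ℕ) :
    Set (List M) := {l | l.length = n ∧ sp A l = ⊤}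

/-- The lists of length `n` annihilated by a nonzero functional. -/
def Dp (A : Type*) [CommRing A] (M : Type*) [AddCommGroup M] [Module A M] (n : ℕ) :
    Set (List M) := {l | l.length = n ∧ ∃ μ : M →ₗ[A] A, μ ≠ 0 ∧ ∀ x ∈ l, μ x = 0}

/-- The lists of length `n` with nonzero entries. -/
def Nz (M : Type*) [AddCommGroup M] (n : ℕ) : Set (List M) := {l | l.length = n ∧ ∀ x ∈ l, x ≠ 0}

/-- Short lists are annihilated by nonzero functionals. -/
def Small (A : Type*) [CommRing A] (M : Type*) [AddCommGroup M] [Module A M] (n : ℕ) : Prop :=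
  ∀ l : List M, l.length < n → ∃ μ : M →ₗ[A] A, μ ≠ 0 ∧ ∀ x ∈ l, μ x = 0

lemma eq_zero_of_sp {l : List M} {μ : M →ₗ[A] A} (h : ∀ x ∈ l, μ x = 0) {x : M}
    (hx : x ∈ sp A l) : μ x = 0 := by
  have : sp A l ≤ LinearMap.ker μ := Submodule.span_le.mpr h
  exact this hx

lemma eq_zero_of_Sp {n : ℕ} {l : List M} (hl : l ∈ Sp A M n) {μ : M →ₗ[A] A}
    (h : ∀ x ∈ l, μ x = 0) : μ = 0 := by
  ext x
  exact eq_zero_of_sp h (by rw [hl.2]; trivial)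

lemma Sp_of {n : ℕ} {l l' : List M} (hl : l ∈ Sp A M n) (hn : l'.length = l.length)
    (h : ∀ x ∈ l, x ∈ sp A l') : l' ∈ Sp A M n :=
  ⟨hn.trans hl.1, top_le_iff.mp (hl.2 ▸ Submodule.span_le.mpr h)⟩

lemma Sp_perm {n : ℕ} {l l' : List M} (hl : l ∈ Sp A M n) (h : l.Perm l') : l' ∈ Sp A M n :=
  Sp_of hl h.length_eq.symm fun _ hx => mem_sp (h.mem_iff.mp hx)

lemma Small.dp {n : ℕ} (hs : Small A M n) {l l₀ : List M} (hl : l.length = n)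
    (h₀ : l₀.length < n) (h : ∀ x ∈ l, x ∈ sp A l₀) : l ∈ Dp A M n := by
  obtain ⟨μ, hμ, hk⟩ := hs l₀ h₀
  exact ⟨hl, μ, hμ, fun x hx => eq_zero_of_sp hk (h x hx)⟩

lemma Small.not_span {n : ℕ} (hs : Small A M n) {l l₀ : List M} (hl : l ∈ Sp A M n)
    (h₀ : l₀.length < n) (h : ∀ x ∈ l, x ∈ sp A l₀) : False := by
  obtain ⟨μ, hμ, hk⟩ := hs l₀ h₀
  exact hμ (eq_zero_of_Sp hl fun x hx => eq_zero_of_sp hk (h x hx))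

lemma Small.ne_zero {n : ℕ} (hs : Small A M n) {l : List M} (hl : l ∈ Sp A M n) :
    ∀ x ∈ l, x ≠ 0 := by
  rintro x hx rfl
  obtain ⟨l₁, l₂, rfl⟩ := List.append_of_mem hx
  have h1 := hl.1
  refine hs.not_span hl (l₀ := l₁ ++ l₂) (by simp at h1 ⊢; omega) fun x hx => ?_
  simp only [List.mem_append, List.mem_cons] at hx
  rcases hx with h | rfl | h
  · exact mem_sp (by simp [h])
  · exact Submodule.zero_mem _
  · exact mem_sp (by simp [h])

/-- The relations between modular symbols. -/
noncomputable def relGen (A : Type*) [CommRing A] (M : Type*) [AddCommGroup M] [Module A M]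
    (n : ℕ) :
    Set (Ch M) :=
  {z | ∃ l₁ a l₂, l₁ ++ a :: l₂ ∈ Sp A M n ∧
    z = single (l₁ ++ a :: l₂) 1 - (-1 : ℚ) ^ l₁.length • single (a :: (l₁ ++ l₂)) 1} ∪
  {z | ∃ (u : Aˣ) (a : M) (l : List M), a :: l ∈ Sp A M n ∧
    z = single ((u : A) • a :: l) 1 - single (a :: l) 1} ∪
  {z | ∃ (a b : M) (l : List M), a :: b :: l ∈ Sp A M n ∧
    z = single (a :: b :: l) 1 - single (a :: (a + b) :: l) 1 - single ((a + b) :: b :: l) 1}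

/-- The span of the relations. -/
noncomputable def Rel (A : Type*) [CommRing A] (M : Type*) [AddCommGroup M] [Module A M] (n : ℕ) :
    Submodule ℚ (Ch M) := Submodule.span ℚ (relGen A M n)

/-- Lists of length `n + 1` whose boundaries realise the relations. -/
def Spec (A : Type*) [CommRing A] (M : Type*) [AddCommGroup M] [Module A M] (n : ℕ) :
    Set (List M) :=
  {l | l ∈ Nz M (n + 1) ∧ ((∃ l₁ a l₂, l = a :: (l₁ ++ a :: l₂)) ∨
    (∃ (u : Aˣ) (a : M) (l₂ : List M), l = (u : A) • a :: a :: l₂) ∨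
    ∃ a b l₂, l = a :: b :: (a + b) :: l₂ ∧ a :: b :: l₂ ∈ Sp A M n)}

variable {n : ℕ}

lemma smul_mem_sp (u : A) {a : M} {l : List M} (h : a ∈ l) : u • a ∈ sp A l :=
  Submodule.smul_mem _ _ (mem_sp h)

lemma sp_of_unit (u : Aˣ) {a : M} {l : List M} (h : (u : A) • a ∈ l) : a ∈ sp A l := by
  have := smul_mem_sp (A := A) ((u⁻¹ : Aˣ) : A) h
  rwa [smul_smul, Units.inv_mul, one_smul] at this

lemma Sp_smul (u : Aˣ) {a : M} {l : List M} (h : a :: l ∈ Sp A M n) :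
    (u : A) • a :: l ∈ Sp A M n := by
  refine Sp_of h (by simp) fun x hx => ?_
  rcases List.mem_cons.mp hx with rfl | hx
  · exact sp_of_unit u (by simp)
  · exact mem_sp (by simp [hx])

lemma Sp_swap {a b : M} {l : List M} (h : a :: b :: l ∈ Sp A M n) : b :: a :: l ∈ Sp A M n :=
  Sp_perm h (List.Perm.swap b a l)

lemma Sp_add_right {a b : M} {l : List M} (h : a :: b :: l ∈ Sp A M n) :
    a :: (a + b) :: l ∈ Sp A M n := by
  refine Sp_of h (by simp) fun x hx => ?_
  simp only [List.mem_cons] at hx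
  rcases hx with rfl | rfl | hx
  · exact mem_sp (by simp)
  · have := Submodule.sub_mem _ (mem_sp (A := A) (l := a :: (a + x) :: l) (x := a + x) (by simp))
      (mem_sp (x := a) (by simp))
    rwa [add_sub_cancel_left] at this
  · exact mem_sp (by simp [hx])

lemma Sp_add_left {a b : M} {l : List M} (h : a :: b :: l ∈ Sp A M n) :
    (a + b) :: b :: l ∈ Sp A M n := by
  have := Sp_swap (Sp_add_right (Sp_swap h))
  rwa [add_comm b a] at this

/-- Relations are boundaries of special chains modulo degenerate lists. -/
lemma Rel.exists_bd (hs : Small A M n) {z : Ch M} (hz : z ∈ Rel A M n) :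
    ∃ q ∈ supp (Spec A M n), z - bd q ∈ supp (Dp A M n ∩ Nz M n) := by
  have hmv : ∀ l₁ a l₂, l₁ ++ a :: l₂ ∈ Sp A M n →
      ∃ q ∈ supp (Spec A M n), single (l₁ ++ a :: l₂) 1 -
        (-1 : ℚ) ^ l₁.length • single (a :: (l₁ ++ l₂)) 1 - bd q ∈ supp (Dp A M n ∩ Nz M n) := by
    intro l₁ a l₂ h
    have hnz := hs.ne_zero h
    have hlen := h.1
    have hm : a :: (l₁ ++ a :: l₂) ∈ Spec A M n := by
      refine ⟨⟨by simpa using hlen, fun x hx => ?_⟩, Or.inl ⟨l₁, a, l₂, rfl⟩⟩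
      rcases List.mem_cons.mp hx with rfl | hx
      · exact hnz _ (by simp)
      · exact hnz x hx
    refine ⟨single (a :: (l₁ ++ a :: l₂)) 1, single_mem_supp hm 1, ?_⟩
    · rw [ct_single_cons, one_smul]
      have e : single (l₁ ++ a :: l₂) 1 - (-1 : ℚ) ^ l₁.length • single (a :: (l₁ ++ l₂)) 1 -
          (single (l₁ ++ a :: l₂) 1 - cone a (bd (single (l₁ ++ a :: l₂) 1))) =
          cone a (bd (single (l₁ ++ a :: l₂) 1) - (-1 : ℚ) ^ l₁.length • single (l₁ ++ l₂) 1) := by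
        rw [map_sub, map_smul, cone_single]; abel
      rw [e]
      refine cone_mem a (fun l hl => ?_) (bd_single_append a l₁ l₂)
      obtain ⟨h1, h2, h3⟩ := hl
      rw [List.length_append, List.length_cons] at hlen
      have hl' : (a :: l).length = n := by rw [List.length_cons]; omega
      refine ⟨hs.dp hl' (l₀ := l) (by omega) ?_, hl', ?_⟩
      · intro x hx
        rcases List.mem_cons.mp hx with rfl | hx
        · exact mem_sp h1
        · exact mem_sp hx
      · intro x hx
        rcases List.mem_cons.mp hx with rfl | hx
        · exact hnz _ (by simp)
        · exact hnz x (h2.subset hx)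
  rw [Rel] at hz
  induction hz using Submodule.span_induction with
  | zero => exact ⟨0, Submodule.zero_mem _, by simp⟩
  | add x y _ _ hx hy =>
    obtain ⟨q, hq, h⟩ := hx
    obtain ⟨q', hq', h'⟩ := hy
    refine ⟨q + q', Submodule.add_mem _ hq hq', ?_⟩
    rw [map_add, add_sub_add_comm]
    exact Submodule.add_mem _ h h'
  | smul c x _ hx =>
    obtain ⟨q, hq, h⟩ := hx
    refine ⟨c • q, Submodule.smul_mem _ _ hq, ?_⟩
    rw [map_smul, ← smul_sub]
    exact Submodule.smul_mem _ _ h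
  | mem z hz =>
    rcases hz with (⟨l₁, a, l₂, h, rfl⟩ | ⟨u, a, l, h, rfl⟩) | ⟨a, b, l, h, rfl⟩
    · exact hmv l₁ a l₂ h
    · have hnz := hs.ne_zero h
      have hnz' := hs.ne_zero (Sp_smul u h)
      have hlen := h.1
      rw [List.length_cons] at hlen
      have hm : (u : A) • a :: a :: l ∈ Spec A M n := by
        refine ⟨⟨by simp [hlen], fun x hx => ?_⟩, Or.inr (Or.inl ⟨u, a, l, rfl⟩)⟩
        rcases List.mem_cons.mp hx with rfl | hx
        · exact hnz' _ (by simp)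
        · exact hnz x hx
      refine ⟨- single ((u : A) • a :: a :: l) 1,
        Submodule.neg_mem _ (single_mem_supp hm 1), ?_⟩
      · rw [map_neg, ct_single_cons, ct_single_cons, map_sub, one_smul, one_smul, cone_single]
        have e : single ((u : A) • a :: l) (1 : ℚ) - single (a :: l) 1 - -(single (a :: l) 1 -
            (single ((u : A) • a :: l) 1 - cone ((u : A) • a) (cone a (bd (single l 1))))) =
            cone ((u : A) • a) (cone a (bd (single l 1))) := by abel
        rw [e]
        refine cone_mem (K := {l' | ∃ l₀, l₀.Sublist l ∧ l₀.length + 1 = l.length ∧ l' = a :: l₀})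
          _ ?_ (cone_mem a (fun l₀ hl₀ => by exact ⟨l₀, hl₀.1, hl₀.2, rfl⟩) (ct_single_mem _ l))
        rintro _ ⟨l₀, h1, h2, rfl⟩
        have hl' : ((u : A) • a :: a :: l₀).length = n := by simp; omega
        refine ⟨hs.dp hl' (l₀ := a :: l₀) (by simp; omega) ?_, hl', ?_⟩
        · intro x hx
          rcases List.mem_cons.mp hx with rfl | hx
          · exact smul_mem_sp _ (by simp)
          · exact mem_sp hx
        · intro x hx
          rcases List.mem_cons.mp hx with rfl | hx
          · exact hnz' _ (by simp)
          · exact hnz x ((h1.cons_cons a).subset hx)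
    · have hlen := h.1
      simp only [List.length_cons] at hlen
      obtain ⟨q, hq, hq'⟩ := hmv [b] (a + b) l (Sp_swap (Sp_add_left h))
      have hnz := hs.ne_zero h
      have hnz' := hs.ne_zero (Sp_add_right h)
      have hm : a :: b :: (a + b) :: l ∈ Spec A M n := by
        refine ⟨⟨by simp [← hlen], fun x hx => ?_⟩, Or.inr (Or.inr ⟨a, b, l, rfl, h⟩)⟩
        simp only [List.mem_cons] at hx
        rcases hx with rfl | rfl | rfl | hx
        · exact hnz _ (by simp)
        · exact hnz _ (by simp)
        · exact hnz' _ (by simp)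
        · exact hnz _ (by simp [hx])
      refine ⟨single (a :: b :: (a + b) :: l) 1 - q,
        Submodule.sub_mem _ (single_mem_supp hm 1) hq, ?_⟩
      · rw [map_sub bd, ct_single_cons, ct_single_cons, ct_single_cons]
        simp only [map_sub, one_smul, cone_single]
        have e : single (a :: b :: l) (1 : ℚ) - single (a :: (a + b) :: l) 1 -
            single ((a + b) :: b :: l) 1 - (single (b :: (a + b) :: l) 1 -
            (single (a :: (a + b) :: l) 1 - (single (a :: b :: l) 1 -
            cone a (cone b (cone (a + b) (bd (single l 1)))))) - bd q) =
            cone a (cone b (cone (a + b) (bd (single l 1)))) -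
            (single ([b] ++ (a + b) :: l) 1 -
              (-1 : ℚ) ^ [b].length • single ((a + b) :: ([b] ++ l)) 1 - bd q) := by
          simp only [List.length_singleton, List.singleton_append, pow_one, neg_smul, one_smul]
          abel
        rw [e]
        refine Submodule.sub_mem _ ?_ hq'
        refine cone_mem (K := {l' | ∃ l₀, l₀.Sublist l ∧ l₀.length + 1 = l.length ∧
          l' = b :: (a + b) :: l₀}) _ ?_ (cone_mem (K := {l' | ∃ l₀, l₀.Sublist l ∧
          l₀.length + 1 = l.length ∧ l' = (a + b) :: l₀}) b ?_
          (cone_mem _ (fun l₀ hl₀ => by exact ⟨l₀, hl₀.1, hl₀.2, rfl⟩) (ct_single_mem _ l)))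
        · rintro _ ⟨l₀, h1, h2, rfl⟩
          have hl' : (a :: b :: (a + b) :: l₀).length = n := by simp; omega
          refine ⟨hs.dp hl' (l₀ := a :: b :: l₀) (by simp; omega) ?_, hl', ?_⟩
          · intro x hx
            simp only [List.mem_cons] at hx
            rcases hx with rfl | rfl | rfl | hx
            · exact mem_sp (by simp)
            · exact mem_sp (by simp)
            · exact Submodule.add_mem _ (mem_sp (by simp)) (mem_sp (by simp))
            · exact mem_sp (by simp [hx])
          · intro x hx
            simp only [List.mem_cons] at hx
            rcases hx with rfl | rfl | rfl | hx
            · exact hnz _ (by simp)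
            · exact hnz _ (by simp)
            · exact hnz' _ (by simp)
            · exact hnz _ (by simp [h1.subset hx])
        · rintro _ ⟨l₀, h1, h2, rfl⟩
          exact ⟨l₀, h1, h2, rfl⟩

/-- The span of degenerate lists and boundaries of lists with nonzero entries. -/
noncomputable def DD (A : Type*) [CommRing A] (M : Type*) [AddCommGroup M] [Module A M] (n : ℕ) :
    Submodule ℚ (Ch M) := supp (Dp A M n) ⊔ (supp (Nz M (n + 1))).map bd

lemma Rel_le_DD (hs : Small A M n) : Rel A M n ≤ DD A M n := by
  intro z hz
  obtain ⟨q, hq, h⟩ := Rel.exists_bd hs hz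
  rw [← sub_add_cancel z (bd q)]
  exact Submodule.add_mem_sup (Finsupp.supported_mono Set.inter_subset_left h)
    (Submodule.mem_map_of_mem (Finsupp.supported_mono (fun l hl => hl.1) hq))

end Symbols

end Eis

namespace Eis

open Finsupp

/-- The properties of the norm on the Eisenstein integers needed to reduce modular symbols. -/
structure Disc {A : Type*} [CommRing A] (N : A → ℕ) : Prop where
  zero : ∀ x, N x = 0 ↔ x = 0
  mul : ∀ x y, N (x * y) = N x * N y
  unit : ∀ x, N x = 1 → IsUnit x
  turn : ∀ a b, b ≠ 0 → N a = N b → ∃ u : Aˣ, N (a + u * b) < N b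
  div : ∀ a b, b ≠ 0 → ∃ s, N (a + s * b) < N b
  lift : ∀ a b t, N a < N b → N (a + t * b) < N b →
    t = 0 ∨ (∃ u : Aˣ, t = u) ∨ ∃ u u' : Aˣ, t = u + u' ∧ N (a + u * b) < N b
  pair : ∀ a a' b, b ≠ 0 → ∃ s s', N (a + s * b) < N b ∧ N (a' + s' * b) < N b ∧
    N (a + s * b + (a' + s' * b)) < N b

section Reduce

variable {A : Type*} [CommRing A] [Nontrivial A] {N : A → ℕ}

lemma Disc.one (hN : Disc N) : N 1 = 1 := by
  have h := hN.mul 1 1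
  rw [mul_one] at h
  have h0 : N 1 ≠ 0 := fun h => one_ne_zero ((hN.zero 1).mp h)
  exact (mul_eq_left₀ h0).mp h.symm

lemma Disc.norm_unit (hN : Disc N) (u : Aˣ) : N u = 1 := by
  have h := hN.mul u (u⁻¹ : Aˣ)
  rw [Units.mul_inv, hN.one] at h
  exact Nat.eq_one_of_mul_eq_one_right h.symm

variable {M : Type*} [AddCommGroup M] [Module A M] {n : ℕ}

lemma Rel.mv {l₁ l₂ : List M} {a : M} (h : l₁ ++ a :: l₂ ∈ Sp A M n) :
    single (l₁ ++ a :: l₂) 1 - (-1 : ℚ) ^ l₁.length • single (a :: (l₁ ++ l₂)) 1 ∈ Rel A M n :=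
  Submodule.subset_span (Or.inl (Or.inl ⟨l₁, a, l₂, h, rfl⟩))

lemma Rel.un (u : Aˣ) {l : List M} {a : M} (h : a :: l ∈ Sp A M n) :
    single ((u : A) • a :: l) 1 - single (a :: l) 1 ∈ Rel A M n :=
  Submodule.subset_span (Or.inl (Or.inr ⟨u, a, l, h, rfl⟩))

lemma Rel.th {l : List M} {a b : M} (h : a :: b :: l ∈ Sp A M n) :
    single (a :: b :: l) 1 - single (a :: (a + b) :: l) 1 - single ((a + b) :: b :: l) 1
      ∈ Rel A M n :=
  Submodule.subset_span (Or.inr ⟨a, b, l, h, rfl⟩)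

lemma mem_of_front {Q : Submodule ℚ (Ch M)} (hQ : Rel A M n ≤ Q) {l₁ l₂ : List M} {a : M}
    (h : l₁ ++ a :: l₂ ∈ Sp A M n) (hm : single (a :: (l₁ ++ l₂)) 1 ∈ Q) :
    single (l₁ ++ a :: l₂) (1 : ℚ) ∈ Q := by
  rw [← sub_add_cancel (single (l₁ ++ a :: l₂) (1 : ℚ))
    ((-1 : ℚ) ^ l₁.length • single (a :: (l₁ ++ l₂)) 1)]
  exact Q.add_mem (hQ (Rel.mv h)) (Q.smul_mem _ hm)

variable (N) in
/-- Spanning lists with all values of `lam` of norm less than `k`. -/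
def Fl (lam : M →ₗ[A] A) (n k : ℕ) : Set (List M) :=
  {l | l ∈ Sp A M n ∧ ∀ x ∈ l, N (lam x) < k}

variable (N) in
/-- Spanning lists whose head has norm `k` and whose other entries have smaller norm. -/
def Gl (lam : M →ₗ[A] A) (n k : ℕ) : Set (List M) :=
  {l | l ∈ Sp A M n ∧ ∃ v l', l = v :: l' ∧ N (lam v) = k ∧ ∀ x ∈ l', N (lam x) < k}

lemma reduce_top (hN : Disc N) (lam : M →ₗ[A] A) {k : ℕ} (hk : 0 < k) : ∀ (c : ℕ) (l : List M),
    l ∈ Sp A M n → (∀ x ∈ l, N (lam x) ≤ k) → l.countP (fun x => N (lam x) = k) = c →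
    single l 1 ∈ Rel A M n ⊔ supp (Fl N lam n k) ⊔ supp (Gl N lam n k) := by
  intro c
  set Q := Rel A M n ⊔ supp (Fl N lam n k) ⊔ supp (Gl N lam n k) with hQd
  have hQ : Rel A M n ≤ Q := le_sup_left.trans le_sup_left
  induction c using Nat.strong_induction_on with
  | _ c ih =>
  intro l hl hle hc
  by_cases h0 : ∀ x ∈ l, N (lam x) < k
  · exact (le_sup_right.trans le_sup_left : _ ≤ Q) (single_mem_supp (K := Fl N lam n k) ⟨hl, h0⟩ 1)
  push Not at h0
  obtain ⟨a, ha, hak⟩ := h0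
  have hak := le_antisymm (hle a ha) hak
  obtain ⟨l₁, l₂, rfl⟩ := List.append_of_mem ha
  refine mem_of_front hQ hl ?_
  have hp : (l₁ ++ a :: l₂).Perm (a :: (l₁ ++ l₂)) := List.perm_middle
  replace hl := Sp_perm hl hp
  rw [hp.countP_eq] at hc
  replace hle : ∀ x ∈ a :: (l₁ ++ l₂), N (lam x) ≤ k := fun x hx => hle x (hp.mem_iff.mpr hx)
  generalize l₁ ++ l₂ = l at *
  by_cases h1 : ∀ x ∈ l, N (lam x) < k
  · exact (le_sup_right : _ ≤ Q) (single_mem_supp (K := Gl N lam n k) ⟨hl, a, l, rfl, hak, h1⟩ 1)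
  push Not at h1
  obtain ⟨b, hb, hbk⟩ := h1
  have hbk := le_antisymm (hle b (by simp [hb])) hbk
  obtain ⟨l₁, l₂, rfl⟩ := List.append_of_mem hb
  refine mem_of_front (l₁ := a :: l₁) hQ hl ?_
  have hp : (a :: (l₁ ++ b :: l₂)).Perm (b :: a :: (l₁ ++ l₂)) :=
    List.perm_middle (l₁ := a :: l₁)
  replace hl := Sp_perm hl hp
  rw [hp.countP_eq] at hc
  replace hle : ∀ x ∈ b :: a :: (l₁ ++ l₂), N (lam x) ≤ k := fun x hx => hle x (hp.mem_iff.mpr hx)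
  rw [List.cons_append]
  generalize l₁ ++ l₂ = l at *
  obtain ⟨u, hu⟩ := hN.turn (lam a) (lam b) (fun h => by
    rw [h, (hN.zero 0).mpr rfl] at hbk; omega) (hak.trans hbk.symm)
  have hlu := Sp_smul u hl
  have hub : N (lam ((u : A) • b)) = k := by
    rw [map_smul, smul_eq_mul, hN.mul, hN.norm_unit, one_mul, hbk]
  have hsum : N (lam ((u : A) • b + a)) < k := by
    rw [map_add, map_smul, smul_eq_mul, add_comm, ← hbk]; exact hu
  have hlt : ∀ x ∈ l, N (lam x) ≤ k := fun x hx => hle x (by simp [hx])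
  simp only [List.countP_cons, hak, hbk, decide_true, if_true] at hc
  have e1 := ih _ (by rw [List.countP_cons_of_pos (by simpa only [decide_eq_true_eq] using hub),
      List.countP_cons_of_neg (by simpa only [decide_eq_true_eq] using hsum.ne)]; omega)
        ((u : A) • b :: ((u : A) • b + a) :: l) (Sp_add_right hlu)
    (by
      intro x hx
      simp only [List.mem_cons] at hx
      rcases hx with rfl | rfl | hx
      · exact hub.le
      · exact hsum.le
      · exact hlt x hx) rfl
  have e2 := ih _ (by rw [List.countP_cons_of_neg (by simpa only [decide_eq_true_eq] using hsum.ne),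
      List.countP_cons_of_pos (by simpa only [decide_eq_true_eq] using hak)]; omega)
        (((u : A) • b + a) :: a :: l) (Sp_add_left hlu)
    (by
      intro x hx
      simp only [List.mem_cons] at hx
      rcases hx with rfl | rfl | hx
      · exact hsum.le
      · exact hak.le
      · exact hlt x hx) rfl
  have := Q.sub_mem (Q.add_mem (Q.add_mem (hQ (Rel.th hlu)) e1) e2) (hQ (Rel.un u hl))
  convert this using 1
  abel

end Reduce

end Eis

namespace Eis

open Finsupp

section Weights

variable {α : Type*}

lemma ct_eq_zero {χ : α → ℚ} {l : List α} (h : ∀ x ∈ l, χ x = 0) : ct χ (single l 1) = 0 := by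
  induction l with
  | nil => simp
  | cons a l ih =>
    rw [ct_single_cons, h a (by simp), ih fun x hx => h x (by simp [hx])]
    simp

lemma ct_congr {χ ψ : α → ℚ} {l : List α} (h : ∀ x ∈ l, χ x = ψ x) :
    ct χ (single l 1) = ct ψ (single l 1) := by
  induction l with
  | nil => simp
  | cons a l ih =>
    rw [ct_single_cons, ct_single_cons, h a (by simp), ih fun x hx => h x (by simp [hx])]

lemma ct_mem_of_eq_zero {χ : α → ℚ} {l : List α} {a : α} (ha : a ∈ l) (h : χ a = 0) :
    ct χ (single l 1) ∈ supp {l' | a ∈ l' ∧ l'.length + 1 = l.length} := by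
  induction l with
  | nil => simp at ha
  | cons b l ih =>
    rw [ct_single_cons]
    by_cases hab : a = b
    · subst hab
      rw [h, zero_smul, zero_sub]
      refine Submodule.neg_mem _ (cone_mem a (fun l' hl' => ?_) (ct_single_mem χ l))
      exact ⟨by simp, by simp [hl'.2]⟩
    · have hl : a ∈ l := by simpa [hab] using ha
      refine Submodule.sub_mem _ (Submodule.smul_mem _ _ (single_mem_supp
        (by exact ⟨hl, by simp⟩) 1)) (cone_mem b (fun l' hl' => ?_) (ih hl))
      exact ⟨by simp [hl'.1], by simp [hl'.2]⟩

end Weights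

section Quotient

variable {A : Type*} [CommRing A] {M : Type*} [AddCommGroup M] [Module A M] {m : ℕ}

lemma sp_map (W : Submodule A M) (l : List M) : sp A (l.map W.mkQ) = (sp A l).map W.mkQ := by
  rw [sp, sp, Submodule.map_span]
  congr 1
  ext x
  simp

lemma Sp_cons_iff {v : M} {l : List M} :
    v :: l ∈ Sp A M (m + 1) ↔ l.map (Submodule.span A {v}).mkQ ∈ Sp A
      (M ⧸ Submodule.span A {v}) m := by
  have h : sp A (v :: l) = Submodule.span A {v} ⊔ sp A l := by
    rw [sp, sp, ← Submodule.span_union]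
    congr 1
    ext x
    simp
  simp only [Sp, Set.mem_ofPred_eq, List.length_cons, List.length_map, add_left_inj, sp_map, h]
  rw [← Submodule.comap_map_mkQ, ← Submodule.comap_top (Submodule.span A {v}).mkQ,
    (Submodule.comap_injective_of_surjective (Submodule.mkQ_surjective _)).eq_iff]

lemma Small.quot (hs : Small A M (m + 1)) (v : M) : Small A (M ⧸ Submodule.span A {v}) m := by
  intro l hl
  obtain ⟨l, rfl⟩ := List.map_surjective_iff.mpr (Submodule.mkQ_surjective _) l
  obtain ⟨μ, hμ, hk⟩ := hs (v :: l) (by simpa using hl)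
  have hv : Submodule.span A {v} ≤ LinearMap.ker μ := by
    rw [Submodule.span_singleton_le_iff_mem]; exact hk v (by simp)
  refine ⟨(Submodule.span A {v}).liftQ μ hv, fun h => hμ ?_, ?_⟩
  · rw [← Submodule.liftQ_mkQ (Submodule.span A {v}) μ hv, h, LinearMap.zero_comp]
  · intro x hx
    obtain ⟨y, hy, rfl⟩ := List.mem_map.mp hx
    simpa using hk y (by simp [hy])

/-- The indicator function of the nonzero vectors of a submodule. -/
noncomputable def chi (W : Submodule A M) : M → ℚ :=
  open Classical in fun x => if x ∈ W ∧ x ≠ 0 then 1 else 0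

/-- Contraction of chains along a line. -/
noncomputable def res (W : Submodule A M) : Ch M →ₗ[ℚ] Ch (M ⧸ W) := (mp W.mkQ).comp (ct (chi W))

variable [IsDomain A]

lemma res_mem_DD (hs : Small A M (m + 1)) (v : M) {z : Ch M} (hz : z ∈ DD A M (m + 1)) :
    res (Submodule.span A {v}) z ∈ DD A (M ⧸ Submodule.span A {v}) m := by
  set W := Submodule.span A {v} with hW
  obtain ⟨x, hx, y, hy, rfl⟩ := Submodule.mem_sup.mp hz
  obtain ⟨y, hy, rfl⟩ := hy
  rw [map_add]
  refine Submodule.add_mem _ (map_supp _ (fun l hl => ?_) hx) ?_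
  · by_cases h : ∀ x ∈ l, chi W x = 0
    · simp [res, ct_eq_zero h]
    push Not at h
    obtain ⟨x, hx, hxv⟩ := h
    obtain ⟨h1, h2⟩ : x ∈ W ∧ x ≠ 0 := by
      by_contra hc
      exact hxv (by simp only [chi, if_neg hc])
    obtain ⟨c, rfl⟩ := Submodule.mem_span_singleton.mp h1
    obtain ⟨hlen, μ, hμ, hk⟩ := hl
    have hv : μ v = 0 := by
      have := hk _ hx
      rw [map_smul, smul_eq_mul] at this
      exact (mul_eq_zero.mp this).resolve_left (by rintro rfl; simp at h2)
    have hv' : W ≤ LinearMap.ker μ := by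
      rw [hW, Submodule.span_singleton_le_iff_mem]; exact hv
    refine (le_sup_left : _ ≤ DD A (M ⧸ W) m) ?_
    refine map_supp (mp W.mkQ) (fun l' hl' => ?_) (ct_single_mem (chi W) l)
    rw [mp_single]
    refine single_mem_supp ?_ 1
    refine ⟨by have := hl'.2; simp; omega, W.liftQ μ hv', fun h => hμ ?_, ?_⟩
    · rw [← Submodule.liftQ_mkQ W μ hv', h, LinearMap.zero_comp]
    · intro x hx
      obtain ⟨y, hy, rfl⟩ := List.mem_map.mp hx
      simpa using hk y (hl'.1.subset hy)
  · have hbd : res W (bd y) = - mp W.mkQ (ct (fun x => 1 - chi W x) (ct (chi W) y)) := by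
      have : (fun _ : M => (1 : ℚ)) = chi W + fun x => 1 - chi W x := by ext; simp
      rw [res, LinearMap.comp_apply, bd, this, ct_add, map_add, ct_self, zero_add, ct_ct, map_neg]
    rw [hbd]
    refine Submodule.neg_mem _ ?_
    have hy' : ct (chi W) y ∈ supp (Nz M (m + 1)) := by
      refine map_supp _ (fun l hl => ?_) hy
      refine Finsupp.supported_mono ?_ (ct_single_mem _ l)
      intro l' hl'
      have h1 := hl'.2
      have h2 := hl.1
      exact ⟨by omega, fun x hx => hl.2 x (hl'.1.subset hx)⟩
    refine map_supp ((mp W.mkQ).comp (ct fun x => 1 - chi W x)) (fun l hl => ?_) hy'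
    rw [LinearMap.comp_apply]
    by_cases h : ∀ x ∈ l, x ∉ W
    · rw [ct_congr (ψ := fun _ => 1) fun x hx => by simp [chi, h x hx], mp_bd, mp_single]
      refine (le_sup_right : _ ≤ DD A (M ⧸ W) m) (Submodule.mem_map_of_mem (single_mem_supp ?_ 1))
      refine ⟨by simpa using hl.1, fun x hx => ?_⟩
      obtain ⟨y, hy, rfl⟩ := List.mem_map.mp hx
      simpa using h y hy
    · push Not at h
      obtain ⟨x, hx, hxW⟩ := h
      refine (le_sup_left : _ ≤ DD A (M ⧸ W) m) ?_
      refine map_supp _ (fun l' hl' => ?_) (ct_mem_of_eq_zero hx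
        (show 1 - chi W x = 0 by simp [chi, hxW, hl.2 x hx]))
      rw [mp_single]
      refine single_mem_supp ?_ 1
      obtain ⟨h1, h2⟩ := hl'
      have h3 := hl.1
      obtain ⟨l₁, l₂, rfl⟩ := List.append_of_mem h1
      rw [List.length_append, List.length_cons] at h2
      refine (hs.quot v).dp (l₀ := (l₁ ++ l₂).map W.mkQ) (by simp; omega) (by simp; omega) ?_
      intro w hw
      obtain ⟨w, hw', rfl⟩ := List.mem_map.mp hw
      rcases List.mem_append.mp hw' with hw' | hw'
      · exact mem_sp (List.mem_map_of_mem (by simp [hw']))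
      rcases List.mem_cons.mp hw' with rfl | hw'
      · have : W.mkQ w = 0 := by simpa using hxW
        rw [this]
        exact Submodule.zero_mem _
      · exact mem_sp (List.mem_map_of_mem (by simp [hw']))

end Quotient

end Eis

namespace Eis

open Finsupp

section Change

variable {A : Type*} [CommRing A] [IsDomain A] {N : A → ℕ}
variable {M : Type*} [AddCommGroup M] [Module A M] {n k : ℕ} {lam : M →ₗ[A] A} {v : M}
variable {Q : Submodule ℚ (Ch M)}

lemma Sp_shift {l₁ l₂ : List M} {w : M} {t : A} (h : v :: (l₁ ++ w :: l₂) ∈ Sp A M n) :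
    v :: (l₁ ++ (w + t • v) :: l₂) ∈ Sp A M n := by
  refine Sp_of h (by simp) fun x hx => ?_
  have hx : x = w ∨ (x = v ∨ x ∈ l₁ ∨ x ∈ l₂) := by
    simp only [List.mem_cons, List.mem_append] at hx; tauto
  rcases hx with rfl | hx
  · have h1 : x + t • v ∈ sp A (v :: (l₁ ++ (x + t • v) :: l₂)) := mem_sp (by simp)
    have h2 : t • v ∈ sp A (v :: (l₁ ++ (x + t • v) :: l₂)) := smul_mem_sp t (by simp)
    simpa using Submodule.sub_mem _ h1 h2
  · exact mem_sp (by simp only [List.mem_cons, List.mem_append]; tauto)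

lemma Rel.mv₂ {l₁ l₂ : List M} {w : M} (h : v :: (l₁ ++ w :: l₂) ∈ Sp A M n) :
    single (v :: (l₁ ++ w :: l₂)) 1 - (-1 : ℚ) ^ l₁.length • single (v :: w :: (l₁ ++ l₂)) 1 ∈
      Rel A M n := by
  have h1 := Rel.mv (l₁ := v :: l₁) h
  have h2 := Rel.mv (l₁ := [v]) (l₂ := l₁ ++ l₂) (a := w)
    (Sp_perm h (List.Perm.cons v List.perm_middle))
  have h3 := Submodule.sub_mem _ h1 (Submodule.smul_mem _ ((-1 : ℚ) ^ l₁.length) h2)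
  convert h3 using 1
  simp only [List.cons_append, List.nil_append, List.length_cons, pow_succ, pow_zero, smul_sub,
    smul_smul, List.length_nil, one_mul]
  abel

lemma Rel.un₂ (u : Aˣ) {l : List M} {w : M} (h : v :: w :: l ∈ Sp A M n) :
    single (v :: (u : A) • w :: l) 1 - single (v :: w :: l) 1 ∈ Rel A M n := by
  have h0 := Sp_smul u (Sp_swap h)
  have h1 := Rel.mv (l₁ := [v]) (Sp_swap h0)
  have h2 := Rel.mv (l₁ := [v]) h
  have h3 := Rel.un u (Sp_swap h)
  have := Submodule.sub_mem _ (Submodule.sub_mem _ h1 h2) h3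
  convert this using 1
  simp only [List.cons_append, List.nil_append, List.length_cons, List.length_nil, zero_add,
    pow_one, neg_smul, one_smul]
  abel

lemma Rel.th₂ {l : List M} {a b : M} (h : v :: a :: b :: l ∈ Sp A M n) :
    single (v :: a :: b :: l) 1 - single (v :: a :: (a + b) :: l) 1 -
      single (v :: (a + b) :: b :: l) 1 ∈ Rel A M n := by
  have hp : ∀ a b : M, (v :: a :: b :: l).Perm (a :: b :: v :: l) := fun a b =>
    (List.perm_middle (l₁ := [a, b])).symm
  have h0 := Sp_perm h (hp a b)
  have h1 := Rel.mv (l₁ := [a, b]) h0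
  have h2 := Rel.mv (l₁ := [a, a + b]) (Sp_add_right h0)
  have h3 := Rel.mv (l₁ := [a + b, b]) (Sp_add_left h0)
  have := Submodule.add_mem _ (Submodule.add_mem _ (Submodule.sub_mem _ (Rel.th h0) h1) h2) h3
  convert this using 1
  simp only [List.cons_append, List.nil_append, List.length_cons, List.length_nil, zero_add,
    one_smul, one_add_one_eq_two, even_two, Even.neg_pow, one_pow]
  abel

lemma change_unit
    (hR : Rel A M n ≤ Q) (hF : supp (Fl N lam n k) ≤ Q)
    {w : M} {l : List M} (u : Aˣ)
    (h : v :: w :: l ∈ Sp A M n) (hl : ∀ x ∈ l, N (lam x) < k) (hw : N (lam w) < k)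
    (hw' : N (lam (w + (u : A) • v)) < k) :
    single (v :: w :: l) 1 - single (v :: (w + (u : A) • v) :: l) 1 ∈ Q := by
  have h0 := Sp_smul u h
  have h1 := Rel.un u h
  have h2 := Rel.th h0
  have h3 := Rel.un u (Sp_shift (l₁ := []) (t := (u : A)) h)
  have hm : ((u : A) • v + w) :: w :: l ∈ Fl N lam n k := by
    refine ⟨Sp_add_left h0, fun x hx => ?_⟩
    simp only [List.mem_cons] at hx
    rcases hx with rfl | rfl | hx
    · rw [add_comm]; exact hw'
    · exact hw
    · exact hl x hx
  have := Q.add_mem (Q.add_mem (Q.sub_mem (hR h2) (hR h1)) (hR h3)) (hF (single_mem_supp hm 1))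
  convert this using 1
  simp only [List.nil_append]
  rw [add_comm w]
  abel

lemma change_second
    (hN : Disc N) (hv : N (lam v) = k) (hR : Rel A M n ≤ Q) (hF : supp (Fl N lam n k) ≤ Q)
    {w : M} {l : List M} (t : A)
    (h : v :: w :: l ∈ Sp A M n) (hl : ∀ x ∈ l, N (lam x) < k) (hw : N (lam w) < k)
    (hw' : N (lam (w + t • v)) < k) :
    single (v :: w :: l) 1 - single (v :: (w + t • v) :: l) 1 ∈ Q := by
  have e : ∀ t : A, lam (w + t • v) = lam w + t * lam v := fun t => by simp
  rcases hN.lift (lam w) (lam v) t (hv ▸ hw) (by rw [← e, hv]; exact hw') with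
    rfl | ⟨u, rfl⟩ | ⟨u, u', rfl, hu⟩
  · simp
  · exact change_unit hR hF u h hl hw hw'
  · rw [← e, hv] at hu
    have h1 := change_unit hR hF u h hl hw hu
    have h2 := change_unit hR hF u' (Sp_shift (l₁ := []) (t := (u : A)) h) hl hu
      (by rwa [add_assoc, ← add_smul])
    have := Q.add_mem h1 h2
    rwa [add_assoc w, ← add_smul, sub_add_sub_cancel] at this

lemma change_one
    (hN : Disc N) (hv : N (lam v) = k) (hR : Rel A M n ≤ Q) (hF : supp (Fl N lam n k) ≤ Q)
    {w : M} {l₁ l₂ : List M} (t : A)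
    (h : v :: (l₁ ++ w :: l₂) ∈ Sp A M n) (hl₁ : ∀ x ∈ l₁, N (lam x) < k)
    (hl₂ : ∀ x ∈ l₂, N (lam x) < k) (hw : N (lam w) < k) (hw' : N (lam (w + t • v)) < k) :
    single (v :: (l₁ ++ w :: l₂)) 1 - single (v :: (l₁ ++ (w + t • v) :: l₂)) 1 ∈ Q := by
  have h1 := Rel.mv₂ h
  have h2 := Rel.mv₂ (Sp_shift (t := t) h)
  have h3 := change_second hN hv hR hF t (Sp_perm h (List.Perm.cons v List.perm_middle))
    (fun x hx => (List.mem_append.mp hx).elim (hl₁ x) (hl₂ x)) hw hw'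
  have := Q.add_mem (Q.sub_mem (hR h1) (hR h2)) (Q.smul_mem ((-1 : ℚ) ^ l₁.length) h3)
  convert this using 1
  rw [smul_sub]
  abel

lemma change_all
    (hN : Disc N) (hv : N (lam v) = k) (hR : Rel A M n ≤ Q) (hF : supp (Fl N lam n k) ≤ Q)
    {l l' : List M} (hll : List.Forall₂ (fun w w' => N (lam w) < k ∧
    N (lam w') < k ∧ ∃ t : A, w' = w + t • v) l l') : ∀ l₀ : List M,
    (∀ x ∈ l₀, N (lam x) < k) → v :: (l₀ ++ l) ∈ Sp A M n →
    single (v :: (l₀ ++ l)) 1 - single (v :: (l₀ ++ l')) 1 ∈ Q := by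
  induction hll with
  | nil => simp
  | @cons w w' l l' hw hll ih =>
    intro l₀ h₀ h
    obtain ⟨h1, h2, t, rfl⟩ := hw
    have hl : ∀ x ∈ l, N (lam x) < k := by
      clear ih h
      induction hll with
      | nil => simp
      | cons hw _ ih =>
        intro x hx
        rcases List.mem_cons.mp hx with rfl | hx
        · exact hw.1
        · exact ih x hx
    have e1 := change_one hN hv hR hF t h h₀ hl h1 h2
    have e2 := ih (l₀ ++ [w + t • v]) (fun x hx => by
      rcases List.mem_append.mp hx with hx | hx
      · exact h₀ x hx
      · rw [List.mem_singleton.mp hx]; exact h2) (by simpa using Sp_shift (t := t) h)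
    simp only [List.append_assoc, List.singleton_append] at e2
    have := Q.add_mem e1 e2
    rwa [sub_add_sub_cancel] at this

end Change

section Lift

variable {A : Type*} [CommRing A] [IsDomain A] {N : A → ℕ}
variable {M : Type*} [AddCommGroup M] [Module A M] {m k : ℕ} {lam : M →ₗ[A] A} {v : M}
variable {Q : Submodule ℚ (Ch M)}
variable {s : M ⧸ Submodule.span A {v} → M}

lemma exists_smul_of_mkQ {a b : M}
    (h : (Submodule.span A {v}).mkQ a = (Submodule.span A {v}).mkQ b) : ∃ t : A, b = a + t • v := by
  rw [← sub_eq_zero, ← map_sub, Submodule.mkQ_apply, Submodule.Quotient.mk_eq_zero,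
    Submodule.mem_span_singleton] at h
  obtain ⟨t, ht⟩ := h
  exact ⟨-t, by rw [neg_smul, ht]; abel⟩

lemma mkQ_add_smul (a : M) (t : A) :
    (Submodule.span A {v}).mkQ (a + t • v) = (Submodule.span A {v}).mkQ a := by
  rw [← sub_eq_zero, ← map_sub, Submodule.mkQ_apply, Submodule.Quotient.mk_eq_zero,
    add_sub_cancel_left]
  exact Submodule.smul_mem _ _ (Submodule.mem_span_singleton_self v)

lemma change_lift
    (hN : Disc N) (hv : N (lam v) = k) (hR : Rel A M (m + 1) ≤ Q)
    (hF : supp (Fl N lam (m + 1) k) ≤ Q) (hs : ∀ x, (Submodule.span A {v}).mkQ (s x) = x)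
    (hsk : ∀ x, N (lam (s x)) < k)
    {l : List M} (h : v :: l ∈ Sp A M (m + 1)) (hl : ∀ x ∈ l, N (lam x) < k) :
    single (v :: l) 1 -
      single (v :: (l.map (Submodule.span A {v}).mkQ).map s) 1 ∈ Q := by
  refine change_all hN hv hR hF (l := l) ?_ [] (by simp) h
  rw [List.map_map, List.forall₂_map_right_iff, List.forall₂_same]
  intro x hx
  exact ⟨hl x hx, hsk _, exists_smul_of_mkQ (hs _).symm⟩

lemma Sp_lift
    (hs : ∀ x, (Submodule.span A {v}).mkQ (s x) = x)
    {l : List (M ⧸ Submodule.span A {v})}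
    (h : l ∈ Sp A (M ⧸ Submodule.span A {v}) m) : v :: l.map s ∈ Sp A M (m + 1) := by
  rw [Sp_cons_iff, List.map_map]
  convert h
  exact List.map_id'' hs l

lemma lift_mem_of_Rel
    (hN : Disc N) (hv : N (lam v) = k) (hk : 0 < k) (hR : Rel A M (m + 1) ≤ Q)
    (hF : supp (Fl N lam (m + 1) k) ≤ Q) (hs : ∀ x, (Submodule.span A {v}).mkQ (s x) = x)
    (hsk : ∀ x, N (lam (s x)) < k)
    {z : Ch (M ⧸ Submodule.span A {v})}
    (hz : z ∈ Rel A (M ⧸ Submodule.span A {v}) m) : cone v (mp s z) ∈ Q := by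
  have hx0 : lam v ≠ 0 := fun h => by rw [h, (hN.zero 0).mpr rfl] at hv; omega
  suffices h : Rel A (M ⧸ Submodule.span A {v}) m ≤ Q.comap ((cone v).comp (mp s)) from h hz
  rw [Rel, Submodule.span_le]
  rintro _ ((⟨l₁, a, l₂, h, rfl⟩ | ⟨u, a, l, h, rfl⟩) | ⟨a, b, l, h, rfl⟩)
  · simp only [SetLike.mem_coe, Submodule.mem_comap, LinearMap.comp_apply, map_sub, map_smul,
      mp_single, cone_single, List.map_append, List.map_cons]
    have := Rel.mv₂ (l₁ := l₁.map s) (l₂ := l₂.map s) (w := s a) (v := v) (A := A) (n := m + 1)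
      (by simpa using Sp_lift hs h)
    rw [List.length_map] at this
    exact hR this
  · simp only [SetLike.mem_coe, Submodule.mem_comap, LinearMap.comp_apply, map_sub,
      mp_single, cone_single, List.map_cons]
    have h1 : v :: (u : A) • s a :: l.map s ∈ Sp A M (m + 1) :=
      Sp_swap (Sp_smul u (Sp_swap (by simpa using Sp_lift hs h)))
    have hlt : ∀ x ∈ (u : A) • s a :: l.map s, N (lam x) < k := by
      intro x hx
      rcases List.mem_cons.mp hx with rfl | hx
      · rw [map_smul, smul_eq_mul, hN.mul, hN.norm_unit, one_mul]; exact hsk _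
      · obtain ⟨y, -, rfl⟩ := List.mem_map.mp hx
        exact hsk y
    have h2 := change_lift hN hv hR hF hs hsk h1 hlt
    have e : ((u : A) • s a :: l.map s).map (Submodule.span A {v}).mkQ = (u : A) • a :: l := by
      rw [List.map_cons, map_smul, hs, List.map_map]
      congr 1
      exact List.map_id'' hs l
    rw [e, List.map_cons] at h2
    have h3 := Rel.un₂ (v := v) u (l := l.map s) (w := s a) (by simpa using Sp_lift hs h)
    have := Q.sub_mem (hR h3) h2
    convert this using 1
    abel
  · simp only [SetLike.mem_coe, Submodule.mem_comap, LinearMap.comp_apply, map_sub,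
      mp_single, cone_single, List.map_cons]
    obtain ⟨t, t', ha, hb, hab⟩ := hN.pair (lam (s a)) (lam (s b)) (lam v) hx0
    rw [hv] at ha hb hab
    obtain ⟨a', ha'⟩ : ∃ a', a' = s a + t • v := ⟨_, rfl⟩
    obtain ⟨b', hb'⟩ : ∃ b', b' = s b + t' • v := ⟨_, rfl⟩
    have ha1 : N (lam a') < k := by rw [ha']; simpa using ha
    have hb1 : N (lam b') < k := by rw [hb']; simpa using hb
    have hab1 : N (lam (a' + b')) < k := by rw [ha', hb', map_add]; simpa using hab
    have qa : (Submodule.span A {v}).mkQ a' = a := by rw [ha', mkQ_add_smul, hs]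
    have qb : (Submodule.span A {v}).mkQ b' = b := by rw [hb', mkQ_add_smul, hs]
    have el : (l.map s).map (Submodule.span A {v}).mkQ = l := by
      rw [List.map_map]
      exact List.map_id'' hs l
    have hsp : v :: a' :: b' :: l.map s ∈ Sp A M (m + 1) := by
      rw [Sp_cons_iff, List.map_cons, List.map_cons, qa, qb, el]
      exact h
    have hp : ∀ a b : M, (v :: a :: b :: l.map s).Perm (a :: b :: v :: l.map s) := fun a b =>
      (List.perm_middle (l₁ := [a, b])).symm
    have hsp0 := Sp_perm hsp (hp a' b')
    have key : ∀ x y : M, v :: x :: y :: l.map s ∈ Sp A M (m + 1) → N (lam x) < k →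
        N (lam y) < k → single (v :: x :: y :: l.map s) 1 -
          single (v :: s ((Submodule.span A {v}).mkQ x) :: s ((Submodule.span A {v}).mkQ y) ::
            l.map s) 1 ∈ Q := by
      intro x y h hx hy
      have := change_lift hN hv hR hF hs hsk h (by
        intro z hz
        simp only [List.mem_cons] at hz
        rcases hz with rfl | rfl | hz
        · exact hx
        · exact hy
        · obtain ⟨y, -, rfl⟩ := List.mem_map.mp hz
          exact hsk y)
      simpa only [List.map_cons, el] using this
    have k1 := key a' b' hsp ha1 hb1
    have k2 := key a' (a' + b') (Sp_perm (Sp_add_right hsp0) (hp _ _).symm) ha1 hab1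
    have k3 := key (a' + b') b' (Sp_perm (Sp_add_left hsp0) (hp _ _).symm) hab1 hb1
    rw [qa, qb] at k1
    rw [map_add, qa, qb] at k2
    rw [map_add, qa, qb] at k3
    have := Q.add_mem (Q.add_mem (Q.sub_mem (hR (Rel.th₂ hsp)) k1) k2) k3
    convert this using 1
    abel

end Lift

end Eis

namespace Eis

open Finsupp

section Reduction

variable {A : Type*} [CommRing A] [IsDomain A] {N : A → ℕ}
variable {M : Type*} [AddCommGroup M] [Module A M] {m k : ℕ} {lam : M →ₗ[A] A} {v : M}

lemma mem_line (hN : Disc N) {x : M} (hv : lam v ≠ 0) (hx : x ∈ Submodule.span A {v}) :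
    (N (lam x) < N (lam v) → x = 0) ∧
      (N (lam x) = N (lam v) → ∃ u : Aˣ, x = (u : A) • v) := by
  obtain ⟨c, rfl⟩ := Submodule.mem_span_singleton.mp hx
  have h0 : N (lam v) ≠ 0 := fun h => hv ((hN.zero _).mp h)
  rw [map_smul, smul_eq_mul, hN.mul]
  refine ⟨fun h => ?_, fun h => ?_⟩
  · have : N c = 0 := by
      by_contra hc
      exact absurd h (not_lt.mpr (Nat.le_mul_of_pos_left _ (Nat.pos_of_ne_zero hc)))
    rw [(hN.zero c).mp this, zero_smul]
  · obtain ⟨u, rfl⟩ := hN.unit c ((mul_eq_right₀ h0).mp h)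
    exact ⟨u, rfl⟩

lemma exists_small_section (hN : Disc N) (hv : lam v ≠ 0) :
    ∃ s : M ⧸ Submodule.span A {v} → M, (∀ x, (Submodule.span A {v}).mkQ (s x) = x) ∧
      ∀ x, N (lam (s x)) < N (lam v) := by
  have : ∀ x : M ⧸ Submodule.span A {v}, ∃ y, (Submodule.span A {v}).mkQ y = x ∧
      N (lam y) < N (lam v) := by
    intro x
    obtain ⟨y, rfl⟩ := Submodule.mkQ_surjective _ x
    obtain ⟨t, ht⟩ := hN.div (lam y) (lam v) hv
    exact ⟨y + t • v, mkQ_add_smul y t, by simpa using ht⟩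
  choose s hs using this
  exact ⟨s, fun x => (hs x).1, fun x => (hs x).2⟩

lemma res_Fl (hN : Disc N) (hv : lam v ≠ 0) {l : List M} (hl : ∀ x ∈ l, N (lam x) < N (lam v)) :
    ct (chi (Submodule.span A {v})) (single l 1) = 0 := by
  refine ct_eq_zero fun x hx => ?_
  by_cases h : x ∈ Submodule.span A {v}
  · simp [chi, (mem_line hN hv h).1 (hl x hx)]
  · simp [chi, h]

lemma res_Gl (hN : Disc N) (hv : lam v ≠ 0) {l : List M} {w : M} (hw : lam w ≠ 0)
    (hl : ∀ x ∈ l, N (lam x) < N (lam v)) :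
    ct (chi (Submodule.span A {v})) (single (w :: l) 1) =
      open Classical in if w ∈ Submodule.span A {v} then single l 1 else 0 := by
  have hw0 : w ≠ 0 := by rintro rfl; simp at hw
  rw [ct_single_cons, res_Fl hN hv hl, map_zero, sub_zero]
  simp only [chi]
  split_ifs <;> simp_all

/-- The part of a chain whose lists satisfy a condition. -/
noncomputable def part {α : Type*} (p : List α → Prop) : Ch α →ₗ[ℚ] Ch α :=
  open Classical in (Finsupp.filterAddHom p).toRatLinearMap

lemma part_pos {α : Type*} {p : List α → Prop} {l : List α} (h : p l) (c : ℚ) :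
    part p (single l c) = single l c := by
  classical
  exact Finsupp.filter_single_of_pos _ h

lemma part_neg {α : Type*} {p : List α → Prop} {l : List α} (h : ¬ p l) (c : ℚ) :
    part p (single l c) = 0 := by
  classical
  exact Finsupp.filter_single_of_neg _ h

lemma mem_of_part {α β : Type*} (φ : List α → β) {Q : Submodule ℚ (Ch α)} {z : Ch α}
    (h : ∀ l ∈ z.support, part (fun l' => φ l' = φ l) z ∈ Q) : z ∈ Q := by
  classical
  have hz : z = ∑ b ∈ z.support.image φ, part (fun l' => φ l' = b) z := by
    conv_lhs => rw [← Finsupp.sum_single z]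
    rw [Finsupp.sum, ← Finset.sum_fiberwise_of_maps_to (g := φ) (t := z.support.image φ)
      (fun l hl => Finset.mem_image_of_mem φ hl)]
    refine Finset.sum_congr rfl fun b _ => ?_
    conv_rhs => rw [← Finsupp.sum_single z, Finsupp.sum, map_sum]
    rw [Finset.sum_filter]
    refine Finset.sum_congr rfl fun l _ => ?_
    split_ifs with h
    · rw [part_pos h]
    · rw [part_neg h]
  rw [hz]
  refine Submodule.sum_mem _ fun b hb => ?_
  obtain ⟨l, hl, rfl⟩ := Finset.mem_image.mp hb
  exact h l hl

lemma Gl_mem (hN : Disc N) (hs : Small A M (m + 1)) (hk : 0 < k)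
    (ih : ∀ (v : M) (b : Ch (M ⧸ Submodule.span A {v})), b ∈ supp (Sp A _ m) → b ∈ DD A _ m →
      b ∈ Rel A _ m) {f g : Ch M} (hf : f ∈ supp (Fl N lam (m + 1) k))
    (hg : g ∈ supp (Gl N lam (m + 1) k)) (hfg : f + g ∈ DD A M (m + 1)) :
    g ∈ Rel A M (m + 1) ⊔ supp (Fl N lam (m + 1) k) := by
  set Q := Rel A M (m + 1) ⊔ supp (Fl N lam (m + 1) k) with hQd
  have hR : Rel A M (m + 1) ≤ Q := le_sup_left
  have hF : supp (Fl N lam (m + 1) k) ≤ Q := le_sup_right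
  refine mem_of_part (fun l => Submodule.span A {l.headD 0}) fun l hl => ?_
  obtain ⟨-, v, l, rfl, hv, -⟩ := (Finsupp.mem_supported ℚ g).mp hg hl
  have hv0 : lam v ≠ 0 := fun h => by rw [h, (hN.zero 0).mpr rfl] at hv; omega
  obtain ⟨s, hsq, hsk⟩ := exists_small_section hN hv0
  rw [hv] at hsk
  simp only [List.headD_cons]
  have hrf : res (Submodule.span A {v}) f = 0 := by
    refine (Submodule.mem_bot ℚ).mp (map_supp (K := Fl N lam (m + 1) k) _ (fun l hl => ?_) hf)
    rw [Submodule.mem_bot, res, LinearMap.comp_apply, res_Fl hN hv0 (hv ▸ hl.2), map_zero]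
  have hG : ∀ l ∈ Gl N lam (m + 1) k,
      (∃ (u : Aˣ) (l' : List M), l = (u : A) • v :: l' ∧ v :: l' ∈ Sp A M (m + 1) ∧
        (∀ x ∈ l', N (lam x) < k) ∧
        res (Submodule.span A {v}) (single l 1) =
          single (l'.map (Submodule.span A {v}).mkQ) 1) ∨
      (res (Submodule.span A {v}) (single l 1) = 0 ∧
        Submodule.span A {l.headD 0} ≠ Submodule.span A {v}) := by
    rintro _ ⟨hsp, w, l, rfl, hw, hl⟩
    have hw0 : lam w ≠ 0 := fun h => by rw [h, (hN.zero 0).mpr rfl] at hw; omega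
    have e := res_Gl hN hv0 hw0 (hv ▸ hl)
    rw [res, LinearMap.comp_apply, e]
    by_cases h : w ∈ Submodule.span A {v}
    · left
      obtain ⟨u, rfl⟩ := (mem_line hN hv0 h).2 (hw.trans hv.symm)
      refine ⟨u, l, rfl, ?_, hl, by rw [if_pos h, mp_single]⟩
      have := Sp_smul u⁻¹ hsp
      rwa [smul_smul, Units.inv_mul, one_smul] at this
    · right
      refine ⟨by rw [if_neg h, map_zero], fun h' => h ?_⟩
      rw [← h']
      exact Submodule.mem_span_singleton_self w
  have hrg : res (Submodule.span A {v}) g ∈ supp (Sp A (M ⧸ Submodule.span A {v}) m) := by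
    refine map_supp _ (fun l hl => ?_) hg
    rcases hG l hl with ⟨u, l', rfl, h1, h2, h3⟩ | ⟨h, -⟩
    · rw [h3]
      exact single_mem_supp (Sp_cons_iff.mp h1) 1
    · rw [h]; exact Submodule.zero_mem _
  have h1 : res (Submodule.span A {v}) g ∈ Rel A (M ⧸ Submodule.span A {v}) m := by
    refine ih v _ hrg ?_
    have := res_mem_DD hs v hfg
    rwa [map_add, hrf, zero_add] at this
  have h2 := lift_mem_of_Rel hN hv hk hR hF hsq hsk h1
  have h3 : (part (fun l' => Submodule.span A {l'.headD 0} = Submodule.span A {v}) -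
      (cone v).comp ((mp s).comp (res (Submodule.span A {v})))) g ∈ Q := by
    refine map_supp _ (fun l hl => ?_) hg
    rw [LinearMap.sub_apply, LinearMap.comp_apply, LinearMap.comp_apply]
    rcases hG l hl with ⟨u, l', rfl, h1, h2, h3⟩ | ⟨h, h'⟩
    · rw [h3, part_pos, mp_single, cone_single]
      · have e1 := change_lift hN hv hR hF hsq hsk h1 h2
        have e2 := hR (Rel.un u h1)
        have := Q.add_mem e2 e1
        rwa [sub_add_sub_cancel] at this
      · rw [List.headD_cons]
        exact Submodule.span_singleton_smul_eq u.isUnit v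
    · rw [part_neg h', h, map_zero, map_zero, sub_zero]
      exact Q.zero_mem
  have := Q.add_mem h3 h2
  simpa using this

end Reduction

universe u

/-- Bykovskii's presentation: chains of spanning lists that bound modulo degenerate lists are
combinations of the basic relations. -/
theorem mem_Rel {A : Type*} [CommRing A] [IsDomain A] {N : A → ℕ} (hN : Disc N) (n : ℕ) :
    ∀ (M : Type u) [AddCommGroup M] [Module A M], Small A M n → ∀ b : Ch M,
      b ∈ supp (Sp A M n) → b ∈ DD A M n → b ∈ Rel A M n := by
  induction n with
  | zero =>
    intro M _ _ hs b hb hd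
    by_cases hb0 : b = 0
    · rw [hb0]; exact Submodule.zero_mem _
    obtain ⟨l, hl⟩ := Finsupp.support_nonempty_iff.mpr hb0
    have hl : l ∈ Sp A M 0 := (Finsupp.mem_supported ℚ b).mp hb hl
    obtain rfl := List.length_eq_zero_iff.mp hl.1
    have h0 : ∀ x : M, x = 0 := fun x => by
      have : x ∈ sp A ([] : List M) := by rw [hl.2]; trivial
      simpa [sp] using this
    obtain ⟨x, hx, _, ⟨y, hy, rfl⟩, h⟩ := Submodule.mem_sup.mp hd
    have e1 : x = 0 := (Submodule.mem_bot ℚ).mp (map_supp (K := Dp A M 0) LinearMap.id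
      (fun l ⟨_, μ, hμ, _⟩ => (hμ (by ext x; rw [h0 x, map_zero, map_zero])).elim) hx)
    have e2 : y = 0 := (Submodule.mem_bot ℚ).mp (map_supp (K := Nz M 1) LinearMap.id
      (fun l ⟨h1, h2⟩ => by
        obtain ⟨a, rfl⟩ := List.length_eq_one_iff.mp h1
        exact (h2 a (by simp) (h0 a)).elim) hy)
    exact absurd (by rw [← h, e1, e2, map_zero, add_zero]) hb0
  | succ m ih =>
    intro M _ _ hs b hb hd
    obtain ⟨lam, hlam, -⟩ := hs [] (by simp)
    have key : ∀ k, ∀ b ∈ supp (Fl N lam (m + 1) k), b ∈ DD A M (m + 1) → b ∈ Rel A M (m + 1) := by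
      intro k
      induction k with
      | zero =>
        intro b hb _
        suffices h : b = 0 by rw [h]; exact Submodule.zero_mem _
        refine (Submodule.mem_bot ℚ).mp (map_supp (K := Fl N lam (m + 1) 0) LinearMap.id
          (fun l hl => ?_) hb)
        exfalso
        have h1 := hl.1.1
        cases l with
        | nil => simp at h1
        | cons a l => exact absurd (hl.2 a (by simp)) (by omega)
      | succ k ihk =>
        intro b hb hd
        rcases Nat.eq_zero_or_pos k with rfl | hk
        · suffices h : b = 0 by rw [h]; exact Submodule.zero_mem _
          refine (Submodule.mem_bot ℚ).mp (map_supp (K := Fl N lam (m + 1) (0 + 1)) LinearMap.id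
            (fun l hl => ?_) hb)
          exact absurd (eq_zero_of_Sp hl.1 fun x hx =>
            (hN.zero _).mp (by have := hl.2 x hx; omega)) hlam
        have h1 : b ∈ Rel A M (m + 1) ⊔ supp (Fl N lam (m + 1) k) ⊔ supp (Gl N lam (m + 1) k) := by
          refine map_supp (K := Fl N lam (m + 1) (k + 1)) LinearMap.id (fun l hl => ?_) hb
          exact reduce_top hN lam hk _ l hl.1 (fun x hx => Nat.le_of_lt_succ (hl.2 x hx)) rfl
        obtain ⟨x, hx, g, hg, rfl⟩ := Submodule.mem_sup.mp h1
        obtain ⟨r, hr, f, hf, rfl⟩ := Submodule.mem_sup.mp hx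
        have hfg : f + g ∈ DD A M (m + 1) := by
          have := Submodule.sub_mem _ hd (Rel_le_DD hs hr)
          rwa [add_assoc, add_sub_cancel_left] at this
        have hgQ := Gl_mem hN hs hk (fun v => ih _ (hs.quot v)) hf hg hfg
        obtain ⟨r', hr', f', hf', rfl⟩ := Submodule.mem_sup.mp hgQ
        have hff : f + f' ∈ Rel A M (m + 1) := by
          refine ihk _ (Submodule.add_mem _ hf hf') ?_
          have := Submodule.sub_mem _ hfg (Rel_le_DD hs hr')
          convert this using 1
          abel
        have := Submodule.add_mem _ (Submodule.add_mem _ hr hr') hff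
        convert this using 1
        abel
    classical
    refine key ((b.support.sup fun l => (l.map fun x => N (lam x)).sum) + 1) b ?_ hd
    rw [Finsupp.mem_supported] at hb ⊢
    intro l hl
    refine ⟨hb hl, fun x hx => Nat.lt_succ_of_le ?_⟩
    exact (List.single_le_sum (by simp) _ (List.mem_map_of_mem hx)).trans
      (Finset.le_sup (f := fun l : List M => (l.map fun x => N (lam x)).sum) hl)

end Eis

namespace Eis

open Finsupp Matrix

section AshRudolph

variable {A : Type*} [CommRing A] [IsDomain A] {n : ℕ}

lemma Dp_of_det {x : Fin n → Fin n → A} (h : (of x).det = 0) :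
    List.ofFn x ∈ Dp A (Fin n → A) n := by
  obtain ⟨v, hv, h⟩ := Matrix.exists_mulVec_eq_zero_iff.mpr h
  refine ⟨List.length_ofFn, (dotProductBilin A A).flip v, fun h0 => hv ?_, fun y hy => ?_⟩
  · ext i
    have := LinearMap.congr_fun h0 (Pi.single i 1)
    simpa using this
  · obtain ⟨i, rfl⟩ := (List.mem_ofFn' _ _).mp hy
    exact congrFun h i

lemma Sp_of_det {x : Fin n → Fin n → A} (h : IsUnit (of x).det) :
    List.ofFn x ∈ Sp A (Fin n → A) n := by
  refine ⟨List.length_ofFn, top_le_iff.mp fun z _ => ?_⟩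
  have h1 : (z ᵥ* (of x)⁻¹) ᵥ* of x = z := by
    rw [Matrix.vecMul_vecMul, Matrix.nonsing_inv_mul _ h, Matrix.vecMul_one]
  rw [← h1, Matrix.vecMul_eq_sum]
  refine Submodule.sum_mem _ fun i _ => Submodule.smul_mem _ _ (mem_sp ?_)
  exact (List.mem_ofFn' _ _).mpr ⟨i, rfl⟩

lemma isUnit_det_of_Sp {x : Fin n → Fin n → A} (h : ∀ z, ∃ c, c ᵥ* of x = z) :
    IsUnit (of x).det := by
  choose c hc using fun i : Fin n => h (Pi.single i 1)
  rw [← Matrix.isUnit_iff_isUnit_det]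
  refine .of_mul_eq_one_right (of c) ?_
  ext i j
  have := congrFun (hc i) j
  rw [Pi.single_apply] at this
  rw [Matrix.one_apply, Matrix.mul_apply]
  simpa [Matrix.vecMul, dotProduct, eq_comm] using this

lemma small_pi : Small A (Fin n → A) n := by
  intro l hl
  let x : Fin n → Fin n → A := fun i => l.getD i 0
  have hX : (of x).det = 0 := Matrix.det_eq_zero_of_row_eq_zero ⟨l.length, hl⟩ (by simp [x])
  obtain ⟨-, μ, hμ, h⟩ := Dp_of_det hX
  refine ⟨μ, hμ, fun y hy => h y ?_⟩
  obtain ⟨i, hi, rfl⟩ := List.mem_iff_getElem.mp hy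
  refine (List.mem_ofFn' _ _).mpr ⟨⟨i, hi.trans hl⟩, by simp [x, hi]⟩

lemma exists_update {N : A → ℕ} (hN : Disc N) {X : Matrix (Fin n) (Fin n) A} (h0 : X.det ≠ 0)
    (hz : ∃ z, ∀ c, c ᵥ* X ≠ z) :
    ∃ w : Fin n → A, w ≠ 0 ∧ ∀ i, N (X.updateRow i w).det < N X.det := by
  obtain ⟨z, hz⟩ := hz
  choose s hs using fun i => hN.div (Xᵀ.cramer z i) X.det h0
  refine ⟨z + s ᵥ* X, fun h => hz (-s) ?_, fun i => ?_⟩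
  · rw [Matrix.neg_vecMul]; exact (eq_neg_of_add_eq_zero_left h).symm
  · rw [← Matrix.cramer_transpose_apply, map_add, Matrix.vecMul_eq_sum, map_sum]
    simp only [map_smul, Matrix.cramer_transpose_row_self]
    simpa [Pi.single_apply] using hs i

/-- Every list of `n` nonzero vectors is homologous to a combination of bases, up to dependent
lists. -/
theorem mem_bases {N : A → ℕ} (hN : Disc N) {l : List (Fin n → A)} (hl : l ∈ Nz (Fin n → A) n) :
    single l 1 ∈ supp (Sp A (Fin n → A) n) ⊔ (supp (Nz (Fin n → A) (n + 1))).map bd ⊔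
      supp (Dp A (Fin n → A) n ∩ Nz (Fin n → A) n) := by
  set Q := supp (Sp A (Fin n → A) n) ⊔ (supp (Nz (Fin n → A) (n + 1))).map bd ⊔
      supp (Dp A (Fin n → A) n ∩ Nz (Fin n → A) n) with hQ
  have key : ∀ (k : ℕ) (x : Fin n → Fin n → A), (∀ i, x i ≠ 0) → N (of x).det = k →
      single (List.ofFn x) 1 ∈ Q := by
    intro k
    induction k using Nat.strong_induction_on with
    | _ k ih =>
    intro x hX hk
    by_cases h0 : (of x).det = 0
    · refine (le_sup_right : _ ≤ Q) (single_mem_supp ?_ 1)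
      refine ⟨Dp_of_det h0, List.length_ofFn, fun x hx => ?_⟩
      obtain ⟨i, rfl⟩ := (List.mem_ofFn' _ _).mp hx
      exact hX i
    by_cases hu : IsUnit (of x).det
    · exact (le_sup_left.trans le_sup_left : _ ≤ Q) (single_mem_supp (Sp_of_det hu) 1)
    obtain ⟨w, hw, h⟩ := exists_update hN h0 (by
      by_contra! h
      exact hu (isUnit_det_of_Sp h))
    cases n with
    | zero => exact absurd (by rw [Matrix.det_fin_zero]; exact isUnit_one) hu
    | succ m =>
    have h1 : bd (single (w :: List.ofFn x) 1) ∈ Q := by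
      refine (le_sup_right.trans le_sup_left : _ ≤ Q) (Submodule.mem_map_of_mem
        (single_mem_supp ?_ 1))
      refine ⟨by rw [List.length_cons, List.length_ofFn], fun y hy => ?_⟩
      rcases List.mem_cons.mp hy with rfl | hy
      · exact hw
      · obtain ⟨i, rfl⟩ := (List.mem_ofFn' _ _).mp hy
        exact hX i
    rw [ct_single_cons, one_smul] at h1
    have h2 : cone w (bd (single (List.ofFn x) 1)) ∈ Q := by
      rw [bd, ct_ofFn, map_sum]
      refine Submodule.sum_mem _ fun i _ => ?_
      rw [map_smul, cone_single]
      refine Q.smul_mem _ ?_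
      have e0 : Fin.cons w (x ∘ i.succAbove) = Function.update x i w ∘ i.cycleRange.symm := by
        rw [← Fin.cons_removeNth_eq_comp_cycleRange_symm]
        rw [Fin.removeNth_update, Function.update_self]
        rfl
      have e : w :: List.ofFn (x ∘ i.succAbove) =
          List.ofFn (Function.update x i w ∘ i.cycleRange.symm) := by
        rw [← e0, List.ofFn_cons]
      rw [e]
      refine ih _ (hk ▸ h i) _ (fun j => ?_) ?_
      · rw [Function.comp_apply, Function.update_apply]
        split_ifs
        · exact hw
        · exact hX _
      · have := Matrix.det_permute i.cycleRange.symm ((of x).updateRow i w)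
        have e2 : of (Function.update x i w ∘ i.cycleRange.symm) =
          ((of x).updateRow i w).submatrix i.cycleRange.symm id := rfl
        rw [e2, this, hN.mul]
        have := hN.norm_unit (Units.map (Int.castRingHom A).toMonoidHom
          (Equiv.Perm.sign i.cycleRange.symm))
        rw [show N ((Equiv.Perm.sign i.cycleRange.symm : ℤˣ) : ℤ) = 1 from this, one_mul]
    have := Q.add_mem h1 h2
    rwa [sub_add_cancel] at this
  obtain ⟨x, hx⟩ := exists_ofFn l
  obtain ⟨h1, h2⟩ := hl
  revert x
  rw [h1]
  rintro x rfl
  exact key _ x (fun i => h2 _ ((List.mem_ofFn' _ _).mpr ⟨i, rfl⟩)) rfl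

end AshRudolph

end Eis

namespace Eis

open Finsupp Module

section Rank

lemma part_mem {α : Type*} {p : List α → Prop} {K : Set (List α)} {z : Ch α} (hz : z ∈ supp K) :
    part p z ∈ supp (K ∩ {l | p l}) := by
  refine map_supp _ (fun l hl => ?_) hz
  by_cases h : p l
  · rw [part_pos h]; exact single_mem_supp (by exact ⟨hl, h⟩) 1
  · rw [part_neg h]; exact Submodule.zero_mem _

lemma sub_part_mem {α : Type*} {p : List α → Prop} {K : Set (List α)} {z : Ch α}
    (hz : z ∈ supp K) : z - part p z ∈ supp (K ∩ {l | ¬ p l}) := by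
  have : ((LinearMap.id : Ch α →ₗ[ℚ] Ch α) - part p) z ∈ supp (K ∩ {l | ¬ p l}) := by
    refine map_supp _ (fun l hl => ?_) hz
    rw [LinearMap.sub_apply, LinearMap.id_apply]
    by_cases h : p l
    · rw [part_pos h, sub_self]; exact Submodule.zero_mem _
    · rw [part_neg h, sub_zero]; exact single_mem_supp (by exact ⟨hl, h⟩) 1
  exact this

variable {K V α : Type*} [Field K] [AddCommGroup V] [Module K V] [FiniteDimensional K V]

/-- Lists of length `k` of vectors in `U` of rank at most `m`. -/
def Rk (φ : α → V) (U : Submodule K V) (m k : ℕ) : Set (List α) :=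
  {l | l.length = k ∧ sp K (l.map φ) ≤ U ∧ finrank K (sp K (l.map φ)) ≤ m}

lemma sp_mono {M : Type*} [AddCommGroup M] [Module K M] {l l' : List M} (h : l ⊆ l') :
    sp K l ≤ sp K l' := Submodule.span_mono fun _ hx => h hx

variable {φ : α → V}

lemma Rk_sublist {U : Submodule K V} {m k : ℕ} {l l' : List α} (hl : l ∈ Rk φ U m (k + 1))
    (h : l'.Sublist l ∧ l'.length + 1 = l.length) : l' ∈ Rk φ U m k := by
  have h1 : sp K (l'.map φ) ≤ sp K (l.map φ) := sp_mono (h.1.map φ).subset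
  exact ⟨by have := hl.1; omega, h1.trans hl.2.1, (Submodule.finrank_mono h1).trans hl.2.2⟩

lemma bd_mem_Rk {U : Submodule K V} {m k : ℕ} {z : Ch α} (hz : z ∈ supp (Rk φ U m (k + 1))) :
    bd z ∈ supp (Rk φ U m k) :=
  map_supp _ (fun l hl => Finsupp.supported_mono (fun _ h => Rk_sublist hl h)
    (ct_single_mem _ l)) hz

/-- Cycles of rank at most `m` and length more than `m` bound within rank at most `m`. -/
theorem exists_bd_of_rank (hφ : ∀ a, φ a ≠ 0) (m : ℕ) : ∀ (U : Submodule K V) (k : ℕ), m ≤ k →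
    ∀ z ∈ supp (Rk φ U m (k + 1)), bd z = 0 → ∃ e ∈ supp (Rk φ U m (k + 1 + 1)), bd e = z := by
  induction m with
  | zero =>
    intro U k _ z hz _
    refine ⟨0, Submodule.zero_mem _, ?_⟩
    rw [map_zero, eq_comm]
    refine (Submodule.mem_bot ℚ).mp (map_supp (K := Rk φ U 0 (k + 1)) LinearMap.id
      (fun l hl => ?_) hz)
    exfalso
    obtain ⟨h1, -, h2⟩ := hl
    cases l with
    | nil => simp at h1
    | cons a l =>
      rw [Nat.le_zero, Submodule.finrank_eq_zero] at h2
      refine hφ a ((Submodule.mem_bot K).mp ?_)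
      rw [← h2]
      exact mem_sp (by simp)
  | succ m ih =>
    intro U k hk z hz hb
    have hQ : z ∈ supp (Rk φ U m (k + 1)) ⊔ (supp (Rk φ U (m + 1) (k + 1 + 1))).map bd := by
      refine mem_of_part (fun l => sp K (l.map φ)) fun l₀ hl₀ => ?_
      replace hl₀ := (Finsupp.mem_supported ℚ z).mp hz hl₀
      obtain ⟨W, hW⟩ : ∃ W, W = sp K (l₀.map φ) := ⟨_, rfl⟩
      rw [← hW]
      obtain ⟨hlen, hWU, hWr⟩ := hl₀
      rw [← hW] at hWU hWr
      have hp := part_mem (p := fun l' => sp K (l'.map φ) = W) hz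
      by_cases hr : finrank K W ≤ m
      · refine (le_sup_left : _ ≤ supp (Rk φ U m (k + 1)) ⊔ _) (Finsupp.supported_mono ?_ hp)
        rintro l ⟨hl, rfl : _ = W⟩
        exact ⟨hl.1, hWU, hr⟩
      obtain ⟨zW, hzW⟩ : ∃ zW, zW = part (fun l' => sp K (l'.map φ) = W) z := ⟨_, rfl⟩
      rw [← hzW] at hp ⊢
      have hzW1 : zW ∈ supp (Rk φ W (m + 1) (k + 1)) := by
        refine Finsupp.supported_mono ?_ hp
        rintro l ⟨hl, rfl : _ = W⟩
        exact ⟨hl.1, le_rfl, hl.2.2⟩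
      have h0 : part (fun l' => sp K (l'.map φ) = W) (bd zW) = 0 := by
        have : part (fun l' => sp K (l'.map φ) = W) (bd (z - zW)) = 0 := by
          refine (Submodule.mem_bot ℚ).mp (map_supp ((part fun l' => sp K (l'.map φ) = W).comp bd)
            (fun l hl => ?_) (hzW ▸ sub_part_mem hz))
          rw [LinearMap.comp_apply, Submodule.mem_bot]
          refine (Submodule.mem_bot ℚ).mp (map_supp _ (fun l' hl' => ?_) (ct_single_mem _ l))
          rw [part_neg, Submodule.mem_bot]
          intro h
          have h1 : W ≤ sp K (l.map φ) := h ▸ sp_mono (hl'.1.map φ).subset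
          exact hl.2 (Submodule.eq_of_le_of_finrank_le h1 (by have := hl.1.2.2; omega)).symm
        rw [map_sub bd, hb, zero_sub, map_neg, neg_eq_zero] at this
        exact this
      obtain ⟨k, rfl⟩ : ∃ j, k = j + 1 := ⟨k - 1, by omega⟩
      have h1 : bd zW ∈ supp (Rk φ W m (k + 1)) := by
        have := sub_part_mem (p := fun l' => sp K (l'.map φ) = W) (bd_mem_Rk hzW1)
        rw [h0, sub_zero] at this
        refine Finsupp.supported_mono ?_ this
        rintro l ⟨hl, hne⟩
        refine ⟨hl.1, hl.2.1, ?_⟩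
        have := Submodule.finrank_lt_finrank_of_lt (lt_of_le_of_ne hl.2.1 hne)
        omega
      obtain ⟨y, hy, hyb⟩ := ih W k (by omega) _ h1 (by rw [bd_bd])
      have hyU : y ∈ supp (Rk φ U m (k + 1 + 1)) :=
        Finsupp.supported_mono (fun l hl => by exact ⟨hl.1, hl.2.1.trans hWU, hl.2.2⟩) hy
      cases l₀ with
      | nil => simp at hlen
      | cons a l₀ =>
      have ha : φ a ∈ W := by rw [hW]; exact mem_sp (by simp)
      have hc : cone a (zW - y) ∈ supp (Rk φ U (m + 1) (k + 1 + 1 + 1)) := by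
        refine cone_mem a (K := Rk φ W (m + 1) (k + 1 + 1)) (fun l hl => ?_)
          (Submodule.sub_mem _ hzW1 (Finsupp.supported_mono
            (fun l hl => by exact ⟨hl.1, hl.2.1, hl.2.2.trans (Nat.le_succ m)⟩) hy))
        have h : sp K ((a :: l).map φ) ≤ W := by
          refine Submodule.span_le.mpr fun x hx => ?_
          rcases List.mem_cons.mp hx with rfl | hx
          · exact ha
          · exact hl.2.1 (mem_sp hx)
        exact ⟨by have := hl.1; simp; omega, h.trans hWU, (Submodule.finrank_mono h).trans hWr⟩
      have e : zW = y + bd (cone a (zW - y)) := by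
        rw [bd_cone, map_sub bd, hyb, sub_self, map_zero, sub_zero]
        abel
      rw [e]
      exact Submodule.add_mem_sup hyU (Submodule.mem_map_of_mem hc)
    obtain ⟨x, hx, _, ⟨y, hy, rfl⟩, rfl⟩ := Submodule.mem_sup.mp hQ
    rw [map_add, bd_bd, add_zero] at hb
    obtain ⟨e, he, rfl⟩ := ih U k (by omega) x hx hb
    exact ⟨e + y, Submodule.add_mem _ (Finsupp.supported_mono
      (fun l hl => by exact ⟨hl.1, hl.2.1, hl.2.2.trans (Nat.le_succ m)⟩) he) hy, map_add _ _ _⟩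

end Rank

end Eis

namespace Eis

open Finsupp Matrix

section Vectors

variable (A : Type*) [CommRing A] (n : ℕ)

/-- Nonzero column vectors. -/
abbrev Vc : Type _ := {v : Fin n → A // v ≠ 0}

instance : MulAction (SpecialLinearGroup (Fin n) A) (Vc A n) where
  smul γ v := ⟨γ.1 *ᵥ v.1, fun h => v.2 (by
    have := congrArg ((γ⁻¹).1 *ᵥ ·) h
    simp only [Matrix.mulVec_mulVec, Matrix.mulVec_zero] at this
    rwa [← Matrix.SpecialLinearGroup.coe_mul, inv_mul_cancel, Matrix.SpecialLinearGroup.coe_one,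
      Matrix.one_mulVec] at this)⟩
  one_smul v := Subtype.ext (by
    show (1 : SpecialLinearGroup (Fin n) A).1 *ᵥ v.1 = v.1
    rw [Matrix.SpecialLinearGroup.coe_one, Matrix.one_mulVec])
  mul_smul γ δ v := Subtype.ext (by
    show (γ * δ).1 *ᵥ v.1 = γ.1 *ᵥ (δ.1 *ᵥ v.1)
    rw [Matrix.SpecialLinearGroup.coe_mul, Matrix.mulVec_mulVec])

/-- Equality of vectors up to units. -/
def uRel : Setoid (Vc A n) where
  r v w := ∃ u : Aˣ, w.1 = (u : A) • v.1
  iseqv := ⟨fun v => ⟨1, by simp⟩, fun {v w} ⟨u, h⟩ => ⟨u⁻¹, by simp [h, smul_smul]⟩,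
    fun {v w z} ⟨u, h⟩ ⟨u', h'⟩ => ⟨u' * u, by simp [h, h', smul_smul]⟩⟩

/-- Lists of vectors not annihilated by a nonzero functional. -/
def Fu : Set (List (Vc A n)) :=
  {x | ∀ μ : (Fin n → A) →ₗ[A] A, (∀ a ∈ x, μ a.1 = 0) → μ = 0}

variable {A n}

@[simp] lemma coe_smul_vec (γ : SpecialLinearGroup (Fin n) A) (v : Vc A n) :
    (γ • v).1 = γ.1 *ᵥ v.1 := rfl

lemma map_val_smul (γ : SpecialLinearGroup (Fin n) A) (x : List (Vc A n)) :
    (x.map (γ • ·)).map Subtype.val = (x.map Subtype.val).map (γ.1 *ᵥ ·) := by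
  simp [List.map_map, Function.comp_def]

lemma Fu_smul (γ : SpecialLinearGroup (Fin n) A) {x : List (Vc A n)} (hx : x ∈ Fu A n) :
    x.map (γ • ·) ∈ Fu A n := by
  intro μ hμ
  have h := hx (μ.comp γ.1.mulVecLin) (fun a ha => hμ _ (List.mem_map_of_mem ha))
  ext i
  have h1 : μ (γ.1 *ᵥ ((γ⁻¹).1 *ᵥ Pi.single i 1)) = 0 := LinearMap.congr_fun h _
  rw [Matrix.mulVec_mulVec, ← Matrix.SpecialLinearGroup.coe_mul, mul_inv_cancel,
    Matrix.SpecialLinearGroup.coe_one, Matrix.one_mulVec] at h1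
  simpa using h1

lemma Fu_sub : SubClosed (Fu A n)ᶜ := by
  intro l hl l' hs hl'
  exact hl fun μ hμ => hl' μ fun a ha => hμ a (hs.subset ha)

lemma exists_smul_of_det {x y : Fin n → Fin n → A} (hx : IsUnit (of x).det)
    (hxy : (of y).det = (of x).det) :
    ∃ γ : SpecialLinearGroup (Fin n) A, ∀ i, γ.1 *ᵥ x i = y i := by
  refine ⟨⟨((of x)⁻¹ * of y)ᵀ, ?_⟩, fun i => ?_⟩
  · rw [Matrix.det_transpose, Matrix.det_mul, hxy, ← Matrix.det_mul,
      Matrix.nonsing_inv_mul _ hx, Matrix.det_one]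
  · show ((of x)⁻¹ * of y)ᵀ *ᵥ x i = y i
    have h1 : x i = Pi.single i 1 ᵥ* of x := by rw [Matrix.single_one_vecMul]; rfl
    rw [Matrix.mulVec_transpose, h1, Matrix.vecMul_vecMul, ← Matrix.mul_assoc,
      Matrix.mul_nonsing_inv _ hx, Matrix.one_mul, Matrix.single_one_vecMul]
    rfl

/-- The matrix exchanging two basis vectors and negating a third one. -/
lemma exists_exchange {k : ℕ} {x : Fin (k + 3) → Fin (k + 3) → A} (hx : IsUnit (of x).det) :
    ∃ γ : SpecialLinearGroup (Fin (k + 3)) A,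
      γ.1 *ᵥ x 0 = x (Fin.succ 0) ∧ γ.1 *ᵥ x (Fin.succ 0) = x 0 ∧
      γ.1 *ᵥ x (Fin.succ (Fin.succ 0)) = - x (Fin.succ (Fin.succ 0)) ∧
      ∀ i : Fin k, γ.1 *ᵥ x i.succ.succ.succ = x i.succ.succ.succ := by
  obtain ⟨p, hp⟩ : ∃ p : Fin (k + 3), p = Fin.succ 0 := ⟨_, rfl⟩
  obtain ⟨q, hq⟩ : ∃ q : Fin (k + 3), q = Fin.succ (Fin.succ 0) := ⟨_, rfl⟩
  rw [← hp, ← hq]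
  have h01 : (0 : Fin (k + 3)) ≠ p := by rw [hp]; exact (Fin.succ_ne_zero _).symm
  have h02 : (0 : Fin (k + 3)) ≠ q := by rw [hq]; exact (Fin.succ_ne_zero _).symm
  have h12 : p ≠ q := by
    rw [hp, hq, Ne, Fin.succ_inj]; exact (Fin.succ_ne_zero _).symm
  let y : Fin (k + 3) → Fin (k + 3) → A :=
    Function.update (x ∘ Equiv.swap 0 p) q ((-1 : A) • x q)
  obtain ⟨γ, hγ⟩ := exists_smul_of_det (x := x) (y := y) hx (by
    have e1 : of y = ((of x).submatrix (Equiv.swap 0 p) id).updateRow q ((-1 : A) • x q) := rfl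
    have e2 : ((of x).submatrix (Equiv.swap 0 p) id).updateRow q (x q) =
        (of x).submatrix (Equiv.swap 0 p) id := by
      conv_rhs => rw [← Matrix.updateRow_eq_self ((of x).submatrix (Equiv.swap 0 p) id) q]
      congr 1
      funext j
      simp [Equiv.swap_apply_of_ne_of_ne h02.symm h12.symm]
    rw [e1, Matrix.det_updateRow_smul, e2, Matrix.det_permute, Equiv.Perm.sign_swap h01]
    simp)
  refine ⟨γ, ?_, ?_, ?_, fun i => ?_⟩
  · simpa [y, h02] using hγ 0
  · simpa [y, h12] using hγ p
  · simpa [y] using hγ q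
  · have e0 : (i.succ.succ.succ : Fin (k + 3)) ≠ 0 := Fin.succ_ne_zero _
    have e1 : (i.succ.succ.succ : Fin (k + 3)) ≠ p := by
      rw [hp, Ne, Fin.succ_inj]; exact Fin.succ_ne_zero _
    have e2 : (i.succ.succ.succ : Fin (k + 3)) ≠ q := by
      rw [hq, Ne, Fin.succ_inj, Fin.succ_inj]; exact Fin.succ_ne_zero _
    have := hγ i.succ.succ.succ
    simpa [y, e2, Equiv.swap_apply_of_ne_of_ne e0 e1] using this

end Vectors

section Alt

lemma IsAlt.eq_zero_of_dup {α : Type*} {f : List α → ℚ} (hf : IsAlt f) {a : α} {l : List α}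
    {l₁ l₂ : List α} (hl : l = a :: (l₁ ++ a :: l₂)) : f l = 0 := by
  obtain ⟨x, hx⟩ := exists_ofFn l
  have h0 : 0 < l.length := by simp [hl]
  have h1 : l₁.length + 1 < l.length := by simp [hl]
  have e0 : l[0] = a := by simp [hl]
  have e1 : l[l₁.length + 1] = a := by simp [hl]
  have hx0 : ∀ (i : ℕ) (hi : i < l.length), x ⟨i, hi⟩ = l[i] := by
    intro i hi
    have : (List.ofFn x)[i]'(by simpa using hi) = l[i] := by congr 1; exact hx.symm
    rw [← this, List.getElem_ofFn]
  have hne : (⟨0, h0⟩ : Fin l.length) ≠ ⟨l₁.length + 1, h1⟩ := by simp [Fin.ext_iff]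
  have h := hf _ x (Equiv.swap ⟨0, h0⟩ ⟨l₁.length + 1, h1⟩)
  have e : x ∘ Equiv.swap ⟨0, h0⟩ ⟨l₁.length + 1, h1⟩ = x := by
    funext j
    rw [Function.comp_apply, Equiv.swap_apply_def]
    split_ifs with c1 c2
    · rw [c1, hx0, hx0, e0, e1]
    · rw [c2, hx0, hx0, e0, e1]
    · rfl
  rw [e, Equiv.Perm.sign_swap hne, ← hx] at h
  simp at h
  linarith

lemma IsAlt.swap {α : Type*} {f : List α → ℚ} (hf : IsAlt f) (a b : α) (l : List α) :
    f (a :: b :: l) = - f (b :: a :: l) := by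
  have h := hf _ (Fin.cons b (Fin.cons a l.get)) (Equiv.swap 0 1)
  rw [Equiv.Perm.sign_swap (by simp)] at h
  have e : (Fin.cons b (Fin.cons a l.get) : Fin (l.length + 2) → α) ∘ Equiv.swap 0 1 =
      Fin.cons a (Fin.cons b l.get) := by
    funext j
    refine Fin.cases ?_ (fun j => Fin.cases ?_ (fun j => ?_) j) j
    · simp only [Function.comp_apply, Equiv.swap_apply_left, Fin.cons_zero]; rfl
    · rw [Function.comp_apply, Fin.succ_zero_eq_one, Equiv.swap_apply_right]; rfl
    · rw [Function.comp_apply, Equiv.swap_apply_of_ne_of_ne (Fin.succ_ne_zero _) (by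
        rw [← Fin.succ_zero_eq_one, Ne, Fin.succ_inj]; exact Fin.succ_ne_zero _)]
      rfl
  rw [e, List.ofFn_cons, List.ofFn_cons, List.ofFn_cons, List.ofFn_cons, List.ofFn_get] at h
  simpa using h

end Alt

section Modular

variable {A : Type*} [CommRing A] [IsDomain A] {n : ℕ}

/-- The symmetries shared by the orbit sums of the cochains under consideration. -/
structure Modu (h : List (Vc A n) → ℚ) : Prop where
  inv : ∀ (γ : SpecialLinearGroup (Fin n) A) x, h (x.map (γ • ·)) = h x
  alt : IsAlt h
  unit : ∀ l l', List.Forall₂ (uRel A n) l l' → h l = h l'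
  off : ∀ x ∉ Fu A n, h x = 0

lemma Modu.unit_at {h : List (Vc A n) → ℚ} (hh : Modu h) {a b : Vc A n} (u : Aˣ)
    (hab : b.1 = (u : A) • a.1) (l₁ l₂ : List (Vc A n)) :
    h (l₁ ++ b :: l₂) = h (l₁ ++ a :: l₂) := by
  have hr : ∀ l : List (Vc A n), List.Forall₂ (uRel A n) l l := fun l =>
    List.forall₂_same.mpr fun x _ => (uRel A n).refl x
  exact (hh.unit _ _ (List.rel_append (hr l₁) (List.Forall₂.cons ⟨u, hab⟩ (hr l₂)))).symm

lemma map_val_append_cons {l : List (Vc A n)} {l₁ l₂ : List (Fin n → A)} {a : Fin n → A}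
    (h : l.map Subtype.val = l₁ ++ a :: l₂) :
    ∃ l₁' a' l₂', l = l₁' ++ a' :: l₂' ∧ l₁'.map Subtype.val = l₁ ∧ a'.1 = a ∧
      l₂'.map Subtype.val = l₂ := by
  obtain ⟨k₁, k, rfl, h1, h2⟩ := List.map_eq_append_iff.mp h
  obtain ⟨a', k₂, rfl, h3, h4⟩ := List.map_eq_cons_iff.mp h2
  exact ⟨k₁, a', k₂, rfl, h1, h3, h4⟩

lemma map_val_cons {l : List (Vc A n)} {l₂ : List (Fin n → A)} {a : Fin n → A}
    (h : l.map Subtype.val = a :: l₂) :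
    ∃ a' l₂', l = a' :: l₂' ∧ a'.1 = a ∧ l₂'.map Subtype.val = l₂ :=
  List.map_eq_cons_iff.mp h

lemma Modu.spec {h : List (Vc A n) → ℚ} (hh : Modu h) (hn : 3 ≤ n) {l : List (Vc A n)}
    (hl : l.map Subtype.val ∈ Spec A (Fin n → A) n) : h l = 0 := by
  obtain ⟨-, ⟨l₁, a, l₂, hl⟩ | ⟨u, a, l₂, hl⟩ | ⟨a, b, l₂, hl, hsp⟩⟩ := hl
  · obtain ⟨a', k, rfl, ha, hk⟩ := map_val_cons hl
    obtain ⟨k₁, b', k₂, rfl, -, hb, -⟩ := map_val_append_cons hk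
    obtain rfl : a' = b' := Subtype.ext (ha.trans hb.symm)
    exact hh.alt.eq_zero_of_dup rfl
  · obtain ⟨b, k, rfl, hb, hk⟩ := map_val_cons hl
    obtain ⟨a', k₂, rfl, ha, -⟩ := map_val_cons hk
    have := hh.unit_at (a := a') (b := b) u (by rw [hb, ha]) [] (a' :: k₂)
    rw [List.nil_append, List.nil_append] at this
    rw [this]
    exact hh.alt.eq_zero_of_dup (l₁ := []) rfl
  · obtain ⟨k, rfl⟩ := Nat.exists_eq_add_of_le' hn
    obtain ⟨a', m, rfl, rfl, hm⟩ := map_val_cons hl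
    obtain ⟨b', m, rfl, rfl, hm⟩ := map_val_cons hm
    obtain ⟨d', m, rfl, hd, hm⟩ := map_val_cons hm
    subst hm
    obtain ⟨hlen, hsp⟩ := hsp
    match m, hlen, hsp with
    | [], hlen, _ => simp at hlen
    | c :: m, hlen, hsp =>
      have hmk : m.length = k := by simpa using hlen
      let y : Fin k → Vc A (k + 3) := fun i => m.get (i.cast hmk.symm)
      have hy : m = List.ofFn y := List.ext_get (by simp [hmk]) fun i h1 h2 => by simp [y]
      let x : Fin (k + 3) → Vc A (k + 3) := Fin.cons a' (Fin.cons b' (Fin.cons c y))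
      have hX : (a'.1 :: b'.1 :: (c :: m).map Subtype.val : List (Fin (k + 3) → A)) =
          List.ofFn (fun i => (x i).1) := by
        rw [hy, ← List.map_cons, ← List.map_cons, ← List.ofFn_cons, ← List.ofFn_cons,
          ← List.ofFn_cons, List.map_ofFn]
        rfl
      rw [hX] at hlen hsp
      have hdet := isUnit_det_of_Sp (x := fun i => (x i).1) fun z => by
        have hz : z ∈ sp A (List.ofFn fun i => (x i).1) := hsp ▸ Submodule.mem_top
        have hr : {w | w ∈ List.ofFn fun i => (x i).1} = Set.range fun i => (x i).1 :=
          Set.ext fun w => List.mem_ofFn' _ _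
        rw [sp, hr, Submodule.mem_span_range_iff_exists_fun] at hz
        obtain ⟨e, he⟩ := hz
        refine ⟨e, ?_⟩
        rw [← he, Matrix.vecMul_eq_sum]
        rfl
      obtain ⟨γ, h1, h2, h3, h4⟩ := exists_exchange hdet
      have g1 : γ • a' = b' := Subtype.ext h1
      have g2 : γ • b' = a' := Subtype.ext h2
      have g3 : (γ • c).1 = ((-1 : Aˣ) : A) • c.1 := by
        rw [Units.val_neg, Units.val_one, neg_one_smul]; exact h3
      have g4 : m.map (γ • ·) = m := by
        conv_rhs => rw [← List.map_id m]
        refine List.map_congr_left fun v hv => ?_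
        rw [hy] at hv
        obtain ⟨i, rfl⟩ := (List.mem_ofFn' _ _).mp hv
        exact Subtype.ext (h4 i)
      have g5 : γ • d' = d' := Subtype.ext (by
        rw [coe_smul_vec, hd, Matrix.mulVec_add, ← coe_smul_vec, ← coe_smul_vec, g1, g2];
          exact add_comm _ _)
      have e1 := hh.inv γ (a' :: b' :: d' :: c :: m)
      simp only [List.map_cons, g1, g2, g4, g5] at e1
      have e2 := hh.unit_at (-1) g3 [b', a', d'] m
      have e3 := hh.alt.swap a' b' (d' :: c :: m)
      simp only [List.cons_append, List.nil_append] at e2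
      linarith

end Modular

end Eis

namespace Eis

open Finsupp Module
open Matrix hiding single

section Coinvariants

variable (Γ : Type*) {L : Type*} [Group Γ] [MulAction Γ L]

/-- Differences of translates of lists in `K`. -/
noncomputable def DG (K : Set (List L)) : Submodule ℚ (Ch L) :=
  Submodule.span ℚ {z | ∃ (γ : Γ), ∃ x ∈ K, z = single (x.map (γ • ·)) 1 - single x 1}

variable {Γ}

lemma tr_sub_mem {K : Set (List L)} {z : Ch L} (hz : z ∈ supp K) (γ : Γ) :
    tr γ z - z ∈ DG Γ K := by
  refine map_supp (tr γ - LinearMap.id) (fun l hl => ?_) hz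
  rw [LinearMap.sub_apply, LinearMap.id_apply, mp_single]
  exact Submodule.subset_span ⟨γ, l, hl, rfl⟩

lemma DG_le {K : Set (List L)} (hK : ∀ (γ : Γ), ∀ x ∈ K, x.map (γ • ·) ∈ K) :
    DG Γ K ≤ supp K := by
  refine Submodule.span_le.mpr ?_
  rintro _ ⟨γ, x, hx, rfl⟩
  exact Submodule.sub_mem _ (single_mem_supp (hK γ x hx) 1) (single_mem_supp hx 1)

lemma ev_DG {K : Set (List L)} {h : List L → ℚ} (hh : ∀ (γ : Γ) x, h (x.map (γ • ·)) = h x)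
    {z : Ch L} (hz : z ∈ DG Γ K) : ev h z = 0 := by
  suffices DG Γ K ≤ LinearMap.ker (ev h) from this hz
  refine Submodule.span_le.mpr ?_
  rintro _ ⟨γ, x, -, rfl⟩
  simp [hh]

lemma part_JL_mem {S : Set (List L)} (n : ℕ) {z : Ch L} (hz : z ∈ JL Γ S) :
    part (fun l => l.length = n) z ∈ DG Γ {l : List L | l.length = n} ⊔
      supp {l | l ∉ S ∧ l.length = n} := by
  suffices JL Γ S ≤ (DG Γ {l : List L | l.length = n} ⊔
      supp {l | l ∉ S ∧ l.length = n}).comap (part (fun l => l.length = n)) from this hz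
  refine Submodule.span_le.mpr ?_
  rintro _ (⟨γ, x, rfl⟩ | ⟨x, hx, rfl⟩)
  · refine Submodule.mem_sup_left ?_
    by_cases h : x.length = n
    · rw [map_sub, part_pos (by simpa using h), part_pos h]
      exact Submodule.subset_span ⟨γ, x, h, rfl⟩
    · rw [map_sub, part_neg (by simpa using h), part_neg h, sub_zero]
      exact Submodule.zero_mem _
  · refine Submodule.mem_sup_right ?_
    by_cases h : x.length = n
    · rw [part_pos h]
      exact single_mem_supp (by exact ⟨hx, h⟩) 1
    · rw [part_neg h]
      exact Submodule.zero_mem _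

end Coinvariants

section Filling

variable {A : Type*} [CommRing A] [IsDomain A] {n : ℕ}

/-- A retraction of all vectors onto the nonzero ones. -/
noncomputable def retr (v₀ : Vc A n) (v : Fin n → A) : Vc A n :=
  open Classical in if h : v ≠ 0 then ⟨v, h⟩ else v₀

lemma map_val_retr (v₀ : Vc A n) {l : List (Fin n → A)} (h : ∀ x ∈ l, x ≠ 0) :
    (l.map (retr v₀)).map Subtype.val = l := by
  rw [List.map_map]
  conv_rhs => rw [← List.map_id l]
  refine List.map_congr_left fun v hv => ?_
  simp [retr, h v hv]

lemma mp_retr_mp_val (v₀ : Vc A n) (z : Ch (Vc A n)) :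
    mp (retr v₀) (mp Subtype.val z) = z := by
  suffices h : (mp (retr v₀)).comp (mp Subtype.val) = (LinearMap.id : Ch (Vc A n) →ₗ[ℚ] _) from
    LinearMap.congr_fun h z
  refine ch_ext fun l => ?_
  have : l.map (retr v₀ ∘ Subtype.val) = l := by
    conv_rhs => rw [← List.map_id l]
    refine List.map_congr_left fun v hv => ?_
    simp [retr, v.2]
  rw [LinearMap.comp_apply, mp_single, mp_single, List.map_map, this]
  rfl

lemma mp_retr_mem (v₀ : Vc A n) {K : Set (List (Fin n → A))} (hK : ∀ l ∈ K, ∀ x ∈ l, x ≠ 0)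
    {z : Ch (Fin n → A)} (hz : z ∈ supp K) :
    mp (retr v₀) z ∈ supp {l : List (Vc A n) | l.map Subtype.val ∈ K} := by
  refine map_supp _ (fun l hl => ?_) hz
  rw [mp_single]
  refine single_mem_supp ?_ 1
  show (l.map (retr v₀)).map Subtype.val ∈ K
  rw [map_val_retr v₀ (hK l hl)]
  exact hl

lemma mp_val_mem {K : Set (List (Vc A n))} {K' : Set (List (Fin n → A))}
    (h : ∀ l ∈ K, l.map Subtype.val ∈ K') {z : Ch (Vc A n)} (hz : z ∈ supp K) :
    mp Subtype.val z ∈ supp K' := by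
  refine map_supp _ (fun l hl => ?_) hz
  rw [mp_single]
  exact single_mem_supp (h l hl) 1

lemma notMem_Fu_iff {l : List (Vc A n)} :
    l ∉ Fu A n ↔ ∃ μ : (Fin n → A) →ₗ[A] A, μ ≠ 0 ∧ ∀ x ∈ l.map Subtype.val, μ x = 0 := by
  simp only [Fu, Set.mem_ofPred_eq]
  push Not
  refine exists_congr fun μ => ?_
  rw [and_comm]
  simp

lemma SpV_smul (γ : SpecialLinearGroup (Fin n) A) {x : List (Vc A n)}
    (hx : x.map Subtype.val ∈ Sp A (Fin n → A) n) :
    (x.map (γ • ·)).map Subtype.val ∈ Sp A (Fin n → A) n := by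
  refine ⟨by simpa using hx.1, ?_⟩
  rw [map_val_smul, eq_top_iff]
  intro z _
  have h1 : (γ⁻¹).1 *ᵥ z ∈ sp A (x.map Subtype.val) := hx.2 ▸ Submodule.mem_top
  have h2 := Submodule.mem_map_of_mem (f := γ.1.mulVecLin) h1
  rw [Submodule.map_span] at h2
  have h3 : γ.1.mulVecLin ((γ⁻¹).1 *ᵥ z) = z := by
    rw [Matrix.mulVecLin_apply, Matrix.mulVec_mulVec, ← Matrix.SpecialLinearGroup.coe_mul,
      mul_inv_cancel, Matrix.SpecialLinearGroup.coe_one, Matrix.one_mulVec]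
  rw [h3] at h2
  refine Submodule.span_mono ?_ h2
  rintro _ ⟨w, hw, rfl⟩
  exact List.mem_map_of_mem (f := (γ.1 *ᵥ ·)) hw

/-- The spanning lists of length `n` of nonzero vectors. -/
def SpV (A : Type*) [CommRing A] (n : ℕ) : Set (List (Vc A n)) :=
  {l | l.map Subtype.val ∈ Sp A (Fin n → A) n}

/-- The nonspanning lists of length `k` of nonzero vectors. -/
def Ns (A : Type*) [CommRing A] (n k : ℕ) : Set (List (Vc A n)) := {l | l ∉ Fu A n ∧ l.length = k}

lemma Dp_Nz_sub (v₀ : Vc A n) {z : Ch (Fin n → A)}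
    (hz : z ∈ supp (Dp A (Fin n → A) n ∩ Nz (Fin n → A) n)) :
    mp (retr v₀) z ∈ supp (Ns A n n) := by
  refine Finsupp.supported_mono ?_ (mp_retr_mem v₀ (fun l hl => hl.2.2) hz)
  rintro l ⟨⟨hl, hd⟩, -⟩
  exact ⟨notMem_Fu_iff.mpr hd, by simpa using hl⟩

lemma Ns_smul (γ : SpecialLinearGroup (Fin n) A) {k : ℕ} {x : List (Vc A n)}
    (hx : x ∈ Ns A n k) : x.map (γ • ·) ∈ Ns A n k := by
  refine ⟨fun h => hx.1 ?_, by simpa using hx.2⟩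
  have := Fu_smul γ⁻¹ h
  rwa [map_smul_map, inv_mul_cancel, map_one_smul] at this

lemma DG_len_le {N : A → ℕ} (hN : Disc N) (v₀ : Vc A n) :
    DG (SpecialLinearGroup (Fin n) A) {l : List (Vc A n) | l.length = n} ≤
      DG (SpecialLinearGroup (Fin n) A) (SpV A n) ⊔
      (DG (SpecialLinearGroup (Fin n) A) {l : List (Vc A n) | l.length = n + 1}).map bd ⊔
      supp (Ns A n n) := by
  refine Submodule.span_le.mpr ?_
  rintro _ ⟨γ, x, hx, rfl⟩
  have hx' : x.map Subtype.val ∈ Nz (Fin n → A) n := ⟨by simpa using hx, fun v hv => by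
    obtain ⟨w, -, rfl⟩ := List.mem_map.mp hv; exact w.2⟩
  obtain ⟨s₁, hs₁, d, hd, h⟩ := Submodule.mem_sup.mp (mem_bases hN hx')
  obtain ⟨s, hs, t₁, ⟨t, ht, rfl⟩, rfl⟩ := Submodule.mem_sup.mp hs₁
  have h1 := congrArg (mp (retr v₀)) h
  rw [map_add, map_add, mp_bd, ← mp_single, mp_retr_mp_val] at h1
  have e : single (x.map (γ • ·)) (1 : ℚ) - single x 1 = tr γ (single x 1) - single x 1 := by
    rw [mp_single]
  rw [SetLike.mem_coe, e, ← h1]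
  have e2 : ∀ s t d : Ch (Vc A n), tr γ (s + bd t + d) - (s + bd t + d) =
      (tr γ s - s) + bd (tr γ t - t) + (tr γ d - d) := by
    intro s t d
    rw [map_add, map_add, mp_bd, map_sub bd]
    abel
  rw [e2]
  refine Submodule.add_mem_sup (Submodule.add_mem_sup ?_ (Submodule.mem_map_of_mem ?_)) ?_
  · exact tr_sub_mem (mp_retr_mem v₀ (fun l hl => small_pi.ne_zero hl) hs) γ
  · refine tr_sub_mem (Finsupp.supported_mono ?_ (mp_retr_mem v₀ (fun l hl => hl.2) ht)) γ
    rintro l ⟨hl, -⟩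
    simpa using hl
  · exact DG_le (fun γ x hx => Ns_smul γ hx) (tr_sub_mem (Dp_Nz_sub v₀ hd) γ)

/-- The coordinatewise embedding of nonzero vectors into vectors over the fraction field. -/
noncomputable def frv (v : Vc A n) : Fin n → FractionRing A := algebraMap A (FractionRing A) ∘ v.1

lemma Ns_sub_Rk (k : ℕ) :
    Ns A n k ⊆ Rk frv (⊤ : Submodule (FractionRing A) (Fin n → FractionRing A)) (n - 1) k := by
  rintro l ⟨hl, hk⟩
  refine ⟨hk, le_top, ?_⟩
  obtain ⟨μ, hμ, hl⟩ := notMem_Fu_iff.mp hl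
  let φ : (Fin n → FractionRing A) →ₗ[FractionRing A] FractionRing A :=
    Fintype.linearCombination (FractionRing A) fun i =>
      algebraMap A (FractionRing A) (μ (Pi.single i 1))
  have hφ : ∀ v : Vc A n, φ (frv v) = algebraMap A _ (μ v.1) := by
    intro v
    rw [Fintype.linearCombination_apply, LinearMap.pi_apply_eq_sum_univ μ v.1, map_sum]
    refine Finset.sum_congr rfl fun i _ => ?_
    rw [smul_eq_mul, smul_eq_mul, map_mul]
    congr 3
    funext j
    simp [Pi.single_apply, eq_comm]
  have hle : sp (FractionRing A) (l.map frv) ≤ LinearMap.ker φ := by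
    refine Submodule.span_le.mpr ?_
    intro w hw
    obtain ⟨v, hv, rfl⟩ := List.mem_map.mp hw
    rw [SetLike.mem_coe, LinearMap.mem_ker, hφ, hl _ (List.mem_map_of_mem hv), map_zero]
  have hne : LinearMap.ker φ < ⊤ := by
    rw [lt_top_iff_ne_top, Ne, LinearMap.ker_eq_top]
    intro h
    refine hμ (LinearMap.pi_ext' fun i => LinearMap.ext_ring ?_)
    have h1 := LinearMap.congr_fun h (Pi.single i 1)
    rw [Fintype.linearCombination_apply_single, one_smul, LinearMap.zero_apply,
      map_eq_zero_iff _ (IsFractionRing.injective A (FractionRing A))] at h1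
    exact h1
  have := Submodule.finrank_lt_finrank_of_lt (lt_of_le_of_lt hle hne)
  rw [finrank_top, Module.finrank_fin_fun] at this
  omega

lemma Rk_sub_Ns (hn : 1 ≤ n) (k : ℕ) :
    Rk frv (⊤ : Submodule (FractionRing A) (Fin n → FractionRing A)) (n - 1) k ⊆ Ns A n k := by
  rintro l ⟨hk, -, hr⟩
  refine ⟨?_, hk⟩
  have hlt : sp (FractionRing A) (l.map frv) < ⊤ := by
    rw [lt_top_iff_ne_top]
    intro h
    rw [h, finrank_top, Module.finrank_fin_fun] at hr
    omega
  obtain ⟨φ, hφ, hle⟩ := Submodule.exists_le_ker_of_lt_top _ hlt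
  obtain ⟨b, hb⟩ := IsLocalization.exist_integer_multiples_of_finite
    (nonZeroDivisors A) fun i : Fin n => φ (Pi.single i 1)
  choose c hc using hb
  rw [notMem_Fu_iff]
  let μ : (Fin n → A) →ₗ[A] A := Fintype.linearCombination A c
  have hμ : ∀ v : Fin n → A, algebraMap A (FractionRing A) (μ v) =
      algebraMap A (FractionRing A) b * φ (algebraMap A (FractionRing A) ∘ v) := by
    intro v
    rw [Fintype.linearCombination_apply, LinearMap.pi_apply_eq_sum_univ φ, map_sum,
      Finset.mul_sum]
    refine Finset.sum_congr rfl fun i _ => ?_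
    rw [smul_eq_mul, map_mul, hc, smul_eq_mul, Algebra.smul_def, Function.comp_apply,
      show (fun j => if i = j then (1 : FractionRing A) else 0) = Pi.single i 1 from
        funext fun j => by simp [Pi.single_apply, eq_comm]]
    ring
  refine ⟨μ, ?_, ?_⟩
  · rintro h0
    refine hφ (LinearMap.pi_ext' fun i => LinearMap.ext_ring ?_)
    have h1 := hc i
    have h2 : c i = 0 := by
      have := LinearMap.congr_fun h0 (Pi.single i 1)
      rwa [Fintype.linearCombination_apply_single, one_smul, LinearMap.zero_apply] at this
    rw [h2, map_zero, Algebra.smul_def, eq_comm, mul_eq_zero,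
      map_eq_zero_iff _ (IsFractionRing.injective A (FractionRing A))] at h1
    exact h1.resolve_left (nonZeroDivisors.ne_zero b.2)
  · intro x hx
    obtain ⟨v, hv, rfl⟩ := List.mem_map.mp hx
    have h1 := hμ v.1
    have h2 : φ (algebraMap A (FractionRing A) ∘ v.1) = 0 :=
      hle (mem_sp (List.mem_map_of_mem (f := frv) hv))
    rwa [h2, mul_zero, map_eq_zero_iff _ (IsFractionRing.injective A (FractionRing A))] at h1

set_option maxHeartbeats 400000 in
theorem exists_filling {N : A → ℕ} (hN : Disc N) (hn : 3 ≤ n) {a : Ch (Vc A n)}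
    (ha : a ∈ supp (len ((n + 1 : ℕ) : ℤ)))
    (hb : bd a ∈ JL (SpecialLinearGroup (Fin n) A) (Fu A n)) :
    ∃ t, ∀ h, Modu h → ev h a = ev h (bd t) := by
  have v₀ : Vc A n := ⟨Pi.single ⟨0, by omega⟩ 1, by simp⟩
  have hlen : ∀ {k : ℕ} {z : Ch (Vc A n)}, z ∈ supp (len ((k + 1 : ℕ) : ℤ)) →
      bd z ∈ supp {l | l.length = k} := by
    intro k z hz
    refine map_supp _ (fun l hl => ?_) hz
    refine Finsupp.supported_mono ?_ (bd_single_mem_len (k := k) (by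
      have : (l.length : ℤ) = ((k + 1 : ℕ) : ℤ) := hl
      exact_mod_cast this))
    intro l' hl'
    have : (l'.length : ℤ) = (k : ℤ) := hl'
    exact_mod_cast this
  have h1 := part_JL_mem n hb
  have h2 : part (fun l => l.length = n) (bd a) = bd a := by
    have := sub_part_mem (p := fun l => l.length = n) (hlen ha)
    rw [show ({l : List (Vc A n) | l.length = n} ∩ {l | ¬ l.length = n}) = ∅ from
      Set.inter_compl_self _, supp, Finsupp.supported_empty, Submodule.mem_bot, sub_eq_zero] at this
    exact this.symm
  rw [h2] at h1
  have h3 : bd a ∈ DG (SpecialLinearGroup (Fin n) A) (SpV A n) ⊔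
      (DG (SpecialLinearGroup (Fin n) A) {l : List (Vc A n) | l.length = n + 1}).map bd ⊔
      supp (Ns A n n) := sup_le (DG_len_le hN v₀) le_sup_right h1
  obtain ⟨y, hy, d, hd, e⟩ := Submodule.mem_sup.mp h3
  obtain ⟨w, hw, y', ⟨s, hs, rfl⟩, rfl⟩ := Submodule.mem_sup.mp hy
  have hsl : s ∈ supp {l : List (Vc A n) | l.length = n + 1} :=
    DG_le (fun γ x hx => by simpa using hx) hs
  have hal : a ∈ supp {l : List (Vc A n) | l.length = n + 1} := by
    refine Finsupp.supported_mono (fun l hl => ?_) ha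
    have : (l.length : ℤ) = ((n + 1 : ℕ) : ℤ) := hl
    exact_mod_cast this
  have hwS : w ∈ supp (SpV A n) := DG_le (fun γ x hx => SpV_smul γ hx) hw
  have ew : w = bd (a - s) - d := by rw [map_sub bd, ← e]; abel
  have hwD : mp Subtype.val w ∈ DD A (Fin n → A) n := by
    rw [ew, map_sub, mp_bd]
    refine Submodule.sub_mem _ (Submodule.mem_sup_right (Submodule.mem_map_of_mem
      (mp_val_mem (fun l hl => ?_) (Submodule.sub_mem _ hal hsl))))
      (Submodule.mem_sup_left (mp_val_mem (fun l hl => ?_) hd))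
    · exact ⟨by simpa using hl, fun v hv => by
        obtain ⟨w, -, rfl⟩ := List.mem_map.mp hv; exact w.2⟩
    · exact ⟨by simpa using hl.2, notMem_Fu_iff.mp hl.1⟩
  obtain ⟨q, hq, hqd⟩ := Rel.exists_bd small_pi
    (mem_Rel hN n _ small_pi _ (mp_val_mem (fun l hl => hl) hwS) hwD)
  have hq' := mp_retr_mem v₀ (fun l hl => hl.1.2) hq
  have hqd' := Dp_Nz_sub v₀ hqd
  rw [map_sub, mp_retr_mp_val, mp_bd] at hqd'
  obtain ⟨p, hp⟩ : ∃ p, p = mp (retr v₀) q := ⟨_, rfl⟩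
  rw [← hp] at hq' hqd'
  have hc : bd (a - s - p) ∈ supp (Ns A n n) := by
    have : bd (a - s - p) = (w - bd p) + d := by rw [ew, map_sub bd]; abel
    rw [this]
    exact Submodule.add_mem _ hqd' hd
  obtain ⟨k, rfl⟩ := Nat.exists_eq_add_of_le' (show 1 ≤ n by omega)
  obtain ⟨f, hf, hfb⟩ := exists_bd_of_rank (K := FractionRing A) (φ := frv (A := A) (n := k + 1))
    (fun v h => v.2 (by
      funext i
      exact (map_eq_zero_iff _ (IsFractionRing.injective A (FractionRing A))).mp (congrFun h i)))
    k ⊤ k le_rfl _ (Finsupp.supported_mono (Ns_sub_Rk _) hc) (bd_bd _)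
  have hf' := Finsupp.supported_mono (Rk_sub_Ns (by omega) _) hf
  refine ⟨cone v₀ (a - s - p - f), fun h hh => ?_⟩
  have e1 : bd (a - s - p - f) = 0 := by rw [map_sub bd, hfb, sub_self]
  rw [bd_cone, e1, map_zero, sub_zero, map_sub, map_sub, map_sub, ev_DG hh.inv hs,
    ev_eq_zero (fun l hl => hh.spec hn hl) hq', ev_eq_zero (fun l hl => hh.off l hl.1) hf']
  ring

end Filling

end Eis

namespace Eis

section Plane

/-- The norm form of the Eisenstein integers. -/
def qf {R : Type*} [CommRing R] (x y : R) : R := x ^ 2 + x * y + y ^ 2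

lemma qf_neg {R : Type*} [CommRing R] (x y : R) : qf (-x) (-y) = qf x y := by
  simp only [qf]; ring

lemma qf_lt_one {x y : ℝ} (hx : |x| < 1) (hy : |y| < 1) (hxy : |x + y| ≤ 1) : qf x y < 1 := by
  rw [abs_lt] at hx hy
  rw [abs_le] at hxy
  unfold qf
  rcases le_or_gt 0 x with h1 | h1 <;> rcases le_or_gt 0 y with h2 | h2
  · rcases h1.eq_or_lt with rfl | h1
    · nlinarith
    · rcases h2.eq_or_lt with rfl | h2
      · nlinarith
      · nlinarith [mul_pos h1 h2]
  · rcases le_or_gt 0 (x + y) with h | h <;> nlinarith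
  · rcases le_or_gt 0 (x + y) with h | h <;> nlinarith
  · nlinarith [mul_pos_of_neg_of_neg h1 h2]

/-- The standard triangle without two of its vertices. -/
def Tri (x y : ℝ) : Prop := 0 ≤ x ∧ 0 ≤ y ∧ x < 1 ∧ y < 1 ∧ x + y ≤ 1

lemma Tri.lt {x y : ℝ} (h : Tri x y) : qf x y < 1 := by
  obtain ⟨h1, h2, h3, h4, h5⟩ := h
  exact qf_lt_one (by rw [abs_lt]; constructor <;> linarith)
    (by rw [abs_lt]; constructor <;> linarith) (by rw [abs_le]; constructor <;> linarith)

lemma Tri.lt_left {x y : ℝ} (h : Tri x y) (h0 : 0 < x + y) :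
    qf (x + (-1 : ℤ)) (y + (0 : ℤ)) < 1 := by
  obtain ⟨h1, h2, h3, h4, h5⟩ := h
  simp only [qf, Int.cast_neg, Int.cast_one, Int.cast_zero, add_zero]
  rcases h1.eq_or_lt with rfl | h1
  · nlinarith
  · nlinarith [mul_nonneg h2 (sub_nonneg.mpr h5)]

lemma Tri.lt_right {x y : ℝ} (h : Tri x y) (h0 : 0 < x + y) :
    qf (x + (0 : ℤ)) (y + (-1 : ℤ)) < 1 := by
  obtain ⟨h1, h2, h3, h4, h5⟩ := h
  have := Tri.lt_left (x := y) (y := x) ⟨h2, h1, h4, h3, by linarith⟩ (by linarith)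
  simp only [qf] at this ⊢
  linarith

/-- Simultaneous reduction of two residues and of their sum. -/
def PairP (x y x' y' : ℝ) : Prop := ∃ m k m' k' : ℤ, qf (x + m) (y + k) < 1 ∧
  qf (x' + m') (y' + k') < 1 ∧ qf (x + m + (x' + m')) (y + k + (y' + k')) < 1

lemma Tri.pair {x y x' y' : ℝ} (h : Tri x y) (h' : Tri x' y') : PairP x y x' y' := by
  have key : ∀ d e : ℝ, -1 < d → d < 1 → -1 < e → e < 1 → -1 ≤ d + e → d + e ≤ 1 → qf d e < 1 :=
    fun d e h1 h2 h3 h4 h5 h6 => qf_lt_one (abs_lt.mpr ⟨h1, h2⟩) (abs_lt.mpr ⟨h3, h4⟩)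
      (abs_le.mpr ⟨h5, h6⟩)
  have z1 : qf (x + (0 : ℤ)) (y + (0 : ℤ)) < 1 := by simpa using h.lt
  have z2 : qf (x' + (0 : ℤ)) (y' + (0 : ℤ)) < 1 := by simpa using h'.lt
  obtain ⟨a1, a2, a3, a4, a5⟩ := id h
  obtain ⟨b1, b2, b3, b4, b5⟩ := id h'
  rcases lt_or_ge (x + x') 1 with c1 | c1 <;> rcases lt_or_ge (y + y') 1 with c2 | c2
  · rcases le_or_gt (x + x' + (y + y')) 1 with c3 | c3
    · exact ⟨0, 0, 0, 0, z1, z2, by apply key <;> push_cast <;> linarith⟩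
    · exact ⟨-1, 0, 0, -1, h.lt_left (by linarith), h'.lt_right (by linarith),
        by apply key <;> push_cast <;> linarith⟩
  · exact ⟨0, 0, 0, -1, z1, h'.lt_right (by linarith), by apply key <;> push_cast <;> linarith⟩
  · exact ⟨0, 0, -1, 0, z1, h'.lt_left (by linarith), by apply key <;> push_cast <;> linarith⟩
  · exact ⟨-1, 0, 0, -1, h.lt_left (by linarith), h'.lt_right (by linarith),
        by apply key <;> push_cast <;> linarith⟩

lemma Tri.pair_neg {x y x' y' : ℝ} (h : Tri x y) (h' : Tri x' y') : PairP x y (-x') (-y') := by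
  have z2 := h'.lt
  rw [← qf_neg] at z2
  obtain ⟨a1, a2, a3, a4, a5⟩ := id h
  obtain ⟨b1, b2, b3, b4, b5⟩ := id h'
  refine ⟨0, 0, 0, 0, by simpa using h.lt, by simpa using z2, qf_lt_one ?_ ?_ ?_⟩
  · rw [abs_lt]; push_cast; constructor <;> linarith
  · rw [abs_lt]; push_cast; constructor <;> linarith
  · rw [abs_le]; push_cast; constructor <;> linarith

lemma PairP.neg {x y x' y' : ℝ} (h : PairP x y x' y') : PairP (-x) (-y) (-x') (-y') := by
  obtain ⟨m, k, m', k', h1, h2, h3⟩ := h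
  refine ⟨-m, -k, -m', -k', ?_, ?_, ?_⟩
  · rw [← qf_neg] at h1; convert h1 using 2 <;> push_cast <;> ring
  · rw [← qf_neg] at h2; convert h2 using 2 <;> push_cast <;> ring
  · rw [← qf_neg] at h3; convert h3 using 2 <;> push_cast <;> ring

lemma PairP.swap {x y x' y' : ℝ} (h : PairP x y x' y') : PairP x' y' x y := by
  obtain ⟨m, k, m', k', h1, h2, h3⟩ := h
  exact ⟨m', k', m, k, h2, h1, by rwa [add_comm (x' + _), add_comm (y' + _)]⟩

lemma PairP.of_shift {x y x' y' : ℝ} (a b c d : ℤ) (h : PairP (x + a) (y + b) (x' + c) (y' + d)) :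
    PairP x y x' y' := by
  obtain ⟨m, k, m', k', h1, h2, h3⟩ := h
  refine ⟨a + m, b + k, c + m', d + k', ?_, ?_, ?_⟩ <;> push_cast
  · rwa [← add_assoc, ← add_assoc]
  · rwa [← add_assoc, ← add_assoc]
  · rwa [← add_assoc x, ← add_assoc y, ← add_assoc x', ← add_assoc y']

lemma exists_tri (x y : ℝ) : ∃ a b : ℤ, Tri (x + a) (y + b) ∨ Tri (-(x + a)) (-(y + b)) := by
  have h1 := Int.fract_nonneg x
  have h2 := Int.fract_lt_one x
  have h3 := Int.fract_nonneg y
  have h4 := Int.fract_lt_one y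
  have e1 := Int.self_sub_floor x
  have e2 := Int.self_sub_floor y
  rcases le_or_gt (Int.fract x + Int.fract y) 1 with h | h
  · refine ⟨-⌊x⌋, -⌊y⌋, Or.inl ?_⟩
    unfold Tri; push_cast
    refine ⟨?_, ?_, ?_, ?_, ?_⟩ <;> linarith
  · refine ⟨-⌊x⌋ - 1, -⌊y⌋ - 1, Or.inr ?_⟩
    unfold Tri; push_cast
    refine ⟨?_, ?_, ?_, ?_, ?_⟩ <;> linarith

lemma exists_pair (x y x' y' : ℝ) : PairP x y x' y' := by
  obtain ⟨a, b, h⟩ := exists_tri x y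
  obtain ⟨c, d, h'⟩ := exists_tri x' y'
  refine PairP.of_shift a b c d ?_
  rcases h with h | h <;> rcases h' with h' | h'
  · exact h.pair h'
  · simpa using h.pair_neg h'
  · simpa using (h'.pair_neg h).swap
  · simpa using (h.pair h').neg

lemma exists_turn {x y : ℝ} (h : qf x y = 1) :
    ∃ m k : ℤ, qf m k = 1 ∧ qf (x + m) (y + k) < 1 := by
  by_contra! hc
  unfold qf at h hc
  have c1 := hc 1 0 (by norm_num)
  have c2 := hc (-1) 0 (by norm_num)
  have c3 := hc 0 1 (by norm_num)
  have c4 := hc 0 (-1) (by norm_num)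
  have c5 := hc 1 (-1) (by norm_num)
  have c6 := hc (-1) 1 (by norm_num)
  push_cast at c1 c2 c3 c4 c5 c6
  obtain ⟨p, hp⟩ : ∃ p, p = 2 * x + y := ⟨_, rfl⟩
  obtain ⟨r, hr⟩ : ∃ r, r = x + 2 * y := ⟨_, rfl⟩
  have e : p ^ 2 - p * r + r ^ 2 = 3 := by rw [hp, hr]; linear_combination 3 * h
  have d1 : -1 ≤ p := by linarith
  have d2 : p ≤ 1 := by linarith
  have d3 : -1 ≤ r := by linarith
  have d4 : r ≤ 1 := by linarith
  have d5 : -1 ≤ p - r := by linarith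
  have d6 : p - r ≤ 1 := by linarith
  have p2 : p ^ 2 ≤ 1 := by rw [sq_le_one_iff_abs_le_one, abs_le]; exact ⟨d1, d2⟩
  have r2 : r ^ 2 ≤ 1 := by rw [sq_le_one_iff_abs_le_one, abs_le]; exact ⟨d3, d4⟩
  have q2 : (p - r) ^ 2 ≤ 1 := by rw [sq_le_one_iff_abs_le_one, abs_le]; exact ⟨d5, d6⟩
  linarith [sq_nonneg (p + r)]

lemma exists_lift {x y : ℝ} {m k : ℤ} (h : qf x y < 1) (h' : qf (x + m) (y + k) < 1) :
    (m = 0 ∧ k = 0) ∨ qf m k = 1 ∨ ∃ a b c d : ℤ, qf a b = 1 ∧ qf c d = 1 ∧ m = a + c ∧ k = b + d ∧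
      qf (x + a) (y + b) < 1 := by
  have h4 : qf m k < 4 := by
    have : (qf m k : ℝ) < 4 := by
      unfold qf at *
      nlinarith [sq_nonneg (2 * x + m + (y + k / 2)), sq_nonneg (2 * y + k)]
    unfold qf at *
    exact_mod_cast this
  unfold qf at h4
  have b1 : m < 3 := by nlinarith [sq_nonneg (m + 2 * k)]
  have b2 : -3 < m := by nlinarith [sq_nonneg (m + 2 * k)]
  have b3 : k < 3 := by nlinarith [sq_nonneg (k + 2 * m)]
  have b4 : -3 < k := by nlinarith [sq_nonneg (k + 2 * m)]
  have key : ∀ a b c d : ℤ, m = a + c → k = b + d → qf a b = 1 → qf c d = 1 →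
      2 * a * c + a * d + b * c + 2 * b * d = 1 →
      ∃ a b c d : ℤ, qf a b = 1 ∧ qf c d = 1 ∧ m = a + c ∧ k = b + d ∧ qf (x + a) (y + b) < 1 := by
    intro a b c d hm hk hab hcd hB
    by_contra! hc
    have g1 := hc a b c d hab hcd hm hk
    have g2 := hc c d a b hcd hab (by omega) (by omega)
    rw [hm, hk] at h'
    push_cast at h'
    have hB' : (2 * a * c + a * d + b * c + 2 * b * d : ℝ) = 1 := by exact_mod_cast hB
    unfold qf at *
    nlinarith
  obtain rfl | rfl | rfl | rfl | rfl : m = -2 ∨ m = -1 ∨ m = 0 ∨ m = 1 ∨ m = 2 := by omega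
  all_goals
    obtain rfl | rfl | rfl | rfl | rfl : k = -2 ∨ k = -1 ∨ k = 0 ∨ k = 1 ∨ k = 2 := by omega
  all_goals first
    | exact Or.inl ⟨rfl, rfl⟩
    | (exfalso; norm_num at h4; done)
    | (refine Or.inr (Or.inl ?_); norm_num [qf]; done)
    | refine Or.inr (Or.inr ?_)
  · exact (key (-1) 0 (-1) 1 (by norm_num) (by norm_num) (by norm_num [qf])
      (by norm_num [qf]) (by norm_num))
  · exact (key (-1) 0 0 (-1) (by norm_num) (by norm_num) (by norm_num [qf])
      (by norm_num [qf]) (by norm_num))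
  · exact (key (-1) 1 0 1 (by norm_num) (by norm_num) (by norm_num [qf])
      (by norm_num [qf]) (by norm_num))
  · exact (key 1 (-1) 0 (-1) (by norm_num) (by norm_num) (by norm_num [qf])
      (by norm_num [qf]) (by norm_num))
  · exact (key 1 0 0 1 (by norm_num) (by norm_num) (by norm_num [qf])
      (by norm_num [qf]) (by norm_num))
  · exact (key 1 (-1) 1 0 (by norm_num) (by norm_num) (by norm_num [qf])
      (by norm_num [qf]) (by norm_num))

end Plane

end Eis

namespace Eis

section Ring

/-- A presentation of the ring of Eisenstein integers with a complex embedding. -/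
structure Eisen {A : Type*} [CommRing A] (σ : A →+* ℂ) (ρ : A) : Prop where
  inj : Function.Injective σ
  sq : ρ ^ 2 = ρ - 1
  gen : ∀ x, ∃ a b : ℤ, x = a + b * ρ

/-- The norm, as a natural number. -/
noncomputable def nmA {A : Type*} [CommRing A] (σ : A →+* ℂ) (x : A) : ℕ := ⌊Complex.normSq (σ x)⌋₊

variable {A : Type*} [CommRing A] {σ : A →+* ℂ} {ρ : A}

lemma Eisen.root (h : Eisen σ ρ) : (σ ρ).re = 1 / 2 ∧ (σ ρ).im ^ 2 = 3 / 4 := by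
  have h1 : σ ρ ^ 2 = σ ρ - 1 := by rw [← map_pow, h.sq, map_sub, map_one]
  have h2 := congrArg Complex.re h1
  have h3 := congrArg Complex.im h1
  simp only [pow_two, Complex.mul_re, Complex.mul_im, Complex.sub_re, Complex.sub_im,
    Complex.one_re, Complex.one_im] at h2 h3
  have h4 : (σ ρ).im ≠ 0 := by
    intro h0
    rw [h0] at h2
    nlinarith [sq_nonneg ((σ ρ).re - 1 / 2)]
  have h5 : (σ ρ).re = 1 / 2 := by
    have : (σ ρ).im * (2 * (σ ρ).re - 1) = 0 := by linarith
    have := (mul_eq_zero.mp this).resolve_left h4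
    linarith
  exact ⟨h5, by rw [h5] at h2; linarith⟩

lemma Eisen.normSq (h : Eisen σ ρ) (x y : ℝ) : Complex.normSq (x + y * σ ρ) = qf x y := by
  obtain ⟨h1, h2⟩ := h.root
  rw [Complex.normSq_apply]
  simp only [Complex.add_re, Complex.add_im, Complex.mul_re, Complex.mul_im, Complex.ofReal_re,
    Complex.ofReal_im, h1, qf]
  linear_combination y ^ 2 * h2

lemma Eisen.coords (h : Eisen σ ρ) (z : ℂ) : ∃ x y : ℝ, z = x + y * σ ρ := by
  obtain ⟨h1, h2⟩ := h.root
  have h0 : (σ ρ).im ≠ 0 := by intro h0; rw [h0] at h2; norm_num at h2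
  refine ⟨z.re - z.im / (σ ρ).im / 2, z.im / (σ ρ).im, ?_⟩
  apply Complex.ext
  · simp [h1]
    ring
  · simp [h0]

lemma Eisen.map_int (_h : Eisen σ ρ) (a b : ℤ) : σ (a + b * ρ) = (a : ℝ) + (b : ℝ) * σ ρ := by
  simp

lemma Eisen.cast_nmA (h : Eisen σ ρ) (x : A) : (nmA σ x : ℝ) = Complex.normSq (σ x) := by
  obtain ⟨a, b, rfl⟩ := h.gen x
  rw [nmA, h.map_int, h.normSq]
  have e : qf (a : ℝ) (b : ℝ) = ((qf a b).toNat : ℝ) := by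
    have h0 : 0 ≤ qf a b := by unfold qf; nlinarith [sq_nonneg (a + b), sq_nonneg a, sq_nonneg b]
    have : (((qf a b).toNat : ℤ) : ℝ) = ((qf a b : ℤ) : ℝ) := by rw [Int.toNat_of_nonneg h0]
    rw [Int.cast_natCast] at this
    rw [this]
    simp [qf]
  rw [e, Nat.floor_natCast]

lemma Eisen.exists_unit (h : Eisen σ ρ) {a b : ℤ} (hab : qf a b = 1) :
    ∃ u : Aˣ, (u : A) = a + b * ρ := by
  have e : (a + b * ρ) * ((a + b : ℤ) + (-b : ℤ) * ρ) = 1 := by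
    have : ((qf a b : ℤ) : A) = 1 := by rw [hab, Int.cast_one]
    rw [← this]
    unfold qf
    push_cast
    linear_combination (-(b : A) ^ 2) * h.sq
  exact ⟨Units.mkOfMulEqOne _ _ e, rfl⟩

lemma Eisen.nmA_lt_iff (h : Eisen σ ρ) {a b : A} (hb : b ≠ 0) {x y : ℝ}
    (hxy : σ a / σ b = x + y * σ ρ) (m k : ℤ) :
    nmA σ (a + (m + k * ρ) * b) < nmA σ b ↔ qf (x + m) (y + k) < 1 := by
  have hb' : σ b ≠ 0 := (map_ne_zero_iff σ h.inj).mpr hb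
  have hp : 0 < Complex.normSq (σ b) := Complex.normSq_pos.mpr hb'
  rw [← Nat.cast_lt (α := ℝ), h.cast_nmA, h.cast_nmA, ← h.normSq]
  have e : σ (a + (m + k * ρ) * b) = ((x + m : ℝ) + (y + k : ℝ) * σ ρ) * σ b := by
    rw [map_add, map_mul, h.map_int]
    push_cast
    have := (div_eq_iff hb').mp hxy
    rw [this]
    ring
  rw [e, Complex.normSq_mul]
  exact mul_lt_iff_lt_one_left hp

theorem Eisen.disc (h : Eisen σ ρ) : Disc (nmA σ) := by
  have hpair : ∀ a a' b : A, b ≠ 0 → ∃ s s', nmA σ (a + s * b) < nmA σ b ∧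
      nmA σ (a' + s' * b) < nmA σ b ∧ nmA σ (a + s * b + (a' + s' * b)) < nmA σ b := by
    intro a a' b hb
    obtain ⟨x, y, hxy⟩ := h.coords (σ a / σ b)
    obtain ⟨x', y', hxy'⟩ := h.coords (σ a' / σ b)
    obtain ⟨m, k, m', k', h1, h2, h3⟩ := exists_pair x y x' y'
    refine ⟨m + k * ρ, m' + k' * ρ, (h.nmA_lt_iff hb hxy m k).mpr h1,
      (h.nmA_lt_iff hb hxy' m' k').mpr h2, ?_⟩
    have hs : σ (a + a') / σ b = ((x + x' : ℝ) : ℂ) + (y + y' : ℝ) * σ ρ := by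
      rw [map_add, add_div, hxy, hxy']
      push_cast
      ring
    have e : a + (m + k * ρ) * b + (a' + (m' + k' * ρ) * b) =
        a + a' + ((m + m' : ℤ) + (k + k' : ℤ) * ρ) * b := by
      push_cast
      ring
    rw [e, h.nmA_lt_iff hb hs]
    convert h3 using 2 <;> push_cast <;> ring
  refine ⟨fun x => ?_, fun x y => ?_, fun x hx => ?_, fun a b hb hab => ?_, fun a b hb => ?_,
    fun a b t ha ht => ?_, hpair⟩
  · rw [← Nat.cast_eq_zero (R := ℝ), h.cast_nmA, Complex.normSq_eq_zero,
      map_eq_zero_iff σ h.inj]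
  · rw [← Nat.cast_inj (R := ℝ), Nat.cast_mul, h.cast_nmA, h.cast_nmA, h.cast_nmA, map_mul,
      Complex.normSq_mul]
  · obtain ⟨a, b, rfl⟩ := h.gen x
    have h1 : (nmA σ (a + b * ρ) : ℝ) = 1 := by rw [hx, Nat.cast_one]
    rw [h.cast_nmA, h.map_int, h.normSq] at h1
    obtain ⟨u, hu⟩ := h.exists_unit (a := a) (b := b) (by unfold qf at *; exact_mod_cast h1)
    exact hu ▸ u.isUnit
  · obtain ⟨x, y, hxy⟩ := h.coords (σ a / σ b)
    have hb' : σ b ≠ 0 := (map_ne_zero_iff σ h.inj).mpr hb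
    have h1 : qf x y = 1 := by
      rw [← h.normSq, ← hxy, Complex.normSq_div, ← h.cast_nmA, ← h.cast_nmA, hab, div_self]
      rw [h.cast_nmA]
      exact (Complex.normSq_pos.mpr hb').ne'
    obtain ⟨m, k, h2, h3⟩ := exists_turn h1
    obtain ⟨u, hu⟩ := h.exists_unit h2
    exact ⟨u, by rw [hu]; exact (h.nmA_lt_iff hb hxy m k).mpr h3⟩
  · obtain ⟨s, -, hs, -⟩ := hpair a 0 b hb
    exact ⟨s, hs⟩
  · have hb : b ≠ 0 := by
      rintro rfl
      have : nmA σ 0 = 0 := by simp [nmA]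
      omega
    obtain ⟨x, y, hxy⟩ := h.coords (σ a / σ b)
    obtain ⟨m, k, rfl⟩ := h.gen t
    have h1 := (h.nmA_lt_iff hb hxy m k).mp ht
    have h0 := (h.nmA_lt_iff hb hxy 0 0).mp (by simpa using ha)
    rcases exists_lift (by simpa using h0) h1 with ⟨rfl, rfl⟩ | h2 | ⟨p, q, r, s, h2, h3, rfl, rfl,
      h4⟩
    · left; simp
    · obtain ⟨u, hu⟩ := h.exists_unit h2
      exact Or.inr (Or.inl ⟨u, hu.symm⟩)
    · obtain ⟨u, hu⟩ := h.exists_unit h2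
      obtain ⟨u', hu'⟩ := h.exists_unit h3
      refine Or.inr (Or.inr ⟨u, u', ?_, ?_⟩)
      · rw [hu, hu']; push_cast; ring
      · rw [hu]; exact (h.nmA_lt_iff hb hxy p q).mpr h4

end Ring

section Cyclotomic

open NumberField

theorem exists_eisen : ∃ (σ : 𝓞 (CyclotomicField 3 ℚ) →+* ℂ) (ρ : 𝓞 (CyclotomicField 3 ℚ)),
    Eisen σ ρ := by
  have : NeZero ((3 : ℕ) : ℚ) := ⟨by norm_num⟩
  have : IsCyclotomicExtension {3} ℚ (CyclotomicField 3 ℚ) :=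
    CyclotomicField.isCyclotomicExtension 3 ℚ
  have : NumberField (CyclotomicField 3 ℚ) := IsCyclotomicExtension.numberField {3} ℚ _
  have hz := IsCyclotomicExtension.zeta_spec 3 ℚ (CyclotomicField 3 ℚ)
  obtain ⟨φ⟩ : Nonempty (CyclotomicField 3 ℚ →+* ℂ) := inferInstance
  have h1 := hz.toInteger_isPrimitiveRoot
  have h2 : hz.toInteger ^ 2 + hz.toInteger + 1 = 0 := by
    have h3 : hz.toInteger ^ 3 = 1 := h1.pow_eq_one
    have h4 : hz.toInteger - 1 ≠ 0 := sub_ne_zero.mpr (h1.ne_one (by norm_num))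
    refine (mul_eq_zero.mp ?_).resolve_left h4
    linear_combination h3
  refine ⟨φ.comp (algebraMap _ _), hz.toInteger + 1, φ.injective.comp
    (FaithfulSMul.algebraMap_injective _ _), by linear_combination h2, fun x => ?_⟩
  have hx : x ∈ Algebra.adjoin ℤ {hz.toInteger} := by
    rw [← hz.integralPowerBasis_gen, hz.integralPowerBasis.adjoin_gen_eq_top]
    trivial
  induction hx using Algebra.adjoin_induction with
  | mem x hx =>
    obtain rfl := Set.mem_singleton_iff.mp hx
    exact ⟨-1, 1, by push_cast; ring⟩
  | algebraMap r => exact ⟨r, 0, by simp⟩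
  | add x y _ _ hx hy =>
    obtain ⟨a, b, rfl⟩ := hx
    obtain ⟨c, d, rfl⟩ := hy
    exact ⟨a + c, b + d, by push_cast; ring⟩
  | mul x y _ _ hx hy =>
    obtain ⟨a, b, rfl⟩ := hx
    obtain ⟨c, d, rfl⟩ := hy
    exact ⟨a * c - b * d, a * d + b * c + b * d, by
      push_cast
      linear_combination (b * d : 𝓞 (CyclotomicField 3 ℚ)) * h2⟩

end Cyclotomic

end Eis

namespace Eis

open Filter Topology

section Line

variable {J : Type*} {a b : J → ℝ}

lemma exists_step (ha : ∀ v, 0 ≤ a v) (hab : ∀ v, a v = 0 → 0 ≤ b v) {t : ℝ} (ht : 0 < t)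
    (hf : {v | a v + t * b v < 0}.Finite) : ∃ s, 0 < s ∧ ∀ v, 0 ≤ a v + s * b v := by
  have h1 : ∀ᶠ s in 𝓝[>] (0 : ℝ), ∀ v ∈ {v | a v + t * b v < 0}, 0 ≤ a v + s * b v := by
    rw [eventually_all_finite hf]
    intro v hv
    have hv' : a v + t * b v < 0 := hv
    have hpos : 0 < a v := by
      refine lt_of_le_of_ne (ha v) fun h => ?_
      have := mul_nonneg ht.le (hab v h.symm)
      linarith
    have hc : Tendsto (fun s : ℝ => a v + s * b v) (𝓝[>] 0) (𝓝 (a v + 0 * b v)) :=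
      ((continuous_const.add (continuous_id.mul continuous_const)).tendsto 0).mono_left
        nhdsWithin_le_nhds
    rw [zero_mul, add_zero] at hc
    exact (hc.eventually (lt_mem_nhds hpos)).mono fun s h => h.le
  have h2 : ∀ᶠ s in 𝓝[>] (0 : ℝ), s < t :=
    nhdsWithin_le_nhds (eventually_lt_nhds ht)
  obtain ⟨s, ⟨h3, h4⟩, h5⟩ := ((h1.and h2).and self_mem_nhdsWithin).exists
  have h5' : 0 < s := h5
  refine ⟨s, h5', fun v => ?_⟩
  by_cases hv : a v + t * b v < 0
  · exact h3 v hv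
  · by_cases hb : 0 ≤ b v
    · have := mul_nonneg h5'.le hb
      linarith [ha v]
    · have : s * (-b v) ≤ t * (-b v) := mul_le_mul_of_nonneg_right h4.le (by linarith)
      linarith

/-- The upper end of the segment cut out by a locally finite family of affine inequalities. -/
theorem exists_line_end (hne : ∃ s, ∀ v, 0 ≤ a v + s * b v) (hb : ∃ v, b v < 0)
    (hf : ∀ s, (∀ v, 0 ≤ a v + s * b v) → ∃ t, 0 < t ∧ {v | a v + (s + t) * b v < 0}.Finite) :
    ∃ s, (∀ v, 0 ≤ a v + s * b v) ∧ (∃ v, b v < 0 ∧ a v + s * b v = 0) ∧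
      ∀ v, b v < 0 → ∀ s', (∀ v, 0 ≤ a v + s' * b v) → a v + s' * b v = 0 → s' = s := by
  set I := {s : ℝ | ∀ v, 0 ≤ a v + s * b v} with hI
  have hcl : IsClosed I := by
    have : I = ⋂ v, {s : ℝ | 0 ≤ a v + s * b v} := by ext; simp [hI]
    rw [this]
    exact isClosed_iInter fun v => isClosed_le continuous_const
      (continuous_const.add (continuous_id.mul continuous_const))
  have hbd : BddAbove I := by
    obtain ⟨v, hv⟩ := hb
    refine ⟨a v / (-b v), fun s hs => ?_⟩
    rw [le_div_iff₀ (by linarith)]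
    have := hs v
    linarith
  have hmem : sSup I ∈ I := hcl.csSup_mem hne hbd
  refine ⟨sSup I, hmem, ?_, ?_⟩
  · by_contra hcon
    push Not at hcon
    obtain ⟨t, ht, hF⟩ := hf _ hmem
    obtain ⟨s, hs, hs'⟩ := exists_step (a := fun v => a v + sSup I * b v) (b := b) hmem
      (fun v hv => le_of_not_gt fun h => hcon v h hv) ht
      (hF.subset fun v hv => by
        have hv' : a v + sSup I * b v + t * b v < 0 := hv
        change a v + (sSup I + t) * b v < 0
        linarith)
    have : sSup I + s ∈ I := fun v => by
      linarith [hs' v]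
    linarith [le_csSup hbd this]
  · intro v hv s' hs' h0
    refine le_antisymm (le_csSup hbd hs') ?_
    have h1 := hmem v
    by_contra hlt
    push Not at hlt
    have := mul_pos_of_neg_of_neg (show s' - sSup I < 0 by linarith) hv
    linarith

end Line

section Sdet

open Module

variable {N : ℕ}

/-- The orientation sign of a list of `N` vectors. -/
noncomputable def sd (l : List (Fin N → ℝ)) : ℚ :=
  if h : l.length = N then
    ((SignType.sign (Matrix.of fun i : Fin N => l.get (i.cast h.symm)).det : ℤ) : ℚ) else 0

lemma sd_ofFn (x : Fin N → Fin N → ℝ) :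
    sd (List.ofFn x) = ((SignType.sign (Matrix.of x).det : ℤ) : ℚ) := by
  rw [sd, dif_pos (by simp)]
  congr 4
  ext i j
  simp

lemma sd_of_length {l : List (Fin N → ℝ)} (h : l.length ≠ N) : sd l = 0 := dif_neg h

lemma linearIndependent_of_det {x : Fin N → Fin N → ℝ} (h : (Matrix.of x).det ≠ 0) :
    LinearIndependent ℝ x :=
  Matrix.linearIndependent_rows_of_isUnit (A := Matrix.of x)
    ((Matrix.isUnit_iff_isUnit_det _).mpr (isUnit_iff_ne_zero.mpr h))

lemma det_ne_zero_of_linearIndependent {x : Fin N → Fin N → ℝ} (h : LinearIndependent ℝ x) :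
    (Matrix.of x).det ≠ 0 :=
  isUnit_iff_ne_zero.mp ((Matrix.isUnit_iff_isUnit_det _).mp
    ((Matrix.linearIndependent_rows_iff_isUnit (A := Matrix.of x)).mp h))

lemma dual_eq_zero_of_det {x : Fin N → Fin N → ℝ} (h : (Matrix.of x).det ≠ 0)
    {w : Dual ℝ (Fin N → ℝ)} (hw : ∀ i, w (x i) = 0) : w = 0 := by
  have h1 := (linearIndependent_of_det h).span_eq_top_of_card_eq_finrank' (by simp)
  refine LinearMap.ext_on_range h1 fun i => by simp [hw i]

end Sdet

end Eis

namespace Eis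

open Module Function

variable {L : Type*} {N : ℕ}

/-- Functionals bounded below by `ω` on all vertices. -/
def RR {V : Type*} [AddCommGroup V] [Module ℝ V] (ι : L → V) (ω : L → ℝ) : Set (Dual ℝ V) :=
  {u | ∀ v, ω v ≤ u (ι v)}

open Classical in
/-- The signed indicator of the lists of facets meeting in a vertex of `RR ι ω`. -/
noncomputable def cf (ι : L → Fin N → ℝ) (ω : L → ℝ) (l : List L) : ℚ :=
  if ∃ u ∈ RR ι ω, ∀ v ∈ l, u (ι v) = ω v then sd (l.map ι) else 0

/-- Conditions making `RR ι ω` a simple, locally finite polyhedron. -/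
structure Simple {V : Type*} [AddCommGroup V] [Module ℝ V] (ι : L → V) (ω : L → ℝ)
    (r : Setoid L) : Prop where
  inv : ∀ a b, r a b → ι a = ι b
  invω : ∀ a b, r a b → ω a = ω b
  ind : ∀ (m : ℕ) (x : Fin m → L), (∃ u ∈ RR ι ω, ∀ i, u (ι (x i)) = ω (x i)) →
    Pairwise (fun i j => ¬ r (x i) (x j)) → LinearIndependent ℝ (ι ∘ x)
  lf : ∀ u ∈ RR ι ω, ∀ d : Dual ℝ V, ∃ t : ℝ, 0 < t ∧ {v | (u + t • d) (ι v) < ω v}.Finite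

lemma isAlt_sd (ι : L → Fin N → ℝ) : IsAlt fun l : List L => sd (l.map ι) := by
  intro m x π
  simp only [List.map_ofFn]
  by_cases h : m = N
  · subst h
    rw [sd_ofFn, sd_ofFn]
    have : (Matrix.of (ι ∘ x ∘ π)) = (Matrix.of (ι ∘ x)).submatrix π id := rfl
    rw [this, Matrix.det_permute]
    rcases Int.units_eq_one_or (Equiv.Perm.sign π) with h | h <;> simp [h, Left.sign_neg]
  · rw [sd_of_length (by simpa), sd_of_length (by simpa), mul_zero]

lemma mem_ofFn_comp {m : ℕ} (x : Fin m → L) (π : Equiv.Perm (Fin m)) (v : L) :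
    v ∈ List.ofFn (x ∘ π) ↔ v ∈ List.ofFn x := by
  simp only [List.mem_ofFn', Set.mem_range, Function.comp]
  exact ⟨fun ⟨i, hi⟩ => ⟨_, hi⟩, fun ⟨i, hi⟩ => ⟨π.symm i, by simpa using hi⟩⟩

lemma isAlt_cf (ι : L → Fin N → ℝ) (ω : L → ℝ) : IsAlt (cf ι ω) := by
  intro m x π
  have e : (∃ u ∈ RR ι ω, ∀ v ∈ List.ofFn (x ∘ π), u (ι v) = ω v) ↔
      ∃ u ∈ RR ι ω, ∀ v ∈ List.ofFn x, u (ι v) = ω v := by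
    simp only [mem_ofFn_comp x π]
  by_cases hh : ∃ u ∈ RR ι ω, ∀ v ∈ List.ofFn x, u (ι v) = ω v
  · rw [cf, cf, if_pos hh, if_pos (e.mpr hh)]
    exact isAlt_sd ι m x π
  · rw [cf, cf, if_neg hh, if_neg (mt e.mp hh), mul_zero]

/-- The linear form completing `M` vectors to a determinant. -/
noncomputable def cof {M : ℕ} (y : Fin M → Fin (M + 1) → ℝ) : Dual ℝ (Fin (M + 1) → ℝ) :=
  (Matrix.detRowAlternating (n := Fin (M + 1)) (R := ℝ)).toMultilinearMap.toLinearMap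
    (Fin.cons 0 y) 0

lemma cof_apply {M : ℕ} (y : Fin M → Fin (M + 1) → ℝ) (z : Fin (M + 1) → ℝ) :
    cof y z = (Matrix.of (Fin.cons z y : Fin (M + 1) → Fin (M + 1) → ℝ)).det := by
  change Matrix.det (update (Fin.cons 0 y : Fin (M + 1) → Fin (M + 1) → ℝ) 0 z) = _
  rw [Fin.update_cons_zero]
  rfl

lemma cof_self {M : ℕ} (y : Fin M → Fin (M + 1) → ℝ) (i : Fin M) : cof y (y i) = 0 := by
  rw [cof_apply]
  exact Matrix.det_zero_of_row_eq (i := 0) (j := i.succ) (Fin.succ_ne_zero i).symm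
    (by ext; simp)

lemma sd_cons {M : ℕ} (y : Fin M → Fin (M + 1) → ℝ) (z : Fin (M + 1) → ℝ) :
    sd (z :: List.ofFn y) = ((SignType.sign (cof y z) : ℤ) : ℚ) := by
  rw [cof_apply, ← sd_ofFn, List.ofFn_cons]

theorem finsum_cf {M : ℕ} {ι : L → Fin (M + 1) → ℝ} {ω : L → ℝ} {r : Setoid L}
    (h : Simple ι ω r) {w : ℕ} (hw : ∀ v, {v' | r v v'}.Finite ∧ {v' | r v v'}.ncard = w)
    (y : Fin M → L)
    (hy : ∀ d : Dual ℝ (Fin (M + 1) → ℝ), d ≠ 0 → (∀ i, d (ι (y i)) = 0) → ∃ v, d (ι v) < 0) :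
    ∑ᶠ v, cf ι ω (v :: List.ofFn y) = 0 := by
  set d := cof (ι ∘ y) with hd
  have hval : ∀ v, cf ι ω (v :: List.ofFn y) ≠ 0 → d (ι v) ≠ 0 ∧
      ∃ u ∈ RR ι ω, u (ι v) = ω v ∧ ∀ i, u (ι (y i)) = ω (y i) := by
    intro v hv
    unfold cf at hv
    split_ifs at hv with hu
    · rw [List.map_cons, List.map_ofFn, sd_cons] at hv
      refine ⟨fun h0 => hv (by rw [← hd, h0]; simp), ?_⟩
      obtain ⟨u, hu, hu'⟩ := hu
      exact ⟨u, hu, hu' v (by simp), fun i => hu' _ (by simp)⟩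
    · exact absurd rfl hv
  by_cases hall : ∀ v, cf ι ω (v :: List.ofFn y) = 0
  · simp [hall]
  push Not at hall
  obtain ⟨v₀, hv₀⟩ := hall
  obtain ⟨hd₀, u₀, hu₀, hu₁, hu₂⟩ := hval v₀ hv₀
  have hdne : d ≠ 0 := fun h0 => hd₀ (by rw [h0]; rfl)
  have hdy : ∀ i, d (ι (y i)) = 0 := fun i => cof_self (ι ∘ y) i
  have hdet : (Matrix.of (Fin.cons (ι v₀) (ι ∘ y) : Fin (M + 1) → Fin (M + 1) → ℝ)).det ≠ 0 := by
    rwa [← cof_apply]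
  have hline : ∀ u : Dual ℝ (Fin (M + 1) → ℝ), (∀ i, u (ι (y i)) = ω (y i)) →
      ∃ s : ℝ, u = u₀ + s • d := by
    intro u hu
    refine ⟨(u - u₀) (ι v₀) / d (ι v₀), sub_eq_zero.mp ?_⟩
    refine dual_eq_zero_of_det hdet fun i => ?_
    refine Fin.cases ?_ (fun i => ?_) i
    · simp only [Fin.cons_zero, LinearMap.sub_apply, LinearMap.add_apply, LinearMap.smul_apply,
        smul_eq_mul]
      field_simp
      ring
    · simp [hu i, hu₂ i, hdy i]
  have hmem : ∀ s : ℝ, u₀ + s • d ∈ RR ι ω ↔ ∀ v, 0 ≤ (u₀ (ι v) - ω v) + s * d (ι v) := by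
    intro s
    refine forall_congr' fun v => ?_
    simp only [LinearMap.add_apply, LinearMap.smul_apply, smul_eq_mul]
    constructor <;> intro <;> linarith
  have hlf : ∀ d' : Dual ℝ (Fin (M + 1) → ℝ), ∀ s : ℝ,
      (∀ v, 0 ≤ (u₀ (ι v) - ω v) + s * d' (ι v)) →
      ∃ t, 0 < t ∧ {v | (u₀ (ι v) - ω v) + (s + t) * d' (ι v) < 0}.Finite := by
    intro d' s hs
    obtain ⟨t, ht, hF⟩ := h.lf (u₀ + s • d') (fun v => by
      have := hs v
      simp only [LinearMap.add_apply, LinearMap.smul_apply, smul_eq_mul]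
      linarith) d'
    refine ⟨t, ht, hF.subset fun v hv => ?_⟩
    have hv' : (u₀ (ι v) - ω v) + (s + t) * d' (ι v) < 0 := hv
    change (u₀ + s • d' + t • d') (ι v) < ω v
    simp only [LinearMap.add_apply, LinearMap.smul_apply, smul_eq_mul]
    linarith
  have h0 : ∀ v, 0 ≤ u₀ (ι v) - ω v := fun v => sub_nonneg.mpr (hu₀ v)
  obtain ⟨s₁, hs₁, ⟨v₁, hv₁, hv₁'⟩, huniq₁⟩ := exists_line_end
    (a := fun v => u₀ (ι v) - ω v) (b := fun v => d (ι v)) ⟨0, by simpa using h0⟩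
    (hy d hdne hdy) (hlf d)
  obtain ⟨s₂, hs₂, ⟨v₂, hv₂, hv₂'⟩, huniq₂⟩ := exists_line_end
    (a := fun v => u₀ (ι v) - ω v) (b := fun v => (-d) (ι v)) ⟨0, by simpa using h0⟩
    (hy (-d) (neg_ne_zero.mpr hdne) (fun i => by simp [hdy i])) (hlf (-d))
  have hyind : ∀ i j, i ≠ j → ¬ r (y i) (y j) := fun i j hij hr => by
    have := (linearIndependent_of_det hdet).injective.ne
      (show i.succ ≠ j.succ from fun e => hij (Fin.succ_injective _ e))
    exact this (by simpa using h.inv _ _ hr)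
  have hpair : ∀ v v', d (ι v) ≠ 0 → d (ι v') ≠ 0 → ∀ u ∈ RR ι ω,
      (∀ i, u (ι (y i)) = ω (y i)) → u (ι v) = ω v → u (ι v') = ω v' → r v v' := by
    intro v v' hv hv' u hu h1 h2 h3
    by_contra hr
    have hy' : ∀ v, d (ι v) ≠ 0 → ∀ i, ¬ r v (y i) ∧ ¬ r (y i) v := fun v hv i =>
      ⟨fun e => hv (by rw [h.inv _ _ e, hdy]), fun e => hv (by rw [← h.inv _ _ e, hdy])⟩
    have := h.ind (M + 2) (Fin.cons v (Fin.cons v' y : Fin (M + 1) → L)) ⟨u, hu, fun i => by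
      refine Fin.cases h2 (fun i => ?_) i
      refine Fin.cases h3 (fun i => ?_) i
      simpa using h1 i⟩ (fun i j hij => by
        revert hij
        refine Fin.cases ?_ (fun i => ?_) i <;> refine Fin.cases ?_ (fun j => ?_) j
        · simp
        · intro _
          refine Fin.cases ?_ (fun j => ?_) j
          · simpa using hr
          · simpa using (hy' v hv j).1
        · intro _
          refine Fin.cases ?_ (fun i => ?_) i
          · simpa using fun e => hr (r.symm e)
          · simpa using (hy' v hv i).2
        · refine Fin.cases ?_ (fun i => ?_) i <;> refine Fin.cases ?_ (fun j => ?_) j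
          · simp
          · intro _
            simpa using (hy' v' hv' j).1
          · intro _
            simpa using (hy' v' hv' i).2
          · intro hij
            simpa using hyind i j (fun e => hij (by rw [e])))
    have hc := this.fintype_card_le_finrank
    simp at hc
  have hu_s₁ : u₀ + s₁ • d ∈ RR ι ω := (hmem s₁).mpr hs₁
  have hu_s₂ : u₀ + (-s₂) • d ∈ RR ι ω := (hmem _).mpr fun v => by
    have := hs₂ v
    simp only [LinearMap.neg_apply] at this
    linarith
  have huy : ∀ (s : ℝ) i, (u₀ + s • d) (ι (y i)) = ω (y i) := fun s i => by
    simp [hu₂ i, hdy i]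
  have hcl : ∀ (s : ℝ) v, u₀ + s • d ∈ RR ι ω → d (ι v) ≠ 0 → (u₀ + s • d) (ι v) = ω v →
      {v' | r v v'} = {v' | d (ι v') ≠ 0 ∧ (u₀ + s • d) (ι v') = ω v'} := by
    intro s v h1 h2 h3
    ext v'
    constructor
    · intro hr
      have hr' : r v v' := hr
      exact ⟨by rwa [← h.inv _ _ hr'], by rw [← h.inv _ _ hr', ← h.invω _ _ hr', h3]⟩
    · rintro ⟨h4, h5⟩
      exact hpair v v' h2 h4 _ h1 (huy s) h3 h5
  simp only [LinearMap.neg_apply] at hv₂ hv₂' huniq₂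
  have hT₁ := hcl s₁ v₁ hu_s₁ hv₁.ne (by
    simp only [LinearMap.add_apply, LinearMap.smul_apply, smul_eq_mul]; linarith)
  have hT₂ := hcl (-s₂) v₂ hu_s₂ (neg_lt_zero.mp hv₂).ne' (by
    simp only [LinearMap.add_apply, LinearMap.smul_apply, smul_eq_mul]; linarith)
  have hform : ∀ v, cf ι ω (v :: List.ofFn y) =
      Set.indicator {v' | r v₂ v'} 1 v - Set.indicator {v' | r v₁ v'} 1 v := by
    intro v
    have hcf : ∀ s : ℝ, u₀ + s • d ∈ RR ι ω → (u₀ + s • d) (ι v) = ω v →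
        cf ι ω (v :: List.ofFn y) = ((SignType.sign (d (ι v)) : ℤ) : ℚ) := by
      intro s h1 h2
      rw [cf, if_pos, List.map_cons, List.map_ofFn, sd_cons]
      refine ⟨_, h1, fun v' hv' => ?_⟩
      rcases List.mem_cons.mp hv' with rfl | hv'
      · exact h2
      · obtain ⟨i, rfl⟩ := (List.mem_ofFn' _ _).mp hv'
        exact huy s i
    by_cases r₁ : r v₁ v
    · have hdv : d (ι v) < 0 := by rwa [← h.inv _ _ r₁]
      have r₂ : ¬ r v₂ v := fun e => by
        rw [h.inv _ _ e] at hv₂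
        linarith
      have h1 : v ∈ {v' | r v₁ v'} := r₁
      have h2 : v ∉ {v' | r v₂ v'} := r₂
      rw [Set.indicator_of_mem h1, Set.indicator_of_notMem h2]
      rw [hT₁] at h1
      rw [hcf s₁ hu_s₁ h1.2, sign_neg hdv]
      simp
    · have h1 : v ∉ {v' | r v₁ v'} := r₁
      rw [Set.indicator_of_notMem h1]
      by_cases r₂ : r v₂ v
      · have hdv : 0 < d (ι v) := by
          rw [← h.inv _ _ r₂]
          linarith
        have h2 : v ∈ {v' | r v₂ v'} := r₂
        rw [Set.indicator_of_mem h2]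
        rw [hT₂] at h2
        rw [hcf (-s₂) hu_s₂ h2.2, sign_pos hdv]
        simp
      · have h2 : v ∉ {v' | r v₂ v'} := r₂
        rw [Set.indicator_of_notMem h2, sub_zero]
        by_contra hne
        obtain ⟨hdv, u, hu, huv, huy'⟩ := hval v hne
        obtain ⟨s, rfl⟩ := hline u huy'
        have hmem' := (hmem s).mp hu
        have huv' : u₀ (ι v) - ω v + s * d (ι v) = 0 := by
          simp only [LinearMap.add_apply, LinearMap.smul_apply, smul_eq_mul] at huv
          linarith
        rcases lt_or_gt_of_ne hdv with hlt | hgt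
        · rw [huniq₁ v hlt s hmem' huv'] at huv
          rw [hT₁] at h1
          exact h1 ⟨hdv, huv⟩
        · have := huniq₂ v (by linarith) (-s) (fun v => by linarith [hmem' v]) (by linarith)
          rw [hT₂, ← this, neg_neg] at h2
          exact h2 ⟨hdv, huv⟩
  have hcard : ∀ v, ∑ᶠ v', Set.indicator {v' | r v v'} (1 : L → ℚ) v' = w := by
    intro v
    rw [← (hw v).2, Set.ncard_eq_toFinset_card _ (hw v).1, ← finsum_mem_def,
      finsum_mem_eq_finite_toFinset_sum _ (hw v).1]
    simp
  simp only [hform]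
  rw [finsum_sub_distrib ((hw v₂).1.subset Set.support_indicator_subset)
    ((hw v₁).1.subset Set.support_indicator_subset), hcard, hcard, sub_self]

end Eis

namespace Eis

open Module Function

variable {N : ℕ}

/-- `p` is a positive combination of the entries of the list. -/
def Cn {V : Type*} [AddCommGroup V] [Module ℝ V] (p : V) (l : List V) : Prop :=
  ∃ c : V → ℝ, (∀ z ∈ l, 0 < c z) ∧ (l.map fun z => c z • z).sum = p

lemma Cn_ofFn {V : Type*} [AddCommGroup V] [Module ℝ V] (p : V) {m : ℕ} {z : Fin m → V}
    (hz : Injective z) : Cn p (List.ofFn z) ↔ ∃ c : Fin m → ℝ, (∀ i, 0 < c i) ∧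
      ∑ i, c i • z i = p := by
  constructor
  · rintro ⟨c, h1, h2⟩
    refine ⟨c ∘ z, fun i => h1 _ ((List.mem_ofFn' _ _).mpr ⟨i, rfl⟩), ?_⟩
    rw [← h2, List.map_ofFn, List.sum_ofFn]
    rfl
  · rintro ⟨c, h1, h2⟩
    refine ⟨extend z c 0, fun w hw => ?_, ?_⟩
    · obtain ⟨i, rfl⟩ := (List.mem_ofFn' _ _).mp hw
      rw [hz.extend_apply]
      exact h1 i
    · rw [← h2, List.map_ofFn, List.sum_ofFn]
      simp [hz.extend_apply]

open Classical in
/-- The signed indicator of the simplicial cones containing `p`. -/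
noncomputable def gp (p : Fin N → ℝ) (l : List (Fin N → ℝ)) : ℚ := if Cn p l then sd l else 0

lemma isAlt_gp (p : Fin N → ℝ) : IsAlt (gp p) := by
  intro m x π
  have e : Cn p (List.ofFn (x ∘ π)) ↔ Cn p (List.ofFn x) := by
    refine exists_congr fun c => ?_
    simp only [mem_ofFn_comp x π, List.map_ofFn, List.sum_ofFn, comp_apply]
    rw [Equiv.sum_comp π fun i => c (x i) • x i]
  have h := isAlt_sd id m x π
  simp only [List.map_id] at h
  by_cases hh : Cn p (List.ofFn x)
  · rw [gp, gp, if_pos hh, if_pos (e.mpr hh), h]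
  · rw [gp, gp, if_neg hh, if_neg (mt e.mp hh), mul_zero]

lemma gp_of_length (p : Fin N → ℝ) {l : List (Fin N → ℝ)} (h : l.length ≠ N) : gp p l = 0 := by
  rw [gp, sd_of_length h, ite_self]

lemma sum_minors (z : Fin (N + 1) → Fin N → ℝ) :
    ∑ i : Fin (N + 1), ((-1) ^ (i : ℕ) * (Matrix.of (z ∘ i.succAbove)).det) • z i = 0 := by
  ext j
  have h : (Matrix.of fun i : Fin (N + 1) => (Fin.cons (z i j) (z i) : Fin (N + 1) → ℝ)).det = 0 :=
    Matrix.det_zero_of_column_eq (i := 0) (j := j.succ) (Fin.succ_ne_zero j).symm (by simp)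
  rw [Matrix.det_succ_column_zero] at h
  rw [Finset.sum_apply, Pi.zero_apply, ← h]
  refine Finset.sum_congr rfl fun i _ => ?_
  have : (Matrix.of fun i : Fin (N + 1) => (Fin.cons (z i j) (z i) : Fin (N + 1) → ℝ)).submatrix
      i.succAbove Fin.succ = Matrix.of (z ∘ i.succAbove) := by
    ext a b
    simp
  rw [this]
  simp
  ring

theorem dl_gp_ofFn {p : Fin N → ℝ} {z : Fin (N + 1) → Fin N → ℝ}
    (hgen : ∀ i j, i ≠ j → p ∉ Submodule.span ℝ (z '' {k | k ≠ i ∧ k ≠ j}))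
    (τ : Dual ℝ (Fin N → ℝ)) (hτ : ∀ i, 0 < τ (z i)) : dl (gp p) (List.ofFn z) = 0 := by
  rw [dl_ofFn]
  set κ : Fin (N + 1) → ℝ := fun i => (-1) ^ (i : ℕ) * (Matrix.of (z ∘ i.succAbove)).det with hκ
  have hker : ∑ i, κ i • z i = 0 := sum_minors z
  have hsd : ∀ i : Fin (N + 1), (-1 : ℚ) ^ (i : ℕ) * sd (List.ofFn (z ∘ i.succAbove)) =
      ((SignType.sign (κ i) : ℤ) : ℚ) := by
    intro i
    rw [sd_ofFn, hκ]
    rcases neg_one_pow_eq_or ℝ (i : ℕ) with h | h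
    · have : (-1 : ℚ) ^ (i : ℕ) = 1 := by exact_mod_cast h
      simp [h, this]
    · have : (-1 : ℚ) ^ (i : ℕ) = -1 := by exact_mod_cast h
      simp [h, this, Left.sign_neg]
  have hex : ∀ i : Fin (N + 1), gp p (List.ofFn (z ∘ i.succAbove)) ≠ 0 → κ i ≠ 0 ∧
      ∃ c : Fin (N + 1) → ℝ, c i = 0 ∧ (∀ j, 0 ≤ c j) ∧ ∑ j, c j • z j = p := by
    intro i hi
    unfold gp at hi
    split_ifs at hi with hC
    · have hdet : (Matrix.of (z ∘ i.succAbove)).det ≠ 0 := fun h0 => hi (by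
        rw [sd_ofFn, h0]
        simp)
      refine ⟨mul_ne_zero (pow_ne_zero _ (by norm_num)) hdet, ?_⟩
      obtain ⟨c, h1, h2⟩ := (Cn_ofFn p (linearIndependent_of_det hdet).injective).mp hC
      refine ⟨i.insertNth 0 c, by simp, fun j => ?_, ?_⟩
      · refine Fin.succAboveCases i ?_ (fun j => ?_) j
        · simp
        · simpa using (h1 j).le
      · rw [Fin.sum_univ_succAbove _ i]
        simpa using h2
    · exact absurd rfl hi
  by_cases hall : ∀ i : Fin (N + 1), gp p (List.ofFn (z ∘ i.succAbove)) = 0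
  · exact Finset.sum_eq_zero fun i _ => by rw [hall i, mul_zero]
  push Not at hall
  obtain ⟨i₀, hi₀⟩ := hall
  obtain ⟨hκ₀, a, ha₀, ha, hap⟩ := hex i₀ hi₀
  have hdet₀ : (Matrix.of (z ∘ i₀.succAbove)).det ≠ 0 := right_ne_zero_of_mul hκ₀
  have hline : ∀ c : Fin (N + 1) → ℝ, ∑ j, c j • z j = p → ∃ s : ℝ, ∀ j, c j = a j + s * κ j := by
    intro c hc
    set s := c i₀ / κ i₀
    refine ⟨s, fun j => ?_⟩
    have h0 : ∑ j, (c j - a j - s * κ j) • z j = 0 := by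
      simp only [sub_smul, mul_smul, Finset.sum_sub_distrib, ← Finset.smul_sum]
      rw [hc, hap, hker]
      simp
    have hs : c i₀ - a i₀ - s * κ i₀ = 0 := by
      rw [ha₀, div_mul_cancel₀ _ hκ₀]
      ring
    rw [Fin.sum_univ_succAbove _ i₀, hs, zero_smul, zero_add] at h0
    have hind := Fintype.linearIndependent_iff.mp (linearIndependent_of_det hdet₀) _ h0
    refine Fin.succAboveCases i₀ ?_ (fun j => ?_) j
    · linarith
    · linarith [hind j]
  have hsum : ∀ s : ℝ, ∑ j, (a j + s * κ j) • z j = p := by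
    intro s
    simp only [add_smul, mul_smul, Finset.sum_add_distrib, ← Finset.smul_sum]
    rw [hker, hap]
    simp
  have huniq : ∀ s : ℝ, ∀ i j, a i + s * κ i = 0 → a j + s * κ j = 0 → i = j := by
    intro s i j hi hj
    by_contra hij
    refine hgen i j hij ?_
    rw [← hsum s]
    refine Submodule.sum_mem _ fun k _ => ?_
    by_cases hk : k ≠ i ∧ k ≠ j
    · exact Submodule.smul_mem _ _ (Submodule.subset_span ⟨k, hk, rfl⟩)
    · have : a k + s * κ k = 0 := by
        by_cases hki : k = i
        · rw [hki, hi]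
        · rw [show k = j by tauto, hj]
      rw [this, zero_smul]
      exact Submodule.zero_mem _
  have hτκ : ∑ i, κ i * τ (z i) = 0 := by
    have := congrArg τ hker
    simpa using this
  have hneg : ∃ i, κ i < 0 := by
    by_contra hcon
    push Not at hcon
    have := (Finset.sum_eq_zero_iff_of_nonneg fun i _ => mul_nonneg (hcon i) (hτ i).le).mp hτκ i₀
      (Finset.mem_univ _)
    exact (mul_ne_zero hκ₀ (hτ i₀).ne') this
  have hpos : ∃ i, -κ i < 0 := by
    by_contra hcon
    push Not at hcon
    have := (Finset.sum_eq_zero_iff_of_nonneg fun i _ => mul_nonneg (hcon i) (hτ i).le).mp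
      (by simpa using hτκ) i₀ (Finset.mem_univ _)
    exact (mul_ne_zero (neg_ne_zero.mpr hκ₀) (hτ i₀).ne') this
  obtain ⟨s₁, hs₁, ⟨v₁, hv₁, hv₁'⟩, hu₁⟩ := exists_line_end (a := a) (b := κ) ⟨0, by simpa using ha⟩
    hneg fun s _ => ⟨1, one_pos, Set.toFinite _⟩
  obtain ⟨s₂, hs₂, ⟨v₂, hv₂, hv₂'⟩, hu₂⟩ := exists_line_end (a := a) (b := fun i => -κ i)
    ⟨0, by simpa using ha⟩ hpos fun s _ => ⟨1, one_pos, Set.toFinite _⟩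
  have hval : ∀ (s : ℝ) (i : Fin (N + 1)), (∀ j, 0 ≤ a j + s * κ j) → a i + s * κ i = 0 → κ i ≠ 0 →
      (-1 : ℚ) ^ (i : ℕ) * gp p (List.ofFn (z ∘ i.succAbove)) =
        ((SignType.sign (κ i) : ℤ) : ℚ) := by
    intro s i h1 h2 h3
    rw [gp, if_pos, hsd]
    refine (Cn_ofFn p (linearIndependent_of_det (right_ne_zero_of_mul h3)).injective).mpr
      ⟨fun j => a (i.succAbove j) + s * κ (i.succAbove j), fun j => ?_, ?_⟩
    · refine lt_of_le_of_ne (h1 _) fun h => ?_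
      exact Fin.succAbove_ne i j (huniq s _ _ h.symm h2)
    · have := hsum s
      rw [Fin.sum_univ_succAbove _ i, h2, zero_smul, zero_add] at this
      exact this
  have hform : ∀ i : Fin (N + 1), (-1 : ℚ) ^ (i : ℕ) * gp p (List.ofFn (z ∘ i.succAbove)) =
      (if i = v₂ then 1 else 0) - (if i = v₁ then 1 else 0) := by
    intro i
    by_cases h1 : i = v₁
    · subst h1
      rw [hval s₁ _ hs₁ hv₁' hv₁.ne, sign_neg hv₁, if_neg, if_pos rfl]
      · simp
      · rintro rfl
        linarith
    · rw [if_neg h1, sub_zero]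
      by_cases h2 : i = v₂
      · subst h2
        rw [hval (-s₂) _ (fun j => by linarith [hs₂ j]) (by linarith) (neg_lt_zero.mp hv₂).ne',
          sign_pos (neg_lt_zero.mp hv₂), if_pos rfl]
        simp
      · rw [if_neg h2]
        by_contra hne
        obtain ⟨hκi, c, hc0, hc, hcp⟩ := hex i (right_ne_zero_of_mul hne)
        obtain ⟨s, hs⟩ := hline c hcp
        rcases lt_or_gt_of_ne hκi with hlt | hgt
        · have := hu₁ i hlt s (fun j => by rw [← hs]; exact hc j) (by rw [← hs, hc0])
          subst this
          exact h1 (huniq s _ _ (by rw [← hs, hc0]) hv₁')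
        · have := hu₂ i (by linarith) (-s) (fun j => by rw [neg_mul_neg, ← hs]; exact hc j)
            (by rw [neg_mul_neg, ← hs, hc0])
          subst this
          exact h2 (huniq s _ _ (by rw [← hs, hc0]) (by linarith))
  rw [Finset.sum_congr rfl fun i _ => hform i]
  simp

end Eis

namespace Eis

open Module Function

variable {L : Type*} {N : ℕ}

/-- `p` lies in no span of fewer than `N` vertices. -/
def Genr (ι : L → Fin N → ℝ) (p : Fin N → ℝ) : Prop :=
  ∀ T : Finset L, T.card < N → p ∉ Submodule.span ℝ (ι '' T)

/-- The cochain counting simplicial cones that contain `p`. -/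
noncomputable def fp (ι : L → Fin N → ℝ) (p : Fin N → ℝ) (l : List L) : ℚ := gp p (l.map ι)

lemma dl_fp {ι : L → Fin N → ℝ} {p : Fin N → ℝ} (hp : Genr ι p) {τ : Dual ℝ (Fin N → ℝ)}
    (hτ : ∀ v, 0 < τ (ι v)) : dl (fp ι p) = 0 := by
  classical
  ext l
  rw [show fp ι p = fun l => gp p (l.map ι) from rfl, dl_map]
  obtain ⟨x, hx⟩ := exists_ofFn l
  rcases Nat.eq_zero_or_pos l.length with h0 | h0
  · obtain rfl := List.length_eq_zero_iff.mp h0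
    simp [dl_apply, bd]
  obtain ⟨m, hm⟩ := Nat.exists_eq_succ_of_ne_zero h0.ne'
  generalize l.length = k at x hm
  subst hm hx
  change dl (gp p) (List.map ι (List.ofFn x)) = 0
  rw [List.map_ofFn]
  by_cases hmN : m = N
  · subst hmN
    refine dl_gp_ofFn (fun i j hij hmem => ?_) τ fun i => hτ _
    refine hp ((Finset.univ.filter fun k => k ≠ i ∧ k ≠ j).image x) ?_ ?_
    · refine lt_of_le_of_lt Finset.card_image_le ?_
      have h1 : Finset.univ.filter (fun k : Fin (m + 1) => k ≠ i ∧ k ≠ j) =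
          (Finset.univ.erase i).erase j := by ext; simp [and_comm]
      rw [h1, Finset.card_erase_of_mem (by simpa using hij.symm), Finset.card_erase_of_mem
        (by simp)]
      have := Fin.pos i
      simp only [Finset.card_univ, Fintype.card_fin]
      have : (i : ℕ) ≠ j := fun h => hij (Fin.ext h)
      omega
    · have : ι '' ((Finset.univ.filter fun k => k ≠ i ∧ k ≠ j).image x : Finset L) =
          (ι ∘ x) '' {k | k ≠ i ∧ k ≠ j} := by
        rw [Finset.coe_image, ← Set.image_comp]
        simp
      rwa [this]
  · rw [dl_ofFn]
    exact Finset.sum_eq_zero fun i _ => by rw [gp_of_length _ (by simpa), mul_zero]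

lemma fp_mem_EE {ι : L → Fin N → ℝ} {p : Fin N → ℝ} {X : Set (Fin N → ℝ)} {r : Setoid L}
    (hι : ∀ a b, r a b → ι a = ι b) (hp : p ∈ X) : fp ι p ∈ EE ι X r N := by
  refine ⟨fun l hl => gp_of_length _ (by simpa), fun m x π => ?_, fun l l' hl => ?_, {p},
    Set.finite_singleton p, by simpa, ?_⟩
  · have := isAlt_gp p m (ι ∘ x) π
    change gp p (List.map ι (List.ofFn (x ∘ π))) = _ * gp p (List.map ι (List.ofFn x))
    rw [List.map_ofFn, List.map_ofFn]
    exact this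
  · have : l.map ι = l'.map ι := by
      induction hl with
      | nil => rfl
      | cons h _ ih => simp [hι _ _ h, ih]
    rw [fp, fp, this]
  · rintro l ⟨u, hu, hul⟩
    rw [fp, gp, if_neg]
    rintro ⟨c, hc, hsum⟩
    have h1 := hu p rfl
    rw [← hsum, map_list_sum] at h1
    refine absurd h1 (not_lt.mpr (List.sum_nonneg fun t ht => ?_))
    simp only [List.map_map, List.mem_map, comp_apply] at ht
    obtain ⟨a, ha, rfl⟩ := ht
    rw [map_smul, smul_eq_mul]
    exact (mul_pos (hc _ (List.mem_map_of_mem ha)) (hul a ha)).le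

lemma cf_mul_fp_nonneg (ι : L → Fin N → ℝ) (ω : L → ℝ) (p : Fin N → ℝ) (l : List L) :
    0 ≤ cf ι ω l * fp ι p l := by
  unfold cf fp gp
  split_ifs
  · exact mul_self_nonneg _
  all_goals simp

theorem exists_vertex {ι : L → Fin N → ℝ} {ω : L → ℝ} {r : Setoid L} (h : Simple ι ω r)
    {p : Fin N → ℝ} (hp : Genr ι p) (hmin : ∃ u ∈ RR ι ω, ∀ u' ∈ RR ι ω, u p ≤ u' p) :
    ∃ l, cf ι ω l * fp ι p l ≠ 0 := by
  classical
  obtain ⟨u, hu, hmin⟩ := hmin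
  let P : ℕ → Prop := fun m => ∃ x : Fin m → L, (∀ i, u (ι (x i)) = ω (x i)) ∧
    Pairwise fun i j => ¬ r (x i) (x j)
  have hPN : ∀ m, P m → m ≤ N := fun m ⟨x, h1, h2⟩ => by
    have := (h.ind m x ⟨u, hu, h1⟩ h2).fintype_card_le_finrank
    simpa using this
  have hP0 : P 0 := ⟨Fin.elim0, fun i => i.elim0, fun i => i.elim0⟩
  obtain ⟨m, hm, hmax⟩ : ∃ m, P m ∧ ¬ P (m + 1) := by
    by_contra hcon
    push Not at hcon
    have : ∀ m, P m := fun m => by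
      induction m with
      | zero => exact hP0
      | succ m ih => exact hcon m ih
    have := hPN _ (this (N + 1))
    omega
  obtain ⟨x, hx, hpair⟩ := id hm
  have hind := h.ind m x ⟨u, hu, hx⟩ hpair
  have hrel : ∀ v, u (ι v) = ω v → ∃ i, r v (x i) := by
    intro v hv
    by_contra hcon
    push Not at hcon
    refine hmax ⟨Fin.cons v x, fun i => ?_, fun i j hij => ?_⟩
    · refine Fin.cases hv (fun i => ?_) i
      simpa using hx i
    · revert hij
      refine Fin.cases ?_ (fun i => ?_) i <;> refine Fin.cases ?_ (fun j => ?_) j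
      · simp
      · intro _
        simpa using hcon j
      · intro _
        simpa using fun e => hcon i (r.symm e)
      · intro hij
        simpa using hpair fun e => hij (by rw [e])
  have hdir : ∀ d : Dual ℝ (Fin N → ℝ), (∀ i, 0 ≤ d (ι (x i))) → 0 ≤ d p := by
    intro d hd
    obtain ⟨t, ht, hF⟩ := h.lf u hu d
    obtain ⟨s, hs, hs'⟩ := exists_step (a := fun v => u (ι v) - ω v) (b := fun v => d (ι v))
      (fun v => sub_nonneg.mpr (hu v)) (fun v hv => by
        obtain ⟨i, hi⟩ := hrel v (sub_eq_zero.mp hv)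
        rw [h.inv _ _ hi]
        exact hd i) ht (hF.subset fun v hv => by
        have hv' : u (ι v) - ω v + t * d (ι v) < 0 := hv
        change (u + t • d) (ι v) < ω v
        simp only [LinearMap.add_apply, LinearMap.smul_apply, smul_eq_mul]
        linarith)
    have := hmin (u + s • d) fun v => by
      have := hs' v
      simp only [LinearMap.add_apply, LinearMap.smul_apply, smul_eq_mul]
      linarith
    simp only [LinearMap.add_apply, LinearMap.smul_apply, smul_eq_mul] at this
    exact nonneg_of_mul_nonneg_right (by linarith) hs
  have hmem : p ∈ Submodule.span ℝ (Set.range (ι ∘ x)) := by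
    by_contra hcon
    obtain ⟨d, hd, hd'⟩ := Submodule.exists_le_ker_of_notMem hcon
    have hd0 : ∀ i, d (ι (x i)) = 0 := fun i => hd' (Submodule.subset_span ⟨i, rfl⟩)
    have h1 := hdir d fun i => (hd0 i).ge
    have h2 := hdir (-d) fun i => by simp [hd0 i]
    simp only [LinearMap.neg_apply] at h2
    exact hd (le_antisymm (by linarith) h1)
  have hmN : m = N := by
    refine le_antisymm (hPN m hm) (not_lt.mp fun hlt => ?_)
    refine hp (Finset.univ.image x) (lt_of_le_of_lt Finset.card_image_le (by simpa)) ?_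
    rwa [Finset.coe_image, ← Set.image_comp, Finset.coe_univ, Set.image_univ]
  subst hmN
  let b := Basis.mk hind (hind.span_eq_top_of_card_eq_finrank' (by simp)).ge
  have hb : ∀ i, b i = ι (x i) := fun i => by simp [b]
  have hc : ∀ i, 0 < b.coord i p := by
    intro i
    refine lt_of_le_of_ne (hdir _ fun j => ?_) fun h0 => ?_
    · rw [← hb, Basis.coord_apply, Basis.repr_self, Finsupp.single_apply]
      split_ifs <;> norm_num
    · refine hp ((Finset.univ.erase i).image x) (lt_of_le_of_lt Finset.card_image_le ?_) ?_
      · rw [Finset.card_erase_of_mem (Finset.mem_univ i)]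
        simp [Fin.pos i]
      · rw [← b.sum_repr p]
        refine Submodule.sum_mem _ fun j _ => ?_
        by_cases hj : j = i
        · subst hj
          rw [← Basis.coord_apply, ← h0, zero_smul]
          exact Submodule.zero_mem _
        · refine Submodule.smul_mem _ _ (Submodule.subset_span ?_)
          rw [hb]
          exact ⟨x j, by simpa using ⟨j, hj, rfl⟩, rfl⟩
  have hdet := det_ne_zero_of_linearIndependent hind
  have hsd : sd (List.ofFn (ι ∘ x)) ≠ 0 := by
    rw [sd_ofFn]
    rcases lt_or_gt_of_ne hdet with h | h <;> simp [h]
  refine ⟨List.ofFn x, mul_ne_zero ?_ ?_⟩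
  · rw [cf, if_pos, List.map_ofFn]
    · exact hsd
    · refine ⟨u, hu, fun v hv => ?_⟩
      obtain ⟨i, rfl⟩ := (List.mem_ofFn' _ _).mp hv
      exact hx i
  · rw [fp, List.map_ofFn, gp, if_pos]
    · exact hsd
    · refine (Cn_ofFn p hind.injective).mpr ⟨fun i => b.coord i p, hc, ?_⟩
      conv_rhs => rw [← b.sum_repr p]
      simp [hb]

end Eis

namespace Eis

open Finsupp

variable {Γ L : Type*} [Group Γ] [MulAction Γ L] {S : Set (List L)} {M : ℕ}

/-- Equivariant cycles with finitely many orbits of simplices. -/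
structure OrbCycle (Γ : Type*) {L : Type*} [Group Γ] [MulAction Γ L] (S : Set (List L)) (M : ℕ)
    (c : List L → ℚ) : Prop where
  alt : IsAlt c
  inv : ∀ (γ : Γ) x, c (x.map (γ • ·)) = c x
  off : ∀ x ∉ S, c x = 0
  len : ∀ x : List L, x.length ≠ M + 1 → c x = 0
  fin : ∃ F : Set (List L), F.Finite ∧ ∀ x, c x ≠ 0 → ∃ γ : Γ, ∃ y ∈ F, x = y.map (γ • ·)
  sum : ∀ y : Fin M → L, List.ofFn y ∈ S → ∑ᶠ v, c (v :: List.ofFn y) = 0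

lemma insertNth_alt {c : List L → ℚ} (hc : IsAlt c) (i : Fin (M + 1)) (v : L) (y : Fin M → L) :
    c (List.ofFn (i.insertNth v y : Fin (M + 1) → L)) = (-1) ^ (i : ℕ) * c (v :: List.ofFn y) := by
  have h := hc (M + 1) (Fin.cons v y) i.cycleRange
  rw [Fin.cons_comp_cycleRange, Fin.sign_cycleRange, List.ofFn_cons] at h
  rw [h]
  push_cast
  rfl

lemma finsum_face {c h : List L → ℚ} (hc : IsAlt c)
    (hz : ∀ y : Fin M → L, h (List.ofFn y) ≠ 0 → ∑ᶠ v, c (v :: List.ofFn y) = 0) (i : Fin (M + 1))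
    (hf : {z : Fin (M + 1) → L | c (List.ofFn z) ≠ 0 ∧
      h (List.ofFn (z ∘ i.succAbove)) ≠ 0}.Finite) :
    ∑ᶠ z : Fin (M + 1) → L, c (List.ofFn z) * h (List.ofFn (z ∘ i.succAbove)) = 0 := by
  let e : (Fin M → L) × L ≃ (Fin (M + 1) → L) :=
    (Equiv.prodComm _ _).trans (Fin.insertNthEquiv (fun _ => L) i)
  have he : ∀ y v, e (y, v) = i.insertNth v y := fun y v => rfl
  rw [← finsum_comp_equiv e, finsum_curry]
  · rw [finsum_eq_zero_of_forall_eq_zero]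
    intro y
    have e1 : ∀ v, c (List.ofFn (e (y, v))) * h (List.ofFn (e (y, v) ∘ i.succAbove)) =
        c (v :: List.ofFn y) * ((-1) ^ (i : ℕ) * h (List.ofFn y)) := by
      intro v
      have e2 : e (y, v) ∘ i.succAbove = y := by
        ext j
        simp [he]
      rw [e2, he, insertNth_alt hc]
      ring
    rw [finsum_congr e1, ← finsum_mul]
    by_cases hy : h (List.ofFn y) = 0
    · rw [hy, mul_zero, mul_zero]
    · rw [hz y hy, zero_mul]
  · refine (hf.preimage e.injective.injOn).subset fun z hz => ?_
    simp only [Function.mem_support, ne_eq, mul_eq_zero, not_or] at hz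
    exact hz

section Orbits

variable {c : List L → ℚ} {σ : List L → Γ}

lemma reps_finite (hc : OrbCycle Γ S M c) (hσ : ∀ x ∈ S, ∀ γ : Γ, σ (x.map (γ • ·)) = γ * σ x) :
    {x | c x ≠ 0 ∧ σ x = 1}.Finite := by
  obtain ⟨F, hF, hF'⟩ := hc.fin
  refine (hF.image fun y => y.map ((σ y)⁻¹ • ·)).subset ?_
  rintro x ⟨hx, h1⟩
  obtain ⟨γ, y, hy, rfl⟩ := hF' x hx
  have hyS : y ∈ S := by
    by_contra hcon
    exact hx (by rw [hc.inv, hc.off y hcon])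
  rw [hσ y hyS] at h1
  exact ⟨y, hy, by rw [eq_inv_of_mul_eq_one_left h1]⟩

/-- Sum of orbit representatives. -/
noncomputable def reps (hR : {x | c x ≠ 0 ∧ σ x = 1}.Finite) : Ch L :=
  ∑ x ∈ hR.toFinset, single x (c x)

lemma ev_reps (hR : {x | c x ≠ 0 ∧ σ x = 1}.Finite) (f : List L → ℚ) :
    ev f (reps hR) = ∑ x ∈ hR.toFinset, c x * f x := by
  rw [reps, map_sum]
  exact Finset.sum_congr rfl fun x _ => by simp

lemma nm_eq {f : List L → ℚ} (hf : f ∈ FO Γ L) (x : List L) :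
    nm Γ f x = ∑ γ ∈ (hf x).toFinset, f (x.map (γ • ·)) := by
  change tot (orb Γ f x) = _
  rw [tot, Finsupp.linearCombination_apply, Finsupp.sum]
  refine Finset.sum_congr ?_ fun γ _ => by simp [orb_apply hf]
  ext γ
  simp [orb_apply hf]

lemma ev_nm_reps (hc : OrbCycle Γ S M c) (hσ : ∀ x ∈ S, ∀ γ : Γ, σ (x.map (γ • ·)) = γ * σ x)
    (hR : {x | c x ≠ 0 ∧ σ x = 1}.Finite) {f : List L → ℚ} (hf : f ∈ FO Γ L) :
    {x | c x * f x ≠ 0}.Finite ∧ ev (nm Γ f) (reps hR) = ∑ᶠ x, c x * f x := by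
  classical
  have hS : ∀ x, c x ≠ 0 → x ∈ S := fun x hx => by
    by_contra hcon
    exact hx (hc.off x hcon)
  let π : List L → List L := fun x => x.map ((σ x)⁻¹ • ·)
  have hπ : ∀ x, (π x).map (σ x • ·) = x := fun x => by
    rw [map_smul_map, mul_inv_cancel, map_one_smul]
  have hcπ : ∀ x, c (π x) = c x := fun x => hc.inv _ _
  have hσπ : ∀ x ∈ S, σ (π x) = 1 := fun x hx => by rw [hσ x hx, inv_mul_cancel]
  have hfin : {x | c x * f x ≠ 0}.Finite := by
    refine (hR.biUnion fun x _ => (hf x).image fun γ : Γ => x.map (γ • ·)).subset ?_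
    intro x hx
    have hx' : c x * f x ≠ 0 := hx
    have hcx := left_ne_zero_of_mul hx'
    simp only [Set.mem_iUnion]
    refine ⟨π x, ⟨by rwa [hcπ], hσπ x (hS x hcx)⟩, σ x, ?_, hπ x⟩
    change f ((π x).map (σ x • ·)) ≠ 0
    rw [hπ]
    exact right_ne_zero_of_mul hx'
  refine ⟨hfin, ?_⟩
  rw [finsum_eq_sum_of_support_subset (s := hfin.toFinset) _ (by simp [Function.support]),
    ev_reps, ← Finset.sum_fiberwise_of_maps_to (s := hfin.toFinset) (g := π) (t := hR.toFinset)]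
  · refine Finset.sum_congr rfl fun d hd => ?_
    obtain ⟨hd1, hd2⟩ : c d ≠ 0 ∧ σ d = 1 := by simpa using hd
    rw [nm_eq hf, Finset.mul_sum]
    refine Finset.sum_nbij' (fun γ => d.map (γ • ·)) σ ?_ ?_ ?_ ?_ ?_
    · intro γ hγ
      have hγ' : f (d.map (γ • ·)) ≠ 0 := by simpa using hγ
      have e1 := hσ d (hS d hd1) γ
      simp only [Finset.mem_filter, Set.Finite.mem_toFinset]
      refine ⟨?_, ?_⟩
      · change c _ * f _ ≠ 0
        rw [hc.inv]
        exact mul_ne_zero hd1 hγ'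
      · change (d.map (γ • ·)).map ((σ (d.map (γ • ·)))⁻¹ • ·) = d
        rw [map_smul_map, e1, hd2, mul_one, inv_mul_cancel, map_one_smul]
    · intro x hx
      simp only [Finset.mem_filter, Set.Finite.mem_toFinset] at hx
      obtain ⟨hx1, rfl⟩ := hx
      have hx' : c x * f x ≠ 0 := hx1
      simp only [Set.Finite.mem_toFinset]
      change f ((π x).map (σ x • ·)) ≠ 0
      rw [hπ]
      exact right_ne_zero_of_mul hx'
    · intro γ _
      rw [hσ d (hS d hd1), hd2, mul_one]
    · intro x hx
      simp only [Finset.mem_filter] at hx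
      rw [← hx.2, hπ]
    · intro γ _
      rw [hc.inv]
  · intro x hx
    have hx' : c x * f x ≠ 0 := by simpa using hx
    have hcx := left_ne_zero_of_mul hx'
    simp only [Set.Finite.mem_toFinset]
    exact ⟨by rwa [hcπ], hσπ x (hS x hcx)⟩

lemma bd_reps_mem (hc : OrbCycle Γ S M c) (hσ : ∀ x ∈ S, ∀ γ : Γ, σ (x.map (γ • ·)) = γ * σ x)
    (hinv : ∀ x ∈ S, ∀ γ : Γ, x.map (γ • ·) ∈ S)
    (hR : {x | c x ≠ 0 ∧ σ x = 1}.Finite) : bd (reps hR) ∈ JL Γ S := by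
  classical
  by_contra hcon
  obtain ⟨φ, hφ, hφ'⟩ := Submodule.exists_le_ker_of_notMem hcon
  let h : List L → ℚ := fun x => φ (single x 1)
  have hφh : φ = ev h := ch_ext fun l => by simp [h]
  have h1 : ∀ (γ : Γ) x, h (x.map (γ • ·)) = h x := fun γ x => by
    have : φ (single (x.map (γ • ·)) 1 - single x 1) = 0 :=
      hφ' (Submodule.subset_span (Or.inl ⟨γ, x, rfl⟩))
    rw [map_sub] at this
    exact sub_eq_zero.mp this
  have h2 : ∀ x ∉ S, h x = 0 := fun x hx =>
    hφ' (Submodule.subset_span (Or.inr ⟨x, hx, rfl⟩))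
  have hinv' : ∀ x ∉ S, ∀ γ : Γ, x.map (γ • ·) ∉ S := fun x hx γ hx' => hx (by
    have := hinv _ hx' γ⁻¹
    rwa [map_smul_map, inv_mul_cancel, map_one_smul] at this)
  let h₀ : List L → ℚ := fun x => if σ x = 1 then h x else 0
  have hoff : ∀ x ∉ S, h₀ x = 0 := fun x hx => by simp [h₀, h2 x hx]
  have hkey : ∀ (x : List L) (γ : Γ), h₀ (x.map (γ • ·)) ≠ 0 → γ = (σ x)⁻¹ := by
    intro x γ hx
    have hxS : x ∈ S := by
      by_contra hc'
      exact hx (hoff _ (hinv' x hc' γ))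
    by_contra hne
    refine hx ?_
    simp only [h₀]
    rw [if_neg]
    rw [hσ x hxS]
    exact fun e => hne (eq_inv_of_mul_eq_one_left e)
  have hFO : h₀ ∈ FO Γ L := mem_FO.2 fun x =>
    (Set.finite_singleton ((σ x)⁻¹)).subset fun γ hγ => hkey x γ hγ
  have hnm : nm Γ h₀ = h := by
    ext x
    by_cases hx : x ∈ S
    · rw [nm_eq hFO, Finset.sum_subset (s₂ := {(σ x)⁻¹})]
      · rw [Finset.sum_singleton]
        simp only [h₀]
        rw [if_pos (by rw [hσ x hx, inv_mul_cancel]), h1]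
      · intro γ hγ
        have : h₀ (x.map (γ • ·)) ≠ 0 := by simpa using hγ
        simpa using hkey x γ this
      · intro γ _ hγ
        by_contra hne
        exact hγ (by simpa using hne)
    · rw [nm_off hFO hoff hinv' hx, h2 x hx]
  refine hcon ?_
  exfalso
  refine hφ ?_
  rw [hφh, ← hnm, ← ev_dl, ← nm_dl hFO]
  obtain ⟨hfin, heq⟩ := ev_nm_reps hc hσ hR (dl_mem_FO hFO)
  rw [heq]
  obtain ⟨F, hF, hF'⟩ := hc.fin
  have hfi : ∀ i : Fin (M + 1), {z : Fin (M + 1) → L |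
      c (List.ofFn z) ≠ 0 ∧ h₀ (List.ofFn (z ∘ i.succAbove)) ≠ 0}.Finite := by
    intro i
    have hF2 : {y : Fin (M + 1) → L | List.ofFn y ∈ F}.Finite :=
      hF.preimage List.ofFn_injective.injOn
    refine (hF2.image fun y j => (σ (List.ofFn (y ∘ i.succAbove)))⁻¹ • y j).subset ?_
    rintro z ⟨hz1, hz2⟩
    obtain ⟨γ, l, hl, he⟩ := hF' _ hz1
    have hlen : l.length = M + 1 := by
      have := congrArg List.length he
      simpa using this.symm
    obtain ⟨y, hy⟩ := exists_ofFn l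
    revert y
    rw [hlen]
    rintro y rfl
    rw [List.map_ofFn] at he
    obtain rfl := List.ofFn_injective he
    refine ⟨y, hl, ?_⟩
    have e1 : List.ofFn (((γ • ·) ∘ y) ∘ i.succAbove) =
        (List.ofFn (y ∘ i.succAbove)).map (γ • ·) := by rw [List.map_ofFn]; rfl
    rw [e1] at hz2
    have hk := hkey _ _ hz2
    funext j
    change (σ (List.ofFn (y ∘ i.succAbove)))⁻¹ • y j = γ • y j
    rw [← hk]
  have e1 : ∑ᶠ x, c x * dl h₀ x =
      ∑ᶠ z : Fin (M + 1) → L, c (List.ofFn z) * dl h₀ (List.ofFn z) := by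
    rw [← finsum_mem_range (f := fun x => c x * dl h₀ x) List.ofFn_injective, ← finsum_mem_univ]
    refine finsum_mem_inter_support_eq _ _ _ ?_
    rw [Set.univ_inter, eq_comm, Set.inter_eq_right]
    intro x hx
    have hx' : c x * dl h₀ x ≠ 0 := hx
    have hlen : x.length = M + 1 := by
      by_contra hne
      exact left_ne_zero_of_mul hx' (hc.len x hne)
    obtain ⟨y, hy⟩ := exists_ofFn x
    revert y
    rw [hlen]
    exact fun y hy => ⟨y, hy.symm⟩
  rw [e1]
  have e2 : ∀ z : Fin (M + 1) → L, c (List.ofFn z) * dl h₀ (List.ofFn z) =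
      ∑ i : Fin (M + 1), (-1) ^ (i : ℕ) *
        (c (List.ofFn z) * h₀ (List.ofFn (z ∘ i.succAbove))) := by
    intro z
    rw [dl_ofFn, Finset.mul_sum]
    exact Finset.sum_congr rfl fun i _ => by ring
  rw [finsum_congr e2, finsum_sum_comm]
  · refine Finset.sum_eq_zero fun i _ => ?_
    rw [← mul_finsum, finsum_face hc.alt (fun y hy => hc.sum y ?_) i (hfi i), mul_zero]
    by_contra hcon'
    exact hy (hoff _ hcon')
  · intro i _
    refine (hfi i).subset fun z hz => ?_
    have hz' : (-1) ^ (i : ℕ) * (c (List.ofFn z) * h₀ (List.ofFn (z ∘ i.succAbove))) ≠ 0 := hz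
    have := right_ne_zero_of_mul hz'
    exact ⟨left_ne_zero_of_mul this, right_ne_zero_of_mul this⟩

/-- An equivariant cycle yields a finite chain of orbit representatives. -/
theorem OrbCycle.exists_chain (hc : OrbCycle Γ S M c)
    (hfree : ∀ x ∈ S, ∀ γ : Γ, x.map (γ • ·) = x → γ = 1)
    (hinv : ∀ x ∈ S, ∀ γ : Γ, x.map (γ • ·) ∈ S) :
    ∃ a ∈ supp (Eis.len ((M + 1 : ℕ) : ℤ)), bd a ∈ JL Γ S ∧ ∀ f ∈ FO Γ L,
      {x | c x * f x ≠ 0}.Finite ∧ ev (nm Γ f) a = ∑ᶠ x, c x * f x := by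
  obtain ⟨σ, hσ⟩ := exists_section hfree
  have hR := reps_finite hc hσ
  refine ⟨reps hR, Submodule.sum_mem _ fun x hx => single_mem_supp ?_ _,
    bd_reps_mem hc hσ hinv hR, fun f hf => ev_nm_reps hc hσ hR hf⟩
  have hx' : c x ≠ 0 ∧ σ x = 1 := by simpa using hx
  change (x.length : ℤ) = _
  by_contra hne
  exact hx'.1 (hc.len x fun e => hne (by rw [e]))

end Orbits

end Eis

namespace Eis

open Module Matrix ComplexConjugate

section Hermitian

variable {n N : ℕ} (e : Fin N ≃ Fin n × Fin n)

/-- The real coordinates of the Hermitian form `z zᴴ`. -/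
noncomputable def ic (z : Fin n → ℂ) (k : Fin N) : ℝ :=
  (z (e k).1 * conj (z (e k).2)).re + (z (e k).1 * conj (z (e k).2)).im

lemma ic_add_sub (z w : Fin n → ℂ) :
    ic e (z + w) + ic e (z - w) = (2 : ℝ) • ic e z + (2 : ℝ) • ic e w := by
  ext k
  simp [ic]
  ring

lemma ic_smul (t : ℂ) (z : Fin n → ℂ) : ic e (t • z) = Complex.normSq t • ic e z := by
  ext k
  simp [ic, Complex.normSq_apply]
  ring

lemma ic_zero : ic e 0 = 0 := by
  ext k
  simp [ic]

lemma continuous_ic : Continuous (ic e) := by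
  unfold ic
  fun_prop

lemma ic_span : Submodule.span ℝ (Set.range (ic e)) = ⊤ := by
  classical
  rw [eq_top_iff, ← (Pi.basisFun ℝ (Fin N)).span_eq, Submodule.span_le]
  rintro _ ⟨k, rfl⟩
  let x : Fin n → ℂ := fun i => ((if i = (e k).1 then 1 else 0 : ℝ) : ℂ)
  let y : Fin n → ℂ := fun i => ((if i = (e k).2 then 1 else 0 : ℝ) : ℂ)
  have h : Pi.basisFun ℝ (Fin N) k =
      (1 / 2 : ℝ) • (ic e (x + y) - ic e (x + Complex.I • y)) := by
    ext j
    have : (if j = k then 1 else 0 : ℝ) =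
        (if (e j).1 = (e k).1 then 1 else 0) * (if (e j).2 = (e k).2 then 1 else 0) := by
      rw [ite_zero_mul_ite_zero, mul_one]
      exact if_congr (by rw [← Prod.ext_iff, e.injective.eq_iff]) rfl rfl
    rw [Pi.basisFun_apply, Pi.single_apply, this]
    simp only [ic, Pi.smul_apply, Pi.sub_apply, Pi.add_apply, smul_eq_mul, x, y, map_add, map_mul,
      Complex.conj_ofReal, Complex.conj_I, Complex.add_re, Complex.add_im, Complex.mul_re,
      Complex.mul_im, Complex.ofReal_re, Complex.ofReal_im, Complex.I_re, Complex.I_im,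
      Complex.neg_re, Complex.neg_im]
    ring
  rw [h]
  exact Submodule.smul_mem _ _ (Submodule.sub_mem _ (Submodule.subset_span ⟨_, rfl⟩)
    (Submodule.subset_span ⟨_, rfl⟩))

lemma hom_ext {M : Type*} [AddCommGroup M] [Module ℝ M] {f g : (Fin N → ℝ) →ₗ[ℝ] M}
    (h : ∀ z, f (ic e z) = g (ic e z)) : f = g :=
  LinearMap.ext_on_range (ic_span e) h

/-- An entry of the Hermitian matrix with given coordinates. -/
noncomputable def hh (i j : Fin n) : (Fin N → ℝ) →ₗ[ℝ] ℂ where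
  toFun R := (((R (e.symm (i, j)) + R (e.symm (j, i))) / 2 : ℝ) : ℂ) +
    (((R (e.symm (i, j)) - R (e.symm (j, i))) / 2 : ℝ) : ℂ) * Complex.I
  map_add' R S := by
    simp only [Pi.add_apply]
    push_cast
    ring
  map_smul' c R := by
    simp only [Pi.smul_apply, smul_eq_mul, RingHom.id_apply, Complex.real_smul]
    push_cast
    ring

lemma hh_ic (z : Fin n → ℂ) (i j : Fin n) : hh e i j (ic e z) = z i * conj (z j) := by
  apply Complex.ext <;> simp [hh, ic] <;> ring

/-- The sesquilinear form `φ H ψᴴ`. -/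
noncomputable def sq (φ ψ : Fin n → ℂ) : (Fin N → ℝ) →ₗ[ℝ] ℂ :=
  ∑ a, ∑ b, LinearMap.mulLeft ℝ (φ a * conj (ψ b)) ∘ₗ hh e a b

lemma sq_ic (φ ψ z : Fin n → ℂ) : sq e φ ψ (ic e z) = (φ ⬝ᵥ z) * conj (ψ ⬝ᵥ z) := by
  simp only [sq, LinearMap.sum_apply, LinearMap.comp_apply, hh_ic, LinearMap.mulLeft_apply,
    dotProduct, map_sum, Finset.sum_mul_sum, map_mul]
  exact Finset.sum_congr rfl fun a _ => Finset.sum_congr rfl fun b _ => by ring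

/-- The functional `z zᴴ ↦ |φ z|²`. -/
noncomputable def qq (φ : Fin n → ℂ) : Dual ℝ (Fin N → ℝ) := Complex.reLm ∘ₗ sq e φ φ

lemma qq_ic (φ z : Fin n → ℂ) : qq e φ (ic e z) = Complex.normSq (φ ⬝ᵥ z) := by
  simp [qq, sq_ic, Complex.normSq_apply]

/-- The trace functional. -/
noncomputable def ta : Dual ℝ (Fin N → ℝ) := ∑ i, qq e (Pi.single i 1)

lemma ta_ic (z : Fin n → ℂ) : ta e (ic e z) = ∑ i, Complex.normSq (z i) := by
  simp [ta, qq_ic]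

/-- The action of a matrix on Hermitian forms. -/
noncomputable def tm (g : Matrix (Fin n) (Fin n) ℂ) : (Fin N → ℝ) →ₗ[ℝ] (Fin N → ℝ) :=
  LinearMap.pi fun k => (Complex.reLm + Complex.imLm) ∘ₗ sq e (g (e k).1) (g (e k).2)

lemma tm_ic (g : Matrix (Fin n) (Fin n) ℂ) (z : Fin n → ℂ) : tm e g (ic e z) = ic e (g *ᵥ z) := by
  ext k
  simp [tm, sq_ic, ic, mulVec]

lemma tm_mul (g h : Matrix (Fin n) (Fin n) ℂ) : tm e (g * h) = tm e g ∘ₗ tm e h :=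
  hom_ext e fun z => by simp [tm_ic]

lemma tm_one : tm e (1 : Matrix (Fin n) (Fin n) ℂ) = LinearMap.id :=
  hom_ext e fun z => by simp [tm_ic]

lemma det_tm_pos {g : Matrix (Fin n) (Fin n) ℂ} (hg : g.det ≠ 0) : 0 < LinearMap.det (tm e g) := by
  have hmul (g h : Matrix (Fin n) (Fin n) ℂ) :
      LinearMap.det (tm e (g * h)) = LinearMap.det (tm e g) * LinearMap.det (tm e h) := by
    rw [tm_mul, LinearMap.det_comp]
  have hsq (g : Matrix (Fin n) (Fin n) ℂ) (hg : g.det ≠ 0) : 0 < LinearMap.det (tm e (g * g)) := by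
    rw [hmul]
    apply mul_self_pos.mpr
    intro h0
    have := hmul g g⁻¹
    rw [mul_nonsing_inv _ (isUnit_iff_ne_zero.mpr hg), tm_one, LinearMap.det_id, h0,
      zero_mul] at this
    exact one_ne_zero this
  refine diagonal_transvection_induction_of_det_ne_zero (fun g => 0 < LinearMap.det (tm e g)) g hg
    (fun D hD => ?_) (fun t => ?_) fun g h _ _ h1 h2 => ?_
  · have h : diagonal D = diagonal (fun i => D i ^ (1 / 2 : ℂ)) * diagonal (
      fun i => D i ^ (1 / 2 : ℂ)) := by
      rw [diagonal_mul_diagonal]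
      congr 1
      ext i
      rw [← pow_two, ← Complex.cpow_nat_mul]
      norm_num
    rw [h]
    apply hsq
    intro h0
    rw [h, det_mul, h0, zero_mul] at hD
    exact hD rfl
  · obtain ⟨i, j, hij, c⟩ := t
    have h : transvection i j c = transvection i j (c / 2) * transvection i j (c / 2) := by
      rw [transvection_mul_transvection_same _ _ hij, add_halves]
    rw [TransvectionStruct.toMatrix_mk, h]
    exact hsq _ (by rw [det_transvection_of_ne _ _ hij]; exact one_ne_zero)
  · rw [hmul]
    exact mul_pos h1 h2

end Hermitian

end Eis

namespace Eis

open Module Matrix ComplexConjugate Filter Topology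

section Lattice

variable {A : Type*} [CommRing A] {σ : A →+* ℂ} {ρ : A} {n N : ℕ}

lemma Eisen.exists_round (h : Eisen σ ρ) (z : ℂ) : ∃ a, ‖z - σ a‖ ≤ 1 := by
  obtain ⟨x, y, rfl⟩ := h.coords z
  obtain ⟨a, b, hab⟩ := exists_tri x y
  have hq : qf (x + a) (y + b) < 1 := by
    rcases hab with hab | hab
    · exact hab.lt
    · rw [← qf_neg]
      exact hab.lt
  refine ⟨(-a : ℤ) + (-b : ℤ) * ρ, ?_⟩
  rw [h.map_int, ← sq_le_one_iff₀ (norm_nonneg _), ← Complex.normSq_eq_norm_sq]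
  refine le_trans (le_of_eq ?_) hq.le
  rw [← h.normSq]
  congr 1
  push_cast
  ring

lemma Eisen.exists_round_vec (h : Eisen σ ρ) (z : Fin n → ℂ) :
    ∃ a : Fin n → A, ‖z - σ ∘ a‖ ≤ 1 := by
  choose a ha using fun i => h.exists_round (z i)
  exact ⟨a, (pi_norm_le_iff_of_nonneg zero_le_one).mpr ha⟩

lemma Eisen.finite_ball (h : Eisen σ ρ) (R : ℝ) : {a : A | ‖σ a‖ ≤ R}.Finite := by
  refine (((Set.finite_Icc (-⌈2 * R⌉) ⌈2 * R⌉).prod (Set.finite_Icc (-⌈2 * R⌉) ⌈2 * R⌉)).image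
    fun q : ℤ × ℤ => (q.1 + q.2 * ρ : A)).subset ?_
  intro a (ha : ‖σ a‖ ≤ R)
  obtain ⟨x, y, rfl⟩ := h.gen a
  have hR : 0 ≤ R := (norm_nonneg _).trans ha
  have h1 : qf (x : ℝ) y ≤ R ^ 2 := by
    rw [← h.normSq, ← h.map_int, Complex.normSq_eq_norm_sq]
    gcongr
  unfold qf at h1
  have h2 : |(x : ℝ)| ≤ 2 * R := abs_le_of_sq_le_sq (by nlinarith [sq_nonneg (x + 2 * y : ℝ)])
    (by linarith)
  have h3 : |(y : ℝ)| ≤ 2 * R := abs_le_of_sq_le_sq (by nlinarith [sq_nonneg (2 * x + y : ℝ)])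
    (by linarith)
  have key : ∀ t : ℤ, |(t : ℝ)| ≤ 2 * R → t ∈ Set.Icc (-⌈2 * R⌉) ⌈2 * R⌉ := by
    intro t ht
    rw [Set.mem_Icc, ← abs_le]
    have := ht.trans (Int.le_ceil _)
    exact_mod_cast this
  exact ⟨(x, y), ⟨key x h2, key y h3⟩, rfl⟩

lemma Eisen.finite_vec (h : Eisen σ ρ) (R : ℝ) : {v : Vc A n | ‖σ ∘ v.1‖ ≤ R}.Finite := by
  have h1 : (Set.univ.pi fun _ : Fin n => {a : A | ‖σ a‖ ≤ R}).Finite :=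
    Set.Finite.pi fun _ => h.finite_ball R
  refine (h1.preimage Subtype.val_injective.injOn).subset ?_
  intro v (hv : ‖σ ∘ v.1‖ ≤ R) i _
  exact (norm_le_pi_norm (σ ∘ v.1) i).trans hv

lemma Eisen.countable (h : Eisen σ ρ) : Countable A := by
  have : Function.Surjective fun q : ℤ × ℤ => (q.1 + q.2 * ρ : A) := fun a => by
    obtain ⟨x, y, rfl⟩ := h.gen a
    exact ⟨(x, y), rfl⟩
  exact this.countable

lemma Eisen.one_le_normSq (h : Eisen σ ρ) {a : A} (ha : a ≠ 0) : 1 ≤ Complex.normSq (σ a) := by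
  rw [← h.cast_nmA, Nat.one_le_cast, Nat.one_le_iff_ne_zero]
  exact fun h0 => ha ((h.disc.zero a).mp h0)

lemma Eisen.normSq_unit (h : Eisen σ ρ) (ε : Aˣ) : Complex.normSq (σ ε) = 1 := by
  have : Nontrivial A := ⟨⟨1, 0, fun h0 => by simpa using congrArg σ h0⟩⟩
  refine le_antisymm ?_ (h.one_le_normSq ε.ne_zero)
  have h1 := h.one_le_normSq (ε⁻¹).ne_zero
  have h2 : Complex.normSq (σ ε) * Complex.normSq (σ (ε⁻¹ : Aˣ)) = 1 := by
    rw [← map_mul, ← map_mul, Units.mul_inv, map_one, map_one]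
  nlinarith [Complex.normSq_nonneg (σ ε)]

variable (σ) (e : Fin N ≃ Fin n × Fin n)

/-- The rank one Hermitian form of a nonzero vector. -/
noncomputable def iv (v : Vc A n) : Fin N → ℝ := ic e (σ ∘ v.1)

/-- Functionals that are nonnegative on rank one forms of lattice vectors. -/
def Ps (u : Dual ℝ (Fin N → ℝ)) : Prop := ∀ v : Vc A n, 0 ≤ u (iv σ e v)

variable {σ e}

lemma iv_rel (h : Eisen σ ρ) {v w : Vc A n} (hvw : uRel A n v w) : iv σ e v = iv σ e w := by
  obtain ⟨ε, hε⟩ := hvw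
  have : σ ∘ w.1 = σ ε • (σ ∘ v.1) := by
    ext i
    simp [hε]
  rw [iv, iv, this, ic_smul, h.normSq_unit, one_smul]

lemma one_le_ta (h : Eisen σ ρ) (v : Vc A n) : 1 ≤ ta e (iv σ e v) := by
  obtain ⟨i, hi⟩ := Function.ne_iff.mp v.2
  rw [iv, ta_ic]
  exact (h.one_le_normSq hi).trans (Finset.single_le_sum (f := fun i => Complex.normSq
    ((σ ∘ v.1) i))
    (fun i _ => Complex.normSq_nonneg _) (Finset.mem_univ i))

lemma continuous_dual_ic (u : Dual ℝ (Fin N → ℝ)) : Continuous fun z => u (ic e z) :=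
  (LinearMap.continuous_of_finiteDimensional u).comp (continuous_ic e)

lemma Ps.lattice {u : Dual ℝ (Fin N → ℝ)} (hu : Ps σ e u) (a : Fin n → A) :
    0 ≤ u (ic e (σ ∘ a)) := by
  by_cases h0 : a = 0
  · have : σ ∘ a = 0 := by
      ext i
      simp [h0]
    rw [this, ic_zero, map_zero]
  · exact hu ⟨a, h0⟩

lemma Ps.nonneg (h : Eisen σ ρ) {u : Dual ℝ (Fin N → ℝ)} (hu : Ps σ e u) (z : Fin n → ℂ) :
    0 ≤ u (ic e z) := by
  choose a ha using fun j : ℕ => h.exists_round_vec ((j : ℂ) • z)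
  have hlim : Tendsto (fun j : ℕ => ((j : ℂ)⁻¹) • (σ ∘ a j)) atTop (𝓝 z) := by
    rw [tendsto_iff_norm_sub_tendsto_zero]
    refine squeeze_zero' (.of_forall fun _ => norm_nonneg _) ?_ tendsto_one_div_atTop_nhds_zero_nat
    filter_upwards [eventually_gt_atTop 0] with j hj
    have hj' : (j : ℂ) ≠ 0 := by exact_mod_cast hj.ne'
    have : ((j : ℂ)⁻¹) • (σ ∘ a j) - z = -((j : ℂ)⁻¹ • ((j : ℂ) • z - σ ∘ a j)) := by
      rw [smul_sub, inv_smul_smul₀ hj']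
      abel
    rw [this, norm_neg, norm_smul, norm_inv, Complex.norm_natCast, one_div]
    exact mul_le_of_le_one_right (by positivity) (ha j)
  refine ge_of_tendsto' (((continuous_dual_ic u).tendsto z).comp hlim) fun j => ?_
  rw [Function.comp_apply, ic_smul, map_smul]
  exact mul_nonneg (Complex.normSq_nonneg _) (hu.lattice (a j))

lemma Ps.add_le (h : Eisen σ ρ) {u : Dual ℝ (Fin N → ℝ)} (hu : Ps σ e u) (z w : Fin n → ℂ) :
    u (ic e (z + w)) ≤ 2 * u (ic e z) + 2 * u (ic e w) := by
  have := congrArg u (ic_add_sub e z w)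
  simp only [map_add, map_smul, smul_eq_mul] at this
  linarith [hu.nonneg h (z - w)]

lemma Ps.sum_le (h : Eisen σ ρ) {u : Dual ℝ (Fin N → ℝ)} (hu : Ps σ e u) {J : Type*} (s : Finset J)
    (z : J → Fin n → ℂ) : u (ic e (∑ j ∈ s, z j)) ≤ 2 ^ s.card * ∑ j ∈ s, u (ic e (z j)) := by
  classical
  induction s using Finset.induction_on with
  | empty => simp [ic_zero]
  | insert a s ha ih =>
    rw [Finset.sum_insert ha, Finset.sum_insert ha, Finset.card_insert_of_notMem ha, pow_succ]
    have h1 := hu.nonneg h (z a)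
    have h2 : (1 : ℝ) ≤ 2 ^ s.card := one_le_pow₀ (by norm_num)
    nlinarith [hu.add_le h (z a) (∑ j ∈ s, z j)]

/-- The null space of a nonnegative form. -/
def Ps.null (h : Eisen σ ρ) {u : Dual ℝ (Fin N → ℝ)} (hu : Ps σ e u) : Submodule ℂ (Fin n → ℂ) where
  carrier := {z | u (ic e z) = 0}
  add_mem' {z w} hz hw := by
    have h1 := hu.add_le h z w
    rw [show u (ic e z) = 0 from hz, show u (ic e w) = 0 from hw] at h1
    exact le_antisymm (by linarith) (hu.nonneg h _)
  zero_mem' := by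
    change u (ic e 0) = 0
    rw [ic_zero, map_zero]
  smul_mem' t z hz := by
    change u (ic e (t • z)) = 0
    rw [ic_smul, map_smul, show u (ic e z) = 0 from hz, smul_zero]

lemma Ps.pos (h : Eisen σ ρ) {u : Dual ℝ (Fin N → ℝ)} (hu : ∀ v : Vc A n, 1 ≤ u (iv σ e v))
    {z : Fin n → ℂ} (hz : z ≠ 0) : 0 < u (ic e z) := by
  have hp : Ps σ e u := fun v => zero_le_one.trans (hu v)
  refine (hp.nonneg h z).lt_of_ne fun h0 => ?_
  have hz0 : z ∈ hp.null h := h0.symm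
  choose a ha using fun j : ℕ => h.exists_round_vec ((j : ℂ) • z)
  have hev : ∀ᶠ w in 𝓝 (0 : Fin n → ℂ), u (ic e w) < 1 / 2 := by
    refine (continuous_dual_ic u).continuousAt.eventually_lt_const ?_
    simp only [ic_zero, map_zero]
    norm_num
  obtain ⟨ε, hε, hball⟩ := Metric.eventually_nhds_iff.mp (hev.and
    (Metric.ball_mem_nhds (0 : Fin n → ℂ) (norm_pos_iff.mpr hz)))
  obtain ⟨b, -, φ, hφ, hlim⟩ := (isCompact_closedBall (0 : Fin n → ℂ) 1).tendsto_subseq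
    (x := fun j : ℕ => (j : ℂ) • z - σ ∘ a j) fun j => by simpa using ha j
  obtain ⟨m, hm⟩ := Metric.cauchySeq_iff'.mp hlim.cauchySeq ε hε
  have hm' := hm (m + 1) (Nat.le_succ m)
  have hlt : φ m < φ (m + 1) := hφ (Nat.lt_succ_self m)
  rw [dist_eq_norm] at hm'
  simp only [Function.comp_apply] at hm'
  set w := ((φ (m + 1) : ℕ) : ℂ) • z - σ ∘ a (φ (m + 1)) - (((φ m : ℕ) : ℂ) • z - σ ∘ a
    (φ m)) with hw
  obtain ⟨h1, h2⟩ := hball (y := w) (by simpa using hm')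
  let t : ℂ := ((φ (m + 1) : ℕ) : ℂ) - ((φ m : ℕ) : ℂ)
  have hv : σ ∘ (a (φ (m + 1)) - a (φ m)) = t • z + (-1 : ℂ) • w := by
    rw [hw]
    ext i
    simp [t]
    ring
  have hv0 : a (φ (m + 1)) - a (φ m) ≠ 0 := by
    intro h0
    have h3 : w = t • z := by
      have : σ ∘ (a (φ (m + 1)) - a (φ m)) = 0 := by
        ext i
        simp [h0]
      rw [this, neg_one_smul, eq_comm, ← sub_eq_add_neg, sub_eq_zero] at hv
      exact hv.symm
    have ht : 1 ≤ ‖t‖ := by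
      have : t = ((φ (m + 1) - φ m : ℕ) : ℂ) := by
        rw [Nat.cast_sub hlt.le]
      rw [this, Complex.norm_natCast, Nat.one_le_cast]
      omega
    have h4 : ‖w‖ < ‖z‖ := by simpa using h2
    rw [h3, norm_smul] at h4
    nlinarith [norm_nonneg z]
  have h5 := hu ⟨_, hv0⟩
  rw [iv, hv] at h5
  have h6 := hp.add_le h (t • z) ((-1 : ℂ) • w)
  have h7 : u (ic e (t • z)) = 0 := (hp.null h).smul_mem t hz0
  rw [ic_smul e (-1), Complex.normSq_neg, map_one, one_smul] at h6
  linarith [hp.nonneg h w]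

end Lattice

end Eis

namespace Eis

open Module Matrix Filter Topology

section Coordinates

variable {N : ℕ}

/-- The functional with given coordinates. -/
noncomputable abbrev dt : (Fin N → ℝ) ≃ₗ[ℝ] Dual ℝ (Fin N → ℝ) := dotProductEquiv ℝ (Fin N)

lemma dt_apply (x p : Fin N → ℝ) : dt x p = x ⬝ᵥ p := rfl

/-- The size of a functional. -/
noncomputable def nu (u : Dual ℝ (Fin N → ℝ)) : ℝ := ‖dt.symm u‖

lemma nu_dt (x : Fin N → ℝ) : nu (dt x) = ‖x‖ := by rw [nu, LinearEquiv.symm_apply_apply]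

lemma continuous_dt : Continuous fun q : (Fin N → ℝ) × (Fin N → ℝ) => dt q.1 q.2 := by
  simp only [dt_apply, dotProduct]
  fun_prop

lemma abs_apply_le (u : Dual ℝ (Fin N → ℝ)) (q : Fin N → ℝ) : |u q| ≤ N * nu u * ‖q‖ := by
  obtain ⟨x, rfl⟩ := dt.surjective u
  rw [nu_dt, dt_apply, dotProduct]
  refine (Finset.abs_sum_le_sum_abs _ _).trans ?_
  have : ∀ i ∈ Finset.univ, |x i * q i| ≤ ‖x‖ * ‖q‖ := fun i _ => by
    rw [abs_mul]
    exact mul_le_mul (norm_le_pi_norm x i) (norm_le_pi_norm q i) (abs_nonneg _) (norm_nonneg _)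
  refine (Finset.sum_le_card_nsmul _ _ _ this).trans (le_of_eq ?_)
  rw [Finset.card_univ, Fintype.card_fin, nsmul_eq_mul]
  ring

lemma exists_scale {u : Dual ℝ (Fin N → ℝ)} (hu : u ≠ 0) :
    0 < nu u ∧ ∃ x : Fin N → ℝ, ‖x‖ = 1 ∧ u = nu u • dt x := by
  have h0 : dt.symm u ≠ 0 := fun h0 => hu (by simpa using h0)
  have h1 : 0 < ‖dt.symm u‖ := norm_pos_iff.mpr h0
  refine ⟨h1, ‖dt.symm u‖⁻¹ • dt.symm u, ?_, ?_⟩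
  · rw [norm_smul, norm_inv, norm_norm, inv_mul_cancel₀ h1.ne']
  · rw [map_smul, nu, smul_inv_smul₀ h1.ne', LinearEquiv.apply_symm_apply]

end Coordinates

section Cone

variable {A : Type*} [CommRing A] {σ : A →+* ℂ} {ρ : A} {n N : ℕ} {e : Fin N ≃ Fin n × Fin n}

variable (σ e) in
/-- The open cone dual to the nonnegative functionals. -/
def Xs : Set (Fin N → ℝ) := {p | ∀ u, u ≠ 0 → Ps σ e u → 0 < u p}

variable (σ e) in
/-- The nonnegative functionals of size one. -/
def Us : Set (Fin N → ℝ) := {x | ‖x‖ = 1 ∧ Ps σ e (dt x)}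

lemma isClosed_dt_le (ω : Vc A n → ℝ) : IsClosed {x | ∀ v, ω v ≤ dt x (iv σ e v)} := by
  rw [Set.ofPred_forall]
  refine isClosed_iInter fun v => isClosed_le continuous_const ?_
  exact continuous_dt.comp (Continuous.prodMk continuous_id continuous_const)

lemma isCompact_Us : IsCompact (Us σ e) :=
  (isCompact_sphere (0 : Fin N → ℝ) 1).of_isClosed_subset
    ((isClosed_eq continuous_norm continuous_const).inter (isClosed_dt_le 0))
    fun x hx => by simpa using hx.1

lemma mem_Xs_iff {p : Fin N → ℝ} : p ∈ Xs σ e ↔ ∀ x ∈ Us σ e, 0 < dt x p := by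
  refine ⟨fun hp x hx => hp _ (fun h0 => ?_) hx.2, fun hp u hu hP => ?_⟩
  · have := hx.1
    rw [← nu_dt, h0, nu, map_zero, norm_zero] at this
    exact zero_ne_one this
  · obtain ⟨h0, x, hx, hux⟩ := exists_scale hu
    rw [hux]
    refine mul_pos h0 (hp x ⟨hx, fun v => ?_⟩)
    have := hP v
    rw [hux, LinearMap.smul_apply, smul_eq_mul] at this
    exact nonneg_of_mul_nonneg_right this h0

lemma isOpen_Xs : IsOpen (Xs σ e) := by
  refine isOpen_iff_mem_nhds.mpr fun p hp => ?_
  have h : ∀ x ∈ Us σ e, ∀ᶠ q : (Fin N → ℝ) × (Fin N → ℝ) in 𝓝 (p, x), 0 < dt q.2 q.1 :=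
    fun x hx => (continuous_dt.comp continuous_swap).continuousAt.eventually_const_lt
      (mem_Xs_iff.mp hp x hx)
  filter_upwards [(isCompact_Us (σ := σ) (e := e)).eventually_forall_of_forall_eventually
    (P := fun q x => 0 < dt x q) h] with q hq
  exact mem_Xs_iff.mpr hq

lemma Xs.bound {p : Fin N → ℝ} (hp : p ∈ Xs σ e) :
    ∃ C, 0 < C ∧ ∀ u, Ps σ e u → nu u ≤ C * u p := by
  obtain ⟨m, hm, h⟩ := isCompact_Us.exists_forall_le' (f := fun x => dt x p)
    (continuous_dt.comp (Continuous.prodMk continuous_id continuous_const)).continuousOn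
    (mem_Xs_iff.mp hp)
  refine ⟨m⁻¹, inv_pos.mpr hm, fun u hu => ?_⟩
  rcases eq_or_ne u 0 with rfl | hu0
  · simp [nu]
  obtain ⟨h0, x, hx, hux⟩ := exists_scale hu0
  have hP : x ∈ Us σ e := ⟨hx, fun v => by
    have := hu v
    rw [hux, LinearMap.smul_apply, smul_eq_mul] at this
    exact nonneg_of_mul_nonneg_right this h0⟩
  have h1 : nu u * m ≤ u p := by
    conv_rhs => rw [hux, LinearMap.smul_apply, smul_eq_mul]
    exact mul_le_mul_of_nonneg_left (h x hP) h0.le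
  rw [inv_mul_eq_div]
  exact (le_div_iff₀ hm).mpr h1

lemma Xs.cov {p : Fin N → ℝ} (hp : p ∈ Xs σ e) : Cov (iv σ e) p := by
  have hc : IsCompact {x : Fin N → ℝ | ‖x‖ = 1 ∧ 0 ≤ dt x p} :=
    (isCompact_sphere (0 : Fin N → ℝ) 1).of_isClosed_subset
      ((isClosed_eq continuous_norm continuous_const).inter (isClosed_le continuous_const
        (continuous_dt.comp (Continuous.prodMk continuous_id continuous_const))))
      fun x hx => by simpa using hx.1
  obtain ⟨S, hS⟩ := hc.elim_finite_subcover (fun v : Vc A n => {x | 0 < dt x (iv σ e v)})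
    (fun v => isOpen_lt continuous_const
      (continuous_dt.comp (Continuous.prodMk continuous_id continuous_const))) fun x hx => by
      by_contra hcon
      simp only [Set.mem_iUnion, Set.mem_ofPred_eq, not_exists, not_lt] at hcon
      have h1 : -dt x ≠ 0 := fun h0 => by
        have := hx.1
        rw [← nu_dt, neg_eq_zero.mp h0, nu, map_zero, norm_zero] at this
        exact zero_ne_one this
      have := hp (-dt x) h1 fun v => by simpa using hcon v
      rw [LinearMap.neg_apply] at this
      linarith [hx.2]
  refine ⟨S, fun u hu hup => ?_⟩
  obtain ⟨h0, x, hx, hux⟩ := exists_scale hu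
  have h1 : 0 ≤ dt x p := by
    rw [hux, LinearMap.smul_apply, smul_eq_mul] at hup
    exact nonneg_of_mul_nonneg_right hup h0
  obtain ⟨v, hv, hxv⟩ := Set.mem_iUnion₂.mp (hS ⟨hx, h1⟩)
  exact ⟨v, hv, by rw [hux]; exact mul_pos h0 hxv⟩

lemma exists_lower (h : Eisen σ ρ) (B : ℝ) : ∃ c > 0, ∀ u : Dual ℝ (Fin N → ℝ), nu u ≤ B →
    (∀ v : Vc A n, 1 ≤ u (iv σ e v)) → ∀ z, c * ‖z‖ ^ 2 ≤ u (ic e z) := by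
  have hc : IsCompact ((Metric.closedBall (0 : Fin N → ℝ) B ∩
      {x | ∀ v : Vc A n, 1 ≤ dt x (iv σ e v)}) ×ˢ Metric.sphere (0 : Fin n → ℂ) 1) :=
    ((isCompact_closedBall _ _).inter_right (isClosed_dt_le 1)).prod (isCompact_sphere _ _)
  obtain ⟨c, hc, hle⟩ := hc.exists_forall_le' (f := fun q => dt q.1 (ic e q.2)) (a := 0)
    (continuous_dt.comp (Continuous.prodMk continuous_fst
      ((continuous_ic e).comp continuous_snd))).continuousOn
    fun q hq => Ps.pos h hq.1.2 (ne_zero_of_mem_unit_sphere (⟨q.2, hq.2⟩ : Metric.sphere _ _))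
  refine ⟨c, hc, fun u hB hu z => ?_⟩
  rcases eq_or_ne z 0 with rfl | hz
  · simp [ic_zero]
  have hz' : 0 < ‖z‖ := norm_pos_iff.mpr hz
  have h1 := hle (dt.symm u, ((‖z‖⁻¹ : ℝ) : ℂ) • z) ⟨⟨by simpa [nu] using hB, fun v => by
    rw [LinearEquiv.apply_symm_apply]; exact hu v⟩, by
    simp [norm_smul, hz'.ne']⟩
  simp only [LinearEquiv.apply_symm_apply, ic_smul, map_smul, smul_eq_mul,
    Complex.normSq_ofReal] at h1
  calc c * ‖z‖ ^ 2 ≤ (‖z‖⁻¹ * ‖z‖⁻¹ * u (ic e z)) * ‖z‖ ^ 2 := by gcongr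
    _ = u (ic e z) := by field_simp

lemma exists_finite (h : Eisen σ ρ) (B R : ℝ) : ∃ F : Set (Vc A n), F.Finite ∧
    ∀ u : Dual ℝ (Fin N → ℝ), nu u ≤ B → (∀ v : Vc A n, 1 ≤ u (iv σ e v)) →
      ∀ v, u (iv σ e v) ≤ R → v ∈ F := by
  obtain ⟨c, hc, hle⟩ := exists_lower (e := e) h B
  refine ⟨_, h.finite_vec (√(R / c)), fun u hB hu v hv => ?_⟩
  change ‖σ ∘ v.1‖ ≤ √(R / c)
  refine Real.le_sqrt_of_sq_le ?_
  rw [le_div_iff₀ hc, mul_comm]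
  exact (hle u hB hu _).trans hv

lemma exists_min {p : Fin N → ℝ} (hp : p ∈ Xs σ e) {ω : Vc A n → ℝ}
    (hω : ∀ v, 0 ≤ ω v) (hne : (RR (iv σ e) ω).Nonempty) :
    ∃ u ∈ RR (iv σ e) ω, ∀ u' ∈ RR (iv σ e) ω, u p ≤ u' p := by
  obtain ⟨C, hC, hb⟩ := Xs.bound hp
  obtain ⟨u₀, hu₀⟩ := hne
  have hcont : Continuous fun x : Fin N → ℝ => dt x p :=
    continuous_dt.comp (Continuous.prodMk continuous_id continuous_const)
  have hc : IsCompact {x | (∀ v, ω v ≤ dt x (iv σ e v)) ∧ dt x p ≤ u₀ p} :=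
    (isCompact_closedBall (0 : Fin N → ℝ) (C * u₀ p)).of_isClosed_subset
      ((isClosed_dt_le ω).inter (isClosed_le hcont continuous_const)) fun x hx => by
      rw [mem_closedBall_zero_iff, ← nu_dt]
      exact (hb _ fun v => (hω v).trans (hx.1 v)).trans (mul_le_mul_of_nonneg_left hx.2 hC.le)
  obtain ⟨x₀, rfl⟩ := dt.surjective u₀
  obtain ⟨x, hx, hmin⟩ := hc.exists_isMinOn ⟨x₀, by exact ⟨hu₀, le_rfl⟩⟩ hcont.continuousOn
  refine ⟨dt x, hx.1, fun u' hu' => ?_⟩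
  obtain ⟨x', rfl⟩ := dt.surjective u'
  rcases le_total (dt x' p) (dt x₀ p) with h1 | h1
  · exact hmin (a := x') (by exact ⟨hu', h1⟩)
  · exact hx.2.trans h1

lemma eq_zero_of_Ps_neg (h : Eisen σ ρ) {u : Dual ℝ (Fin N → ℝ)} (h1 : Ps σ e u)
    (h2 : Ps σ e (-u)) :
    u = 0 :=
  hom_ext e fun z => le_antisymm (by simpa using h2.nonneg h z) (h1.nonneg h z)

variable [IsDomain A]

lemma eq_zero_of_Fu (h : Eisen σ ρ) {u : Dual ℝ (Fin N → ℝ)} (hu : Ps σ e u) {x : List (Vc A n)}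
    (hx : x ∈ Fu A n) (h0 : ∀ a ∈ x, u (iv σ e a) = 0) : u = 0 := by
  rcases Nat.eq_zero_or_pos n with rfl | hn
  · refine hom_ext e fun z => ?_
    rw [Subsingleton.elim z 0, ic_zero, map_zero, map_zero]
  let g : FractionRing A →+* ℂ := IsFractionRing.lift h.inj
  let G : (Fin n → FractionRing A) →ₛₗ[g] (Fin n → ℂ) :=
    { toFun := fun k => g ∘ k
      map_add' := fun k l => by ext; simp
      map_smul' := fun c k => by ext; simp }
  have hG (v : Vc A n) : G (frv v) = σ ∘ v.1 := by
    ext i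
    exact IsFractionRing.lift_algebraMap h.inj (v.1 i)
  have htop : sp (FractionRing A) (x.map frv) = ⊤ := by
    by_contra hne
    have := Submodule.finrank_lt (lt_top_iff_ne_top.mpr hne).ne
    rw [finrank_fin_fun] at this
    exact (Rk_sub_Ns hn x.length ⟨rfl, le_top, by omega⟩).1 hx
  have hle : sp (FractionRing A) (x.map frv) ≤ (hu.null h).comap G := by
    refine Submodule.span_le.mpr fun w hw => ?_
    obtain ⟨v, hv, rfl⟩ := List.mem_map.mp hw
    change G (frv v) ∈ hu.null h
    rw [hG]
    exact h0 v hv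
  refine eq_zero_of_Ps_neg h hu fun v => ?_
  have h1 : G (frv v) ∈ hu.null h := (htop ▸ hle) (Submodule.mem_top (x := frv v))
  rw [hG] at h1
  have h2 : u (iv σ e v) = 0 := h1
  rw [LinearMap.neg_apply, h2, neg_zero]

lemma sum_mem_Xs (h : Eisen σ ρ) {x : List (Vc A n)} (hx : x ∈ Fu A n) :
    (x.map (iv σ e)).sum ∈ Xs σ e := by
  intro u hu0 hu
  rw [map_list_sum, List.map_map]
  have hnn : ∀ a ∈ x.map (u ∘ iv σ e), 0 ≤ a := by
    intro a ha
    obtain ⟨v, -, rfl⟩ := List.mem_map.mp ha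
    exact hu v
  refine (List.sum_nonneg hnn).lt_of_ne fun h0 => hu0 (eq_zero_of_Fu h hu hx fun a ha => ?_)
  exact le_antisymm (h0 ▸ List.single_le_sum hnn _ (List.mem_map_of_mem ha)) (hu a)

end Cone

end Eis

namespace Eis

open Module Matrix Filter Topology

section Generic

lemma exists_generic {V : Type*} [NormedAddCommGroup V] [NormedSpace ℝ V] [FiniteDimensional ℝ V]
    {U : Set V} (hU : IsOpen U) (hne : U.Nonempty) {I : Type*} [Countable I]
    (W : I → Submodule ℝ V) (hW : ∀ i, W i ≠ ⊤) : ∃ x ∈ U, ∀ i, x ∉ W i := by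
  have : CompleteSpace V := FiniteDimensional.complete ℝ V
  have hd : Dense (⋂ i, (W i : Set V)ᶜ) := by
    refine dense_iInter_of_isOpen
      (fun i => (Submodule.closed_of_finiteDimensional (W i)).isOpen_compl) fun i => ?_
    rw [← interior_eq_empty_iff_dense_compl]
    by_contra h
    exact hW i (Submodule.eq_top_of_nonempty_interior' _ (Set.nonempty_iff_ne_empty.mpr h))
  obtain ⟨x, hx, hxU⟩ := hd.inter_open_nonempty U hU hne
  exact ⟨x, hx, fun i => Set.mem_iInter.mp hxU i⟩

lemma exists_weight {L K V : Type*} [Countable L] [Finite K] [AddCommGroup V] [Module ℝ V]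
    (ι : L → V) (κ : L → K) : ∃ θ : K → ℝ, (∀ k, 1 ≤ θ k ∧ θ k ≤ 2) ∧
      ∀ (m : ℕ) (x : Fin m → L), Function.Injective (κ ∘ x) → ∀ u : Dual ℝ V,
        (∀ i, u (ι (x i)) = θ (κ (x i))) → LinearIndependent ℝ (ι ∘ x) := by
  classical
  have := Fintype.ofFinite K
  let I := {q : Σ m, Fin m → L // Function.Injective (κ ∘ q.2) ∧ ¬ LinearIndependent ℝ (ι ∘ q.2)}
  choose g hg i₀ hi₀ using fun q : I => Fintype.not_linearIndependent_iff.mp q.2.2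
  let W (q : I) : Submodule ℝ (K → ℝ) :=
    LinearMap.ker (∑ i, g q i • LinearMap.proj (R := ℝ) (φ := fun _ : K => ℝ) (κ (q.1.2 i)))
  obtain ⟨θ, hθ, hW⟩ := exists_generic (U := Set.univ.pi fun _ : K => Set.Ioo (1 : ℝ) 2)
    (isOpen_set_pi Set.finite_univ fun _ _ => isOpen_Ioo) ⟨fun _ => 3 / 2, fun _ _ => by norm_num⟩ W
    fun q h => hi₀ q (by
      have h1 := LinearMap.congr_fun (LinearMap.ker_eq_top.mp h) (Pi.single (κ (q.1.2 (i₀ q))) 1)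
      simp only [LinearMap.sum_apply, LinearMap.smul_apply, LinearMap.proj_apply, smul_eq_mul,
        LinearMap.zero_apply] at h1
      rw [Finset.sum_eq_single (i₀ q)] at h1
      · simpa using h1
      · intro j _ hj
        rw [Pi.single_eq_of_ne (fun h : κ (q.1.2 j) = κ (q.1.2 (i₀ q)) => hj (q.2.1 h)), mul_zero]
      · simp)
  refine ⟨θ, fun k => ⟨(hθ k trivial).1.le, (hθ k trivial).2.le⟩, fun m x hx u hu => ?_⟩
  by_contra hdep
  refine hW ⟨⟨m, x⟩, hx, hdep⟩ ?_
  have h1 := congrArg u (hg ⟨⟨m, x⟩, hx, hdep⟩)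
  rw [LinearMap.mem_ker]
  simp only [map_sum, map_smul, map_zero, Function.comp_apply, hu] at h1
  simpa using h1

end Generic

section Action

variable {A : Type*} [CommRing A] {n N : ℕ}

variable (σ : A →+* ℂ) (e : Fin N ≃ Fin n × Fin n) in
/-- The action of the special linear group on Hermitian forms. -/
noncomputable def ga (γ : SpecialLinearGroup (Fin n) A) : (Fin N → ℝ) →ₗ[ℝ] (Fin N → ℝ) :=
  tm e (γ.1.map σ)

variable {σ : A →+* ℂ} {e : Fin N ≃ Fin n × Fin n}

lemma map_coe_smul (γ : SpecialLinearGroup (Fin n) A) (v : Vc A n) :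
    σ ∘ (γ • v).1 = γ.1.map σ *ᵥ (σ ∘ v.1) := by
  ext i
  exact RingHom.map_mulVec σ γ.1 v.1 i

lemma ga_iv (γ : SpecialLinearGroup (Fin n) A) (v : Vc A n) :
    ga σ e γ (iv σ e v) = iv σ e (γ • v) := by
  rw [ga, iv, tm_ic, iv, map_coe_smul]

lemma map_ga (γ : SpecialLinearGroup (Fin n) A) (x : List (Vc A n)) :
    (x.map (γ • ·)).map (iv σ e) = (x.map (iv σ e)).map (ga σ e γ) := by
  simp [Function.comp_def, ga_iv]

lemma ga_mul (γ δ : SpecialLinearGroup (Fin n) A) : ga σ e (γ * δ) = ga σ e γ ∘ₗ ga σ e δ := by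
  change tm e ((γ.1 * δ.1).map σ) = _
  rw [Matrix.map_mul, tm_mul]
  rfl

lemma ga_one : ga σ e (1 : SpecialLinearGroup (Fin n) A) = LinearMap.id := by
  change tm e ((1 : Matrix (Fin n) (Fin n) A).map σ) = _
  rw [Matrix.map_one _ (map_zero σ) (map_one σ), tm_one]

lemma ga_ga_inv (γ : SpecialLinearGroup (Fin n) A) (x : Fin N → ℝ) :
    ga σ e γ (ga σ e γ⁻¹ x) = x := by
  rw [← LinearMap.comp_apply, ← ga_mul, mul_inv_cancel, ga_one, LinearMap.id_apply]

lemma det_ga_pos (γ : SpecialLinearGroup (Fin n) A) : 0 < LinearMap.det (ga σ e γ) := by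
  refine det_tm_pos e ?_
  rw [← RingHom.mapMatrix_apply, ← RingHom.map_det, γ.2, map_one]
  exact one_ne_zero

lemma Ps.comp {u : Dual ℝ (Fin N → ℝ)} (hu : Ps σ e u) (γ : SpecialLinearGroup (Fin n) A) :
    Ps σ e (u ∘ₗ ga σ e γ) := fun v => by
  rw [LinearMap.comp_apply, ga_iv]
  exact hu _

lemma ga_mem_Xs {p : Fin N → ℝ} (hp : p ∈ Xs σ e) (γ : SpecialLinearGroup (Fin n) A) :
    ga σ e γ p ∈ Xs σ e := fun u hu0 hu => by
  refine hp (u ∘ₗ ga σ e γ) (fun h0 => hu0 (LinearMap.ext fun x => ?_)) (hu.comp γ)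
  have := LinearMap.congr_fun h0 (ga σ e γ⁻¹ x)
  rwa [LinearMap.comp_apply, ga_ga_inv] at this

lemma exists_ofFn' {α : Type*} {l : List α} {m : ℕ} (h : l.length = m) :
    ∃ x : Fin m → α, l = List.ofFn x := by
  subst h
  exact exists_ofFn l

lemma sd_map {f : (Fin N → ℝ) →ₗ[ℝ] (Fin N → ℝ)} (hf : 0 < LinearMap.det f)
    (l : List (Fin N → ℝ)) : sd (l.map f) = sd l := by
  by_cases hl : l.length = N
  · obtain ⟨x, rfl⟩ : ∃ x : Fin N → Fin N → ℝ, l = List.ofFn x := exists_ofFn' hl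
    have h1 : of (f ∘ x) = of x * (LinearMap.toMatrix' f)ᵀ := by
      ext i j
      have := congrFun (LinearMap.toMatrix'_mulVec f (x i)) j
      rw [of_apply, Function.comp_apply, ← this, mul_apply]
      simp only [mulVec, dotProduct, of_apply, transpose_apply, mul_comm]
    rw [List.map_ofFn, sd_ofFn, sd_ofFn, h1, det_mul, det_transpose, LinearMap.det_toMatrix',
      sign_mul, sign_pos hf, mul_one]
  · rw [sd_of_length hl, sd_of_length (by rwa [List.length_map])]

lemma RR_comp {ω : Vc A n → ℝ} (γ : SpecialLinearGroup (Fin n) A) {u : Dual ℝ (Fin N → ℝ)} :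
    u ∘ₗ ga σ e γ ∈ RR (iv σ e) (fun v => ω (γ • v)) ↔ u ∈ RR (iv σ e) ω := by
  refine ⟨fun h v => ?_, fun h v => ?_⟩
  · have := h (γ⁻¹ • v)
    simpa only [LinearMap.comp_apply, ga_iv, smul_inv_smul] using this
  · simpa only [LinearMap.comp_apply, ga_iv] using h (γ • v)

lemma exists_comp_ga (γ : SpecialLinearGroup (Fin n) A) (u : Dual ℝ (Fin N → ℝ)) :
    ∃ u', u = u' ∘ₗ ga σ e γ :=
  ⟨u ∘ₗ ga σ e γ⁻¹, LinearMap.ext fun x => by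
    rw [LinearMap.comp_apply, LinearMap.comp_apply, ← LinearMap.comp_apply (ga σ e γ⁻¹), ← ga_mul,
      inv_mul_cancel, ga_one, LinearMap.id_apply]⟩

lemma cf_smul (ω : Vc A n → ℝ) (γ : SpecialLinearGroup (Fin n) A) (x : List (Vc A n)) :
    cf (iv σ e) ω (x.map (γ • ·)) = cf (iv σ e) (fun v => ω (γ • v)) x := by
  suffices key : (∃ u ∈ RR (iv σ e) ω, ∀ v ∈ x.map (γ • ·), u (iv σ e v) = ω v) ↔
      ∃ u ∈ RR (iv σ e) (fun v => ω (γ • v)), ∀ v ∈ x, u (iv σ e v) = ω (γ • v)  by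
    classical
    rw [cf, cf, map_ga, sd_map (det_ga_pos γ)]
    exact if_congr key rfl rfl
  refine ⟨?_, ?_⟩
  · rintro ⟨u, hu, hx⟩
    refine ⟨u ∘ₗ ga σ e γ, (RR_comp γ).mpr hu, fun v hv => ?_⟩
    rw [LinearMap.comp_apply, ga_iv]
    exact hx _ (List.mem_map_of_mem hv)
  · rintro ⟨u, hu, hx⟩
    obtain ⟨u, rfl⟩ := exists_comp_ga (σ := σ) (e := e) γ u
    refine ⟨u, (RR_comp γ).mp hu, fun v hv => ?_⟩
    obtain ⟨w, hw, rfl⟩ := List.mem_map.mp hv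
    rw [← ga_iv]
    exact hx w hw

/-- Weight functions whose polyhedra are simple. -/
structure Wt (σ : A →+* ℂ) (e : Fin N ≃ Fin n × Fin n) (ω : Vc A n → ℝ) : Prop where
  lo : ∀ v, 1 ≤ ω v
  hi : ∀ v, ω v ≤ 2
  rel : ∀ v w, uRel A n v w → ω v = ω w
  ind : ∀ (m : ℕ) (x : Fin m → Vc A n),
    (∃ u ∈ RR (iv σ e) ω, ∀ i, u (iv σ e (x i)) = ω (x i)) →
    Pairwise (fun i j => ¬ uRel A n (x i) (x j)) → LinearIndependent ℝ (iv σ e ∘ x)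

lemma uRel_smul (γ : SpecialLinearGroup (Fin n) A) {v w : Vc A n} (h : uRel A n v w) :
    uRel A n (γ • v) (γ • w) := by
  obtain ⟨ε, hε⟩ := h
  exact ⟨ε, by rw [coe_smul_vec, coe_smul_vec, hε, mulVec_smul]⟩

lemma Wt.smul {ω : Vc A n → ℝ} (h : Wt σ e ω) (γ : SpecialLinearGroup (Fin n) A) :
    Wt σ e fun v => ω (γ • v) := by
  refine ⟨fun v => h.lo _, fun v => h.hi _, fun v w hvw => h.rel _ _ (uRel_smul γ hvw), ?_⟩
  rintro m x ⟨u, hu, hx⟩ hp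
  obtain ⟨u, rfl⟩ := exists_comp_ga (σ := σ) (e := e) γ u
  have h1 := h.ind m (fun i => γ • x i) ⟨u, (RR_comp γ).mp hu, fun i => by
    rw [← ga_iv]
    exact hx i⟩ fun i j hij hr => hp hij (by simpa using uRel_smul γ⁻¹ hr)
  have h2 : iv σ e ∘ (fun i => γ • x i) = ga σ e γ ∘ iv σ e ∘ x := by
    ext1 i
    exact (ga_iv γ (x i)).symm
  rw [h2] at h1
  exact h1.of_comp

lemma Wt.simple {ρ : A} (hE : Eisen σ ρ) {ω : Vc A n → ℝ} (h : Wt σ e ω) :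
    Simple (iv σ e) ω (uRel A n) := by
  refine ⟨fun a b => iv_rel hE, h.rel, h.ind, fun u hu d => ?_⟩
  have hu1 : ∀ v : Vc A n, 1 ≤ u (iv σ e v) := fun v => (h.lo v).trans (hu v)
  obtain ⟨c, hc, hle⟩ := exists_lower (e := e) hE (nu u)
  obtain ⟨C, hC⟩ : ∃ C, 0 < C ∧ ∀ z, |d (ic e z)| ≤ C * ‖z‖ ^ 2 := by
    obtain ⟨C, hC⟩ := ((isCompact_sphere (0 : Fin n → ℂ) 1).image
      (continuous_dual_ic (e := e) d)).isBounded.exists_norm_le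
    refine ⟨|C| + 1, by positivity, fun z => ?_⟩
    rcases eq_or_ne z 0 with rfl | hz
    · simp [ic_zero]
    have hz' : 0 < ‖z‖ := norm_pos_iff.mpr hz
    have h1 : z = ((‖z‖ : ℝ) : ℂ) • (((‖z‖⁻¹ : ℝ) : ℂ) • z) := by
      rw [smul_smul, ← Complex.ofReal_mul, mul_inv_cancel₀ hz'.ne', Complex.ofReal_one, one_smul]
    have h2 := hC _ ⟨((‖z‖⁻¹ : ℝ) : ℂ) • z, by simp [norm_smul, hz'.ne'], rfl⟩
    conv_lhs => rw [h1]
    rw [ic_smul e, map_smul, Complex.normSq_ofReal, smul_eq_mul, abs_mul, abs_mul_self, mul_comm,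
      ← pow_two]
    rw [Real.norm_eq_abs] at h2
    gcongr
    linarith [le_abs_self C]
  refine ⟨c / (2 * C), by have := hC.1; positivity,
    (hE.finite_vec (√(4 / c))).subset fun v hv => ?_⟩
  change ‖σ ∘ v.1‖ ≤ √(4 / c)
  refine Real.le_sqrt_of_sq_le ((le_div_iff₀ hc).mpr ?_)
  have h1 : (u + (c / (2 * C)) • d) (iv σ e v) < ω v := hv
  have h2 := hle u le_rfl hu1 (σ ∘ v.1)
  have h3 := (abs_le.mp (hC.2 (σ ∘ v.1))).1
  rw [LinearMap.add_apply, LinearMap.smul_apply, smul_eq_mul, iv] at h1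
  have h4 : c / (2 * C) * -(C * ‖σ ∘ v.1‖ ^ 2) ≤ c / (2 * C) * d (ic e (σ ∘ v.1)) :=
    mul_le_mul_of_nonneg_left h3 (by have := hC.1; positivity)
  have h5 : c / (2 * C) * -(C * ‖σ ∘ v.1‖ ^ 2) = -(c * ‖σ ∘ v.1‖ ^ 2 / 2) := by
    have := hC.1.ne'
    field_simp
  linarith [h.hi v]

end Action

end Eis

namespace Eis

open Module Matrix

section Weights

variable {A : Type*} [CommRing A] {σ : A →+* ℂ} {ρ : A} {n N : ℕ} {e : Fin N ≃ Fin n × Fin n}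

lemma Eisen.finite_quotient (h : Eisen σ ρ) : Finite (A ⧸ Ideal.span {(3 : A)}) := by
  refine Finite.of_surjective (fun q : Fin 3 × Fin 3 =>
    Ideal.Quotient.mk (Ideal.span {(3 : A)}) ((q.1 : ℕ) + (q.2 : ℕ) * ρ)) fun y => ?_
  obtain ⟨x, rfl⟩ := Ideal.Quotient.mk_surjective y
  obtain ⟨a, b, rfl⟩ := h.gen x
  refine ⟨(⟨(a % 3).toNat, by omega⟩, ⟨(b % 3).toNat, by omega⟩), ?_⟩
  rw [Ideal.Quotient.eq, Ideal.mem_span_singleton]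
  refine ⟨-(a / 3 : ℤ) - (b / 3 : ℤ) * ρ, ?_⟩
  have key : ∀ a : ℤ, (((a % 3).toNat : ℕ) : A) = a - 3 * (a / 3 : ℤ) := fun a => by
    rw [← Int.cast_natCast, Int.toNat_of_nonneg (by omega), Int.emod_def]
    push_cast
    rfl
  simp only [key]
  ring

/-- The class of a vector modulo three and units. -/
def kp (v : Vc A n) : Set (Fin n → A ⧸ Ideal.span {(3 : A)}) :=
  Set.range fun (ε : Aˣ) i => Ideal.Quotient.mk _ (ε * v.1 i)

lemma kp_smul (γ : SpecialLinearGroup (Fin n) A) (v : Vc A n) :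
    kp (γ • v) = (fun w => γ.1.map (Ideal.Quotient.mk (Ideal.span {(3 : A)})) *ᵥ w) '' kp v := by
  rw [kp, kp, ← Set.range_comp]
  congr 1
  ext1 ε
  ext1 i
  rw [coe_smul_vec, Function.comp_apply, ← smul_eq_mul, ← Pi.smul_apply, ← mulVec_smul]
  exact RingHom.map_mulVec _ γ.1 ((ε : A) • v.1) i

lemma exists_of_kp_eq {v w : Vc A n} (h : kp v = kp w) :
    ∃ (ε : Aˣ) (z : Fin n → A), v.1 = (ε : A) • w.1 + (3 : A) • z := by
  have h1 : (fun i => Ideal.Quotient.mk (Ideal.span {(3 : A)}) (((1 : Aˣ) : A) * v.1 i)) ∈ kp v :=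
    ⟨1, rfl⟩
  rw [h] at h1
  obtain ⟨ε, hε⟩ := h1
  have h2 : ∀ i, ∃ z, v.1 i - ε * w.1 i = 3 * z := fun i => by
    have := congrFun hε i
    rw [Units.val_one, one_mul, eq_comm, Ideal.Quotient.eq, Ideal.mem_span_singleton] at this
    exact this
  choose z hz using h2
  refine ⟨ε, z, ?_⟩
  ext i
  simp [← hz i]

lemma uRel_of_kp_eq (h : Eisen σ ρ) {v w : Vc A n} (hvw : kp v = kp w)
    {u : Dual ℝ (Fin N → ℝ)} (hu : ∀ v : Vc A n, 1 ≤ u (iv σ e v)) (hv : u (iv σ e v) ≤ 2)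
    (hw : u (iv σ e w) ≤ 2) : uRel A n v w := by
  obtain ⟨ε, z, hz⟩ := exists_of_kp_eq hvw
  by_cases h0 : z = 0
  · refine (uRel A n).symm ⟨ε, ?_⟩
    rw [hz, h0, smul_zero, add_zero]
  have hp : Ps σ e u := fun v => zero_le_one.trans (hu v)
  have h1 : (3 : ℂ) • (σ ∘ z) = σ ∘ v.1 + (-σ ε) • (σ ∘ w.1) := by
    ext i
    have : σ 3 = 3 := map_ofNat σ 3
    simp [hz, this]
  have h2 := hp.add_le h (σ ∘ v.1) ((-σ ε) • (σ ∘ w.1))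
  rw [← h1, ic_smul, ic_smul, Complex.normSq_neg, h.normSq_unit, one_smul, map_smul, smul_eq_mul]
    at h2
  have h3 : Complex.normSq 3 = 9 := by
    rw [Complex.normSq_ofNat]
    norm_num
  rw [h3] at h2
  have h4 := hu ⟨z, h0⟩
  unfold iv at h4 hv hw
  linarith

theorem exists_wt (h : Eisen σ ρ) : ∃ ω : Vc A n → ℝ, Wt σ e ω ∧
    (Set.range fun (γ : SpecialLinearGroup (Fin n) A) v => ω (γ • v)).Finite := by
  have := h.finite_quotient
  have := h.countable
  have : Countable (Vc A n) := inferInstanceAs (Countable {v : Fin n → A // v ≠ 0})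
  obtain ⟨θ, hθ, hind⟩ := exists_weight (iv σ e) (kp (A := A) (n := n))
  refine ⟨θ ∘ kp, ⟨fun v => (hθ _).1, fun v => (hθ _).2, fun v w hvw => ?_, ?_⟩, ?_⟩
  · obtain ⟨ε, hε⟩ := hvw
    rw [Function.comp_apply, Function.comp_apply]
    congr 1
    rw [kp, kp, ← (Equiv.mulRight ε).surjective.range_comp]
    congr 1
    ext1 δ
    ext1 i
    simp [hε, mul_assoc]
  · rintro m x ⟨u, hu, hx⟩ hp
    refine hind m x (fun i j hij => ?_) u hx
    by_contra hne
    exact hp hne (uRel_of_kp_eq h hij (fun v => (hθ _).1.trans (hu v)) ((hx i).trans_le (hθ _).2)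
      ((hx j).trans_le (hθ _).2))
  · refine (Set.finite_range fun (f : Set (Fin n → A ⧸ Ideal.span {(3 : A)}) →
      Set (Fin n → A ⧸ Ideal.span {(3 : A)})) (v : Vc A n) => θ (f (kp v))).subset ?_
    rintro _ ⟨γ, rfl⟩
    exact ⟨_, funext fun v => congrArg θ (kp_smul γ v).symm⟩

lemma Eisen.finite_units (h : Eisen σ ρ) : Finite Aˣ := by
  have h1 := (h.finite_ball 1).to_subtype
  have h2 : ∀ ε : Aˣ, ‖σ ε‖ ≤ 1 := fun ε => by
    have := h.normSq_unit ε
    rw [Complex.normSq_eq_norm_sq] at this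
    nlinarith [norm_nonneg (σ ε)]
  exact Finite.of_injective (fun ε : Aˣ => (⟨ε, h2 ε⟩ : {a : A | ‖σ a‖ ≤ 1}))
    fun a b hab => Units.ext (congrArg Subtype.val hab)

lemma class_finite [IsDomain A] (h : Eisen σ ρ) (v : Vc A n) :
    {w | uRel A n v w}.Finite ∧ {w | uRel A n v w}.ncard = Nat.card Aˣ := by
  have := h.finite_units
  let f (ε : Aˣ) : Vc A n := ⟨(ε : A) • v.1, smul_ne_zero ε.ne_zero v.2⟩
  have h1 : {w | uRel A n v w} = Set.range f := by
    ext w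
    refine ⟨?_, ?_⟩
    · rintro ⟨ε, hε⟩
      exact ⟨ε, Subtype.ext hε.symm⟩
    · rintro ⟨ε, rfl⟩
      exact ⟨ε, rfl⟩
  rw [h1]
  refine ⟨Set.finite_range f, ?_⟩
  rw [← Nat.card_coe_set_eq, Nat.card_range_of_injective]
  exact fun a b hab => Units.ext (smul_left_injective A v.2 (congrArg Subtype.val hab))

end Weights

end Eis

namespace Eis

open Module Matrix

section Reduction

variable {A : Type*} [CommRing A] {σ : A →+* ℂ} {ρ : A} {n N : ℕ} {e : Fin N ≃ Fin n × Fin n}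

lemma exists_min_pair {M : A → ℕ} (hM : Disc M) {J : Finset (Fin n)}
    (γ : SpecialLinearGroup (Fin n) A) (w : Fin n → A) (hw : ∃ i ∉ J, w i ≠ 0) :
    ∃ (γ' : SpecialLinearGroup (Fin n) A) (w' : Fin n → A), γ'.1 *ᵥ w' = γ.1 *ᵥ w ∧
      (∀ j ∈ J, ∀ a, γ'.1 a j = γ.1 a j) ∧ (∃ i ∉ J, w' i ≠ 0) ∧
        ∀ i ∉ J, w' i ≠ 0 → ∀ a, a ≠ i → M (w' a) < M (w' i) := by
  classical
  let S : Set (SpecialLinearGroup (Fin n) A × (Fin n → A)) := {q | q.1.1 *ᵥ q.2 = γ.1 *ᵥ w ∧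
    (∀ j ∈ J, ∀ a, q.1.1 a j = γ.1 a j) ∧ ∃ i ∉ J, q.2 i ≠ 0}
  obtain ⟨⟨γ', w'⟩, ⟨h1, h2, h3⟩, hmin⟩ := exists_minimalFor_of_wellFoundedLT (· ∈ S)
    (fun q => ∑ a, M (q.2 a)) ⟨(γ, w), rfl, fun _ _ _ => rfl, hw⟩
  refine ⟨γ', w', h1, h2, h3, fun i hi hi0 a ha => ?_⟩
  by_contra hlt
  obtain ⟨s, hs⟩ := hM.div (w' a) (w' i) hi0
  have hlt' : M (w' a + s * w' i) < M (w' a) := hs.trans_le (not_lt.mp hlt)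
  have hT : Matrix.transvection a i (-s) *ᵥ Function.update w' a (w' a + s * w' i) = w' := by
    ext b
    rw [Matrix.transvection, add_mulVec, one_mulVec, Pi.add_apply, single_mulVec]
    rcases eq_or_ne b a with rfl | hb
    · simp [Function.update_of_ne ha.symm]
    · simp [hb]
  have hmem : (γ' * SpecialLinearGroup.transvection ha (-s),
      Function.update w' a (w' a + s * w' i)) ∈ S := by
    refine ⟨?_, fun j hj b => ?_, i, hi, ?_⟩
    · change (γ'.1 * Matrix.transvection a i (-s)) *ᵥ _ = _
      rw [← mulVec_mulVec, hT, h1]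
    · change (γ'.1 * Matrix.transvection a i (-s)) b j = _
      rw [mul_transvection_apply_of_ne _ _ _ _ (by rintro rfl; exact hi hj), h2 j hj b]
    · change Function.update w' a (w' a + s * w' i) i ≠ 0
      rwa [Function.update_of_ne ha.symm]
  have hsum : ∑ b, M (Function.update w' a (w' a + s * w' i) b) < ∑ b, M (w' b) := by
    refine Finset.sum_lt_sum (fun b _ => ?_) ⟨a, Finset.mem_univ a, by simpa using hlt'⟩
    rcases eq_or_ne b a with rfl | hb
    · simpa using hlt'.le
    · simp [hb]
  exact absurd (hmin hmem hsum.le) (not_le.mpr hsum)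

lemma reduce_step (h : Eisen σ ρ) {u : Dual ℝ (Fin N → ℝ)} (hu : Ps σ e u) {C : ℝ} (hC : 0 ≤ C)
    {J : Finset (Fin n)} {γ : SpecialLinearGroup (Fin n) A}
    (hγ : ∀ j ∈ J, u (ic e (σ ∘ fun a => γ.1 a j)) ≤ C) {w : Fin n → A} (hw : ∃ i ∉ J, w i ≠ 0)
    (hy : u (ic e (σ ∘ (γ.1 *ᵥ w))) ≤ 2) :
    ∃ (γ' : SpecialLinearGroup (Fin n) A), ∃ i ∉ J, ∀ j ∈ insert i J,
      u (ic e (σ ∘ fun a => γ'.1 a j)) ≤ C + 4 + 2 ^ (n + 1) * n * C := by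
  obtain ⟨γ', w', h1, h2, ⟨i, hi, hi0⟩, hmin⟩ := exists_min_pair h.disc γ w hw
  have hγ' : ∀ j ∈ J, u (ic e (σ ∘ fun a => γ'.1 a j)) ≤ C := fun j hj => by
    have : (fun a => γ'.1 a j) = fun a => γ.1 a j := funext (h2 j hj)
    rw [this]
    exact hγ j hj
  rw [← h1] at hy
  have hlt := hmin i hi hi0
  refine ⟨γ', i, hi, fun j hj => ?_⟩
  have hP : 0 ≤ 2 ^ (n + 1) * n * C := by positivity
  rcases Finset.mem_insert.mp hj with rfl | hj
  swap
  · linarith [hγ' j hj]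
  clear hj
  have hz : ∀ a ∉ insert j J, w' a = 0 := fun a ha => by
    rw [Finset.mem_insert, not_or] at ha
    by_contra h0
    exact (hlt a ha.1).asymm (hmin a ha.2 h0 j (Ne.symm ha.1))
  have hy2 : σ (w' j) • (σ ∘ fun a => γ'.1 a j) =
      σ ∘ (γ'.1 *ᵥ w') + ∑ b ∈ J, (-σ (w' b)) • (σ ∘ fun a => γ'.1 a b) := by
    ext a
    have : (γ'.1 *ᵥ w') a = ∑ b ∈ insert j J, γ'.1 a b * w' b :=
      (Finset.sum_subset (f := fun b => γ'.1 a b * w' b) (Finset.subset_univ (insert j J))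
        fun b _ hb => by rw [hz b hb, mul_zero]).symm
    rw [Pi.add_apply, Finset.sum_apply, Function.comp_apply, this, Finset.sum_insert hi]
    simp only [Pi.smul_apply, Function.comp_apply, smul_eq_mul, map_add, map_mul, map_sum,
      neg_mul, Finset.sum_neg_distrib]
    simp only [mul_comm (σ (w' _))]
    ring
  have h3 := hu.add_le h (σ ∘ (γ'.1 *ᵥ w')) (∑ b ∈ J, (-σ (w' b)) • (σ ∘ fun a => γ'.1 a b))
  have h4 := hu.sum_le h J fun b => (-σ (w' b)) • (σ ∘ fun a => γ'.1 a b)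
  rw [← hy2] at h3
  simp only [ic_smul, map_smul, Complex.normSq_neg, smul_eq_mul] at h3 h4
  have h5 : ∑ b ∈ J, Complex.normSq (σ (w' b)) * u (ic e (σ ∘ fun a => γ'.1 a b)) ≤
      n * (Complex.normSq (σ (w' j)) * C) := by
    refine (Finset.sum_le_card_nsmul _ _ (Complex.normSq (σ (w' j)) * C) fun b hb => ?_).trans ?_
    · have h6 : Complex.normSq (σ (w' b)) ≤ Complex.normSq (σ (w' j)) := by
        rw [← h.cast_nmA, ← h.cast_nmA]
        exact_mod_cast (hlt b (by rintro rfl; exact hi hb)).le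
      exact mul_le_mul h6 (hγ' b hb) (hu.nonneg h _) (Complex.normSq_nonneg _)
    · rw [nsmul_eq_mul]
      refine mul_le_mul_of_nonneg_right ?_ (mul_nonneg (Complex.normSq_nonneg _) hC)
      exact_mod_cast (Finset.card_le_univ J).trans_eq (Fintype.card_fin n)
  have h7 : (2 : ℝ) ^ J.card ≤ 2 ^ n :=
    pow_le_pow_right₀ (by norm_num) ((Finset.card_le_univ J).trans_eq (Fintype.card_fin n))
  have hm := h.one_le_normSq hi0
  set m := Complex.normSq (σ (w' j))
  have h8 : u (ic e (∑ b ∈ J, (-σ (w' b)) • (σ ∘ fun a => γ'.1 a b))) ≤ 2 ^ n * (n * (m * C)) :=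
    h4.trans (mul_le_mul h7 h5 (Finset.sum_nonneg fun b _ =>
      mul_nonneg (Complex.normSq_nonneg _) (hu.nonneg h _)) (by positivity))
  have h9 : m * u (ic e (σ ∘ fun a => γ'.1 a j)) ≤ m * (4 + 2 ^ (n + 1) * n * C) := by
    rw [pow_succ]
    nlinarith
  linarith [le_of_mul_le_mul_left h9 (by linarith)]

lemma exists_reduced (h : Eisen σ ρ) {k : ℕ} (hk : k ≤ n) : ∃ C : ℝ, 0 ≤ C ∧
    ∀ u : Dual ℝ (Fin N → ℝ), Ps σ e u → ∀ x ∈ Fu A n, (∀ y ∈ x, u (iv σ e y) ≤ 2) →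
      ∃ (J : Finset (Fin n)) (γ : SpecialLinearGroup (Fin n) A), J.card = k ∧
        ∀ j ∈ J, u (ic e (σ ∘ fun a => γ.1 a j)) ≤ C := by
  induction k with
  | zero => exact ⟨0, le_rfl, fun u _ x _ _ => ⟨∅, 1, rfl, by simp⟩⟩
  | succ k ih =>
    obtain ⟨C, hC, hr⟩ := ih (by omega)
    refine ⟨C + 4 + 2 ^ (n + 1) * n * C, by positivity, fun u hu x hx hy => ?_⟩
    obtain ⟨J, γ, hJ, hγ⟩ := hr u hu x hx hy
    obtain ⟨i, hi⟩ : ∃ i, i ∉ J := by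
      by_contra! hall
      rw [Finset.eq_univ_iff_forall.mpr hall, Finset.card_univ, Fintype.card_fin] at hJ
      omega
    obtain ⟨y, hyx, hy0⟩ : ∃ y ∈ x, (γ⁻¹.1 *ᵥ y.1) i ≠ 0 := by
      by_contra! hall
      have h1 := hx (LinearMap.proj i ∘ₗ mulVecLin γ⁻¹.1) hall
      have h2 := LinearMap.congr_fun h1 (γ.1 *ᵥ Pi.single i 1)
      rw [LinearMap.comp_apply, mulVecLin_apply, mulVec_mulVec] at h2
      have h3 : γ⁻¹.1 * γ.1 = 1 := congrArg Subtype.val (inv_mul_cancel γ)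
      rw [h3, one_mulVec] at h2
      have : (1 : A) = 0 := by simpa using h2
      simpa using congrArg σ this
    have h4 : γ.1 *ᵥ (γ⁻¹.1 *ᵥ y.1) = y.1 := by
      have h3 : γ.1 * γ⁻¹.1 = 1 := congrArg Subtype.val (mul_inv_cancel γ)
      rw [mulVec_mulVec, h3, one_mulVec]
    obtain ⟨γ', i', hi', hγ'⟩ := reduce_step h hu hC hγ ⟨i, hi, hy0⟩ (by
      rw [h4]
      exact hy y hyx)
    exact ⟨insert i' J, γ', by rw [Finset.card_insert_of_notMem hi', hJ], hγ'⟩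

theorem finite_orbits [IsDomain A] (h : Eisen σ ρ) (m : ℕ) : ∃ F : Set (List (Vc A n)), F.Finite ∧
    ∀ u : Dual ℝ (Fin N → ℝ), (∀ v : Vc A n, 1 ≤ u (iv σ e v)) → ∀ x ∈ Fu A n, x.length = m →
      (∀ y ∈ x, u (iv σ e y) ≤ 2) →
        ∃ γ : SpecialLinearGroup (Fin n) A, ∃ y ∈ F, x = y.map (γ • ·) := by
  obtain ⟨C, hC, hr⟩ := exists_reduced (e := e) h (le_refl n)
  let b (j : Fin n) : Vc A n := ⟨Pi.single j 1, by simp⟩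
  have hb : List.ofFn b ∈ Fu A n := fun μ hμ => by
    refine LinearMap.pi_ext' fun j => LinearMap.ext_ring ?_
    have := hμ (b j) (List.mem_ofFn.mpr ⟨j, rfl⟩)
    simpa [b] using this
  have hp : _ ∈ Xs σ e := sum_mem_Xs h hb
  obtain ⟨K, hK, hKu⟩ := Xs.bound hp
  obtain ⟨F, hF, hFu⟩ := exists_finite (e := e) h (n := n) (K * (n * C)) 2
  refine ⟨List.ofFn '' (Set.univ.pi fun _ : Fin m => F), (Set.Finite.pi fun _ => hF).image _,
    fun u hu x hx hm hy => ?_⟩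
  have hu0 : Ps σ e u := fun v => zero_le_one.trans (hu v)
  obtain ⟨J, γ, hJ, hγ⟩ := hr u hu0 x hx hy
  have hJ' : J = Finset.univ := by
    rw [← Finset.card_eq_iff_eq_univ, hJ, Fintype.card_fin]
  have h1 : nu (u ∘ₗ ga σ e γ) ≤ K * (n * C) := by
    refine (hKu _ (hu0.comp γ)).trans (mul_le_mul_of_nonneg_left ?_ hK.le)
    rw [List.map_ofFn, List.sum_ofFn, map_sum]
    refine (Finset.sum_le_card_nsmul _ _ C fun j _ => ?_).trans_eq (by simp)
    rw [Function.comp_apply, LinearMap.comp_apply, ga_iv]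
    have h2 : (γ • b j).1 = fun a => γ.1 a j := by
      rw [coe_smul_vec]
      ext a
      simp [b]
    rw [iv, h2]
    exact hγ j (hJ' ▸ Finset.mem_univ j)
  obtain ⟨y, rfl⟩ := exists_ofFn' hm
  refine ⟨γ, List.ofFn fun i => γ⁻¹ • y i, ⟨_, fun i _ => ?_, rfl⟩, ?_⟩
  · refine hFu _ h1 (fun v => ?_) _ ?_
    · rw [LinearMap.comp_apply, ga_iv]
      exact hu _
    · rw [LinearMap.comp_apply, ga_iv, smul_inv_smul]
      exact hy _ (List.mem_ofFn.mpr ⟨i, rfl⟩)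
  · rw [List.map_ofFn]
    congr 1
    ext1 i
    exact (smul_inv_smul γ (y i)).symm

end Reduction

end Eis

namespace Eis

open Module Matrix

section Cycle

variable {A : Type*} [CommRing A] {σ : A →+* ℂ} {ρ : A} {n : ℕ}

lemma exists_row_of_notMem_Fu {x : List (Vc A n)} (hx : x ∉ Fu A n) :
    ∃ a : Fin n → A, a ≠ 0 ∧ ∀ v ∈ x, a ⬝ᵥ v.1 = 0 := by
  simp only [Fu, Set.mem_ofPred_eq, not_forall] at hx
  obtain ⟨μ, hμ, h0⟩ := hx
  have key : ∀ v, (fun j => μ (Pi.single j 1)) ⬝ᵥ v = μ v := fun v => by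
    rw [LinearMap.pi_apply_eq_sum_univ μ v, dotProduct]
    exact Finset.sum_congr rfl fun j _ => by
      rw [smul_eq_mul, mul_comm]
      congr 2
      ext k
      simp [Pi.single_apply, eq_comm]
  refine ⟨fun j => μ (Pi.single j 1), fun h => h0 (LinearMap.ext fun v => ?_), fun v hv => ?_⟩
  · rw [← key, h, zero_dotProduct, LinearMap.zero_apply]
  · rw [key, hμ v hv]

lemma qq_iv {N : ℕ} (e : Fin N ≃ Fin n × Fin n) (a : Fin n → A) (v : Vc A n) :
    qq e (σ ∘ a) (iv σ e v) = Complex.normSq (σ (a ⬝ᵥ v.1)) := by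
  rw [iv, qq_ic, RingHom.map_dotProduct]

variable {M : ℕ} {e : Fin (M + 1) ≃ Fin n × Fin n}

lemma cf_of_notMem_Fu (h : Eisen σ ρ) (ω : Vc A n → ℝ) {x : List (Vc A n)} (hx : x ∉ Fu A n) :
    cf (iv σ e) ω x = 0 := by
  have hsd : sd (x.map (iv σ e)) = 0 := by
    obtain ⟨a, ha, h0⟩ := exists_row_of_notMem_Fu hx
    by_cases hl : x.length = M + 1
    · obtain ⟨y, rfl⟩ := exists_ofFn' hl
      rw [List.map_ofFn, sd_ofFn]
      have hdet : (of (iv σ e ∘ y)).det = 0 := by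
        by_contra hdet
        have h1 := dual_eq_zero_of_det (w := qq e (σ ∘ a)) hdet fun i => by
          rw [Function.comp_apply, qq_iv, h0 _ (List.mem_ofFn.mpr ⟨i, rfl⟩), map_zero, map_zero]
        obtain ⟨j, hj⟩ := Function.ne_iff.mp ha
        have h2 := LinearMap.congr_fun h1 (ic e (Pi.single j 1))
        rw [qq_ic, dotProduct_single_one, LinearMap.zero_apply, Complex.normSq_eq_zero] at h2
        exact hj (h.inj (h2.trans (map_zero σ).symm))
      simp [hdet]
    · exact sd_of_length (by rwa [List.length_map])
  rw [cf, hsd, ite_self]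

lemma finite_support_cf [IsDomain A] (h : Eisen σ ρ) {ω : Vc A n → ℝ} (hω : Wt σ e ω)
    (y : Fin M → Vc A n) (hy : List.ofFn y ∈ Fu A n) :
    {v | cf (iv σ e) ω (v :: List.ofFn y) ≠ 0}.Finite := by
  have hp : _ ∈ Xs σ e := sum_mem_Xs h hy
  obtain ⟨C, hC, hu⟩ := Xs.bound hp
  obtain ⟨F, hF, hFu⟩ := exists_finite (e := e) h (n := n) (C * (M * 2)) 2
  refine hF.subset fun v (hv : cf (iv σ e) ω (v :: List.ofFn y) ≠ 0) => ?_
  have : ∃ u ∈ RR (iv σ e) ω, ∀ w ∈ v :: List.ofFn y, u (iv σ e w) = ω w := by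
    by_contra hc
    exact hv (if_neg hc)
  obtain ⟨u, hur, htight⟩ := this
  have h1 : ∀ v, 1 ≤ u (iv σ e v) := fun v => (hω.lo v).trans (hur v)
  refine hFu u ((hu u fun v => zero_le_one.trans (h1 v)).trans
    (mul_le_mul_of_nonneg_left ?_ hC.le)) h1 v ((htight v List.mem_cons_self).trans_le (hω.hi v))
  rw [List.map_ofFn, List.sum_ofFn, map_sum]
  refine (Finset.sum_le_card_nsmul _ _ 2 fun j _ => ?_).trans_eq (by simp)
  exact (htight _ (List.mem_cons_of_mem _ (List.mem_ofFn.mpr ⟨j, rfl⟩))).trans_le (hω.hi _)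

/-- The sum of the cycles of all translates of a weight function. -/
noncomputable def cy (σ : A →+* ℂ) (e : Fin (M + 1) ≃ Fin n × Fin n) {ω : Vc A n → ℝ}
    (hf : (Set.range fun (γ : SpecialLinearGroup (Fin n) A) v => ω (γ • v)).Finite)
    (l : List (Vc A n)) : ℚ :=
  ∑ ω' ∈ hf.toFinset, cf (iv σ e) ω' l

theorem orbCycle_cy [IsDomain A] (h : Eisen σ ρ) {ω : Vc A n → ℝ} (hω : Wt σ e ω)
    (hf : (Set.range fun (γ : SpecialLinearGroup (Fin n) A) v => ω (γ • v)).Finite) :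
    OrbCycle (SpecialLinearGroup (Fin n) A) (Fu A n) M (cy σ e hf) := by
  have hW : ∀ ω' ∈ hf.toFinset, Wt σ e ω' := fun ω' hω' => by
    obtain ⟨γ, rfl⟩ := hf.mem_toFinset.mp hω'
    exact hω.smul γ
  refine ⟨fun m x π => ?_, fun γ x => ?_, fun x hx => ?_, fun x hx => ?_, ?_, fun y hy => ?_⟩
  · rw [cy, cy, Finset.mul_sum]
    exact Finset.sum_congr rfl fun ω' _ => isAlt_cf _ ω' m x π
  · have hm : ∀ (δ : SpecialLinearGroup (Fin n) A), ∀ ω' ∈ hf.toFinset,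
        (fun v => ω' (δ • v)) ∈ hf.toFinset := fun δ ω' hω' => by
      obtain ⟨γ', rfl⟩ := hf.mem_toFinset.mp hω'
      refine hf.mem_toFinset.mpr ⟨γ' * δ, funext fun v => ?_⟩
      simp only [mul_smul]
    refine Finset.sum_nbij' (fun ω' v => ω' (γ • v)) (fun ω' v => ω' (γ⁻¹ • v)) (hm γ) (hm γ⁻¹)
      (fun ω' _ => by simp) (fun ω' _ => by simp) fun ω' _ => cf_smul ω' γ x
  · exact Finset.sum_eq_zero fun ω' _ => cf_of_notMem_Fu h ω' hx
  · refine Finset.sum_eq_zero fun ω' _ => ?_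
    rw [cf, sd_of_length (by rwa [List.length_map]), ite_self]
  · obtain ⟨F, hF, hFu⟩ := finite_orbits (e := e) (n := n) h (M + 1)
    refine ⟨F, hF, fun x hx => ?_⟩
    obtain ⟨ω', hω', h0⟩ := Finset.exists_ne_zero_of_sum_ne_zero hx
    have : ∃ u ∈ RR (iv σ e) ω', ∀ w ∈ x, u (iv σ e w) = ω' w := by
      by_contra hc
      exact h0 (if_neg hc)
    obtain ⟨u, hur, htight⟩ := this
    refine hFu u (fun v => ((hW ω' hω').lo v).trans (hur v)) x ?_ ?_
      fun y hy => (htight y hy).trans_le ((hW ω' hω').hi y)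
    · by_contra hc
      exact h0 (cf_of_notMem_Fu h ω' hc)
    · by_contra hc
      rw [cf, sd_of_length (by rwa [List.length_map]), ite_self] at h0
      exact h0 rfl
  · simp only [cy]
    rw [finsum_sum_comm _ _ fun ω' hω' => finite_support_cf h (hW ω' hω') y hy]
    refine Finset.sum_eq_zero fun ω' hω' => finsum_cf ((hW ω' hω').simple h) (class_finite h) y ?_
    intro d hd h0
    by_contra! hc
    refine hd (eq_zero_of_Fu h hc hy fun v hv => ?_)
    obtain ⟨i, rfl⟩ := List.mem_ofFn.mp hv
    exact h0 i

end Cycle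

end Eis

namespace Eis

open Module Matrix

section Equivariance

variable {A : Type*} [CommRing A] {σ : A →+* ℂ} {ρ : A} {n N : ℕ} {e : Fin N ≃ Fin n × Fin n}

lemma exists_bound {α : Type*} {s : Set α} (hs : s.Finite) (f : α → ℝ) :
    ∃ R, 0 < R ∧ ∀ a ∈ s, f a < R := by
  obtain ⟨R, hR⟩ := (hs.image f).bddAbove
  refine ⟨|R| + 1, by positivity, fun a ha => ?_⟩
  linarith [hR (Set.mem_image_of_mem f ha), le_abs_self R]

lemma Ps.ta (h : Eisen σ ρ) : Ps σ e (ta e) := fun v => zero_le_one.trans (one_le_ta h v)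

lemma Ps.qq (a : Fin n → A) : Ps σ e (qq e (σ ∘ a)) := fun v => by
  rw [qq_iv]
  exact Complex.normSq_nonneg _

lemma qq_single (a : Fin n → A) (j : Fin n) :
    Eis.qq e (σ ∘ a) (ic e (Pi.single j 1)) = Complex.normSq (σ (a j)) := by
  rw [qq_ic, dotProduct_single_one, Function.comp_apply]

lemma Xs.ta_pos (h : Eisen σ ρ) (hn : 0 < n) {p : Fin N → ℝ} (hp : p ∈ Xs σ e) : 0 < ta e p := by
  refine hp _ (fun h0 => ?_) (Ps.ta h)
  have h1 := LinearMap.congr_fun h0 (ic e (Pi.single ⟨0, hn⟩ 1))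
  rw [ta_ic, Finset.sum_eq_single ⟨0, hn⟩ (fun j _ hj => by simp [Pi.single_eq_of_ne hj])
    (fun h => absurd (Finset.mem_univ _) h)] at h1
  simp at h1

lemma Xs.qq_pos (h : Eisen σ ρ) {a : Fin n → A} (ha : a ≠ 0) {p : Fin N → ℝ} (hp : p ∈ Xs σ e) :
    0 < qq e (σ ∘ a) p := by
  refine hp _ (fun h0 => ?_) (Ps.qq a)
  obtain ⟨j, hj⟩ := Function.ne_iff.mp ha
  have h1 := LinearMap.congr_fun h0 (ic e (Pi.single j 1))
  rw [qq_single, LinearMap.zero_apply, Complex.normSq_eq_zero] at h1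
  exact hj (h.inj (h1.trans (map_zero σ).symm))

lemma EE.van (h : Eisen σ ρ) {m : ℕ} {f : List (Vc A n) → ℚ}
    (hf : f ∈ EE (iv σ e) (Xs σ e) (uRel A n) m) {x : List (Vc A n)} (hx : x ∉ Fu A n) :
    f x = 0 := by
  obtain ⟨-, -, -, P, hP, hPX, hv⟩ := id hf
  obtain ⟨a, ha, h0⟩ := exists_row_of_notMem_Fu hx
  obtain ⟨K, -, hK⟩ := exists_bound hP fun p => ta e p / qq e (σ ∘ a) p
  refine hv x ⟨ta e - K • qq e (σ ∘ a), fun p hp => ?_, fun v hvx => ?_⟩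
  · have := hK p hp
    rw [div_lt_iff₀ (Xs.qq_pos h ha (hPX hp))] at this
    rw [LinearMap.sub_apply, LinearMap.smul_apply, smul_eq_mul]
    linarith
  · rw [LinearMap.sub_apply, LinearMap.smul_apply, qq_iv, h0 v hvx, map_zero, map_zero, smul_zero,
      sub_zero]
    exact zero_lt_one.trans_le (one_le_ta h v)

lemma EE.stab {m : ℕ} {f : List (Vc A n) → ℚ} (hf : f ∈ EE (iv σ e) (Xs σ e) (uRel A n) m)
    (γ : SpecialLinearGroup (Fin n) A) : tc γ f ∈ EE (iv σ e) (Xs σ e) (uRel A n) m := by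
  obtain ⟨h1, h2, h3, P, hP, hPX, hv⟩ := id hf
  refine ⟨fun l hl => h1 _ (by rwa [List.length_map]), fun k x π => ?_, fun l l' hl => ?_,
    ga σ e γ '' P, hP.image _, ?_, ?_⟩
  · change f ((List.ofFn (x ∘ π)).map _) = _ * f ((List.ofFn x).map _)
    rw [List.map_ofFn, List.map_ofFn, ← Function.comp_assoc]
    exact h2 k _ π
  · refine h3 _ _ ?_
    rw [List.forall₂_map_left_iff, List.forall₂_map_right_iff]
    exact hl.imp fun a b hab => uRel_smul γ⁻¹ hab
  · rintro _ ⟨p, hp, rfl⟩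
    exact ga_mem_Xs (hPX hp) γ
  · rintro l ⟨u, hu, hl⟩
    refine hv _ ⟨u ∘ₗ ga σ e γ, fun p hp => hu _ ⟨p, hp, rfl⟩, fun a ha => ?_⟩
    obtain ⟨b, hb, rfl⟩ := List.mem_map.mp ha
    rw [LinearMap.comp_apply, ga_iv, smul_inv_smul]
    exact hl b hb

lemma EE.fin (h : Eisen σ ρ) {m : ℕ} {f : List (Vc A n) → ℚ}
    (hf : f ∈ EE (iv σ e) (Xs σ e) (uRel A n) m) : f ∈ FO (SpecialLinearGroup (Fin n) A)
    (Vc A n) := by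
  obtain ⟨-, -, -, P, hP, hPX, hv⟩ := id hf
  refine mem_FO.mpr fun x => ?_
  obtain ⟨R, hR, hxR⟩ := exists_bound x.finite_toSet fun v => ta e (iv σ e v)
  have hCp : ∀ p : P, ∃ C, 0 < C ∧ ∀ u, Ps σ e u → nu u ≤ C * u p := fun p => Xs.bound (hPX p.2)
  choose C hC hb using hCp
  have := hP.to_subtype
  obtain ⟨B, hB, hBP⟩ := exists_bound (Set.toFinite (Set.univ : Set P))
    fun p => C p * ((R + 1) * ta e p)
  obtain ⟨D, hD, hDj⟩ := exists_bound (Set.toFinite (Set.univ : Set (Fin n)))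
    fun j => ‖ic e (Pi.single j 1)‖
  have key : ∀ γ : SpecialLinearGroup (Fin n) A, f (x.map (γ • ·)) ≠ 0 →
      ∀ i j, Complex.normSq (σ (γ⁻¹.1 i j)) ≤ N * B * D := by
    intro γ hγ i j
    have hex : ∃ p ∈ P, qq e (σ ∘ γ⁻¹.1 i) p ≤ (R + 1) * ta e p := by
      by_contra! hc
      refine hγ (hv _ ⟨(R + 1) • ta e - qq e (σ ∘ γ⁻¹.1 i), fun p hp => ?_, fun a ha => ?_⟩)
      · rw [LinearMap.sub_apply, LinearMap.smul_apply, smul_eq_mul]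
        linarith [hc p hp]
      · obtain ⟨v, hvx, rfl⟩ := List.mem_map.mp ha
        have h1 : γ⁻¹.1 i ⬝ᵥ (γ • v).1 = v.1 i := by
          conv_rhs => rw [← inv_smul_smul γ v]
          rw [coe_smul_vec γ⁻¹]
          rfl
        rw [LinearMap.sub_apply, LinearMap.smul_apply, smul_eq_mul, qq_iv, h1]
        have h2 := hxR v hvx
        have h3 : Complex.normSq (σ (v.1 i)) ≤ ta e (iv σ e v) := by
          rw [iv, ta_ic]
          exact Finset.single_le_sum (f := fun i => Complex.normSq ((σ ∘ v.1) i))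
            (fun i _ => Complex.normSq_nonneg _) (Finset.mem_univ i)
        nlinarith [one_le_ta (e := e) h (γ • v)]
    obtain ⟨p, hp, hle⟩ := hex
    have h1 : nu (qq e (σ ∘ γ⁻¹.1 i)) ≤ B :=
      ((hb ⟨p, hp⟩ _ (Ps.qq _)).trans (mul_le_mul_of_nonneg_left hle (hC _).le)).trans
        (hBP ⟨p, hp⟩ trivial).le
    rw [← qq_single (e := e)]
    refine (le_abs_self _).trans ((abs_apply_le _ _).trans ?_)
    exact mul_le_mul (mul_le_mul_of_nonneg_left h1 (Nat.cast_nonneg N)) (hDj j trivial).le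
      (norm_nonneg _) (by positivity)
  have hfin : (Set.univ.pi fun _ : Fin n => Set.univ.pi fun _ : Fin n =>
      {a : A | ‖σ a‖ ≤ √(N * B * D)}).Finite :=
    Set.Finite.pi fun _ => Set.Finite.pi fun _ => h.finite_ball _
  refine (hfin.preimage (f := fun γ : SpecialLinearGroup (Fin n) A => fun i j => γ⁻¹.1 i j)
    fun γ _ δ _ hγδ => inv_injective (Subtype.ext hγδ)).subset fun γ hγ i _ j _ => ?_
  change ‖σ (γ⁻¹.1 i j)‖ ≤ _
  refine Real.le_sqrt_of_sq_le ?_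
  rw [← Complex.normSq_eq_norm_sq]
  exact key γ hγ i j

lemma eq_one_of_map_eq {x : List (Vc A n)} (hx : x ∈ Fu A n) {γ : SpecialLinearGroup (Fin n) A}
    (hγ : x.map (γ • ·) = x) : γ = 1 := by
  have h1 : ∀ v ∈ x, γ • v = v := by
    conv_rhs at hγ => rw [← List.map_id x]
    exact List.map_inj_left.mp hγ
  have h2 : ∀ i, LinearMap.proj i ∘ₗ (mulVecLin γ.1 - LinearMap.id) = 0 := fun i =>
    hx _ fun v hv => by
      have := congrFun (congrArg Subtype.val (h1 v hv)) i
      rw [coe_smul_vec] at this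
      simp [this]
  have h3 : mulVecLin γ.1 = mulVecLin 1 := by
    rw [mulVecLin_one, ← sub_eq_zero]
    exact LinearMap.ext fun v => funext fun i => LinearMap.congr_fun (h2 i) v
  exact Subtype.ext (Matrix.toLin'.injective h3)

lemma exists_mem_Xs [IsDomain A] (h : Eisen σ ρ) : (Xs (n := n) σ e).Nonempty := by
  let b (j : Fin n) : Vc A n := ⟨Pi.single j 1, fun h0 => by
    have h1 : (1 : A) = 0 := by simpa using congrFun h0 j
    simpa using congrArg σ h1⟩
  refine ⟨_, sum_mem_Xs h (x := List.ofFn b) fun μ hμ => ?_⟩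
  refine LinearMap.pi_ext' fun j => LinearMap.ext_ring ?_
  have := hμ (b j) (List.mem_ofFn.mpr ⟨j, rfl⟩)
  simpa [b] using this

lemma good [IsDomain A] (h : Eisen σ ρ) (hn : 0 < n) : Good (iv σ e) (Xs σ e) (uRel A n) :=
  ⟨fun _ _ => iv_rel h, exists_mem_Xs h, fun _ => Xs.cov,
    ⟨ta e, fun v => zero_lt_one.trans_le (one_le_ta h v), fun _ => Xs.ta_pos h hn⟩,
    ⟨⟨Pi.single ⟨0, hn⟩ 1, by simp⟩⟩⟩

theorem pipe [IsDomain A] (h : Eisen σ ρ) (hn : 0 < n) :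
    Pipe (Γ := SpecialLinearGroup (Fin n) A) (EE (iv σ e) (Xs σ e) (uRel A n)) (Fu A n) N where
  fin _ _ := EE.fin h
  stab _ _ hf γ := EE.stab hf γ
  van _ _ hf _ hx := EE.van h hf hx
  sub := Fu_sub
  inv _ hx γ := Fu_smul γ hx
  free _ hx _ hγ := eq_one_of_map_eq hx hγ
  ex _ hm _ hf hd := (good h hn).exists_dl (by rwa [finrank_fin_fun]) hf hd
  top _ hm _ hf₁ hd₁ _ hf₂ hd₂ :=
    (good h hn).exists_dl_top (by rwa [finrank_fin_fun]) hf₁ hd₁ hf₂ hd₂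

lemma modu_nm (h : Eisen σ ρ) {m : ℕ} {f : List (Vc A n) → ℚ}
    (hf : f ∈ EE (iv σ e) (Xs σ e) (uRel A n) m) : Modu (nm (SpecialLinearGroup (Fin n) A) f) := by
  have hF := EE.fin h hf
  obtain ⟨-, h2, h3, -⟩ := id hf
  refine ⟨fun γ x => nm_smul hF γ x, fun k x π => ?_, fun l l' hl => ?_, fun x hx =>
    nm_off hF (fun x hx => EE.van h hf hx) (fun x hx γ hγx => hx ?_) hx⟩
  · change tot (orb _ f _) = _ * tot (orb _ f _)
    rw [← smul_eq_mul, ← map_smul]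
    congr 1
    ext γ
    rw [orb_apply hF, Finsupp.smul_apply, orb_apply hF, List.map_ofFn, List.map_ofFn,
      ← Function.comp_assoc]
    exact h2 k _ π
  · change tot (orb _ f _) = tot (orb _ f _)
    congr 1
    ext γ
    rw [orb_apply hF, orb_apply hF]
    refine h3 _ _ ?_
    rw [List.forall₂_map_left_iff, List.forall₂_map_right_iff]
    exact hl.imp fun a b hab => uRel_smul γ hab
  · simpa [Function.comp_def] using Fu_smul γ⁻¹ hγx

lemma exists_genr [IsDomain A] (h : Eisen σ ρ) : ∃ p ∈ Xs σ e, Genr (iv (n := n) σ e) p := by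
  have := h.countable
  have : Countable (Vc A n) := inferInstanceAs (Countable {v : Fin n → A // v ≠ 0})
  obtain ⟨p, hp, hg⟩ := exists_generic isOpen_Xs (exists_mem_Xs (e := e) h)
    (fun T : {T : Finset (Vc A n) // T.card < N} => Submodule.span ℝ (iv σ e '' T)) fun T hT => by
      classical
      have h1 := finrank_span_finset_le_card (R := ℝ) (T.1.image (iv σ e))
      rw [Finset.coe_image, Set.finrank, hT, finrank_top, finrank_fin_fun] at h1
      exact absurd (h1.trans Finset.card_image_le) (not_le.mpr T.2)
  exact ⟨p, hp, fun T hT => hg ⟨T, hT⟩⟩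

end Equivariance

end Eis

namespace Eis

open Module Matrix

theorem exists_fundamental {A : Type*} [CommRing A] [IsDomain A] {σ : A →+* ℂ} {ρ : A}
    (h : Eisen σ ρ) {n M : ℕ} (e : Fin (M + 1) ≃ Fin n × Fin n) :
    ∃ f ∈ EE (iv σ e) (Xs σ e) (uRel A n) (M + 1), dl f = 0 ∧
      ∃ a ∈ supp (len ((M + 1 : ℕ) : ℤ)), bd a ∈ JL (SpecialLinearGroup (Fin n) A) (Fu A n) ∧
        ev (nm (SpecialLinearGroup (Fin n) A) f) a ≠ 0 := by
  obtain ⟨p, hp, hg⟩ := exists_genr (e := e) (n := n) h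
  obtain ⟨ω, hω, hfin⟩ := exists_wt (e := e) (n := n) h
  have hmem : fp (iv σ e) p ∈ EE (iv σ e) (Xs σ e) (uRel A n) (M + 1) :=
    fp_mem_EE (fun _ _ => iv_rel h) hp
  obtain ⟨a, ha, hbd, hev⟩ := (orbCycle_cy h hω hfin).exists_chain
    (fun x hx γ hγ => eq_one_of_map_eq hx hγ) fun x hx γ => Fu_smul γ hx
  obtain ⟨hfs, hev⟩ := hev _ (EE.fin h hmem)
  refine ⟨_, hmem, dl_fp hg fun v => zero_lt_one.trans_le (one_le_ta h v), a, ha, hbd, ?_⟩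
  have hterm : ∀ x, 0 ≤ cy σ e hfin x * fp (iv σ e) p x := fun x => by
    rw [cy, Finset.sum_mul]
    exact Finset.sum_nonneg fun ω' _ => cf_mul_fp_nonneg _ ω' p x
  have hne : (RR (iv σ e) ω).Nonempty := ⟨(2 : ℝ) • ta e, fun v => by
    rw [LinearMap.smul_apply, smul_eq_mul]
    linarith [one_le_ta (e := e) h v, hω.hi v]⟩
  obtain ⟨l, hl⟩ := exists_vertex (hω.simple h) hg
    (exists_min hp (fun v => zero_le_one.trans (hω.lo v)) hne)
  have hmemω : ω ∈ hfin.toFinset := hfin.mem_toFinset.mpr ⟨1, by simp⟩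
  have hpos : 0 < cy σ e hfin l * fp (iv σ e) p l := by
    rw [cy, Finset.sum_mul]
    exact Finset.sum_pos' (fun ω' _ => cf_mul_fp_nonneg _ ω' p l)
      ⟨ω, hmemω, lt_of_le_of_ne (cf_mul_fp_nonneg _ ω p l) (Ne.symm hl)⟩
  rw [hev]
  exact (hpos.trans_le (single_le_finsum l hfs hterm)).ne'

theorem subsingleton_cohomology {A : Type} [CommRing A] [IsDomain A] {σ : A →+* ℂ} {ρ : A}
    (h : Eisen σ ρ) {n : ℕ} (hn : 3 ≤ n) :
    Subsingleton (groupCohomology (Rep.trivial ℚ (SpecialLinearGroup (Fin n) A) ℚ)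
      (n ^ 2 - n - 1)) := by
  have hsq : 3 * n ≤ n ^ 2 := by nlinarith
  obtain ⟨i, hi⟩ : ∃ i, n ^ 2 - n - 1 = i + 1 := ⟨n ^ 2 - n - 2, by omega⟩
  have hN : n * n = n + 1 + (i + 1) := by
    rw [← pow_two]
    omega
  let e : Fin (n + 1 + i + 1) ≃ Fin n × Fin n := Fintype.equivOfCardEq (by simp [hN, add_assoc])
  obtain ⟨f, hf, hd, a, ha, hbd, hev⟩ := exists_fundamental h e
  rw [hi]
  refine subsingleton_groupCohomology i fun c _ hc hdc =>
    (pipe (e := e) h (by omega)).exists_primitive (M := n + 1) (i := i) hf hd ha hbd hev rfl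
      (fun a ha hbd => ?_) hc hdc
  obtain ⟨t, ht⟩ := exists_filling h.disc hn ha hbd
  exact ⟨t, fun f hf => ht _ (modu_nm h hf)⟩

end Eis


/-- **Kupers–Miller–Patzt–Wilson.** Let `𝓞` be the ring of Eisenstein integers, i.e. the
ring of integers of the third cyclotomic field `ℚ(ζ₃)`. For every `n ≥ 3`, the rational
group cohomology of `SL_n(𝓞)` vanishes in codimension one below its virtual cohomological
dimension `n² − n`. -/
theorem sln_eisensteinInt_cohomology_vanishes_codim_one (n : ℕ) (hn : 3 ≤ n) :
    Subsingleton
      (groupCohomology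
        (Rep.trivial ℚ
          (Matrix.SpecialLinearGroup (Fin n)
            (NumberField.RingOfIntegers (CyclotomicField 3 ℚ))) ℚ)
        (n ^ 2 - n - 1)) := by
  obtain ⟨σ, ρ, h⟩ := Eis.exists_eisen
  exact Eis.subsingleton_cohomology h hn
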